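/- There exist constants c₁, C > 0 such that for every prime p and all integers L, N with 0 < L+1 < L+N < p and N ≥ c₁·p^(13/14)·(log p)^(4/7), one has |A_N / A_N| ≥ p − C·p^(13/14)·(log p)^(4/7). -/

import Mathlib

/-- For a prime `p` and integers `L, N`, `A_N = {n! mod p : L+1 ≤ n ≤ L+N} ⊆ ZMod p`. -/
def intervalFactorials (p L N : ℕ) : Finset (ZMod p) :=
  (Finset.Icc (L + 1) (L + N)).image (fun n => (n.factorial : ZMod p))

/-- The ratio set `A_N / A_N = {a·b⁻¹ : a, b ∈ A_N}`. -/
def intervalFactorialsRatio (p L N : ℕ) : Finset (ZMod p) :=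
  Finset.image₂ (fun a b => a * b⁻¹) (intervalFactorials p L N) (intervalFactorials p L N)

theorem LinearMap.trace_eq_trace_restrict_add_trace_mapQ {F V : Type*} [Field F] [AddCommGroup V]
    [Module F V] [FiniteDimensional F V] (W : Submodule F V) (e : V →ₗ[F] V)
    (he : W ≤ W.comap e) :
    LinearMap.trace F V e = LinearMap.trace F W (e.restrict he) +
      LinearMap.trace F (V ⧸ W) (W.mapQ W e he) := by
  classical
  let bW := Module.finBasis F W
  let bQ := Module.finBasis F (V ⧸ W)
  let b := Module.Basis.sumQuot bW bQ
  have hl : ∀ (w : W) i, b.repr w (Sum.inl i) = bW.repr w i :=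
    Module.Basis.sumQuot_repr_inl bW bQ
  have hr : ∀ (v : V) j, b.repr v (Sum.inr j) = bQ.repr (W.mkQ v) j :=
    Module.Basis.sumQuot_repr_inr bW bQ
  rw [LinearMap.trace_eq_matrix_trace F b, LinearMap.trace_eq_matrix_trace F bW,
    LinearMap.trace_eq_matrix_trace F bQ]
  simp only [Matrix.trace, Matrix.diag, Fintype.sum_sum_type, LinearMap.toMatrix_apply]
  congr 1
  · refine Finset.sum_congr rfl fun i _ => ?_
    have : b (Sum.inl i) = bW i := Module.Basis.sumQuot_inl bW bQ i
    rw [this, ← hl]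
    rfl
  · refine Finset.sum_congr rfl fun j _ => ?_
    rw [hr]
    have := Module.Basis.sumQuot_inr bW bQ j
    rw [← this]
    rfl

theorem LinearMap.trace_eq_add_of_exact {F A V B : Type*} [Field F] [AddCommGroup A]
    [Module F A] [AddCommGroup V] [Module F V] [AddCommGroup B] [Module F B]
    [FiniteDimensional F V] (f : A →ₗ[F] V) (g : V →ₗ[F] B)
    (hf : Function.Injective f) (hg : Function.Surjective g) (hfg : Function.Exact f g)
    (eA : A →ₗ[F] A) (eV : V →ₗ[F] V) (eB : B →ₗ[F] B)
    (hA : ∀ a, f (eA a) = eV (f a)) (hB : ∀ v, g (eV v) = eB (g v)) :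
    LinearMap.trace F V eV = LinearMap.trace F A eA + LinearMap.trace F B eB := by
  have hW : LinearMap.ker g ≤ (LinearMap.ker g).comap eV := by
    intro v hv
    simp only [Submodule.mem_comap, LinearMap.mem_ker] at hv ⊢
    rw [hB, hv, map_zero]
  rw [LinearMap.trace_eq_trace_restrict_add_trace_mapQ _ eV hW]
  have hk : LinearMap.range f = LinearMap.ker g := by
    ext v
    exact (hfg v).symm
  let e1 : A ≃ₗ[F] LinearMap.ker g :=
    (LinearEquiv.ofInjective f hf).trans (LinearEquiv.ofEq _ _ hk)
  let e2 := g.quotKerEquivOfSurjective hg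
  congr 1
  · rw [← LinearMap.trace_conj' eA e1]
    congr 1
    ext v
    obtain ⟨a, rfl⟩ := e1.surjective v
    simp only [LinearEquiv.conj_apply_apply, LinearEquiv.symm_apply_apply]
    simpa [e1] using (hA a).symm
  · rw [← LinearMap.trace_conj' _ e2]
    congr 1
    ext v
    obtain ⟨u, rfl⟩ := hg v
    have : e2.symm (g u) = Submodule.Quotient.mk u := by
      rw [LinearEquiv.symm_apply_eq]
      rfl
    rw [LinearEquiv.conj_apply_apply, this]
    exact hB u

section IdealInvariants

variable (F : Type*) {O : Type*} [Field F] [CommRing O] [Algebra F O]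

/-- The dimension of the quotient by an ideal. -/
noncomputable def Ideal.codim (I : Ideal O) : ℕ := Module.finrank F (O ⧸ I)

/-- The trace of multiplication by `x` on the quotient by an ideal. -/
noncomputable def Ideal.traceOf (x : O) (I : Ideal O) : F :=
  Algebra.trace F (O ⧸ I) (Ideal.Quotient.mk I x)

variable {F}

/-- In a Dedekind domain, `I / IJ` is isomorphic to `O / J`. -/
theorem Ideal.exists_exact_quotient_mul [IsDedekindDomain O] {I J : Ideal O} (hI : I ≠ ⊥)
    (hJ : J ≠ ⊥) :
    ∃ (f : (O ⧸ J) →ₗ[O] (O ⧸ I * J)) (g : (O ⧸ I * J) →ₗ[O] (O ⧸ I)),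
      Function.Injective f ∧ Function.Surjective g ∧ Function.Exact f g := by
  obtain ⟨a, ha⟩ := IsDedekindDomain.exists_sup_span_eq (Ideal.mul_le_left : I * J ≤ I)
    (mul_ne_zero hI hJ)
  have haI : a ∈ I := by
    rw [← ha]
    exact Ideal.mem_sup_right (Ideal.mem_span_singleton_self a)
  obtain ⟨A, hA⟩ : I ∣ Ideal.span {a} := by
    rw [Ideal.dvd_iff_le, Ideal.span_singleton_le_iff_mem]
    exact haI
  have hcop : J ⊔ A = ⊤ := by
    have h1 : I * (J ⊔ A) = I * ⊤ := by
      rw [Ideal.mul_sup, ← hA, ha, Ideal.mul_top]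
    exact mul_left_cancel₀ hI h1
  let f0 : O →ₗ[O] (O ⧸ I * J) := LinearMap.toSpanSingleton O _ (Ideal.Quotient.mk _ a)
  have hf0 : ∀ r, f0 r = Ideal.Quotient.mk (I * J) (r * a) := fun r => rfl
  have hker : ∀ r, f0 r = 0 ↔ r ∈ J := by
    intro r
    rw [hf0, Ideal.Quotient.eq_zero_iff_mem]
    constructor
    · intro h
      have h1 : I * (Ideal.span {r} * A) ≤ I * J := by
        rw [mul_left_comm, ← hA, Ideal.span_singleton_mul_span_singleton,
          Ideal.span_singleton_le_iff_mem]
        exact h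
      have h2 : Ideal.span {r} * A ≤ J := by
        rw [← Ideal.dvd_iff_le] at h1 ⊢
        exact (mul_dvd_mul_iff_left hI).1 h1
      have h3 : Ideal.span {r} ≤ J := by
        calc Ideal.span {r} = Ideal.span {r} * (J ⊔ A) := by rw [hcop, Ideal.mul_top]
          _ = Ideal.span {r} * J ⊔ Ideal.span {r} * A := Ideal.mul_sup _ _ _
          _ ≤ J := sup_le Ideal.mul_le_right h2
      exact h3 (Ideal.mem_span_singleton_self r)
    · intro h
      rw [mul_comm r a]
      exact Ideal.mul_mem_mul haI h
  let f : (O ⧸ J) →ₗ[O] (O ⧸ I * J) := Submodule.liftQ J f0 fun r hr => (hker r).2 hr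
  let g : (O ⧸ I * J) →ₗ[O] (O ⧸ I) :=
    Submodule.mapQ (I * J) I LinearMap.id (Ideal.mul_le_left : I * J ≤ I)
  have hfmk : ∀ r, f (Submodule.Quotient.mk r) = f0 r := fun r => rfl
  have hgmk : ∀ r : O, g (Submodule.Quotient.mk r) = Submodule.Quotient.mk r := fun r => rfl
  refine ⟨f, g, ?_, ?_, ?_⟩
  · rw [← LinearMap.ker_eq_bot, Submodule.eq_bot_iff]
    intro v hv
    obtain ⟨r, rfl⟩ := Submodule.Quotient.mk_surjective _ v
    rw [LinearMap.mem_ker, hfmk, hker] at hv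
    exact (Submodule.Quotient.mk_eq_zero _).2 hv
  · intro v
    obtain ⟨r, rfl⟩ := Submodule.Quotient.mk_surjective _ v
    exact ⟨Submodule.Quotient.mk r, rfl⟩
  · intro v
    obtain ⟨r, rfl⟩ := Submodule.Quotient.mk_surjective _ v
    rw [hgmk, Submodule.Quotient.mk_eq_zero]
    constructor
    · intro hr
      rw [← ha, Submodule.mem_sup] at hr
      obtain ⟨y, hy, z, hz, rfl⟩ := hr
      obtain ⟨c, rfl⟩ := Ideal.mem_span_singleton'.1 hz
      refine ⟨Submodule.Quotient.mk c, ?_⟩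
      rw [hfmk, hf0]
      refine (Submodule.Quotient.eq _).2 ?_
      simpa using neg_mem hy
    · rintro ⟨u, hu⟩
      obtain ⟨c, rfl⟩ := Submodule.Quotient.mk_surjective _ u
      rw [hfmk, hf0] at hu
      have := (Submodule.Quotient.eq (I * J)).1 hu
      have h2 := Ideal.mul_le_left this
      have h3 : c * a ∈ I := I.mul_mem_left _ haI
      simpa using sub_mem h3 h2

variable [IsDedekindDomain O]

theorem Ideal.codim_mul {I J : Ideal O} (hI : I ≠ ⊥) (hJ : J ≠ ⊥)
    [FiniteDimensional F (O ⧸ I * J)] :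
    (I * J).codim F = I.codim F + J.codim F := by
  obtain ⟨f, g, hf, hg, hfg⟩ := Ideal.exists_exact_quotient_mul hI hJ
  have := LinearMap.finrank_range_add_finrank_ker (g.restrictScalars F)
  have h1 : LinearMap.range (g.restrictScalars F) = ⊤ := LinearMap.range_eq_top.2 hg
  have h2 : LinearMap.ker (g.restrictScalars F) = LinearMap.range (f.restrictScalars F) := by
    ext v
    exact hfg v
  rw [h1, h2, finrank_top, LinearMap.finrank_range_of_inj (f := f.restrictScalars F) hf] at this
  exact this.symm

theorem Ideal.traceOf_mul (x : O) {I J : Ideal O} (hI : I ≠ ⊥) (hJ : J ≠ ⊥)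
    [FiniteDimensional F (O ⧸ I * J)] :
    (I * J).traceOf F x = I.traceOf F x + J.traceOf F x := by
  obtain ⟨f, g, hf, hg, hfg⟩ := Ideal.exists_exact_quotient_mul hI hJ
  rw [add_comm]
  refine LinearMap.trace_eq_add_of_exact (f.restrictScalars F) (g.restrictScalars F) hf hg hfg
    _ _ _ ?_ ?_
  · intro v
    exact f.map_smul x v
  · intro v
    exact g.map_smul x v

end IdealInvariants

section

open Polynomial

namespace Polynomial

variable {F : Type*} [Field F]

/-- The ratio of the two leading coefficients; minus the sum of the roots. -/
noncomputable def subleading (f : F[X]) : F := f.nextCoeff / f.leadingCoeff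

theorem nextCoeff_C_mul_of_ne {c : F} (hc : c ≠ 0) (f : F[X]) :
    (C c * f).nextCoeff = c * f.nextCoeff := by
  simp only [nextCoeff, natDegree_C_mul hc, coeff_C_mul]
  split_ifs <;> simp

theorem subleading_C_mul {c : F} (hc : c ≠ 0) (f : F[X]) :
    (C c * f).subleading = f.subleading := by
  unfold subleading
  rw [nextCoeff_C_mul_of_ne hc, leadingCoeff_mul, leadingCoeff_C,
    mul_div_mul_left _ _ hc]

theorem Monic.subleading {f : F[X]} (hf : f.Monic) : f.subleading = f.nextCoeff := by
  simp [Polynomial.subleading, hf.leadingCoeff]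

theorem subleading_mul {f g : F[X]} (hf : f ≠ 0) (hg : g ≠ 0) :
    (f * g).subleading = f.subleading + g.subleading := by
  have key : ∀ f : F[X], f ≠ 0 → ∃ c : F, c ≠ 0 ∧ ∃ m : F[X], m.Monic ∧ f = C c * m := by
    intro f hf
    refine ⟨f.leadingCoeff, leadingCoeff_ne_zero.2 hf, C f.leadingCoeff⁻¹ * f, ?_, ?_⟩
    · rw [mul_comm]
      exact monic_mul_leadingCoeff_inv hf
    · rw [← mul_assoc, ← C_mul, mul_inv_cancel₀ (leadingCoeff_ne_zero.2 hf), C_1, one_mul]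
  obtain ⟨c, hc, m, hm, rfl⟩ := key f hf
  obtain ⟨d, hd, k, hk, rfl⟩ := key g hg
  rw [mul_mul_mul_comm, ← C_mul, subleading_C_mul (mul_ne_zero hc hd), subleading_C_mul hc,
    subleading_C_mul hd, (hm.mul hk).subleading, hm.subleading, hk.subleading,
    hm.nextCoeff_mul hk]

theorem subleading_eq_of_associated {f g : F[X]} (h : Associated f g) :
    f.subleading = g.subleading := by
  obtain ⟨u, rfl⟩ := h
  obtain ⟨c, hc, hu⟩ := Polynomial.isUnit_iff.1 u.isUnit
  rw [mul_comm, ← hu, subleading_C_mul hc.ne_zero]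

theorem subleading_one : (1 : F[X]).subleading = 0 := by
  simp [subleading, nextCoeff]

theorem subleading_prod {ι : Type*} (s : Finset ι) (f : ι → F[X]) (h : ∀ i ∈ s, f i ≠ 0) :
    (∏ i ∈ s, f i).subleading = ∑ i ∈ s, (f i).subleading := by
  classical
  induction s using Finset.induction_on with
  | empty => simp [subleading_one]
  | insert a s ha ih =>
    rw [Finset.prod_insert ha, Finset.sum_insert ha, subleading_mul (h a (by simp)), ih]
    · exact fun i hi => h i (by simp [hi])
    · exact Finset.prod_ne_zero_iff.2 fun i hi => h i (by simp [hi])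

theorem subleading_X_sub_C_pow (b : F) (n : ℕ) : ((X - C b) ^ n).subleading = -(n * b) := by
  have := subleading_prod (Finset.range n) (fun _ => X - C b) (fun _ _ => X_sub_C_ne_zero b)
  rw [Finset.prod_const, Finset.card_range] at this
  rw [this, (monic_X_sub_C b).subleading, nextCoeff_X_sub_C]
  simp

/-- Polynomials agreeing in their two top coefficients have the same `subleading`. -/
theorem subleading_eq_of_degree_sub {f g : F[X]}
    (h : f - g = 0 ∨ (f - g).natDegree + 2 ≤ g.natDegree) :
    f.natDegree = g.natDegree ∧ f.subleading = g.subleading := by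
  rcases h with h | h
  · rw [sub_eq_zero.1 h]; simp
  obtain ⟨e, rfl⟩ : ∃ e, f = g + e := ⟨f - g, by ring⟩
  rw [add_sub_cancel_left] at h
  have h1 : (g + e).natDegree = g.natDegree :=
    natDegree_add_eq_left_of_natDegree_lt (by omega)
  refine ⟨h1, ?_⟩
  unfold subleading
  have h2 : (g + e).leadingCoeff = g.leadingCoeff := by
    unfold leadingCoeff
    rw [h1, coeff_add, coeff_eq_zero_of_natDegree_lt (p := e) (by omega), add_zero]
  have h3 : (g + e).nextCoeff = g.nextCoeff := by
    rw [nextCoeff_of_natDegree_pos (by omega), nextCoeff_of_natDegree_pos (by omega), h1,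
      coeff_add, coeff_eq_zero_of_natDegree_lt (p := e) (by omega), add_zero]
  rw [h2, h3]

end Polynomial

theorem LinearMap.trace_piMap_eq_sum {F ι : Type*} [Field F] [Fintype ι] {M : ι → Type*}
    [∀ i, AddCommGroup (M i)] [∀ i, Module F (M i)] [∀ i, FiniteDimensional F (M i)]
    (f : (∀ i, M i) →ₗ[F] (∀ i, M i)) (g : ∀ i, M i →ₗ[F] M i) (h : ∀ v i, f v i = g i (v i)) :
    LinearMap.trace F _ f = ∑ i, LinearMap.trace F _ (g i) := by
  classical
  let b := Pi.basis fun i => Module.finBasis F (M i)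
  rw [LinearMap.trace_eq_matrix_trace F b]
  simp only [Matrix.trace, Matrix.diag, LinearMap.toMatrix_apply]
  rw [Fintype.sum_sigma]
  refine Finset.sum_congr rfl fun i _ => ?_
  rw [LinearMap.trace_eq_matrix_trace F (Module.finBasis F (M i))]
  refine Finset.sum_congr rfl fun j _ => ?_
  simp only [Matrix.diag, LinearMap.toMatrix_apply]
  rw [Pi.basis_repr, h, Pi.basis_apply]
  simp

theorem Polynomial.trace_X_quotient {F : Type*} [Field F] {d : F[X]} (hd : d ≠ 0) :
    Algebra.trace F (F[X] ⧸ Ideal.span {d}) (Ideal.Quotient.mk _ X) = -d.subleading := by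
  by_cases hu : IsUnit d
  · have : Subsingleton (F[X] ⧸ Ideal.span {d}) := by
      rw [Ideal.Quotient.subsingleton_iff, Ideal.span_singleton_eq_top]
      exact hu
    rw [Subsingleton.elim (Ideal.Quotient.mk (Ideal.span {d}) X) 0, map_zero,
      subleading_eq_of_associated (associated_one_iff_isUnit.2 hu), subleading_one, neg_zero]
  · have hn : Nontrivial (AdjoinRoot d) := by
      refine AdjoinRoot.nontrivial d fun h => hu ?_
      exact isUnit_iff_degree_eq_zero.2 h
    have h := PowerBasis.trace_gen_eq_nextCoeff_minpoly (AdjoinRoot.powerBasis hd)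
    rw [AdjoinRoot.powerBasis_gen, AdjoinRoot.minpoly_root hd] at h
    have h2 : (d * C d.leadingCoeff⁻¹).nextCoeff = d.subleading := by
      rw [mul_comm, nextCoeff_C_mul_of_ne (inv_ne_zero (leadingCoeff_ne_zero.2 hd)),
        subleading, div_eq_inv_mul]
    rw [h2] at h
    exact h

theorem Ideal.traceOf_span_singleton {F S ι : Type*} [Field F] [CommRing S] [IsDomain S]
    [Algebra F[X] S] [Algebra F S] [IsScalarTower F F[X] S] [Finite ι]
    (b : Module.Basis ι F[X] S) {a : S} (ha : a ≠ 0) :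
    (Ideal.span {a}).traceOf F (algebraMap F[X] S X) = -(Algebra.norm F[X] a).subleading := by
  have := Fintype.ofFinite ι
  have hI : Ideal.span {a} ≠ ⊥ := Ideal.span_singleton_eq_bot.not.2 ha
  rw [subleading_eq_of_associated (associated_norm_prod_smith b ha),
    subleading_prod _ _ fun i _ => Ideal.smithCoeffs_ne_zero b _ hI i, ← Finset.sum_neg_distrib]
  have h1 : ∀ i, FiniteDimensional F (F[X] ⧸ Ideal.span
      ({(Ideal.span {a}).smithCoeffs b hI i} : Set F[X])) := fun i => inferInstance
  simp_rw [← fun i => trace_X_quotient (Ideal.smithCoeffs_ne_zero b _ hI i)]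
  let e := (Ideal.span {a}).quotientEquivPiSpan b hI
  unfold Ideal.traceOf
  rw [Algebra.trace_apply, ← LinearMap.trace_conj' _ (e.restrictScalars F)]
  refine LinearMap.trace_piMap_eq_sum _ _ ?_
  intro v i
  obtain ⟨u, rfl⟩ := e.surjective v
  have : (Ideal.Quotient.mk (Ideal.span {a}) (algebraMap F[X] S X)) * u = (X : F[X]) • u := by
    rw [Algebra.smul_def]; rfl
  simp only [LinearEquiv.conj_apply_apply]
  have h3 : (e.restrictScalars F).symm (e u) = u := e.symm_apply_apply u
  rw [h3]
  change e ((Ideal.Quotient.mk (Ideal.span {a}) (algebraMap F[X] S X)) * u) i = _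
  rw [this, map_smul]
  rw [Pi.smul_apply, Algebra.smul_def]
  rfl

end

section

/-- A filtration of the function field `K` by pole order at infinity, compatible with
a Dedekind coordinate ring `O`. -/
structure PoleFiltration (F O K : Type*) [Field F] [CommRing O] [Field K] [Algebra O K]
    [Algebra F O] [Algebra F K] [IsScalarTower F O K] (n g : ℕ) (x : O) where
  W : ℤ → Submodule F K
  mono : ∀ {i j}, i ≤ j → W i ≤ W j
  mul_mem : ∀ {i j a b}, a ∈ W i → b ∈ W j → a * b ∈ W (i + j)
  one_mem : (1 : K) ∈ W 0
  one_notMem : (1 : K) ∉ W (-1)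
  exhaust : ∀ a, ∃ j, a ∈ W j
  finite_quot : ∀ i j, FiniteDimensional F (W j ⧸ (W i).submoduleOf (W j))
  finrank_quot : ∀ {i j}, i ≤ j →
    (Module.finrank F (W j ⧸ (W i).submoduleOf (W j)) : ℤ) = n * (j - i)
  x_mem : algebraMap O K x ∈ W 1
  x_ne : x ≠ 0
  x_inv_mem : (algebraMap O K x)⁻¹ ∈ W (-1)
  top : ∃ j, ∀ a : K, ∃ o : O, a - algebraMap O K o ∈ W j
  P : ℕ → Submodule F O
  P_le : ∀ s, ∀ r ∈ P s, algebraMap O K r ∈ W s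
  P_finrank : ∀ s, n * (s + 1) ≤ Module.finrank F (P s) + g
  finite_quotient : ∀ I : Ideal O, I ≠ ⊥ → FiniteDimensional F (O ⧸ I)
  finite_ideals : ∀ m, {I : Ideal O | I ≠ ⊥ ∧ I.codim F = m}.Finite
  codim_le : ∀ (f : K) (a b : O) (j : ℤ), a ≠ 0 → b ≠ 0 → f ∈ W j →
    algebraMap O K a = f * algebraMap O K b →
    ((Ideal.span {a}).codim F : ℤ) ≤ (Ideal.span {b}).codim F + n * j
  trace_eq : ∀ (f : K) (a b : O), a ≠ 0 → b ≠ 0 → f - 1 ∈ W (-2) →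
    algebraMap O K a = f * algebraMap O K b →
    (Ideal.span {a}).traceOf F x = (Ideal.span {b}).traceOf F x
  trace_sub : ∀ b : F, x - algebraMap F O b ≠ 0 ∧
    (Ideal.span {x - algebraMap F O b}).traceOf F x = n * b

namespace PoleFiltration

variable {F O K : Type*} [Field F] [CommRing O] [IsDedekindDomain O] [Field K] [Algebra O K]
  [IsFractionRing O K] [Algebra F O] [Algebra F K] [IsScalarTower F O K] {n g : ℕ} {x : O}
  (D : PoleFiltration F O K n g x)

/-- The elements `f` with `f I ⊆ J`. -/
def colon (F K : Type*) {O : Type*} [Field F] [CommRing O] [Field K] [Algebra O K]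
    [Algebra F O] [Algebra F K] [IsScalarTower F O K] (I J : Ideal O) : Submodule F K where
  carrier := {f | ∀ a ∈ I, ∃ b ∈ J, f * algebraMap O K a = algebraMap O K b}
  add_mem' := by
    intro f h hf hh a ha
    obtain ⟨b, hb, h1⟩ := hf a ha
    obtain ⟨c, hc, h2⟩ := hh a ha
    exact ⟨b + c, add_mem hb hc, by rw [add_mul, h1, h2, map_add]⟩
  zero_mem' := fun a _ => ⟨0, zero_mem _, by simp⟩
  smul_mem' := by
    intro r f hf a ha
    obtain ⟨b, hb, h1⟩ := hf a ha
    refine ⟨r • b, ?_, ?_⟩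
    · rw [Algebra.smul_def]; exact J.mul_mem_left _ hb
    · rw [smul_mul_assoc, h1]
      exact ((IsScalarTower.toAlgHom F O K).toLinearMap.map_smul r b).symm

theorem finite_inf (A : Submodule F K) {i j : ℤ} (hij : i ≤ j)
    (hA : FiniteDimensional F ↥(A ⊓ D.W i)) :
    FiniteDimensional F ↥(A ⊓ D.W j) ∧
    (Module.finrank F ↥(A ⊓ D.W j) : ℤ) ≤ Module.finrank F ↥(A ⊓ D.W i) + n * (j - i) ∧
    (A ⊔ D.W i = ⊤ → (Module.finrank F ↥(A ⊓ D.W j) : ℤ) =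
      Module.finrank F ↥(A ⊓ D.W i) + n * (j - i)) := by
  have := D.finite_quot i j
  let φ : ↥(A ⊓ D.W j) →ₗ[F] (D.W j ⧸ (D.W i).submoduleOf (D.W j)) :=
    ((D.W i).submoduleOf (D.W j)).mkQ ∘ₗ Submodule.inclusion inf_le_right
  have hker : LinearMap.ker φ = (A ⊓ D.W i).submoduleOf (A ⊓ D.W j) := by
    ext ⟨v, hv⟩
    change φ ⟨v, hv⟩ = 0 ↔ v ∈ A ∧ v ∈ D.W i
    exact (Submodule.Quotient.mk_eq_zero _).trans ⟨fun h => ⟨hv.1, h⟩, fun h => h.2⟩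
  have hle : A ⊓ D.W i ≤ A ⊓ D.W j := inf_le_inf_left _ (D.mono hij)
  have e : LinearMap.ker φ ≃ₗ[F] ↥(A ⊓ D.W i) :=
    (LinearEquiv.ofEq _ _ hker).trans (Submodule.submoduleOfEquivOfLe hle)
  have hkf : FiniteDimensional F (LinearMap.ker φ) := Module.Finite.equiv e.symm
  have hfd : FiniteDimensional F ↥(A ⊓ D.W j) := by
    have : Module.Finite F (↥(A ⊓ D.W j) ⧸ LinearMap.ker φ) :=
      Module.Finite.equiv φ.quotKerEquivRange.symm
    exact Module.Finite.of_submodule_quotient (LinearMap.ker φ)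
  have h1 := LinearMap.finrank_range_add_finrank_ker φ
  rw [LinearEquiv.finrank_eq e] at h1
  have h2 : Module.finrank F (LinearMap.range φ) ≤ _ := Submodule.finrank_le (LinearMap.range φ)
  have h3 := D.finrank_quot hij
  refine ⟨hfd, by omega, fun htop => ?_⟩
  have hsurj : LinearMap.range φ = ⊤ := by
    rw [LinearMap.range_eq_top]
    intro q
    obtain ⟨⟨w, hw⟩, rfl⟩ := Submodule.Quotient.mk_surjective _ q
    obtain ⟨a, ha, b, hb, hab⟩ := Submodule.mem_sup.1 (htop ▸ Submodule.mem_top : w ∈ A ⊔ D.W i)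
    have ha' : a ∈ D.W j := by
      rw [eq_sub_of_add_eq hab]
      exact sub_mem hw (D.mono hij hb)
    refine ⟨⟨a, ha, ha'⟩, (Submodule.Quotient.eq _).2 ?_⟩
  
    change a - w ∈ D.W i
    rw [← hab]
    simpa using hb
  rw [hsurj, finrank_top] at h1
  omega

/-- Comparison of a subspace of `O` with its intersection with an ideal. -/
theorem finrank_inf_ideal (B : Ideal O) (V : Submodule F O) [FiniteDimensional F V]
    (hV : ∀ o : O, ∃ v ∈ V, o - v ∈ B) :
    Module.finrank F V =
      Module.finrank F ↥(B.restrictScalars F ⊓ V) + B.codim F := by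
  let φ : V →ₗ[F] (O ⧸ B) := (Ideal.Quotient.mkₐ F B).toLinearMap ∘ₗ V.subtype
  have hker : LinearMap.ker φ = (B.restrictScalars F ⊓ V).submoduleOf V := by
    ext ⟨v, hv⟩
    simp [φ, Submodule.submoduleOf, Ideal.Quotient.eq_zero_iff_mem, hv]
  have hsurj : LinearMap.range φ = ⊤ := by
    rw [LinearMap.range_eq_top]
    intro q
    obtain ⟨o, rfl⟩ := Ideal.Quotient.mk_surjective q
    obtain ⟨v, hv, h⟩ := hV o
    exact ⟨⟨v, hv⟩, ((Ideal.Quotient.mk_eq_mk_iff_sub_mem _ _).2 h).symm⟩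
  have e : LinearMap.ker φ ≃ₗ[F] ↥(B.restrictScalars F ⊓ V) :=
    (LinearEquiv.ofEq _ _ hker).trans (Submodule.submoduleOfEquivOfLe inf_le_right)
  have h1 := LinearMap.finrank_range_add_finrank_ker φ
  rw [LinearEquiv.finrank_eq e, hsurj, finrank_top] at h1
  rw [Ideal.codim]
  omega

theorem exists_quotient_mem (f : K) : ∃ a b : O, b ≠ 0 ∧ f * algebraMap O K b = algebraMap O K a := by
  obtain ⟨a, b, hb, rfl⟩ := IsFractionRing.div_surjective (A := O) f
  have hb' : algebraMap O K b ≠ 0 := by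
    simpa using nonZeroDivisors.ne_zero hb
  exact ⟨a, b, nonZeroDivisors.ne_zero hb, by field_simp⟩

include D in
theorem exists_top {J : Ideal O} (hJ : J ≠ ⊥) :
    ∃ j, ∀ a : K, ∃ o ∈ J, a - algebraMap O K o ∈ D.W j := by
  obtain ⟨c, hc, hc0⟩ := Submodule.exists_mem_ne_zero_of_ne_bot hJ
  have hcK : algebraMap O K c ≠ 0 := by simpa using hc0
  obtain ⟨j, hj⟩ := D.top
  obtain ⟨i, hi⟩ := D.exhaust (algebraMap O K c)
  refine ⟨i + j, fun a => ?_⟩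
  obtain ⟨o, ho⟩ := hj (a / algebraMap O K c)
  refine ⟨c * o, J.mul_mem_right _ hc, ?_⟩
  have := D.mul_mem hi ho
  rwa [mul_sub, mul_div_cancel₀ _ hcK, ← map_mul] at this

end PoleFiltration

end

section

namespace PoleFiltration

variable {F O K : Type*} [Field F] [CommRing O] [IsDedekindDomain O] [Field K] [Algebra O K]
  [IsFractionRing O K] [Algebra F O] [Algebra F K] [IsScalarTower F O K] {n g : ℕ} {x : O}
  (D : PoleFiltration F O K n g x)

include D in
theorem codim_mul {I J : Ideal O} (hI : I ≠ ⊥) (hJ : J ≠ ⊥) :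
    (I * J).codim F = I.codim F + J.codim F := by
  have := D.finite_quotient (I * J) (mul_ne_zero hI hJ)
  exact Ideal.codim_mul hI hJ

include D in
theorem traceOf_mul {I J : Ideal O} (hI : I ≠ ⊥) (hJ : J ≠ ⊥) :
    (I * J).traceOf F x = I.traceOf F x + J.traceOf F x := by
  have := D.finite_quotient (I * J) (mul_ne_zero hI hJ)
  exact Ideal.traceOf_mul x hI hJ

include D in
theorem codim_anti {I J : Ideal O} (hI : I ≠ ⊥) (hIJ : I ≤ J) : J.codim F ≤ I.codim F := by
  obtain ⟨A, rfl⟩ := Ideal.dvd_iff_le.2 hIJ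
  have hJ : J ≠ ⊥ := left_ne_zero_of_mul hI
  have hA : A ≠ ⊥ := right_ne_zero_of_mul hI
  rw [D.codim_mul hJ hA]
  omega

theorem span_ne_bot {a : O} (ha : a ≠ 0) : Ideal.span {a} ≠ ⊥ := by simpa using ha

/-- A nonzero element of the fraction field carrying `I` into `J` in terms of ideals. -/
theorem span_mul_le_of_mem_colon {I J : Ideal O} {f : K} (hf : f ∈ colon F K I J) {a b : O}
    (hab : f * algebraMap O K b = algebraMap O K a) :
    Ideal.span {a} * I ≤ Ideal.span {b} * J := by
  rw [Ideal.span_singleton_mul_le_iff]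
  intro i hi
  obtain ⟨j, hj, h⟩ := hf i hi
  rw [Ideal.mem_span_singleton_mul]
  refine ⟨j, hj, ?_⟩
  apply IsFractionRing.injective O K
  rw [map_mul, map_mul, ← h, ← hab]
  ring

include D in
theorem colon_inf_eq_bot {I J : Ideal O} (hI : I ≠ ⊥) (hJ : J ≠ ⊥) {j : ℤ}
    (h : n * j + I.codim F - J.codim F < 0) : colon F K I J ⊓ D.W j = ⊥ := by
  rw [Submodule.eq_bot_iff]
  rintro f ⟨hf, hfj⟩
  by_contra hf0
  obtain ⟨a, b, hb, hab⟩ := exists_quotient_mem (O := O) f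
  have ha : a ≠ 0 := by
    rintro rfl
    have hb' : algebraMap O K b ≠ 0 := by simpa using hb
    simp [hf0, hb] at hab
  have h1 := D.codim_anti (mul_ne_zero (span_ne_bot ha) hI) (span_mul_le_of_mem_colon hf hab)
  rw [D.codim_mul (span_ne_bot ha) hI, D.codim_mul (span_ne_bot hb) hJ] at h1
  have h2 := D.codim_le f a b j ha hb hfj hab.symm
  omega

/-- Division by `c` as a linear map from `O` to its fraction field. -/
def divLin (F K : Type*) {O : Type*} [Field F] [CommRing O] [Field K] [Algebra O K]
    [Algebra F O] [Algebra F K] [IsScalarTower F O K] (c : O) : O →ₗ[F] K :=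
  (LinearMap.mulLeft F (algebraMap O K c)⁻¹) ∘ₗ (IsScalarTower.toAlgHom F O K).toLinearMap

theorem divLin_apply (c o : O) : divLin F K c o = (algebraMap O K c)⁻¹ * algebraMap O K o := rfl

theorem divLin_injective {c : O} (hc : c ≠ 0) : Function.Injective (divLin F K c) := by
  intro o o' h
  have hc' : algebraMap O K c ≠ 0 := by simpa using hc
  rw [divLin_apply, divLin_apply] at h
  exact IsFractionRing.injective O K (mul_left_cancel₀ (inv_ne_zero hc') h)

theorem colon_eq_map {I J B : Ideal O} {c : O} (hc : c ≠ 0) (hI : I ≠ ⊥) (hcI : c ∈ I)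
    (h : Ideal.span {c} * J = I * B) :
    colon F K I J = (B.restrictScalars F).map (divLin F K c) := by
  have hc' : algebraMap O K c ≠ 0 := by simpa using hc
  ext f
  constructor
  · intro hf
    obtain ⟨b, hb, hfb⟩ := hf c hcI
    refine ⟨b, ?_, by rw [divLin_apply, ← hfb]; field_simp⟩
    have h1 := span_mul_le_of_mem_colon hf hfb
    rw [h, mul_comm, ← Ideal.dvd_iff_le, mul_dvd_mul_iff_left hI, Ideal.dvd_iff_le] at h1
    exact h1 (Ideal.mem_span_singleton_self b)
  · rintro ⟨b, hb, rfl⟩ a ha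
    have h1 : a * b ∈ Ideal.span {c} * J := h ▸ Ideal.mul_mem_mul ha hb
    obtain ⟨j, hj, h2⟩ := Ideal.mem_span_singleton_mul.1 h1
    refine ⟨j, hj, ?_⟩
    rw [divLin_apply, mul_assoc, ← map_mul, mul_comm b a, ← h2, map_mul]
    field_simp

theorem finrank_map_inf (B : Ideal O) {c : O} (hc : c ≠ 0) (W : Submodule F K) :
    Module.finrank F ↥((B.restrictScalars F).map (divLin F K c) ⊓ W) =
      Module.finrank F ↥(B.restrictScalars F ⊓ W.comap (divLin F K c)) := by
  rw [Submodule.map_inf_eq_map_inf_comap]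
  exact (Submodule.equivMapOfInjective _ (divLin_injective hc) _).finrank_eq.symm

include D in
theorem finite_colon_inf {I J : Ideal O} (hI : I ≠ ⊥) (hJ : J ≠ ⊥) (hn : 0 < n) (j : ℤ) :
    FiniteDimensional F ↥(colon F K I J ⊓ D.W j) := by
  obtain ⟨i, hi, hij⟩ : ∃ i : ℤ, n * i + I.codim F - J.codim F < 0 ∧ i ≤ j := by
    refine ⟨min j (-(I.codim F) - 1), ?_, min_le_left _ _⟩
    have h1 : min j (-(I.codim F : ℤ) - 1) ≤ -(I.codim F : ℤ) - 1 := min_le_right _ _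
    have : (1 : ℤ) ≤ n := by exact_mod_cast hn
    nlinarith
  refine (D.finite_inf _ hij ?_).1
  rw [D.colon_inf_eq_bot hI hJ hi]
  infer_instance

include D in
theorem finrank_colon (hn : 0 < n) {I J : Ideal O} (hI : I ≠ ⊥) (hJ : J ≠ ⊥) :
    ∃ j₀, ∀ j ≥ j₀, colon F K I J ⊔ D.W j = ⊤ ∧
      Module.finrank F ↥(colon F K I J ⊓ D.W j) + J.codim F =
      Module.finrank F ↥(colon F K (⊤ : Ideal O) ⊤ ⊓ D.W j) + I.codim F := by
  obtain ⟨c, hcI, hc⟩ := Submodule.exists_mem_ne_zero_of_ne_bot hI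
  have hc' : algebraMap O K c ≠ 0 := by simpa using hc
  obtain ⟨I', hI'⟩ : I ∣ Ideal.span {c} :=
    Ideal.dvd_iff_le.2 ((Ideal.span_singleton_le_iff_mem _).2 hcI)
  have hI'0 : I' ≠ ⊥ := right_ne_zero_of_mul (hI' ▸ span_ne_bot hc)
  have hB0 : I' * J ≠ ⊥ := mul_ne_zero hI'0 hJ
  obtain ⟨j1, hj1⟩ := D.exists_top hB0
  obtain ⟨j2, hj2⟩ := D.exists_top (span_ne_bot hc)
  obtain ⟨i, hi⟩ := D.exhaust (algebraMap O K c)⁻¹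
  refine ⟨i + max j1 j2, fun j hj => ?_⟩
  set V := (D.W j).comap (divLin F K c) with hV
  have e1 : colon F K I J = _ := colon_eq_map hc hI hcI (B := I' * J) (by rw [hI', mul_assoc])
  have e2 : colon F K (⊤ : Ideal O) ⊤ = _ :=
    colon_eq_map hc top_ne_bot Submodule.mem_top (B := Ideal.span {c}) (mul_comm _ _)
  have e3 : colon F K (Ideal.span {c}) (⊤ : Ideal O) = _ :=
    colon_eq_map hc (span_ne_bot hc) (Ideal.mem_span_singleton_self c) (B := ⊤) rfl
  have hVfin : FiniteDimensional F V := by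
    have h1 := D.finite_colon_inf (span_ne_bot hc) top_ne_bot hn j
    refine Module.Finite.of_injective (N := ↥(colon F K (Ideal.span {c}) ⊤ ⊓ D.W j))
      ((divLin F K c).restrict fun v hv => ?_) ?_
    · refine ⟨?_, hv⟩
      rw [e3]
      exact ⟨v, Submodule.mem_top, rfl⟩
    · intro v v' h
      exact Subtype.ext (divLin_injective hc (congrArg Subtype.val h))
  have key : ∀ (B : Ideal O) (j' : ℤ), i + j' ≤ j →
      (∀ a : K, ∃ o ∈ B, a - algebraMap O K o ∈ D.W j') →
      (B.restrictScalars F).map (divLin F K c) ⊔ D.W j = ⊤ ∧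
      Module.finrank F V =
      Module.finrank F ↥((B.restrictScalars F).map (divLin F K c) ⊓ D.W j) + B.codim F := by
    intro B j' hij hB
    have h0 : ∀ a : K, ∃ o ∈ B, (algebraMap O K c)⁻¹ * a - divLin F K c o ∈ D.W j := by
      intro a
      obtain ⟨o, ho, h⟩ := hB a
      refine ⟨o, ho, ?_⟩
      rw [divLin_apply, ← mul_sub]
      exact D.mono hij (D.mul_mem hi h)
    constructor
    · rw [eq_top_iff]
      intro a _
      obtain ⟨o, ho, h⟩ := h0 (algebraMap O K c * a)
      rw [inv_mul_cancel_left₀ hc'] at h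
      rw [← add_sub_cancel (divLin F K c o) a]
      exact Submodule.add_mem_sup ⟨o, ho, rfl⟩ h
    · rw [finrank_map_inf B hc]
      refine finrank_inf_ideal B V fun a => ?_
      obtain ⟨o, ho, h⟩ := h0 (algebraMap O K a)
      refine ⟨a - o, ?_, by simpa using ho⟩
      rwa [hV, Submodule.mem_comap, map_sub]
  obtain ⟨k1, k2⟩ := key _ j1 (by have := le_max_left j1 j2; omega) hj1
  obtain ⟨k3, k4⟩ := key _ j2 (by have := le_max_right j1 j2; omega) hj2
  rw [← e1] at k1 k2
  rw [← e2] at k4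
  refine ⟨k1, ?_⟩
  rw [D.codim_mul hI'0 hJ] at k2
  rw [hI', D.codim_mul hI hI'0] at k4
  omega

end PoleFiltration

end

section

namespace PoleFiltration

variable {F O K : Type*} [Field F] [CommRing O] [IsDedekindDomain O] [Field K] [Algebra O K]
  [IsFractionRing O K] [Algebra F O] [Algebra F K] [IsScalarTower F O K] {n g : ℕ} {x : O}
  (D : PoleFiltration F O K n g x)

include D in
theorem finrank_quotient_colon_le {A : Submodule F K} {i j : ℤ} (hij : i ≤ j)
    (hA : A ⊓ D.W i = ⊥) (htop : A ⊔ D.W j = ⊤) :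
    FiniteDimensional F (K ⧸ A ⊔ D.W i) ∧
    (Module.finrank F (K ⧸ A ⊔ D.W i) + Module.finrank F ↥(A ⊓ D.W j) : ℤ) ≤ n * (j - i) := by
  have := D.finite_quot i j
  let φ : (D.W j ⧸ (D.W i).submoduleOf (D.W j)) →ₗ[F] (K ⧸ A ⊔ D.W i) :=
    Submodule.mapQ _ _ (D.W j).subtype fun v hv => Submodule.mem_sup_right hv
  have hφ : LinearMap.range φ = ⊤ := by
    rw [LinearMap.range_eq_top]
    intro q
    obtain ⟨w, rfl⟩ := Submodule.Quotient.mk_surjective _ q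
    obtain ⟨a, ha, b, hb, hab⟩ := Submodule.mem_sup.1 (htop ▸ Submodule.mem_top : w ∈ A ⊔ D.W j)
    refine ⟨Submodule.Quotient.mk ⟨b, hb⟩, (Submodule.Quotient.eq _).2 ?_⟩
    change b - w ∈ _
    rw [← hab]
    simpa using Submodule.mem_sup_left ha
  let χ : ↥(A ⊓ D.W j) →ₗ[F] (D.W j ⧸ (D.W i).submoduleOf (D.W j)) :=
    ((D.W i).submoduleOf (D.W j)).mkQ ∘ₗ Submodule.inclusion inf_le_right
  have hχ : Function.Injective χ := by
    rw [← LinearMap.ker_eq_bot, Submodule.eq_bot_iff]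
    rintro ⟨v, hv⟩ h
    have h1 : v ∈ D.W i := (Submodule.Quotient.mk_eq_zero ((D.W i).submoduleOf (D.W j))).1 (LinearMap.mem_ker.1 h)
    have h2 : v ∈ A ⊓ D.W i := ⟨hv.1, h1⟩
    rw [hA, Submodule.mem_bot] at h2
    exact Subtype.ext h2
  have hle : LinearMap.range χ ≤ LinearMap.ker φ := by
    rintro _ ⟨⟨v, hv⟩, rfl⟩
    exact (Submodule.Quotient.mk_eq_zero _).2 (Submodule.mem_sup_left hv.1)
  have h1 := Submodule.finrank_mono hle
  rw [LinearMap.finrank_range_of_inj hχ] at h1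
  have h2 := LinearMap.finrank_range_add_finrank_ker φ
  rw [hφ, finrank_top] at h2
  have h3 := D.finrank_quot hij
  exact ⟨Module.Finite.of_surjective φ (LinearMap.range_eq_top.1 hφ), by omega⟩

include D in
theorem finrank_P_le (hn : 0 < n) (s : ℕ) : Module.finrank F (D.P s) ≤
    Module.finrank F ↥(colon F K (⊤ : Ideal O) ⊤ ⊓ D.W s) := by
  have := D.finite_colon_inf (I := (⊤ : Ideal O)) (J := ⊤) top_ne_bot top_ne_bot hn s
  refine LinearMap.finrank_le_finrank_of_injective (f := ((IsScalarTower.toAlgHom F O K).toLinearMap.restrict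
    (q := colon F K (⊤ : Ideal O) ⊤ ⊓ D.W s) fun r hr => ⟨?_, D.P_le s r hr⟩)) ?_
  · intro a _
    exact ⟨r * a, Submodule.mem_top, (map_mul (algebraMap O K) _ _).symm⟩
  · intro v v' h
    exact Subtype.ext (IsFractionRing.injective O K (congrArg Subtype.val h))

include D in
/-- The Riemann inequality in degree larger than `2 * g`. -/
theorem colon_sup_eq_top (hn : 0 < n) {I J : Ideal O} (hI : I ≠ ⊥) (hJ : J ≠ ⊥)
    (hIJ : J.codim F + 2 * g < I.codim F) : colon F K I J ⊔ D.W (-2) = ⊤ := by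
  by_contra hne
  obtain ⟨l, hl0, hl⟩ := Submodule.exists_le_ker_of_lt_top _ (lt_top_iff_ne_top.2 hne)
  obtain ⟨j₀, hj₀⟩ := D.finrank_colon hn hI hJ
  set s : ℕ := I.codim F with hs
  set j : ℕ := j₀.toNat with hj
  obtain ⟨h1, h2⟩ := hj₀ j (Int.self_le_toNat j₀)
  have hn' : (1 : ℤ) ≤ n := by exact_mod_cast hn
  have h3 : colon F K I J ⊓ D.W (-2 - s) = ⊥ := by
    apply D.colon_inf_eq_bot hI hJ
    rw [← hs]
    have : (0 : ℤ) ≤ s := by positivity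
    nlinarith
  obtain ⟨h4, h5⟩ := D.finrank_quotient_colon_le (i := -2 - s) (j := j) (by omega) h3 h1
  set S := colon F K I J ⊔ D.W (-2 - s) with hS
  let m : O →ₗ[F] Module.Dual F K :=
    ((LinearMap.mul F K).compr₂ l) ∘ₗ (IsScalarTower.toAlgHom F O K).toLinearMap
  have hm : ∀ r v, m r v = l (algebraMap O K r * v) := fun r v => rfl
  have hmem : ∀ r ∈ D.P s, m r ∈ S.dualAnnihilator := by
    intro r hr
    rw [Submodule.mem_dualAnnihilator]
    intro v hv
    obtain ⟨a, ha, b, hb, rfl⟩ := Submodule.mem_sup.1 hv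
    rw [hm, mul_add]
    refine hl (Submodule.add_mem_sup ?_ ?_)
    · intro i hi
      obtain ⟨c, hc, h⟩ := ha i hi
      exact ⟨r * c, J.mul_mem_left _ hc, by rw [mul_assoc, h, map_mul]⟩
    · have := D.mul_mem (D.P_le s r hr) hb
      rwa [show (s : ℤ) + (-2 - s) = -2 by ring] at this
  have h6 : Module.finrank F (D.P s) ≤ Module.finrank F S.dualAnnihilator := by
    have : FiniteDimensional F S.dualAnnihilator :=
      Module.Finite.equiv S.dualQuotEquivDualAnnihilator
    refine LinearMap.finrank_le_finrank_of_injective (f := m.restrict hmem) ?_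
    rw [injective_iff_map_eq_zero]
    rintro ⟨r, hr⟩ h
    have h0 : m r = 0 := congrArg Subtype.val h
    by_contra hr0
    have hr1 : algebraMap O K r ≠ 0 := by
      have : r ≠ 0 := fun h => hr0 (Subtype.ext h)
      simpa using this
    apply hl0
    ext v
    have := LinearMap.congr_fun h0 ((algebraMap O K r)⁻¹ * v)
    rwa [hm, mul_inv_cancel_left₀ hr1] at this
  rw [← S.dualQuotEquivDualAnnihilator.finrank_eq, Subspace.dual_finrank_eq] at h6
  have h7 := D.P_finrank s
  have h8 := D.P_finrank j
  have h9 := D.finrank_P_le hn j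
  zify at *
  nlinarith

include D in
/-- The dimension of the space of elements carrying `I` into `J` with small poles, when the
difference of the codimensions is large. -/
theorem exists_finrank_colon_inf (hn : 0 < n) : ∃ e : ℤ, ∀ I J : Ideal O, I ≠ ⊥ → J ≠ ⊥ →
    J.codim F + 2 * g < I.codim F →
    (Module.finrank F ↥(colon F K I J ⊓ D.W (-1)) : ℤ) = I.codim F - J.codim F + e := by
  obtain ⟨j₁, hj₁⟩ := D.finrank_colon hn (I := (⊤ : Ideal O)) (J := ⊤) top_ne_bot top_ne_bot
  obtain ⟨h1, -⟩ := hj₁ j₁ le_rfl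
  refine ⟨Module.finrank F ↥(colon F K (⊤ : Ideal O) ⊤ ⊓ D.W j₁) - n * (j₁ + 1),
    fun I J hI hJ hIJ => ?_⟩
  obtain ⟨j₀, hj₀⟩ := D.finrank_colon hn hI hJ
  set j := max (max j₀ j₁) 0 with hj
  have hjj : j₀ ≤ j ∧ j₁ ≤ j ∧ 0 ≤ j := by omega
  obtain ⟨-, h2⟩ := hj₀ j hjj.1
  have h3 := (D.finite_inf _ hjj.2.1
    (D.finite_colon_inf top_ne_bot top_ne_bot hn j₁)).2.2 h1
  have h4 := (D.finite_inf (colon F K I J) (i := -1) (j := j) (by omega)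
    (D.finite_colon_inf hI hJ hn _)).2.2 (by
      rw [eq_top_iff, ← D.colon_sup_eq_top hn hI hJ hIJ]
      exact sup_le_sup_left (D.mono (by norm_num)) _)
  zify at *
  linarith

end PoleFiltration

end

/-- A linear section of the projection modulo `W` with values in a complementary space `A`. -/
theorem Submodule.exists_section_of_sup_eq_top {F K : Type*} [Field F] [AddCommGroup K] [Module F K]
    {A W : Submodule F K} (h : A ⊔ W = ⊤) :
    ∃ s : (K ⧸ W) →ₗ[F] K, ∀ q, s q ∈ A ∧ W.mkQ (s q) = q := by
  have hs : LinearMap.range (W.mkQ ∘ₗ A.subtype) = ⊤ := by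
    rwa [LinearMap.range_comp, Submodule.range_subtype, Submodule.map_mkQ_eq_top, sup_comm]
  obtain ⟨s, hs⟩ := LinearMap.exists_rightInverse_of_surjective _ hs
  exact ⟨A.subtype ∘ₗ s, fun q => ⟨(s q).2, LinearMap.congr_fun hs q⟩⟩

namespace PoleFiltration

variable {F O K : Type*} [Field F] [CommRing O] [IsDedekindDomain O] [Field K] [Algebra O K]
  [IsFractionRing O K] [Algebra F O] [Algebra F K] [IsScalarTower F O K] {n g : ℕ} {x : O}
  (D : PoleFiltration F O K n g x)

/-- The units of the order at infinity. -/
def units : Set K := {f | f ≠ 0 ∧ f ∈ D.W 0 ∧ f⁻¹ ∈ D.W 0}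

theorem one_mem_units : (1 : K) ∈ D.units := ⟨one_ne_zero, D.one_mem, by simpa using D.one_mem⟩

theorem inv_mem_units {f : K} (hf : f ∈ D.units) : f⁻¹ ∈ D.units :=
  ⟨inv_ne_zero hf.1, hf.2.2, by simpa using hf.2.1⟩

theorem pow_mem {f : K} {i : ℤ} (hf : f ∈ D.W i) (k : ℕ) : f ^ k ∈ D.W (k * i) := by
  induction k with
  | zero => simpa using D.one_mem
  | succ k ih =>
    rw [pow_succ]
    have := D.mul_mem ih hf
    rwa [show (k : ℤ) * i + i = (k + 1 : ℕ) * i by push_cast; ring] at this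

theorem one_add_mem_units {u : K} (hu : u ∈ D.W (-1)) : 1 + u ∈ D.units := by
  have h0 : 1 + u ≠ 0 := by
    intro h
    apply D.one_notMem
    rw [eq_neg_of_add_eq_zero_left h]
    exact neg_mem hu
  refine ⟨h0, add_mem D.one_mem (D.mono (by norm_num) hu), ?_⟩
  obtain ⟨j, hj⟩ := D.exhaust (1 + u)⁻¹
  have h1 : (1 + u)⁻¹ = ∑ i ∈ Finset.range j.toNat, (-u) ^ i + (-u) ^ j.toNat * (1 + u)⁻¹ := by
    have := geom_sum_mul (-u) j.toNat
    field_simp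
    linear_combination this
  rw [h1]
  refine add_mem (sum_mem fun i _ => ?_) ?_
  · exact D.mono (by simp) (D.pow_mem (neg_mem hu) i)
  · refine D.mono ?_ (D.mul_mem (D.pow_mem (neg_mem hu) j.toNat) hj)
    have := Int.self_le_toNat j
    omega

theorem add_mem_units {f w : K} (hf : f ∈ D.units) (hw : w ∈ D.W (-1)) : f + w ∈ D.units := by
  have h0 := hf.1
  have h1 : f⁻¹ * w ∈ D.W (-1) := by simpa using D.mul_mem hf.2.2 hw
  have h2 : f + w = f * (1 + f⁻¹ * w) := by field_simp
  obtain ⟨h3, h4, h5⟩ := D.one_add_mem_units h1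
  rw [h2]
  refine ⟨mul_ne_zero h0 h3, by simpa using D.mul_mem hf.2.1 h4, ?_⟩
  rw [mul_inv]
  simpa using D.mul_mem hf.2.2 h5

/-- The number of residue classes of units at infinity. -/
noncomputable def unitClasses : ℕ := Nat.card ((D.W (-1)).mkQ '' D.units)

theorem unitClasses_ne_zero [Finite F] : D.unitClasses ≠ 0 := by
  have hfin : ((D.W (-1)).mkQ '' D.units).Finite := by
    have := D.finite_quot (-1) 0
    let φ : (D.W 0 ⧸ (D.W (-1)).submoduleOf (D.W 0)) →ₗ[F] (K ⧸ D.W (-1)) :=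
      Submodule.mapQ _ _ (D.W 0).subtype fun v hv => hv
    have : Finite (D.W 0 ⧸ (D.W (-1)).submoduleOf (D.W 0)) := Module.finite_of_finite F
    refine (Set.finite_range φ).subset ?_
    rintro _ ⟨f, hf, rfl⟩
    exact ⟨Submodule.Quotient.mk ⟨f, hf.2.1⟩, rfl⟩
  have : Finite ((D.W (-1)).mkQ '' D.units) := hfin
  have : Nonempty ((D.W (-1)).mkQ '' D.units) := ⟨⟨_, 1, D.one_mem_units, rfl⟩⟩
  exact Nat.card_pos.ne'

theorem card_inter_units [Finite F] {A : Submodule F K} (hA : A ⊔ D.W (-1) = ⊤)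
    (hfin : FiniteDimensional F ↥(A ⊓ D.W (-1))) :
    Nat.card ↥((A : Set K) ∩ D.units) =
      D.unitClasses * Nat.card F ^ Module.finrank F ↥(A ⊓ D.W (-1)) := by
  obtain ⟨s, hs⟩ := Submodule.exists_section_of_sup_eq_top hA
  have hsub : ∀ f, f - s ((D.W (-1)).mkQ f) ∈ D.W (-1) := fun f => by
    rw [← Submodule.Quotient.eq]
    exact ((hs _).2).symm
  let e : ↥((A : Set K) ∩ D.units) ≃ ↥((D.W (-1)).mkQ '' D.units) × ↥(A ⊓ D.W (-1)) :=
    { toFun := fun f => (⟨(D.W (-1)).mkQ f, f, f.2.2, rfl⟩,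
        ⟨f - s ((D.W (-1)).mkQ f), sub_mem f.2.1 (hs _).1, hsub _⟩)
      invFun := fun q => ⟨s q.1 + q.2, add_mem (hs _).1 q.2.2.1, by
        obtain ⟨⟨_, f, hf, rfl⟩, w, hw⟩ := q
        refine D.add_mem_units ?_ hw.2
        have := D.add_mem_units hf (neg_mem (hsub f))
        simpa using this⟩
      left_inv := fun f => by simp
      right_inv := by
        rintro ⟨⟨q, hq⟩, w, hw⟩
        have h1 : (D.W (-1)).mkQ (s q + w) = q := by
          rw [map_add, (hs q).2, add_eq_left]
          exact (Submodule.Quotient.mk_eq_zero _).2 hw.2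
        ext
        · exact h1
        · change s q + w - s ((D.W (-1)).mkQ (s q + w)) = w
          rw [h1]
          abel }
  rw [Nat.card_congr e, Nat.card_prod, unitClasses,
    Module.natCard_eq_pow_finrank (K := F) (V := ↥(A ⊓ D.W (-1)))]

end PoleFiltration

section

namespace PoleFiltration

variable {F O K : Type*} [Field F] [CommRing O] [IsDedekindDomain O] [Field K] [Algebra O K]
  [IsFractionRing O K] [Algebra F O] [Algebra F K] [IsScalarTower F O K] {n g : ℕ} {x : O}
  (D : PoleFiltration F O K n g x)

/-- The part of the fractional ideal `f I` contained in `O`. -/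
def fracMul (f : K) (I : Ideal O) : Ideal O where
  carrier := {b | ∃ a ∈ I, f * algebraMap O K a = algebraMap O K b}
  add_mem' := by
    rintro b b' ⟨a, ha, h⟩ ⟨a', ha', h'⟩
    exact ⟨a + a', add_mem ha ha', by rw [map_add, mul_add, h, h', map_add]⟩
  zero_mem' := ⟨0, zero_mem _, by simp⟩
  smul_mem' := by
    rintro c b ⟨a, ha, h⟩
    refine ⟨c * a, I.mul_mem_left _ ha, ?_⟩
    rw [smul_eq_mul, map_mul, map_mul, ← h]
    ring

theorem fracMul_le {f : K} {I J : Ideal O} (hf : f ∈ colon F K I J) : fracMul f I ≤ J := by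
  rintro b ⟨a, ha, h⟩
  obtain ⟨c, hc, h'⟩ := hf a ha
  rwa [← IsFractionRing.injective O K (h.symm.trans h')] at hc

theorem colon_mono {I J J' : Ideal O} (h : J ≤ J') : colon F K I J ≤ colon F K I J' := by
  intro f hf a ha
  obtain ⟨b, hb, h1⟩ := hf a ha
  exact ⟨b, h hb, h1⟩

theorem inv_mem_colon {f : K} (hf0 : f ≠ 0) {I : Ideal O} :
    f⁻¹ ∈ colon F K (fracMul f I) I := by
  rintro b ⟨a, ha, h⟩
  exact ⟨a, ha, by rw [← h, inv_mul_cancel_left₀ hf0]⟩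

theorem fracMul_inv_fracMul {f : K} (hf0 : f ≠ 0) {I J : Ideal O} (hf : f ∈ colon F K I J) :
    fracMul f⁻¹ (fracMul f I) = I := by
  refine le_antisymm (fracMul_le (inv_mem_colon (F := F) hf0)) fun a ha => ?_
  obtain ⟨b, hb, h⟩ := hf a ha
  exact ⟨b, ⟨a, ha, h⟩, by rw [← h, inv_mul_cancel_left₀ hf0]⟩

theorem fracMul_ne_bot {f : K} (hf0 : f ≠ 0) {I J : Ideal O} (hI : I ≠ ⊥)
    (hf : f ∈ colon F K I J) : fracMul f I ≠ ⊥ := by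
  intro h
  apply hI
  rw [← fracMul_inv_fracMul hf0 hf, h, eq_bot_iff]
  rintro b ⟨a, ha, h⟩
  rw [Ideal.mem_bot.1 ha, map_zero, mul_zero] at h
  exact Ideal.mem_bot.2 ((map_eq_zero_iff _ (IsFractionRing.injective O K)).1 h.symm)

theorem span_mul_eq {f : K} (hf0 : f ≠ 0) {I J : Ideal O} (hf : f ∈ colon F K I J) {a b : O}
    (hab : f * algebraMap O K b = algebraMap O K a) :
    Ideal.span {a} * I = Ideal.span {b} * fracMul f I := by
  refine le_antisymm ?_ ?_
  · refine span_mul_le_of_mem_colon (F := F) (fun i hi => ?_) hab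
    obtain ⟨j, hj, h⟩ := hf i hi
    exact ⟨j, ⟨i, hi, h⟩, h⟩
  · refine span_mul_le_of_mem_colon (inv_mem_colon (F := F) hf0) ?_
    rw [← hab, inv_mul_cancel_left₀ hf0]

theorem num_ne_zero {f : K} (hf0 : f ≠ 0) {a b : O} (hb : b ≠ 0)
    (hab : f * algebraMap O K b = algebraMap O K a) : a ≠ 0 := by
  rintro rfl
  have hb' : algebraMap O K b ≠ 0 := by simpa using hb
  simp [hf0, hb] at hab

theorem codim_fracMul {f : K} (hf : f ∈ D.units) {I J : Ideal O} (hI : I ≠ ⊥)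
    (hfI : f ∈ colon F K I J) : (fracMul f I).codim F = I.codim F := by
  obtain ⟨a, b, hb, hab⟩ := exists_quotient_mem (O := O) f
  have ha := num_ne_zero hf.1 hb hab
  have h1 := congrArg (Ideal.codim F) (span_mul_eq hf.1 hfI hab)
  rw [D.codim_mul (span_ne_bot ha) hI,
    D.codim_mul (span_ne_bot hb) (fracMul_ne_bot hf.1 hI hfI)] at h1
  have h2 := D.codim_le f a b 0 ha hb hf.2.1 hab.symm
  have h3 := D.codim_le f⁻¹ b a 0 hb ha hf.2.2 (by rw [← hab, inv_mul_cancel_left₀ hf.1])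
  omega

theorem traceOf_fracMul {f f' t : K} {b : F} (hf0 : f ≠ 0) (hf0' : f' ≠ 0) (ht0 : t ≠ 0)
    {I J : Ideal O} (hI : I ≠ ⊥) (hf : f ∈ colon F K I J) (hf' : f' ∈ colon F K I J)
    (ht : t - 1 ∈ D.W (-2))
    (h : f' * algebraMap O K x = f * t * algebraMap O K (x - algebraMap F O b)) :
    (fracMul f' I).traceOf F x = (fracMul f I).traceOf F x + n * b := by
  obtain ⟨a, c, hc, hac⟩ := exists_quotient_mem (O := O) f
  have ha := num_ne_zero hf0 hc hac
  obtain ⟨α, β, hβ, hαβ⟩ := exists_quotient_mem (O := O) t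
  have hα := num_ne_zero ht0 hβ hαβ
  obtain ⟨hxb, htr⟩ := D.trace_sub b
  obtain ⟨-, htr0⟩ := D.trace_sub 0
  rw [map_zero, sub_zero, mul_zero] at htr0
  have h1 := D.trace_eq t α β hα hβ ht hαβ.symm
  have h2 := congrArg (Ideal.traceOf F x) (span_mul_eq hf0 hf hac)
  have h3 := congrArg (Ideal.traceOf F x) (span_mul_eq hf0' hf'
    (a := a * α * (x - algebraMap F O b)) (b := c * β * x) (by
      rw [map_mul, map_mul, map_mul, map_mul, ← hac, ← hαβ]
      linear_combination (algebraMap O K c * algebraMap O K β) * h))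
  have hI' := fracMul_ne_bot hf0 hI hf
  have hI'' := fracMul_ne_bot hf0' hI hf'
  simp only [← Ideal.span_singleton_mul_span_singleton] at h3
  have sa := span_ne_bot ha
  have sc := span_ne_bot hc
  have sα := span_ne_bot hα
  have sβ := span_ne_bot hβ
  have sx := span_ne_bot D.x_ne
  have sxb := span_ne_bot hxb
  rw [D.traceOf_mul sa hI, D.traceOf_mul sc hI'] at h2
  rw [D.traceOf_mul (mul_ne_zero (mul_ne_zero sa sα) sxb) hI, D.traceOf_mul (mul_ne_zero sa sα) sxb,
    D.traceOf_mul sa sα, D.traceOf_mul (mul_ne_zero (mul_ne_zero sc sβ) sx) hI'',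
    D.traceOf_mul (mul_ne_zero sc sβ) sx, D.traceOf_mul sc sβ, htr, htr0, h1] at h3
  linear_combination h2 - h3

include D in
/-- Multiplication of the elements of `A` at infinity by `1 - b / x`, to second order. -/
theorem exists_shift {A : Submodule F K} (hA : A ⊔ D.W (-2) = ⊤) :
    ∃ τ : K →ₗ[F] K, (∀ f, τ f ∈ A) ∧ (∀ f, τ f - (algebraMap O K x)⁻¹ * f ∈ D.W (-2)) ∧
      ∀ f ∈ D.W 0, τ f ∈ D.W (-1) ∧ τ (τ f) = 0 := by
  obtain ⟨s, hs⟩ := Submodule.exists_section_of_sup_eq_top hA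
  let τ : K →ₗ[F] K := s ∘ₗ (D.W (-2)).mkQ ∘ₗ LinearMap.mulLeft F (algebraMap O K x)⁻¹
  have h1 : ∀ f, τ f - (algebraMap O K x)⁻¹ * f ∈ D.W (-2) := fun f => by
    rw [← Submodule.Quotient.eq]
    exact (hs _).2
  have h2 : ∀ f ∈ D.W 0, τ f ∈ D.W (-1) := fun f hf => by
    rw [← sub_add_cancel (τ f) ((algebraMap O K x)⁻¹ * f)]
    refine add_mem (D.mono (by norm_num) (h1 f)) ?_
    simpa using D.mul_mem D.x_inv_mem hf
  refine ⟨τ, fun f => (hs _).1, h1, fun f hf => ⟨h2 f hf, ?_⟩⟩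
  have h3 : (D.W (-2)).mkQ ((algebraMap O K x)⁻¹ * τ f) = 0 :=
    (Submodule.Quotient.mk_eq_zero _).2 (D.mul_mem D.x_inv_mem (h2 f hf))
  change s ((D.W (-2)).mkQ ((algebraMap O K x)⁻¹ * τ f)) = 0
  rw [h3, map_zero]

end PoleFiltration

end

section

namespace PoleFiltration

variable {F O K : Type*} [Field F] [CommRing O] [IsDedekindDomain O] [Field K] [Algebra O K]
  [IsFractionRing O K] [Algebra F O] [Algebra F K] [IsScalarTower F O K] {n g : ℕ} {x : O}
  (D : PoleFiltration F O K n g x)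

theorem finite_colon_inter_units [Finite F] (hn : 0 < n) {I J : Ideal O} (hI : I ≠ ⊥) (hJ : J ≠ ⊥) :
    ((colon F K I J : Set K) ∩ D.units).Finite := by
  have := D.finite_colon_inf hI hJ hn 0
  have : Finite ↥(colon F K I J ⊓ D.W 0) := Module.finite_of_finite F
  exact (Set.toFinite ((colon F K I J ⊓ D.W 0 : Submodule F K) : Set K)).subset
    fun f hf => ⟨hf.1, hf.2.2.1⟩

theorem shift_mem_units {f b : K} (hf : f ∈ D.units) (hb : b ∈ D.W (-1)) : f - b ∈ D.units := by
  rw [sub_eq_add_neg]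
  exact D.add_mem_units hf (neg_mem hb)

theorem sum_traceOf_fracMul_eq_zero (hn : (n : F) ≠ 0) (ψ : AddChar F ℂ) (hψ : ψ ≠ 1)
    {I : Ideal O} (hI : I ≠ ⊥) (hIg : 2 * g < I.codim F) (S : Finset K)
    (hS : (S : Set K) = (colon F K I (⊤ : Ideal O) : Set K) ∩ D.units) :
    ∑ f ∈ S, ψ ((fracMul f I).traceOf F x) = 0 := by
  have hn0 : 0 < n := Nat.pos_of_ne_zero fun h => hn (by simp [h])
  have htop : (⊤ : Ideal O).codim F = 0 := by
    rw [Ideal.codim]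
    exact Module.finrank_zero_of_subsingleton
  have hsup := D.colon_sup_eq_top hn0 hI (J := ⊤) top_ne_bot (by omega)
  obtain ⟨τ, hτA, hτ, hτ0⟩ := D.exists_shift hsup
  obtain ⟨a, ha⟩ : ∃ a, ψ a ≠ 1 := by
    by_contra! h
    exact hψ (by ext a; simp [h a])
  set b : F := a / n with hb
  have hnb : n * b = a := by rw [hb]; field_simp
  have hmem : ∀ f, f ∈ S ↔ f ∈ colon F K I (⊤ : Ideal O) ∧ f ∈ D.units := fun f => by
    rw [← Finset.mem_coe, hS]; rfl
  have hΦ : ∀ (c : F) f, f ∈ S → f - c • τ f ∈ S := fun c f hf => by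
    rw [hmem] at hf ⊢
    exact ⟨sub_mem hf.1 (Submodule.smul_mem _ _ (hτA f)),
      D.shift_mem_units hf.2 (Submodule.smul_mem _ _ (hτ0 f hf.2.2.1).1)⟩
  have hΦΦ : ∀ (c : F) f, f ∈ S → (f - c • τ f) - (-c) • τ (f - c • τ f) = f := fun c f hf => by
    rw [map_sub, map_smul, (hτ0 f ((hmem f).1 hf).2.2.1).2]
    simp
  have hx : algebraMap O K x ≠ 0 := by simpa using D.x_ne
  have key : ∀ f ∈ S, ψ ((fracMul (f - b • τ f) I).traceOf F x) =
      ψ ((fracMul f I).traceOf F x) * ψ a := by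
    intro f hf
    have hf' := hΦ b f hf
    rw [hmem] at hf hf'
    have hxb : algebraMap O K (x - algebraMap F O b) ≠ 0 :=
      (map_ne_zero_iff _ (IsFractionRing.injective O K)).2 (D.trace_sub b).1
    have hf0 := hf.2.1
    have hf0' := hf'.2.1
    rw [← AddChar.map_add_eq_mul, ← hnb]
    congr 1
    refine D.traceOf_fracMul (t := (f - b • τ f) * algebraMap O K x /
      (f * algebraMap O K (x - algebraMap F O b))) hf0 hf0' ?_ hI hf.1 hf'.1 ?_ ?_
    · exact div_ne_zero (mul_ne_zero hf0' hx) (mul_ne_zero hf0 hxb)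
    · have hu := D.one_add_mem_units (u := -(b • (algebraMap O K x)⁻¹))
        (neg_mem (Submodule.smul_mem _ _ D.x_inv_mem))
      have h1 := D.mul_mem (D.mul_mem (hτ f) hf.2.2.2) hu.2.2
      simp only [add_zero] at h1
      have h2 := Submodule.smul_mem _ (-b) h1
      convert h2 using 1
      have h3 : (1 : K) + -(b • (algebraMap O K x)⁻¹) =
          algebraMap O K (x - algebraMap F O b) / algebraMap O K x := by
        rw [map_sub, ← IsScalarTower.algebraMap_apply, Algebra.smul_def]
        field_simp
        ring
      rw [h3, inv_div, Algebra.smul_def, Algebra.smul_def, map_neg]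
      rw [map_sub, ← IsScalarTower.algebraMap_apply] at hxb ⊢
      field_simp
      ring
    · field_simp
  have h1 : ∑ f ∈ S, ψ ((fracMul f I).traceOf F x) =
      ∑ f ∈ S, ψ ((fracMul (f - b • τ f) I).traceOf F x) := by
    symm
    refine Finset.sum_nbij' (fun f => f - b • τ f) (fun f => f - (-b) • τ f) (hΦ b) (hΦ (-b))
      (hΦΦ b) (fun f hf => ?_) (fun f hf => rfl)
    have := hΦΦ (-b) f hf
    rwa [neg_neg] at this
  rw [Finset.sum_congr rfl key, ← Finset.sum_mul] at h1
  have h2 : (∑ f ∈ S, ψ ((fracMul f I).traceOf F x)) * (1 - ψ a) = 0 := by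
    linear_combination h1
  rcases mul_eq_zero.1 h2 with h | h
  · exact h
  · exact absurd (sub_eq_zero.1 h).symm ha

end PoleFiltration

end

section

namespace PoleFiltration

variable {F O K : Type*} [Field F] [CommRing O] [IsDedekindDomain O] [Field K] [Algebra O K]
  [IsFractionRing O K] [Algebra F O] [Algebra F K] [IsScalarTower F O K] {n g : ℕ} {x : O}
  (D : PoleFiltration F O K n g x)

/-- The nonzero ideals of codimension `m`. -/
noncomputable def idealsOfCodim (m : ℕ) : Finset (Ideal O) := (D.finite_ideals m).toFinset

theorem mem_idealsOfCodim {m : ℕ} {I : Ideal O} :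
    I ∈ D.idealsOfCodim m ↔ I ≠ ⊥ ∧ I.codim F = m := by
  simp [idealsOfCodim]

theorem exists_colonUnits [Finite F] (hn : 0 < n) : ∃ U : Ideal O → Ideal O → Finset K,
    ∀ I J, I ≠ ⊥ → J ≠ ⊥ → (U I J : Set K) = (colon F K I J : Set K) ∩ D.units := by
  classical
  refine ⟨fun I J => if h : I ≠ ⊥ ∧ J ≠ ⊥ then
    (D.finite_colon_inter_units hn h.1 h.2).toFinset else ∅, fun I J hI hJ => ?_⟩
  simp [hI, hJ]

include D in
theorem codim_top : (⊤ : Ideal O).codim F = 0 := by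
  rw [Ideal.codim]
  exact Module.finrank_zero_of_subsingleton

theorem exists_card_colonUnits [Finite F] (hn : 0 < n) : ∃ e : ℤ, ∀ (U : Finset K) (I J : Ideal O),
    I ≠ ⊥ → J ≠ ⊥ → J.codim F + 2 * g < I.codim F →
    (U : Set K) = (colon F K I J : Set K) ∩ D.units →
    (U.card : ℚ) = D.unitClasses * (Nat.card F : ℚ) ^ ((I.codim F : ℤ) - J.codim F + e) := by
  obtain ⟨e, he⟩ := D.exists_finrank_colon_inf hn
  refine ⟨e, fun U I J hI hJ hIJ hU => ?_⟩
  have htop : colon F K I J ⊔ D.W (-1) = ⊤ := by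
    rw [eq_top_iff, ← D.colon_sup_eq_top hn hI hJ hIJ]
    exact sup_le_sup_left (D.mono (by norm_num)) _
  rw [← he I J hI hJ hIJ, zpow_natCast, ← Set.ncard_coe_finset U, ← Nat.card_coe_set_eq]
  have := D.card_inter_units htop (D.finite_colon_inf hI hJ hn _)
  rw [← hU] at this
  exact_mod_cast this

/-- Vanishing of the twisted count of ideals of large codimension. -/
theorem sum_traceOf_eq_zero [Finite F] (hn : (n : F) ≠ 0) (ψ : AddChar F ℂ) (hψ : ψ ≠ 1) {m : ℕ}
    (hm : 2 * g < m) : ∑ I ∈ D.idealsOfCodim m, ψ (I.traceOf F x) = 0 := by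
  have hn0 : 0 < n := Nat.pos_of_ne_zero fun h => hn (by simp [h])
  obtain ⟨U, hU⟩ := D.exists_colonUnits hn0
  obtain ⟨e, he⟩ := D.exists_card_colonUnits hn0
  have hmem : ∀ I f, I ≠ ⊥ → (f ∈ U I ⊤ ↔ f ∈ colon F K I (⊤ : Ideal O) ∧ f ∈ D.units) :=
    fun I f hI => by rw [← Finset.mem_coe, hU I ⊤ hI top_ne_bot]; rfl
  have h1 : ∑ I ∈ D.idealsOfCodim m, ∑ f ∈ U I ⊤, ψ ((fracMul f I).traceOf F x) = 0 := by
    refine Finset.sum_eq_zero fun I hI => ?_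
    obtain ⟨hI0, hIm⟩ := D.mem_idealsOfCodim.1 hI
    exact D.sum_traceOf_fracMul_eq_zero hn ψ hψ hI0 (by omega) _ (hU I ⊤ hI0 top_ne_bot)
  have hmaps : ∀ p ∈ (D.idealsOfCodim m).sigma (fun I => U I ⊤),
      (⟨fracMul p.2 p.1, p.2⁻¹⟩ : (_ : Ideal O) × K) ∈
        (D.idealsOfCodim m).sigma (fun I => U I ⊤) := by
    rintro ⟨I, f⟩ h
    rw [Finset.mem_sigma, mem_idealsOfCodim] at h ⊢
    obtain ⟨⟨hI, hIm⟩, hf⟩ := h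
    rw [hmem _ _ hI] at hf
    have hb := fracMul_ne_bot hf.2.1 hI hf.1
    refine ⟨⟨hb, (D.codim_fracMul hf.2 hI hf.1).trans hIm⟩, ?_⟩
    rw [hmem _ _ hb]
    exact ⟨colon_mono le_top (inv_mem_colon hf.2.1), D.inv_mem_units hf.2⟩
  have hinv : ∀ p ∈ (D.idealsOfCodim m).sigma (fun I => U I ⊤),
      (⟨fracMul p.2⁻¹ (fracMul p.2 p.1), p.2⁻¹⁻¹⟩ : (_ : Ideal O) × K) = p := by
    rintro ⟨I, f⟩ h
    rw [Finset.mem_sigma, mem_idealsOfCodim] at h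
    obtain ⟨⟨hI, hIm⟩, hf⟩ := h
    rw [hmem _ _ hI] at hf
    simp only [inv_inv, fracMul_inv_fracMul hf.2.1 hf.1]
  have h2 : ∑ I ∈ D.idealsOfCodim m, ∑ f ∈ U I ⊤, ψ ((fracMul f I).traceOf F x) =
      ∑ I ∈ D.idealsOfCodim m, ∑ f ∈ U I ⊤, ψ (I.traceOf F x) := by
    rw [Finset.sum_sigma', Finset.sum_sigma']
    exact Finset.sum_nbij' (fun p => ⟨fracMul p.2 p.1, p.2⁻¹⟩) (fun p => ⟨fracMul p.2 p.1, p.2⁻¹⟩)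
      hmaps hmaps hinv hinv (fun p hp => rfl)
  rw [h1] at h2
  have h3 : ∀ I ∈ D.idealsOfCodim m, ∑ f ∈ U I ⊤, ψ (I.traceOf F x) =
      ((D.unitClasses * (Nat.card F : ℚ) ^ ((m : ℤ) + e) : ℚ) : ℂ) * ψ (I.traceOf F x) := by
    intro I hI
    obtain ⟨hI0, hIm⟩ := D.mem_idealsOfCodim.1 hI
    have := he (U I ⊤) I ⊤ hI0 top_ne_bot (by rw [D.codim_top]; omega) (hU I ⊤ hI0 top_ne_bot)
    rw [D.codim_top, hIm, Nat.cast_zero, sub_zero] at this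
    rw [Finset.sum_const, nsmul_eq_mul, ← this]
    norm_cast
  rw [Finset.sum_congr rfl h3, ← Finset.mul_sum, eq_comm, mul_eq_zero] at h2
  refine h2.resolve_left ?_
  have := D.unitClasses_ne_zero
  have hF : Nat.card F ≠ 0 := Nat.card_pos.ne'
  refine Rat.cast_ne_zero.2 ?_
  exact mul_ne_zero (by exact_mod_cast this) (zpow_ne_zero _ (by exact_mod_cast hF))

theorem card_sigma_colonUnits {P : Ideal O} (hP : P ≠ ⊥) (hP1 : P.codim F = 1)
    {U : Ideal O → Ideal O → Finset K} (hmem : ∀ I J f, I ≠ ⊥ → J ≠ ⊥ →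
      (f ∈ U I J ↔ f ∈ colon F K I J ∧ f ∈ D.units)) (m : ℕ) :
    ((D.idealsOfCodim m).sigma (fun I => U (I * P) ⊤)).card =
      ((D.idealsOfCodim (m + 1)).sigma (fun J => U J P)).card := by
  refine Finset.card_bij (fun p _ => ⟨fracMul p.2 (p.1 * P), p.2⁻¹⟩) ?_ ?_ ?_
  · rintro ⟨I, f⟩ h
    rw [Finset.mem_sigma, mem_idealsOfCodim] at h ⊢
    obtain ⟨⟨hI, hIm⟩, hf⟩ := h
    have hIP : I * P ≠ ⊥ := mul_ne_zero hI hP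
    rw [hmem _ _ _ hIP top_ne_bot] at hf
    have hb := fracMul_ne_bot hf.2.1 hIP hf.1
    refine ⟨⟨hb, ?_⟩, ?_⟩
    · rw [D.codim_fracMul hf.2 hIP hf.1, D.codim_mul hI hP, hIm, hP1]
    · rw [hmem _ _ _ hb hP]
      exact ⟨colon_mono Ideal.mul_le_right (inv_mem_colon hf.2.1), D.inv_mem_units hf.2⟩
  · rintro ⟨I, f⟩ h ⟨I', f'⟩ h' heq
    rw [Finset.mem_sigma, mem_idealsOfCodim] at h h'
    have hf := (hmem _ _ _ (mul_ne_zero h.1.1 hP) top_ne_bot).1 h.2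
    have hf' := (hmem _ _ _ (mul_ne_zero h'.1.1 hP) top_ne_bot).1 h'.2
    simp only [Sigma.mk.injEq, heq_eq_eq, inv_inj] at heq
    obtain ⟨h1, rfl⟩ := heq
    have h2 := congrArg (fracMul f⁻¹) h1
    rw [fracMul_inv_fracMul hf.2.1 hf.1, fracMul_inv_fracMul hf.2.1 hf'.1] at h2
    have h3 : I = I' := mul_right_cancel₀ hP h2
    rw [h3]
  · rintro ⟨J, f⟩ h
    rw [Finset.mem_sigma, mem_idealsOfCodim] at h
    obtain ⟨⟨hJ, hJm⟩, hf⟩ := h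
    rw [hmem _ _ _ hJ hP] at hf
    obtain ⟨I, hI⟩ := Ideal.dvd_iff_le.2 (fracMul_le hf.1)
    rw [mul_comm] at hI
    have hb := fracMul_ne_bot hf.2.1 hJ hf.1
    have hI0 : I ≠ ⊥ := left_ne_zero_of_mul (hI ▸ hb)
    have hc := D.codim_fracMul hf.2 hJ hf.1
    rw [hI, D.codim_mul hI0 hP] at hc
    refine ⟨⟨I, f⁻¹⟩, ?_, ?_⟩
    · rw [Finset.mem_sigma, mem_idealsOfCodim]
      refine ⟨⟨hI0, by change I.codim F = m; omega⟩, ?_⟩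
      rw [hmem _ _ _ (mul_ne_zero hI0 hP) top_ne_bot, ← hI]
      exact ⟨colon_mono le_top (inv_mem_colon hf.2.1), D.inv_mem_units hf.2⟩
    · simp only [← hI, inv_inv, fracMul_inv_fracMul hf.2.1 hf.1]

/-- Recursion for the number of ideals of large codimension. -/
theorem card_idealsOfCodim_succ [Finite F] (hn : 0 < n) {P : Ideal O} (hP : P ≠ ⊥)
    (hP1 : P.codim F = 1) {m : ℕ} (hm : 2 * g < m) :
    (D.idealsOfCodim (m + 1)).card = Nat.card F * (D.idealsOfCodim m).card := by
  obtain ⟨U, hU⟩ := D.exists_colonUnits hn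
  obtain ⟨e, he⟩ := D.exists_card_colonUnits hn
  have hmem : ∀ I J f, I ≠ ⊥ → J ≠ ⊥ → (f ∈ U I J ↔ f ∈ colon F K I J ∧ f ∈ D.units) :=
    fun I J f hI hJ => by rw [← Finset.mem_coe, hU I J hI hJ]; rfl
  have h1 := D.card_sigma_colonUnits hP hP1 hmem m
  rw [Finset.card_sigma, Finset.card_sigma] at h1
  have h2 : ∀ I ∈ D.idealsOfCodim m, ((U (I * P) ⊤).card : ℚ) =
      D.unitClasses * (Nat.card F : ℚ) ^ ((m : ℤ) + e) * Nat.card F := by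
    intro I hI
    obtain ⟨hI0, hIm⟩ := D.mem_idealsOfCodim.1 hI
    have hIP : I * P ≠ ⊥ := mul_ne_zero hI0 hP
    have hc := D.codim_mul hI0 hP
    have hF : (Nat.card F : ℚ) ≠ 0 := by exact_mod_cast (Nat.card_pos (α := F)).ne'
    rw [he _ _ _ hIP top_ne_bot (by rw [D.codim_top]; omega) (hU _ _ hIP top_ne_bot), D.codim_top,
      hc, hIm, hP1, mul_assoc, ← zpow_add_one₀ hF]
    congr 2
    push_cast
    ring
  have h3 : ∀ J ∈ D.idealsOfCodim (m + 1), ((U J P).card : ℚ) =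
      D.unitClasses * (Nat.card F : ℚ) ^ ((m : ℤ) + e) := by
    intro J hJ
    obtain ⟨hJ0, hJm⟩ := D.mem_idealsOfCodim.1 hJ
    rw [he _ _ _ hJ0 hP (by omega) (hU _ _ hJ0 hP), hJm, hP1]
    congr 2
    push_cast
    ring
  have h4 : ((∑ I ∈ D.idealsOfCodim m, (U (I * P) ⊤).card : ℕ) : ℚ) =
    ((∑ J ∈ D.idealsOfCodim (m + 1), (U J P).card : ℕ) : ℚ) := by rw [h1]
  push_cast at h4
  rw [Finset.sum_congr rfl h2, Finset.sum_congr rfl h3, Finset.sum_const, Finset.sum_const,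
    nsmul_eq_mul, nsmul_eq_mul] at h4
  have h5 : (D.unitClasses * (Nat.card F : ℚ) ^ ((m : ℤ) + e)) ≠ 0 := by
    have hF : Nat.card F ≠ 0 := Nat.card_pos.ne'
    exact mul_ne_zero (by exact_mod_cast D.unitClasses_ne_zero)
      (zpow_ne_zero _ (by exact_mod_cast hF))
  have h6 : ((D.idealsOfCodim (m + 1)).card : ℚ) = Nat.card F * (D.idealsOfCodim m).card := by
    apply mul_right_cancel₀ h5
    linear_combination -h4
  exact_mod_cast h6

end PoleFiltration

end

section

namespace PoleFiltration

open UniqueFactorizationMonoid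

variable {F O K : Type*} [Field F] [CommRing O] [IsDedekindDomain O] [Field K] [Algebra O K]
  [IsFractionRing O K] [Algebra F O] [Algebra F K] [IsScalarTower F O K] {n g : ℕ} {x : O}
  (D : PoleFiltration F O K n g x)

include D in
theorem codim_pos {P : Ideal O} (hP : Prime P) : 1 ≤ P.codim F := by
  have := D.finite_quotient P hP.ne_zero
  have : Nontrivial (O ⧸ P) := Ideal.Quotient.nontrivial_iff.2 fun h => hP.not_isUnit (Ideal.isUnit_iff.2 h)
  exact Module.finrank_pos

include D in
theorem codim_pow {P : Ideal O} (hP : P ≠ ⊥) (i : ℕ) : (P ^ i).codim F = i * P.codim F := by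
  induction i with
  | zero => rw [pow_zero, Ideal.one_eq_top, D.codim_top, zero_mul]
  | succ i ih => rw [pow_succ, D.codim_mul (pow_ne_zero i hP) hP, ih, Nat.succ_mul]

include D in
theorem addChar_traceOf_pow (ψ : AddChar F ℂ) {P : Ideal O} (hP : P ≠ ⊥) (i : ℕ) :
    ψ ((P ^ i).traceOf F x) = ψ (P.traceOf F x) ^ i := by
  induction i with
  | zero =>
    have : Subsingleton (O ⧸ (P ^ 0)) := by
      rw [pow_zero, Ideal.one_eq_top]; infer_instance
    have hz : (P ^ 0).traceOf F x = 0 := by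
      rw [Ideal.traceOf, Subsingleton.elim (Ideal.Quotient.mk (P ^ 0) x) 0, map_zero]
    rw [hz, pow_zero, AddChar.map_zero_eq_one]
  | succ i ih =>
    rw [pow_succ, D.traceOf_mul (pow_ne_zero i hP) hP, AddChar.map_add_eq_mul, ih, pow_succ]

open Classical in
/-- Pairs of a prime ideal `P` and an exponent `i ≥ 1` such that `P ^ i` has codimension `j`. -/
noncomputable def primePowers (j : ℕ) : Finset (Ideal O × ℕ) :=
  ((((Finset.range (j + 1)).biUnion D.idealsOfCodim).filter Prime) ×ˢ
    Finset.range (j + 1)).filter fun p => 1 ≤ p.2 ∧ p.2 * p.1.codim F = j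

theorem mem_primePowers {j : ℕ} {P : Ideal O} {i : ℕ} :
    (P, i) ∈ D.primePowers j ↔ Prime P ∧ 1 ≤ i ∧ i * P.codim F = j := by
  simp only [primePowers, Finset.mem_filter, Finset.mem_product, Finset.mem_biUnion,
    Finset.mem_range, mem_idealsOfCodim]
  constructor
  · rintro ⟨⟨⟨-, h1⟩, -⟩, h2⟩
    exact ⟨h1, h2⟩
  · rintro ⟨h1, h2, h3⟩
    have := D.codim_pos h1
    refine ⟨⟨⟨⟨P.codim F, ?_, h1.ne_zero, rfl⟩, h1⟩, ?_⟩, h2, h3⟩ <;> nlinarith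

open Classical in
theorem sum_codim_primePowers {m : ℕ} {I : Ideal O} (hI : I ∈ D.idealsOfCodim m) :
    ∑ j ∈ Finset.Icc 1 m, ∑ p ∈ (D.primePowers j).filter (fun p => p.1 ^ p.2 ∣ I), p.1.codim F
      = m := by
  obtain ⟨hI0, hIm⟩ := D.mem_idealsOfCodim.1 hI
  set Q : Finset ((_ : Ideal O) × ℕ) := (normalizedFactors I).toFinset.sigma
    fun P => Finset.Icc 1 ((normalizedFactors I).count P) with hQ
  have hmemQ : ∀ P i, (⟨P, i⟩ : (_ : Ideal O) × ℕ) ∈ Q ↔ Prime P ∧ 1 ≤ i ∧ P ^ i ∣ I := by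
    intro P i
    rw [hQ, Finset.mem_sigma, Multiset.mem_toFinset, Finset.mem_Icc]
    constructor
    · rintro ⟨h1, h2, h3⟩
      have hp := prime_of_normalized_factor P h1
      refine ⟨hp, h2, ?_⟩
      rw [pow_dvd_iff_le_emultiplicity, emultiplicity_eq_count_normalizedFactors hp.irreducible hI0,
        normalize_eq]
      exact_mod_cast h3
    · rintro ⟨hp, h2, h3⟩
      rw [pow_dvd_iff_le_emultiplicity, emultiplicity_eq_count_normalizedFactors hp.irreducible hI0,
        normalize_eq] at h3
      have h3' : i ≤ (normalizedFactors I).count P := by exact_mod_cast h3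
      exact ⟨by convert Multiset.count_pos.1 (h2.trans h3'), h2, by convert h3'⟩
  have hsum : ∑ p ∈ Q, p.1.codim F = m := by
    rw [hQ, Finset.sum_sigma]
    simp only [Finset.sum_const, Nat.card_Icc, Nat.add_sub_cancel]
    rw [← Finset.sum_multiset_map_count, ← hIm]
    conv_rhs => rw [← Ideal.prod_normalizedFactors_eq_self hI0]
    have : ∀ s : Multiset (Ideal O), (∀ P ∈ s, P ≠ ⊥) →
        (s.map fun P => P.codim F).sum = s.prod.codim F ∧ s.prod ≠ ⊥ := by
      intro s
      induction s using Multiset.induction_on with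
      | empty => intro _; simp [D.codim_top]
      | cons P s ih =>
        intro h
        obtain ⟨h1, h2⟩ := ih fun Q hQ => h Q (Multiset.mem_cons_of_mem hQ)
        have hP := h P (Multiset.mem_cons_self P s)
        rw [Multiset.map_cons, Multiset.sum_cons, Multiset.prod_cons, D.codim_mul hP h2, h1]
        exact ⟨rfl, mul_ne_zero hP h2⟩
    exact (this _ fun P hP => (prime_of_normalized_factor P hP).ne_zero).1
  refine Eq.trans ?_ hsum
  rw [← Finset.sum_fiberwise_of_maps_to (s := Q) (t := Finset.Icc 1 m)
    (g := fun p => p.2 * p.1.codim F)]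
  · refine Finset.sum_congr rfl fun j hj => ?_
    refine Finset.sum_bij' (fun p _ => (⟨p.1, p.2⟩ : (_ : Ideal O) × ℕ)) (fun p _ => (p.1, p.2))
      ?_ ?_ (fun _ _ => rfl) (fun _ _ => rfl) (fun _ _ => rfl)
    · rintro ⟨P, i⟩ h
      rw [Finset.mem_filter, mem_primePowers] at h
      rw [Finset.mem_filter, hmemQ]
      exact ⟨⟨h.1.1, h.1.2.1, h.2⟩, h.1.2.2⟩
    · rintro ⟨P, i⟩ h
      rw [Finset.mem_filter, hmemQ] at h
      rw [Finset.mem_filter, mem_primePowers]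
      exact ⟨⟨h.1.1, h.1.2.1, h.2⟩, h.1.2.2⟩
  · rintro ⟨P, i⟩ h
    rw [hmemQ] at h
    have h1 := D.codim_pos h.1
    have h2 := D.codim_anti hI0 (Ideal.dvd_iff_le.1 h.2.2)
    rw [D.codim_pow h.1.ne_zero, hIm] at h2
    rw [Finset.mem_Icc]
    exact ⟨by nlinarith [h.2.1], h2⟩

/-- The power sums attached to a character. -/
noncomputable def powerSum (ψ : AddChar F ℂ) (j : ℕ) : ℂ :=
  ∑ p ∈ D.primePowers j, (p.1.codim F : ℂ) * ψ (p.1.traceOf F x) ^ p.2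

/-- The coefficients of the L-function attached to a character. -/
noncomputable def coeffL (ψ : AddChar F ℂ) (m : ℕ) : ℂ :=
  ∑ I ∈ D.idealsOfCodim m, ψ (I.traceOf F x)

theorem coeffL_zero (ψ : AddChar F ℂ) : D.coeffL ψ 0 = 1 := by
  have : D.idealsOfCodim 0 = {⊤} := by
    ext I
    rw [mem_idealsOfCodim, Finset.mem_singleton]
    constructor
    · rintro ⟨h1, h2⟩
      have := D.finite_quotient I h1
      have := Module.finrank_zero_iff.1 h2
      exact Ideal.Quotient.subsingleton_iff.1 this
    · rintro rfl
      exact ⟨top_ne_bot, D.codim_top⟩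
  have h := D.addChar_traceOf_pow ψ (P := (⊤ : Ideal O)) top_ne_bot 0
  rw [pow_zero, pow_zero, Ideal.one_eq_top] at h
  rw [coeffL, this, Finset.sum_singleton, h]

/-- Newton's identities. -/
theorem natCast_mul_coeffL (ψ : AddChar F ℂ) (m : ℕ) :
    m * D.coeffL ψ m = ∑ j ∈ Finset.Icc 1 m, D.powerSum ψ j * D.coeffL ψ (m - j) := by
  classical
  have h1 : m * D.coeffL ψ m = ∑ I ∈ D.idealsOfCodim m, ∑ j ∈ Finset.Icc 1 m,
      ∑ p ∈ D.primePowers j, if p.1 ^ p.2 ∣ I then (p.1.codim F : ℂ) * ψ (I.traceOf F x) else 0 := by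
    rw [coeffL, Finset.mul_sum]
    refine Finset.sum_congr rfl fun I hI => ?_
    have := D.sum_codim_primePowers hI
    conv_lhs => rw [← this]
    push_cast
    simp_rw [Finset.sum_mul, Finset.sum_filter]
  rw [h1, Finset.sum_comm]
  refine Finset.sum_congr rfl fun j hj => ?_
  rw [Finset.sum_comm, powerSum, Finset.sum_mul]
  refine Finset.sum_congr rfl ?_
  rintro ⟨P, i⟩ hp
  rw [mem_primePowers] at hp
  obtain ⟨hP, hi, hij⟩ := hp
  have hPi : P ^ i ≠ ⊥ := pow_ne_zero i hP.ne_zero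
  rw [← Finset.sum_filter, coeffL, Finset.mul_sum]
  symm
  refine Finset.sum_bij (fun I _ => P ^ i * I) ?_ ?_ ?_ ?_
  · intro I hI
    obtain ⟨h1, h2⟩ := D.mem_idealsOfCodim.1 hI
    rw [Finset.mem_filter, mem_idealsOfCodim, D.codim_mul hPi h1, D.codim_pow hP.ne_zero, hij, h2]
    have := (Finset.mem_Icc.1 hj).2
    exact ⟨⟨mul_ne_zero hPi h1, by omega⟩, dvd_mul_right _ _⟩
  · intro I _ I' _ h
    exact mul_left_cancel₀ hPi h
  · intro J hJ
    rw [Finset.mem_filter, mem_idealsOfCodim] at hJ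
    obtain ⟨⟨h1, h2⟩, I, rfl⟩ := hJ
    have hI : I ≠ ⊥ := right_ne_zero_of_mul h1
    rw [D.codim_mul hPi hI, D.codim_pow hP.ne_zero, hij] at h2
    exact ⟨I, D.mem_idealsOfCodim.2 ⟨hI, by omega⟩, rfl⟩
  · intro I hI
    obtain ⟨h1, h2⟩ := D.mem_idealsOfCodim.1 hI
    rw [D.traceOf_mul hPi h1, AddChar.map_add_eq_mul, D.addChar_traceOf_pow ψ hP.ne_zero]
    ring

end PoleFiltration

end

open Finset Polynomial in
/-- A sequence with finitely many nonzero terms and its Newton power sums come from a finite family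
of inverse roots. -/
theorem exists_inverse_roots (a S : ℕ → ℂ) (G : ℕ) (h0 : a 0 = 1) (hG : ∀ m, G < m → a m = 0)
    (hN : ∀ m : ℕ, m * a m = ∑ j ∈ Icc 1 m, S j * a (m - j)) :
    ∃ (ι : Type) (_ : Fintype ι) (α : ι → ℂ), Fintype.card ι = G ∧
      ∀ j, 1 ≤ j → S j = -∑ i, α i ^ j := by
  classical
  set B : ℂ[X] := ∑ i ∈ range (G + 1), C (a i) * X ^ (G - i) with hB
  have hcoeff : ∀ i ≤ G, B.coeff (G - i) = a i := by
    intro i hi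
    rw [hB, finsetSum_coeff, sum_eq_single i]
    · simp
    · intro j hj hji
      rw [mem_range] at hj
      rw [coeff_C_mul, coeff_X_pow, if_neg (by omega), mul_zero]
    · intro h
      exact absurd (mem_range.2 (by omega)) h
  have hdeg : B.natDegree ≤ G := by
    refine natDegree_sum_le_of_forall_le _ _ fun i _ => ?_
    exact (natDegree_C_mul_X_pow_le _ _).trans (Nat.sub_le _ _)
  have hG1 : B.coeff G = 1 := by have := hcoeff 0 (Nat.zero_le _); rwa [h0] at this
  have hnat : B.natDegree = G := le_antisymm hdeg (le_natDegree_of_ne_zero (by simp [hG1]))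
  have hmonic : B.leadingCoeff = 1 := by rw [leadingCoeff, hnat, hG1]
  have hroots : Multiset.card B.roots = B.natDegree :=
    splits_iff_card_roots.1 (IsAlgClosed.splits B)
  refine ⟨B.roots.ToType, inferInstance, fun i => i.1, ?_, ?_⟩
  · rw [Multiset.card_coe, hroots, hnat]
  set α : B.roots.ToType → ℂ := fun i => i.1 with hα
  have hmap : (univ.val.map α) = B.roots := Multiset.map_univ_coe _
  have hes : ∀ m, MvPolynomial.aeval α (MvPolynomial.esymm B.roots.ToType ℂ m) =
      (-1) ^ m * a m := by
    intro m
    rw [MvPolynomial.aeval_esymm_eq_multiset_esymm, hmap]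
    rcases le_or_gt m G with hm | hm
    · have h1 := coeff_eq_esymm_roots_of_card hroots (k := G - m) (by omega)
      rw [hcoeff m hm, hmonic, one_mul, hnat, Nat.sub_sub_self hm] at h1
      rw [h1, ← mul_assoc, ← mul_pow]
      simp
    · rw [hG m hm, Multiset.esymm, Multiset.powersetCard_eq_empty]
      · simp
      · rw [hroots, hnat]; exact hm
  have hp : ∀ m, MvPolynomial.aeval α (MvPolynomial.psum B.roots.ToType ℂ m) = ∑ i, α i ^ m := by
    intro m
    simp [MvPolynomial.psum]
  have hnewt : ∀ m : ℕ, m * a m = -∑ j ∈ Icc 1 m, (∑ i, α i ^ j) * a (m - j) := by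
    intro m
    have h := congrArg (MvPolynomial.aeval α)
      (MvPolynomial.mul_esymm_eq_sum (σ := B.roots.ToType) (R := ℂ) m)
    simp only [map_mul, map_sum, map_pow, map_neg, map_one, map_natCast, hes, hp] at h
    have h2 : ∑ x ∈ antidiagonal m with x.1 < m,
        (-1 : ℂ) ^ x.1 * ((-1) ^ x.1 * a x.1) * ∑ i, α i ^ x.2 =
        ∑ j ∈ Icc 1 m, (∑ i, α i ^ j) * a (m - j) := by
      refine sum_bij' (fun x _ => x.2) (fun j _ => (m - j, j)) ?_ ?_ ?_ ?_ ?_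
      · rintro ⟨i, j⟩ h
        simp only [mem_filter, HasAntidiagonal.mem_antidiagonal, mem_Icc] at h ⊢
        omega
      · intro j h
        simp only [mem_filter, HasAntidiagonal.mem_antidiagonal, mem_Icc] at h ⊢
        omega
      · rintro ⟨i, j⟩ h
        simp only [mem_filter, HasAntidiagonal.mem_antidiagonal] at h
        ext
        · simp only; omega
        · rfl
      · intro j h; rfl
      · rintro ⟨i, j⟩ h
        simp only [mem_filter, HasAntidiagonal.mem_antidiagonal] at h
        have h3 : m - j = i := by omega
        simp only [h3]
        rw [← mul_assoc, ← mul_pow]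
        simp [mul_comm]
    rw [h2] at h
    have h3 : (-1 : ℂ) ^ m * (-1) ^ m = 1 := by rw [← mul_pow]; simp
    have h4 : (m : ℂ) * a m = (-1 : ℂ) ^ m * (m * ((-1) ^ m * a m)) := by linear_combination (-(m * a m)) * h3
    rw [h4, h, pow_succ]
    linear_combination (-∑ j ∈ Icc 1 m, (∑ i, α i ^ j) * a (m - j)) * h3
  intro j
  induction j using Nat.strong_induction_on with
  | _ j ih =>
    intro hj
    have h1 := hN j
    rw [hnewt j, ← sum_neg_distrib, ← sub_eq_zero, ← sum_sub_distrib, sum_eq_single j] at h1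
    · rw [Nat.sub_self, h0, mul_one, mul_one] at h1
      linear_combination -h1
    · intro i hi hij
      rw [mem_Icc] at hi
      rw [ih i (by omega) hi.1]
      ring
    · intro h
      exact absurd (mem_Icc.2 ⟨hj, le_rfl⟩) h

open Finset Polynomial in
theorem norm_le_of_powerSums {ι : Type*} [Fintype ι] (β : ι → ℂ) {C r : ℝ} (hr : 0 < r)
    (h : ∀ μ : ℕ, 1 ≤ μ → ‖∑ i, β i ^ μ‖ ≤ C * r ^ μ) (i : ι) : ‖β i‖ ≤ r := by
  classical
  by_contra! hlt
  set L : ℂ[X] := ∏ v ∈ (univ.image β).erase (β i), (X - Polynomial.C v) with hL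
  have hLi : L.eval (β i) ≠ 0 := by
    rw [hL, eval_prod, prod_ne_zero_iff]
    intro v hv
    rw [mem_erase] at hv
    simpa [sub_eq_zero] using hv.1.symm
  have hLj : ∀ j, β j ≠ β i → L.eval (β j) = 0 := by
    intro j hj
    rw [hL, eval_prod]
    exact prod_eq_zero (mem_erase.2 ⟨hj, mem_image_of_mem _ (mem_univ j)⟩) (by simp)
  set k : ℕ := #{j | β j = β i} with hk
  have hk1 : 1 ≤ k := card_pos.2 ⟨i, by simp⟩
  have key : ∀ μ : ℕ, 1 ≤ μ → (k : ℂ) * L.eval (β i) * β i ^ μ =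
      ∑ t ∈ range (L.natDegree + 1), L.coeff t * ∑ j, β j ^ (μ + t) := by
    intro μ _
    have h1 : ∑ j, L.eval (β j) * β j ^ μ = (k : ℂ) * L.eval (β i) * β i ^ μ := by
      rw [← sum_filter_add_sum_filter_not univ (fun j => β j = β i)]
      rw [sum_congr rfl (g := fun _ => L.eval (β i) * β i ^ μ), sum_const, nsmul_eq_mul,
        sum_eq_zero, add_zero, mul_assoc]
      · intro j hj
        rw [hLj j (mem_filter.1 hj).2, zero_mul]
      · intro j hj
        rw [(mem_filter.1 hj).2]
    rw [← h1]
    simp_rw [mul_sum]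
    rw [sum_comm]
    refine sum_congr rfl fun j _ => ?_
    rw [eval_eq_sum_range, sum_mul]
    refine sum_congr rfl fun t _ => ?_
    rw [pow_add]
    ring
  set D : ℝ := ∑ t ∈ range (L.natDegree + 1), ‖L.coeff t‖ * (C * r ^ t) with hD
  have hbound : ∀ μ : ℕ, 1 ≤ μ → k * ‖L.eval (β i)‖ * (‖β i‖ / r) ^ μ ≤ D := by
    intro μ hμ
    rw [div_pow, ← mul_div_assoc, div_le_iff₀ (pow_pos hr μ)]
    have := congrArg norm (key μ hμ)
    rw [norm_mul, norm_mul, norm_pow, Complex.norm_natCast] at this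
    rw [this, hD, sum_mul]
    refine (norm_sum_le _ _).trans (sum_le_sum fun t _ => ?_)
    rw [norm_mul]
    have := h (μ + t) (by omega)
    calc _ ≤ ‖L.coeff t‖ * (C * r ^ (μ + t)) := by gcongr
      _ = _ := by rw [pow_add]; ring
  have hpos : 0 < k * ‖L.eval (β i)‖ := by
    have : (0 : ℝ) < k := by exact_mod_cast hk1
    positivity
  have h1 : 1 < ‖β i‖ / r := (one_lt_div hr).2 hlt
  obtain ⟨μ, hμ⟩ := ((tendsto_pow_atTop_atTop_of_one_lt h1).eventually_gt_atTop
    (D / (k * ‖L.eval (β i)‖))).exists_forall_of_atTop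
  have h2 := hμ (μ + 1) (by omega)
  rw [div_lt_iff₀ hpos] at h2
  have := hbound (μ + 1) (by omega)
  linarith

/-- Bounds for all even power sums of square-root quality propagate to the first one. -/
theorem norm_powerSum_one_le (a S : ℕ → ℂ) (G : ℕ) (h0 : a 0 = 1) (hG : ∀ m, G < m → a m = 0)
    (hN : ∀ m : ℕ, m * a m = ∑ j ∈ Finset.Icc 1 m, S j * a (m - j)) {C r : ℝ} (hr : 0 < r)
    (h : ∀ μ : ℕ, 1 ≤ μ → ‖S (2 * μ)‖ ≤ C * r ^ μ) : ‖S 1‖ ≤ G * √r := by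
  obtain ⟨ι, _, α, hc, hS⟩ := exists_inverse_roots a S G h0 hG hN
  have hα : ∀ i, ‖α i‖ ≤ √r := by
    intro i
    have := norm_le_of_powerSums (fun i => α i ^ 2) (C := C) hr (fun μ hμ => by
      have := h μ hμ
      rw [hS _ (by omega), norm_neg] at this
      simpa only [pow_mul] using this) i
    rw [norm_pow] at this
    exact Real.le_sqrt_of_sq_le this
  rw [hS 1 le_rfl, norm_neg, ← hc]
  refine (norm_sum_le _ _).trans ?_
  refine (Finset.sum_le_card_nsmul _ _ (√r) fun i _ => ?_).trans ?_
  · rw [pow_one]; exact hα i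
  · simp

open PowerSeries in
/-- Newton's identities survive multiplication of the generating function by `1 - q X`. -/
theorem newton_sub_geometric {R : Type*} [CommRing R] (a S : ℕ → R) (q : R)
    (hN : ∀ m : ℕ, m * a m = ∑ j ∈ Finset.Icc 1 m, S j * a (m - j)) (m : ℕ) :
    m * (a m - if m = 0 then 0 else q * a (m - 1)) = ∑ j ∈ Finset.Icc 1 m, (S j - q ^ j) *
      (a (m - j) - if m - j = 0 then 0 else q * a (m - j - 1)) := by
  have hsum : ∀ (u v : ℕ → R) (k : ℕ), coeff k (PowerSeries.mk (fun j => if j = 0 then 0 else u j) *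
      PowerSeries.mk v) = ∑ j ∈ Finset.Icc 1 k, u j * v (k - j) := by
    intro u v k
    rw [coeff_mul, Finset.Nat.sum_antidiagonal_eq_sum_range_succ_mk, Finset.sum_range_succ']
    simp only [coeff_mk, if_true, zero_mul, add_zero]
    refine Finset.sum_bij' (fun i _ => i + 1) (fun i _ => i - 1) ?_ ?_ ?_ ?_ ?_
    · intro i hi
      simp only [Finset.mem_range, Finset.mem_Icc] at hi ⊢
      omega
    · intro i hi
      simp only [Finset.mem_range, Finset.mem_Icc] at hi ⊢
      omega
    · intro i _; rfl
    · intro i hi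
      rw [Finset.mem_Icc] at hi
      exact Nat.sub_add_cancel hi.1
    · intro i _
      rw [if_neg (Nat.succ_ne_zero i)]
  have hmul : ∀ u : ℕ → R, PowerSeries.mk (fun k => u k - if k = 0 then 0 else q * u (k - 1)) =
      PowerSeries.mk u * (1 - PowerSeries.C q * X) := by
    intro u
    ext k
    rw [mul_sub, mul_one, map_sub, ← mul_assoc]
    rcases k with _ | k
    · simp
    · rw [coeff_succ_mul_X, coeff_mul_C]
      simp [mul_comm]
  have h1 : PowerSeries.mk (fun k : ℕ => (k : R) * a k) =
      PowerSeries.mk (fun j => if j = 0 then 0 else S j) * PowerSeries.mk a := by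
    ext k
    rw [hsum, ← hN, coeff_mk]
  have h2 : PowerSeries.mk (fun j => if j = 0 then 0 else q ^ j) * (1 - PowerSeries.C q * X) =
      PowerSeries.C q * X := by
    rw [← hmul]
    ext k
    rcases k with _ | _ | k
    · simp
    · simp
    · simp [pow_succ, coeff_X, mul_comm]
  have h3 : PowerSeries.mk (fun k : ℕ => (k : R) * (a k - if k = 0 then 0 else q * a (k - 1))) =
      PowerSeries.mk (fun k : ℕ => (k : R) * a k) * (1 - PowerSeries.C q * X) -
        PowerSeries.C q * X * PowerSeries.mk a := by
    rw [← hmul]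
    ext k
    rcases k with _ | k
    · simp
    · rw [map_sub, mul_assoc, coeff_C_mul, coeff_succ_X_mul]
      simp
      ring
  have h4 : PowerSeries.mk (fun j => if j = 0 then 0 else S j - q ^ j) =
      PowerSeries.mk (fun j => if j = 0 then 0 else S j) -
        PowerSeries.mk (fun j => if j = 0 then 0 else q ^ j) := by
    ext k
    rw [map_sub, coeff_mk, coeff_mk, coeff_mk]
    split_ifs <;> simp
  rw [← hsum (fun j => S j - q ^ j) (fun k => a k - if k = 0 then 0 else q * a (k - 1)), hmul, h4]
  rw [← coeff_mk m fun k : ℕ => (k : R) * (a k - if k = 0 then 0 else q * a (k - 1)), h3, h1]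
  congr 1
  linear_combination (PowerSeries.mk a) * h2

section

namespace RatFunc

open Polynomial

variable {F : Type*} [Field F]

/-- Rational functions of degree at most `d`. -/
def degLE (F : Type*) [Field F] (d : ℤ) : Submodule F (RatFunc F) where
  carrier := {f | f = 0 ∨ f.intDegree ≤ d}
  zero_mem' := Or.inl rfl
  add_mem' := by
    rintro a b (rfl | ha) (rfl | hb)
    · exact Or.inl (add_zero 0)
    · rw [zero_add]; exact Or.inr hb
    · rw [add_zero]; exact Or.inr ha
    · by_cases h : a + b = 0
      · exact Or.inl h
      · by_cases h0 : b = 0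
        · subst h0; rw [add_zero]; exact Or.inr ha
        · exact Or.inr ((intDegree_add_le h0 h).trans (max_le ha hb))
  smul_mem' := by
    rintro c f (rfl | hf)
    · exact Or.inl (smul_zero c)
    · by_cases hc : c = 0
      · subst hc; exact Or.inl (zero_smul F f)
      by_cases h0 : f = 0
      · subst h0; exact Or.inl (smul_zero c)
      right
      rw [← algebraMap_smul F[X] c f, Algebra.smul_def, Polynomial.algebraMap_eq, algebraMap_C,
        intDegree_mul ((_root_.map_ne_zero _).2 hc) h0, intDegree_C, zero_add]
      exact hf

theorem mem_degLE {d : ℤ} {f : RatFunc F} : f ∈ degLE F d ↔ f = 0 ∨ f.intDegree ≤ d := Iff.rfl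

theorem degLE_mono {i j : ℤ} (h : i ≤ j) : degLE F i ≤ degLE F j :=
  fun _ hf => hf.imp_right fun h' => h'.trans h

theorem mul_mem_degLE {i j : ℤ} {a b : RatFunc F} (ha : a ∈ degLE F i) (hb : b ∈ degLE F j) :
    a * b ∈ degLE F (i + j) := by
  by_cases h0 : a = 0
  · rw [h0, zero_mul]; exact zero_mem _
  by_cases h1 : b = 0
  · rw [h1, mul_zero]; exact zero_mem _
  right
  rw [intDegree_mul h0 h1]
  exact add_le_add (ha.resolve_left h0) (hb.resolve_left h1)

theorem algebraMap_mem_degLE {p : F[X]} {d : ℤ} :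
    algebraMap F[X] (RatFunc F) p ∈ degLE F d ↔ p = 0 ∨ (p.natDegree : ℤ) ≤ d := by
  rw [mem_degLE, intDegree_polynomial, map_eq_zero_iff _ (algebraMap_injective F)]

theorem one_mem_degLE : (1 : RatFunc F) ∈ degLE F 0 := Or.inr intDegree_one.le

theorem exists_mem_degLE (f : RatFunc F) : f ∈ degLE F f.intDegree := Or.inr le_rfl

theorem prod_mem_degLE {ι : Type*} (s : Finset ι) (f : ι → RatFunc F) (d : ι → ℤ)
    (h : ∀ i ∈ s, f i ∈ degLE F (d i)) : ∏ i ∈ s, f i ∈ degLE F (∑ i ∈ s, d i) := by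
  classical
  induction s using Finset.induction_on with
  | empty => exact one_mem_degLE
  | insert a s ha ih =>
    rw [Finset.prod_insert ha, Finset.sum_insert ha]
    exact mul_mem_degLE (h a (Finset.mem_insert_self a s))
      (ih fun i hi => h i (Finset.mem_insert_of_mem hi))

theorem prod_sub_prod_mem_degLE {ι : Type*} (s : Finset ι) (f g : ι → RatFunc F) (d : ι → ℤ)
    (e : ℤ) (hf : ∀ i ∈ s, f i ∈ degLE F (d i)) (hg : ∀ i ∈ s, g i ∈ degLE F (d i))
    (h : ∀ i ∈ s, f i - g i ∈ degLE F (d i + e)) :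
    ∏ i ∈ s, f i - ∏ i ∈ s, g i ∈ degLE F (∑ i ∈ s, d i + e) := by
  classical
  induction s using Finset.induction_on with
  | empty => simp [zero_mem]
  | insert a s ha ih =>
    have hs : ∀ i ∈ s, i ∈ insert a s := fun i hi => Finset.mem_insert_of_mem hi
    have haa := Finset.mem_insert_self a s
    have h1 := ih (fun i hi => hf i (hs i hi)) (fun i hi => hg i (hs i hi))
      (fun i hi => h i (hs i hi))
    rw [Finset.prod_insert ha, Finset.prod_insert ha, Finset.sum_insert ha]
    have h2 : f a * ∏ i ∈ s, f i - g a * ∏ i ∈ s, g i =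
        (f a - g a) * ∏ i ∈ s, f i + g a * (∏ i ∈ s, f i - ∏ i ∈ s, g i) := by ring
    rw [h2]
    refine add_mem ?_ ?_
    · have := mul_mem_degLE (h a haa) (prod_mem_degLE s f d fun i hi => hf i (hs i hi))
      rwa [add_right_comm] at this
    · have := mul_mem_degLE (hg a haa) h1
      rwa [← add_assoc] at this

theorem sign_mul_mem_degLE {ι : Type*} [Fintype ι] [DecidableEq ι] (σ : Equiv.Perm ι) {d : ℤ}
    {f : RatFunc F} (hf : f ∈ degLE F d) : Equiv.Perm.sign σ • f ∈ degLE F d := by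
  rcases Int.units_eq_one_or (Equiv.Perm.sign σ) with h | h <;> rw [h]
  · rwa [one_smul]
  · rw [Units.neg_smul, one_smul]; exact neg_mem hf

theorem sum_perm_weight {ι : Type*} [Fintype ι] (σ : Equiv.Perm ι) (v : ι → ℤ) (j : ℤ) :
    ∑ i, (j + v i - v (σ i)) = Fintype.card ι * j := by
  rw [Finset.sum_sub_distrib, Finset.sum_add_distrib, Equiv.sum_comp σ v, add_sub_cancel_right,
    Finset.sum_const, Finset.card_univ, nsmul_eq_mul]

theorem det_mem_degLE {ι : Type*} [Fintype ι] [DecidableEq ι] (v : ι → ℤ) (j : ℤ)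
    (M : Matrix ι ι (RatFunc F)) (h : ∀ i k, M i k ∈ degLE F (j + v k - v i)) :
    M.det ∈ degLE F (Fintype.card ι * j) := by
  rw [Matrix.det_apply]
  refine sum_mem fun σ _ => sign_mul_mem_degLE σ ?_
  rw [← sum_perm_weight σ v j]
  exact prod_mem_degLE _ _ _ fun i _ => h _ _

theorem det_sub_one_mem_degLE {ι : Type*} [Fintype ι] [DecidableEq ι] (v : ι → ℤ) {e : ℤ}
    (he : e ≤ 0) (M : Matrix ι ι (RatFunc F)) (h : ∀ i k, (M - 1) i k ∈ degLE F (e + v k - v i)) :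
    M.det - 1 ∈ degLE F e := by
  have h1 : ∀ i k, (1 : Matrix ι ι (RatFunc F)) i k ∈ degLE F (v k - v i) := by
    intro i k
    by_cases hik : i = k
    · subst hik; rw [Matrix.one_apply_eq, sub_self]; exact one_mem_degLE
    · rw [Matrix.one_apply_ne hik]; exact zero_mem _
  have h2 : ∀ i k, M i k ∈ degLE F (v k - v i) := by
    intro i k
    have := add_mem (degLE_mono (by omega) (h i k)) (h1 i k)
    rwa [Matrix.sub_apply, sub_add_cancel] at this
  rw [← Matrix.det_one (n := ι), Matrix.det_apply, Matrix.det_apply, ← Finset.sum_sub_distrib]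
  refine sum_mem fun σ _ => ?_
  rw [← smul_sub]
  refine sign_mul_mem_degLE σ ?_
  have := prod_sub_prod_mem_degLE Finset.univ (fun i => M (σ i) i)
    (fun i => (1 : Matrix ι ι (RatFunc F)) (σ i) i) (fun i => v i - v (σ i)) e
    (fun i _ => h2 _ _) (fun i _ => h1 _ _) (fun i _ => by
      have := h (σ i) i
      rw [Matrix.sub_apply] at this
      convert this using 2
      ring)
  have hs := sum_perm_weight σ v 0
  simp only [zero_add, mul_zero] at hs
  rwa [hs, zero_add] at this

theorem X_zpow_mul_mem_degLE (k : ℤ) {d : ℤ} {f : RatFunc F} :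
    (X : RatFunc F) ^ k * f ∈ degLE F (k + d) ↔ f ∈ degLE F d := by
  have h : ∀ k : ℤ, (X : RatFunc F) ^ k ∈ degLE F k := by
    have h1 : ∀ m : ℕ, (X : RatFunc F) ^ m ∈ degLE F m := by
      intro m
      rw [← algebraMap_X, ← map_pow, algebraMap_mem_degLE]
      right; simp
    intro k
    rcases Int.eq_nat_or_neg k with ⟨m, rfl | rfl⟩
    · rw [zpow_natCast]; exact h1 m
    · rw [zpow_neg, zpow_natCast, mem_degLE]
      right
      have : (X : RatFunc F) ^ m ≠ 0 := pow_ne_zero m X_ne_zero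
      rw [intDegree_inv, ← algebraMap_X, ← map_pow, intDegree_polynomial]
      simp
  constructor
  · intro hf
    have := mul_mem_degLE (h (-k)) hf
    rwa [← mul_assoc, ← zpow_add₀ X_ne_zero, neg_add_cancel, zpow_zero, one_mul,
      neg_add_cancel_left] at this
  · exact fun hf => mul_mem_degLE (h k) hf

theorem exists_polynomial_sub_mem (f : RatFunc F) :
    ∃ p : F[X], f - algebraMap F[X] (RatFunc F) p ∈ degLE F (-1) := by
  have hd : f.denom ≠ 0 := f.denom_ne_zero
  refine ⟨f.num / f.denom, ?_⟩
  have hd' : algebraMap F[X] (RatFunc F) f.denom ≠ 0 := algebraMap_ne_zero hd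
  have h : f - algebraMap F[X] (RatFunc F) (f.num / f.denom) =
      algebraMap F[X] (RatFunc F) (f.num % f.denom) / algebraMap F[X] (RatFunc F) f.denom := by
    rw [eq_div_iff hd', sub_mul]
    have h1 : f * algebraMap F[X] (RatFunc F) f.denom = algebraMap F[X] (RatFunc F) f.num := by
      conv_lhs => rw [← num_div_denom f, div_mul_eq_mul_div, num_div_denom]
      rw [mul_div_assoc, div_self hd', mul_one]
    rw [h1, ← map_mul, ← map_sub]
    congr 1
    have := EuclideanDomain.div_add_mod f.num f.denom
    linear_combination -this
  rw [h]
  by_cases hr : f.num % f.denom = 0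
  · rw [hr, map_zero, zero_div]; exact zero_mem _
  right
  rw [div_eq_mul_inv, intDegree_mul (algebraMap_ne_zero hr) (inv_ne_zero hd'), intDegree_inv,
    intDegree_polynomial, intDegree_polynomial]
  have := natDegree_lt_natDegree hr (EuclideanDomain.mod_lt f.num hd)
  omega

end RatFunc

end

section

open Polynomial RatFunc

variable {F K : Type*} [Field F] [Field K] [Algebra (RatFunc F) K] [Algebra F K]
  [IsScalarTower F (RatFunc F) K] {n : ℕ}

/-- Elements all of whose coordinates satisfy the weighted degree bound `j`. -/
def poleLE (b : Module.Basis (Fin n) (RatFunc F) K) (w : ℕ) (j : ℤ) : Submodule F K where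
  carrier := {a | ∀ i : Fin n, b.repr a i ∈ degLE F (j - w * (i : ℕ))}
  zero_mem' := fun i => by rw [map_zero]; exact zero_mem _
  add_mem' := fun ha hc i => by rw [map_add]; exact add_mem (ha i) (hc i)
  smul_mem' := fun c a ha i => by
    rw [← algebraMap_smul (RatFunc F) c a, map_smul, Finsupp.smul_apply, algebraMap_smul]
    exact Submodule.smul_mem _ c (ha i)

variable (b : Module.Basis (Fin n) (RatFunc F) K) {w : ℕ}

theorem poleLE_mono {i j : ℤ} (h : i ≤ j) : poleLE b w i ≤ poleLE b w j :=
  fun _ ha k => degLE_mono (by omega) (ha k)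

theorem smul_mem_poleLE {i j : ℤ} {f : RatFunc F} {a : K} (hf : f ∈ degLE F i)
    (ha : a ∈ poleLE b w j) : f • a ∈ poleLE b w (i + j) := fun k => by
  rw [map_smul, Finsupp.smul_apply, smul_eq_mul, add_sub_assoc]
  exact mul_mem_degLE hf (ha k)

theorem basis_mem_poleLE (i : Fin n) : b i ∈ poleLE b w (w * (i : ℕ)) := fun k => by
  rw [Module.Basis.repr_self]
  by_cases h : i = k
  · subst h
    rw [Finsupp.single_eq_same, sub_self]
    exact one_mem_degLE
  · rw [Finsupp.single_eq_of_ne' h]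
    exact zero_mem _

theorem exists_mem_poleLE (a : K) : ∃ j, a ∈ poleLE b w j := by
  refine ⟨∑ i : Fin n, (|(b.repr a i).intDegree| + w * (i : ℕ)), fun i => ?_⟩
  refine degLE_mono ?_ (exists_mem_degLE _)
  have h := Finset.single_le_sum (f := fun i : Fin n => |(b.repr a i).intDegree| + w * (i : ℕ))
    (fun i _ => by positivity) (Finset.mem_univ i)
  have := le_abs_self (b.repr a i).intDegree
  linarith

/-- Combinations of the basis with prescribed polynomial coefficients, shifted by a power of `X`. -/
noncomputable def polyComb (w : ℕ) (i : ℤ) (m : ℕ) :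
    (Fin n → degreeLT F m) →ₗ[F] K where
  toFun v := ∑ k : Fin n, ((RatFunc.X : RatFunc F) ^ (i + 1 - w * (k : ℕ)) *
    algebraMap F[X] (RatFunc F) (v k).1) • b k
  map_add' u v := by
    rw [← Finset.sum_add_distrib]
    refine Finset.sum_congr rfl fun k _ => ?_
    rw [← add_smul, ← mul_add, ← map_add]
    rfl
  map_smul' c v := by
    rw [Finset.smul_sum]
    refine Finset.sum_congr rfl fun k _ => ?_
    rw [← smul_assoc, ← mul_smul_comm, RingHom.id_apply]
    congr 2
    exact (IsScalarTower.toAlgHom F F[X] (RatFunc F)).toLinearMap.map_smul c _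

theorem repr_polyComb (i : ℤ) (m : ℕ) (v : Fin n → degreeLT F m) (k : Fin n) :
    b.repr (polyComb b w i m v) k = (RatFunc.X : RatFunc F) ^ (i + 1 - w * (k : ℕ)) *
      algebraMap F[X] (RatFunc F) (v k).1 :=
  congrFun (Module.Basis.repr_sum_self b _) k

theorem polyComb_mem (i : ℤ) (m : ℕ) (v : Fin n → degreeLT F m) :
    polyComb b w i m v ∈ poleLE b w (i + m) := fun k => by
  rw [repr_polyComb, show i + m - w * (k : ℕ) = (i + 1 - w * (k : ℕ)) + (m - 1 : ℤ) by ring,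
    X_zpow_mul_mem_degLE, algebraMap_mem_degLE]
  by_cases h : (v k).1 = 0
  · exact Or.inl h
  · have := mem_degreeLT.1 (v k).2
    rw [← natDegree_lt_iff_degree_lt h] at this
    omega

theorem polyComb_mem_iff (i : ℤ) (m : ℕ) (v : Fin n → degreeLT F m) :
    polyComb b w i m v ∈ poleLE b w i ↔ v = 0 := by
  constructor
  · intro h
    ext1 k
    have := h k
    rw [repr_polyComb, show i - w * (k : ℕ) = (i + 1 - w * (k : ℕ)) + (-1 : ℤ) by ring,
      X_zpow_mul_mem_degLE, algebraMap_mem_degLE] at this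
    exact Subtype.ext (this.resolve_right (by omega))
  · rintro rfl
    rw [map_zero]
    exact zero_mem _

theorem exists_polyComb (i : ℤ) (m : ℕ) {a : K} (ha : a ∈ poleLE b w (i + m)) :
    ∃ v, a - polyComb b w i m v ∈ poleLE b w i := by
  have h : ∀ k : Fin n, ∃ p : degreeLT F m, b.repr a k - (RatFunc.X : RatFunc F) ^ (i + 1 - w * (k : ℕ)) *
      algebraMap F[X] (RatFunc F) p.1 ∈ degLE F (i - w * (k : ℕ)) := by
    intro k
    obtain ⟨p, hp⟩ := exists_polynomial_sub_mem
      ((RatFunc.X : RatFunc F) ^ (-(i + 1 - w * (k : ℕ))) * b.repr a k)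
    have h1 : (RatFunc.X : RatFunc F) ^ (-(i + 1 - w * (k : ℕ))) * b.repr a k ∈
        degLE F ((m : ℤ) - 1) := by
      have := (X_zpow_mul_mem_degLE (-(i + 1 - w * (k : ℕ)))).2 (ha k)
      convert this using 2
      ring
    have h2 : algebraMap F[X] (RatFunc F) p ∈ degLE F ((m : ℤ) - 1) := by
      have := sub_mem h1 (degLE_mono (by omega) hp)
      rwa [sub_sub_cancel] at this
    refine ⟨⟨p, ?_⟩, ?_⟩
    · rw [mem_degreeLT]
      rcases algebraMap_mem_degLE.1 h2 with rfl | h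
      · rw [degree_zero]; exact WithBot.bot_lt_coe m
      · by_cases hp : p = 0
        · rw [hp, degree_zero]; exact WithBot.bot_lt_coe m
        rw [← natDegree_lt_iff_degree_lt hp]
        omega
    · have := (X_zpow_mul_mem_degLE (i + 1 - w * (k : ℕ))).2 hp
      rw [mul_sub, ← mul_assoc, ← zpow_add₀ RatFunc.X_ne_zero, add_neg_cancel, zpow_zero,
        one_mul] at this
      convert this using 2
      ring
  choose v hv using h
  refine ⟨v, fun k => ?_⟩
  rw [map_sub, Finsupp.sub_apply, repr_polyComb]
  exact hv k

theorem exists_quotient_equiv (i : ℤ) (m : ℕ) :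
    Nonempty ((Fin n → degreeLT F m) ≃ₗ[F]
      (poleLE b w (i + m) ⧸ (poleLE b w i).submoduleOf (poleLE b w (i + m)))) := by
  let φ := ((poleLE b w i).submoduleOf (poleLE b w (i + m))).mkQ ∘ₗ
    (polyComb b w i m).codRestrict (poleLE b w (i + m)) (polyComb_mem b i m)
  refine ⟨LinearEquiv.ofBijective φ ⟨?_, ?_⟩⟩
  · rw [← LinearMap.ker_eq_bot, LinearMap.ker_eq_bot']
    intro v hv
    have h1 := (Submodule.Quotient.mk_eq_zero ((poleLE b w i).submoduleOf (poleLE b w (i + m)))).1 hv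
    exact (polyComb_mem_iff b i m v).1 h1
  · intro q
    obtain ⟨⟨a, ha⟩, rfl⟩ := Submodule.Quotient.mk_surjective _ q
    obtain ⟨v, hv⟩ := exists_polyComb b i m ha
    refine ⟨v, ?_⟩
    symm
    exact (Submodule.Quotient.eq _).2 hv

theorem finite_poleLE_quotient (i j : ℤ) : FiniteDimensional F
    (poleLE b w j ⧸ (poleLE b w i).submoduleOf (poleLE b w j)) := by
  rcases le_total i j with h | h
  · obtain ⟨m, rfl⟩ := Int.le.dest h
    obtain ⟨e⟩ := exists_quotient_equiv b (w := w) i m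
    have : Module.Finite F (degreeLT F m) := Module.Finite.equiv (degreeLTEquiv F m).symm
    exact Module.Finite.equiv e
  · have : (poleLE b w i).submoduleOf (poleLE b w j) = ⊤ :=
      Submodule.submoduleOf_eq_top.2 (poleLE_mono b h)
    rw [this]
    infer_instance

theorem finrank_degreeLT (m : ℕ) : Module.finrank F (degreeLT F m) = m := by
  rw [(degreeLTEquiv F m).finrank_eq, Module.finrank_fin_fun]

theorem finrank_poleLE_quotient {i j : ℤ} (h : i ≤ j) : (Module.finrank F
    (poleLE b w j ⧸ (poleLE b w i).submoduleOf (poleLE b w j)) : ℤ) = n * (j - i) := by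
  obtain ⟨m, rfl⟩ := Int.le.dest h
  obtain ⟨e⟩ := exists_quotient_equiv b (w := w) i m
  have : Module.Finite F (degreeLT F m) := Module.Finite.equiv (degreeLTEquiv F m).symm
  rw [← e.finrank_eq, Module.finrank_pi_fintype]
  simp only [finrank_degreeLT, Finset.sum_const, Finset.card_univ, Fintype.card_fin, smul_eq_mul]
  push_cast
  ring

section Mul

variable [Algebra F[X] K] [IsScalarTower F[X] (RatFunc F) K] {y : K}
  (hb : ∀ i : Fin n, b i = y ^ (i : ℕ)) {H : F[X][X]} (hH : H.Monic) (hn : H.natDegree = n)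
  (hw : ∀ i, (H.coeff i).natDegree ≤ w * (n - i)) (hy : aeval y H = 0)

include hb hH hn hw hy

theorem root_mul_mem_poleLE {j : ℤ} {a : K} (ha : a ∈ poleLE b w j) :
    y * a ∈ poleLE b w (w + j) := by
  rw [← b.sum_repr a, Finset.mul_sum]
  refine sum_mem fun i _ => ?_
  rw [mul_smul_comm, hb, ← pow_succ']
  have hi := ha i
  by_cases h : (i : ℕ) + 1 < n
  · have := smul_mem_poleLE b hi (basis_mem_poleLE b (w := w) ⟨i + 1, h⟩)
    rw [hb] at this
    convert this using 2
    push_cast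
    ring
  · have hin : (i : ℕ) + 1 = n := by omega
    have h1 : y ^ n = -∑ k : Fin n, algebraMap F[X] (RatFunc F) (H.coeff k) • b k := by
      rw [aeval_eq_sum_range, hn, Finset.sum_range_succ] at hy
      have h2 : H.coeff n = 1 := by rw [← hn]; exact hH
      rw [h2, one_smul, Finset.sum_range] at hy
      rw [eq_neg_iff_add_eq_zero, add_comm, ← hy]
      congr 1
      refine Finset.sum_congr rfl fun k _ => ?_
      rw [hb, algebraMap_smul]
    rw [hin, h1, smul_neg, Finset.smul_sum]
    refine neg_mem (sum_mem fun k _ => ?_)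
    rw [smul_smul]
    have h2 : algebraMap F[X] (RatFunc F) (H.coeff k) ∈ degLE F (w * (n - (k : ℕ))) := by
      refine algebraMap_mem_degLE.2 (Or.inr ?_)
      have := hw k
      have hk := k.2
      zify [hk.le] at this
      exact this
    have := smul_mem_poleLE b (mul_mem_degLE hi h2) (basis_mem_poleLE b (w := w) k)
    convert this using 2
    have hin' : ((i : ℕ) : ℤ) + 1 = n := by exact_mod_cast hin
    linear_combination (w : ℤ) * hin'

theorem pow_root_mul_mem_poleLE (m : ℕ) {j : ℤ} {a : K} (ha : a ∈ poleLE b w j) :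
    y ^ m * a ∈ poleLE b w (w * m + j) := by
  induction m with
  | zero => simpa using ha
  | succ m ih =>
    rw [pow_succ', mul_assoc]
    convert root_mul_mem_poleLE b hb hH hn hw hy ih using 2
    push_cast
    ring

theorem mul_mem_poleLE {i j : ℤ} {a c : K} (ha : a ∈ poleLE b w i) (hc : c ∈ poleLE b w j) :
    a * c ∈ poleLE b w (i + j) := by
  rw [← b.sum_repr a, Finset.sum_mul]
  refine sum_mem fun k _ => ?_
  rw [smul_mul_assoc, hb]
  have := smul_mem_poleLE b (ha k) (pow_root_mul_mem_poleLE b hb hH hn hw hy (k : ℕ) hc)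
  convert this using 2
  ring

theorem leftMulMatrix_mem {j : ℤ} {f : K} (hf : f ∈ poleLE b w j) (i k : Fin n) :
    Algebra.leftMulMatrix b f i k ∈ degLE F (j + w * (k : ℕ) - w * (i : ℕ)) := by
  rw [Algebra.leftMulMatrix_eq_repr_mul]
  exact mul_mem_poleLE b hb hH hn hw hy hf (basis_mem_poleLE b k) i

theorem norm_mem_degLE {j : ℤ} {f : K} (hf : f ∈ poleLE b w j) :
    Algebra.norm (RatFunc F) f ∈ degLE F (n * j) := by
  rw [Algebra.norm_eq_matrix_det b]
  have := det_mem_degLE (fun i : Fin n => (w : ℤ) * (i : ℕ)) j (Algebra.leftMulMatrix b f)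
    (leftMulMatrix_mem b hb hH hn hw hy hf)
  rwa [Fintype.card_fin] at this

theorem norm_sub_one_mem_degLE {e : ℤ} (he : e ≤ 0) {f : K} (hf : f - 1 ∈ poleLE b w e) :
    Algebra.norm (RatFunc F) f - 1 ∈ degLE F e := by
  rw [Algebra.norm_eq_matrix_det b]
  refine det_sub_one_mem_degLE (fun i : Fin n => (w : ℤ) * (i : ℕ)) he _ ?_
  intro i k
  have := leftMulMatrix_mem b hb hH hn hw hy hf i k
  rwa [map_sub, map_one] at this

end Mul

end

section

open Polynomial RatFunc nonZeroDivisors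

section FiniteQuotients

variable {F O : Type*} [Field F] [CommRing O] [IsDomain O] [Algebra F[X] O] [Algebra F O]
  [IsScalarTower F F[X] O] [Module.Finite F[X] O] [Module.Free F[X] O]

theorem finiteDimensional_quotient_of_ne_bot {I : Ideal O} (hI : I ≠ ⊥) :
    FiniteDimensional F (O ⧸ I) := by
  let b := Module.Free.chooseBasis F[X] O
  let e := (I.quotientEquivPiSpan b hI).restrictScalars F
  have : ∀ i, FiniteDimensional F (F[X] ⧸ Ideal.span ({I.smithCoeffs b hI i} : Set F[X])) := by
    intro i
    have h : I.smithCoeffs b hI i ≠ 0 := Ideal.smithCoeffs_ne_zero b _ hI i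
    exact Module.Finite.of_basis (AdjoinRoot.powerBasis h).basis
  exact Module.Finite.equiv e.symm

theorem finite_setOf_codim_eq [Finite F] [FaithfulSMul F[X] O] (m : ℕ) :
    {I : Ideal O | I ≠ ⊥ ∧ I.codim F = m}.Finite := by
  have hfin : {p : F[X] | p ≠ 0 ∧ p.natDegree ≤ m}.Finite := by
    have : Finite (degreeLT F (m + 1)) := Finite.of_equiv _ (degreeLTEquiv F (m + 1)).symm.toEquiv
    refine (Set.toFinite (degreeLT F (m + 1) : Set F[X])).subset ?_
    rintro p ⟨h1, h2⟩
    rw [SetLike.mem_coe, mem_degreeLT, ← natDegree_lt_iff_degree_lt h1]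
    omega
  refine (hfin.biUnion (t := fun p => {I : Ideal O | algebraMap F[X] O p ∈ I}) ?_).subset ?_
  · rintro p ⟨hp, -⟩
    have hp' : algebraMap F[X] O p ≠ 0 := by
      rwa [Ne, FaithfulSMul.algebraMap_eq_zero_iff]
    have hfd : FiniteDimensional F (O ⧸ Ideal.span {algebraMap F[X] O p}) :=
      finiteDimensional_quotient_of_ne_bot (Ideal.span_singleton_eq_bot.not.2 hp')
    have : Finite (O ⧸ Ideal.span {algebraMap F[X] O p}) := Module.finite_of_finite F
    have : Finite (Ideal (O ⧸ Ideal.span {algebraMap F[X] O p})) :=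
      Finite.of_injective (fun I : Ideal _ => (I : Set (O ⧸ Ideal.span {algebraMap F[X] O p})))
        SetLike.coe_injective
    refine (Set.finite_range fun J : Ideal (O ⧸ Ideal.span {algebraMap F[X] O p}) =>
      J.comap (Ideal.Quotient.mk _)).subset ?_
    intro I hI
    refine ⟨I.map (Ideal.Quotient.mk _), ?_⟩
    beta_reduce
    rw [Ideal.comap_map_of_surjective _ Ideal.Quotient.mk_surjective, ← RingHom.ker_eq_comap_bot,
      Ideal.mk_ker, sup_eq_left, Ideal.span_singleton_le_iff_mem]
    exact hI
  · rintro I ⟨hI, hm⟩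
    have := finiteDimensional_quotient_of_ne_bot (F := F) hI
    set x : O ⧸ I := Ideal.Quotient.mk I (algebraMap F[X] O X) with hx
    set χ := (Algebra.lmul F (O ⧸ I) x).charpoly with hχ
    have h1 : aeval x χ = 0 := by
      have := LinearMap.aeval_self_charpoly (Algebra.lmul F (O ⧸ I) x)
      rw [aeval_algHom_apply] at this
      exact Algebra.lmul_injective (this.trans (map_zero _).symm)
    refine Set.mem_biUnion (x := χ) ⟨(LinearMap.charpoly_monic _).ne_zero, ?_⟩ ?_
    · rw [LinearMap.charpoly_natDegree]
      exact hm.le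
    · have h2 : Ideal.Quotient.mk I (algebraMap F[X] O χ) = aeval x χ := by
        have : ((Ideal.Quotient.mkₐ F I).comp (IsScalarTower.toAlgHom F F[X] O)) = aeval x := by
          ext; simp [hx]
        exact congrArg (fun f => f χ) this
      exact Ideal.Quotient.eq_zero_iff_mem.1 (h2.trans h1)

end FiniteQuotients

variable {F K O : Type*} [Field F] [Field K] [Algebra (RatFunc F) K] [Algebra F K]
  [IsScalarTower F (RatFunc F) K] [Algebra F[X] K] [IsScalarTower F[X] (RatFunc F) K]
  [CommRing O] [IsDomain O] [Algebra F[X] O] [Algebra F O] [IsScalarTower F F[X] O]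
  [Algebra O K] [IsScalarTower F[X] O K] [IsScalarTower F O K] [Module.Finite F[X] O]
  [Module.Free F[X] O] [FaithfulSMul F[X] O]
  [IsLocalization (Algebra.algebraMapSubmonoid O F[X]⁰) K]
  {n : ℕ} (b : Module.Basis (Fin n) (RatFunc F) K) {w : ℕ} {y : O} {H : F[X][X]}

theorem norm_eq_of_eq_mul {a c : O} {f : K} (h : algebraMap O K a = f * algebraMap O K c) :
    algebraMap F[X] (RatFunc F) (Algebra.norm F[X] a) =
      Algebra.norm (RatFunc F) f * algebraMap F[X] (RatFunc F) (Algebra.norm F[X] c) := by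
  have := congrArg (Algebra.norm (RatFunc F)) h
  rwa [map_mul, Algebra.norm_localization F[X] F[X]⁰, Algebra.norm_localization F[X] F[X]⁰] at this

/-- Polynomial combinations of the powers of `y` of weighted degree at most `s`. -/
noncomputable def weightedComb (F : Type*) {O : Type*} [Field F] [CommRing O] [Algebra F[X] O]
    [Algebra F O] [IsScalarTower F F[X] O] (n w : ℕ) (y : O) (s : ℕ) :
    (∀ i : Fin n, degreeLT F (s + 1 - w * (i : ℕ))) →ₗ[F] O where
  toFun v := ∑ i, (v i).1 • y ^ (i : ℕ)
  map_add' u v := by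
    rw [← Finset.sum_add_distrib]
    refine Finset.sum_congr rfl fun k _ => ?_
    rw [← add_smul]
    rfl
  map_smul' c v := by
    rw [Finset.smul_sum]
    refine Finset.sum_congr rfl fun k _ => ?_
    rw [← smul_assoc]
    rfl

theorem finrank_range_weightedComb (hinj : ∀ s, Function.Injective (weightedComb F n w y s)) (s : ℕ) :
    n * (s + 1) ≤ Module.finrank F (LinearMap.range (weightedComb F n w y s)) + w * n ^ 2 := by
  have : ∀ m, Module.Finite F (degreeLT F m) := fun m => Module.Finite.equiv (degreeLTEquiv F m).symm
  rw [LinearMap.finrank_range_of_inj (hinj s), Module.finrank_pi_fintype]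
  simp only [finrank_degreeLT]
  have h1 : ∑ i : Fin n, (s + 1) ≤ ∑ i : Fin n, ((s + 1 - w * (i : ℕ)) + w * n) := by
    refine Finset.sum_le_sum fun i _ => ?_
    have : w * (i : ℕ) ≤ w * n := Nat.mul_le_mul_left w i.2.le
    omega
  have h2 : ∑ i : Fin n, (s + 1) = n * (s + 1) := by simp
  have h3 : ∑ i : Fin n, w * n = w * n ^ 2 := by simp; ring
  rwa [h2, Finset.sum_add_distrib, h3] at h1

section

variable (hb : ∀ i : Fin n, b i = (algebraMap O K y) ^ (i : ℕ))

include hb in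
theorem algebraMap_weightedComb (s : ℕ) (v : ∀ i : Fin n, degreeLT F (s + 1 - w * (i : ℕ))) :
    algebraMap O K (weightedComb F n w y s v) =
      ∑ i, algebraMap F[X] (RatFunc F) (v i).1 • b i := by
  change algebraMap O K (∑ i, (v i).1 • y ^ (i : ℕ)) = _
  rw [map_sum]
  refine Finset.sum_congr rfl fun i _ => ?_
  rw [hb, ← map_pow, algebraMap_smul, Algebra.smul_def, Algebra.smul_def, map_mul,
    ← IsScalarTower.algebraMap_apply]

include hb in
theorem weightedComb_injective (s : ℕ) : Function.Injective (weightedComb F n w y s) := by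
  rw [← LinearMap.ker_eq_bot, LinearMap.ker_eq_bot']
  intro v hv
  have h := algebraMap_weightedComb b hb s v
  rw [hv, map_zero] at h
  ext1 i
  have h1 := congrFun (Module.Basis.repr_sum_self b fun i => algebraMap F[X] (RatFunc F) (v i).1) i
  rw [← h, map_zero] at h1
  exact Subtype.ext ((map_eq_zero_iff _ (RatFunc.algebraMap_injective F)).1 h1.symm)

include hb in
theorem algebraMap_weightedComb_mem (s : ℕ)
    (v : ∀ i : Fin n, degreeLT F (s + 1 - w * (i : ℕ))) :
    algebraMap O K (weightedComb F n w y s v) ∈ poleLE b w s := by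
  intro i
  rw [algebraMap_weightedComb b hb, Module.Basis.repr_sum_self, algebraMap_mem_degLE]
  by_cases h : (v i).1 = 0
  · exact Or.inl h
  · have := mem_degreeLT.1 (v i).2
    rw [← natDegree_lt_iff_degree_lt h] at this
    right
    zify at this ⊢
    omega

include hb in
theorem one_mem_poleLE (hn0 : 0 < n) : (1 : K) ∈ poleLE b w 0 := by
  have := basis_mem_poleLE b (w := w) ⟨0, hn0⟩
  rw [hb] at this
  simpa using this

include hb in
theorem algebraMap_mem_poleLE (hn0 : 0 < n) {d : ℤ} {f : RatFunc F} (hf : f ∈ degLE F d) :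
    algebraMap (RatFunc F) K f ∈ poleLE b w d := by
  have := smul_mem_poleLE b hf (one_mem_poleLE b hb hn0 (w := w))
  rwa [add_zero, ← Algebra.algebraMap_eq_smul_one] at this

include hb in
theorem exists_sub_mem_poleLE (a : K) : ∃ o : O, a - algebraMap O K o ∈ poleLE b w (w * n) := by
  choose p hp using fun i => exists_polynomial_sub_mem (b.repr a i)
  refine ⟨∑ i : Fin n, p i • y ^ (i : ℕ), fun i => ?_⟩
  have h1 : algebraMap O K (∑ i : Fin n, p i • y ^ (i : ℕ)) =
      ∑ i, algebraMap F[X] (RatFunc F) (p i) • b i := by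
    rw [map_sum]
    refine Finset.sum_congr rfl fun i _ => ?_
    rw [hb, ← map_pow, algebraMap_smul, Algebra.smul_def, Algebra.smul_def, map_mul,
      ← IsScalarTower.algebraMap_apply]
  rw [h1, map_sub, Finsupp.sub_apply, Module.Basis.repr_sum_self]
  refine degLE_mono ?_ (hp i)
  have : (w : ℤ) * (i : ℕ) ≤ w * n := by
    have := i.2.le
    gcongr
  omega

end

/-- The pole filtration of an affine plane curve `H(X, y) = 0`, monic in `y`. -/
noncomputable def curveFiltration [Finite F] (hn0 : 0 < n)
    (hb : ∀ i : Fin n, b i = (algebraMap O K y) ^ (i : ℕ)) (hH : H.Monic) (hn : H.natDegree = n)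
    (hw : ∀ i, (H.coeff i).natDegree ≤ w * (n - i)) (hy : aeval y H = 0)
    (hrank : Module.finrank F[X] O = n) :
    PoleFiltration F O K n (w * n ^ 2) (algebraMap F[X] O Polynomial.X) where
  W := poleLE b w
  mono := poleLE_mono b
  mul_mem := by
    have hy' : aeval (algebraMap O K y) H = 0 := by
      rw [aeval_algebraMap_apply, hy, map_zero]
    exact fun {_ _ _ _} ha hc => mul_mem_poleLE b hb hH hn hw hy' ha hc
  one_mem := one_mem_poleLE b hb hn0
  one_notMem := by
    have h1 : (1 : K) = b ⟨0, hn0⟩ := by rw [hb]; simp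
    intro h
    have := h ⟨0, hn0⟩
    rw [h1, Module.Basis.repr_self, Finsupp.single_eq_same, mem_degLE] at this
    simp at this
  exhaust := exists_mem_poleLE b
  finite_quot := finite_poleLE_quotient b
  finrank_quot := finrank_poleLE_quotient b
  x_mem := by
    rw [← IsScalarTower.algebraMap_apply, IsScalarTower.algebraMap_apply F[X] (RatFunc F) K]
    refine algebraMap_mem_poleLE b hb hn0 (algebraMap_mem_degLE.2 (Or.inr ?_))
    simp
  x_ne := by
    rw [Ne, FaithfulSMul.algebraMap_eq_zero_iff]
    exact Polynomial.X_ne_zero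
  x_inv_mem := by
    rw [← IsScalarTower.algebraMap_apply, IsScalarTower.algebraMap_apply F[X] (RatFunc F) K,
      ← map_inv₀]
    refine algebraMap_mem_poleLE b hb hn0 (Or.inr ?_)
    rw [intDegree_inv, intDegree_polynomial, natDegree_X]
    rfl
  top := ⟨_, exists_sub_mem_poleLE b hb⟩
  P s := LinearMap.range (weightedComb F n w y s)
  P_le := by
    rintro s _ ⟨v, rfl⟩
    exact algebraMap_weightedComb_mem b hb s v
  P_finrank := finrank_range_weightedComb (weightedComb_injective b hb)
  finite_quotient := fun I hI => finiteDimensional_quotient_of_ne_bot hI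
  finite_ideals := finite_setOf_codim_eq
  codim_le := by
    intro f a c j ha hc hf h
    have hy' : aeval (algebraMap O K y) H = 0 := by
      rw [aeval_algebraMap_apply, hy, map_zero]
    have h1 := norm_eq_of_eq_mul (F := F) h
    have h2 := norm_mem_degLE b hb hH hn hw hy' hf
    let e := Module.Free.chooseBasis F[X] O
    rw [Ideal.codim, Ideal.codim, finrank_quotient_span_eq_natDegree_norm e ha,
      finrank_quotient_span_eq_natDegree_norm e hc]
    have h3 := mul_mem_degLE h2 (algebraMap_mem_degLE.2
      (Or.inr le_rfl : Algebra.norm F[X] c = 0 ∨ _))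
    rw [← h1, algebraMap_mem_degLE] at h3
    have := h3.resolve_left (Algebra.norm_ne_zero_iff.2 ha)
    omega
  trace_eq := by
    intro f a c ha hc hf h
    have hy' : aeval (algebraMap O K y) H = 0 := by
      rw [aeval_algebraMap_apply, hy, map_zero]
    have h1 := norm_eq_of_eq_mul (F := F) h
    have h2 := norm_sub_one_mem_degLE b hb hH hn hw hy' (by norm_num) hf
    let e := Module.Free.chooseBasis F[X] O
    rw [Ideal.traceOf_span_singleton e ha, Ideal.traceOf_span_singleton e hc]
    have h3 := mul_mem_degLE h2 (algebraMap_mem_degLE.2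
      (Or.inr le_rfl : Algebra.norm F[X] c = 0 ∨ _))
    rw [sub_mul, one_mul, ← h1, ← map_sub, algebraMap_mem_degLE] at h3
    rw [(subleading_eq_of_degree_sub (h3.imp_right fun h => by omega)).2]
  trace_sub := by
    intro c
    have h1 : algebraMap F[X] O X - algebraMap F O c = algebraMap F[X] O (Polynomial.X - Polynomial.C c) := by
      rw [map_sub, IsScalarTower.algebraMap_apply F F[X] O]
      rfl
    have h2 : algebraMap F[X] O (Polynomial.X - Polynomial.C c) ≠ 0 := by
      rw [Ne, FaithfulSMul.algebraMap_eq_zero_iff]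
      exact X_sub_C_ne_zero c
    let e := Module.Free.chooseBasis F[X] O
    rw [h1]
    refine ⟨h2, ?_⟩
    rw [Ideal.traceOf_span_singleton e h2, Algebra.norm_algebraMap_of_basis e,
      ← Module.finrank_eq_card_basis e, hrank, subleading_X_sub_C_pow]
    ring

end

section

namespace PoleFiltration

variable {F O K : Type*} [Field F] [CommRing O] [IsDedekindDomain O] [Field K] [Algebra O K]
  [IsFractionRing O K] [Algebra F O] [Algebra F K] [IsScalarTower F O K] {n g : ℕ} {x : O}
  (D : PoleFiltration F O K n g x)

/-- The elements of the coordinate ring with pole order at most `j`. -/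
def regular (j : ℤ) : Submodule F O := (D.W j).comap (IsScalarTower.toAlgHom F O K).toLinearMap

theorem mem_regular {j : ℤ} {r : O} : r ∈ D.regular j ↔ algebraMap O K r ∈ D.W j := Iff.rfl

theorem mul_mem_regular {i j : ℤ} {r s : O} (hr : r ∈ D.regular i) (hs : s ∈ D.regular j) :
    r * s ∈ D.regular (i + j) := by
  rw [mem_regular, map_mul]
  exact D.mul_mem hr hs

theorem pow_mem_regular {j : ℤ} {r : O} (hr : r ∈ D.regular j) (k : ℕ) :
    r ^ k ∈ D.regular (k * j) := by
  rw [mem_regular, map_pow]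
  exact D.pow_mem hr k

theorem P_le_regular (s : ℕ) : D.P s ≤ D.regular s := D.P_le s

theorem codim_span_le {r : O} (hr : r ≠ 0) {j : ℤ} (h : r ∈ D.regular j) :
    ((Ideal.span {r}).codim F : ℤ) ≤ n * j := by
  have h1 := D.codim_le (algebraMap O K r) r 1 j hr one_ne_zero h (by simp)
  rwa [Ideal.span_singleton_one, D.codim_top, Nat.cast_zero, zero_add] at h1

theorem finite_regular (hn : 0 < n) (j : ℕ) : FiniteDimensional F (D.regular j) ∧
    Module.finrank F (D.regular j) ≤ n * (j + 1) := by
  have := D.finite_quot (-1) j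
  let φ : D.regular j →ₗ[F] (D.W j ⧸ (D.W (-1)).submoduleOf (D.W j)) :=
    ((D.W (-1)).submoduleOf (D.W j)).mkQ ∘ₗ
      ((IsScalarTower.toAlgHom F O K).toLinearMap.restrict (q := D.W j) fun r hr => hr)
  have hφ : Function.Injective φ := by
    rw [← LinearMap.ker_eq_bot, LinearMap.ker_eq_bot']
    rintro ⟨r, hr⟩ h
    have h1 : r ∈ D.regular (-1) := (Submodule.Quotient.mk_eq_zero ((D.W (-1)).submoduleOf (D.W j))).1 h
    by_contra hr0
    have h2 := D.codim_span_le (fun h => hr0 (Subtype.ext h)) h1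
    omega
  refine ⟨Module.Finite.of_injective φ hφ, ?_⟩
  have h1 := LinearMap.finrank_le_finrank_of_injective hφ
  have h2 := D.finrank_quot (show (-1 : ℤ) ≤ j by omega)
  zify
  calc _ ≤ _ := Nat.cast_le.2 h1
    _ = _ := by rw [h2]; ring

/-- Homomorphisms into a domain killing an element of bounded pole order. -/
theorem card_algHom_le {E : Type*} [Field E] [Algebra F E] {r : O} (hr : r ≠ 0) {j : ℤ}
    (h : r ∈ D.regular j) (s : Finset (O →ₐ[F] E)) (hs : ∀ φ ∈ s, φ r = 0) :
    (s.card : ℤ) ≤ n * j := by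
  classical
  have hfin := D.finite_quotient (Ideal.span {r}) (span_ne_bot hr)
  refine le_trans ?_ (D.codim_span_le hr h)
  let lift : s → ((O ⧸ Ideal.span {r}) →ₐ[F] E) := fun φ =>
    Ideal.Quotient.liftₐ (Ideal.span {r}) φ.1 fun a ha => by
      obtain ⟨b, rfl⟩ := Ideal.mem_span_singleton.1 ha
      rw [map_mul, hs φ.1 φ.2, zero_mul]
  have hinj : Function.Injective lift := by
    intro φ φ' h
    refine Subtype.ext (AlgHom.ext fun o => ?_)
    exact congrArg (fun f : (O ⧸ Ideal.span {r}) →ₐ[F] E => f (Ideal.Quotient.mk _ o)) h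
  have h1 := Nat.card_le_card_of_injective lift hinj
  have h2 := card_algHom_le_finrank F (O ⧸ Ideal.span {r}) E
  rw [Nat.card_eq_fintype_card, Fintype.card_coe] at h1
  exact_mod_cast h1.trans h2

include D in
theorem finrank_inf_pow_le {P : Ideal O} (hP : P ≠ ⊥) (hP1 : P.codim F = 1) (V : Submodule F O)
    [FiniteDimensional F V] (k : ℕ) :
    Module.finrank F ↥(V ⊓ (P ^ k).restrictScalars F) ≤
      Module.finrank F ↥(V ⊓ (P ^ (k + 1)).restrictScalars F) + 1 := by
  have hle : P ^ (k + 1) ≤ P ^ k := Ideal.pow_le_pow_right (Nat.le_succ k)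
  have hfin := D.finite_quotient _ (pow_ne_zero (k + 1) hP)
  have hfin' := D.finite_quotient _ (pow_ne_zero k hP)
  set A := V ⊓ (P ^ k).restrictScalars F
  let π := ((Ideal.Quotient.factorₐ F hle).toLinearMap)
  have hπ : Module.finrank F (LinearMap.ker π) = 1 := by
    have h1 := LinearMap.finrank_range_add_finrank_ker π
    have h2 : LinearMap.range π = ⊤ :=
      LinearMap.range_eq_top.2 (Ideal.Quotient.factor_surjective hle)
    rw [h2, finrank_top] at h1
    have h3 := D.codim_pow hP k
    have h4 := D.codim_pow hP (k + 1)
    rw [hP1] at h3 h4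
    simp only [Ideal.codim] at h3 h4
    omega
  let φ : A →ₗ[F] LinearMap.ker π :=
    LinearMap.codRestrict _ ((Ideal.Quotient.mkₐ F (P ^ (k + 1))).toLinearMap ∘ₗ A.subtype) (by
      rintro ⟨v, hv⟩
      exact Ideal.Quotient.eq_zero_iff_mem.2 hv.2)
  have h1 := LinearMap.finrank_range_add_finrank_ker φ
  have h2 : Module.finrank F (LinearMap.range φ) ≤ 1 := (Submodule.finrank_le _).trans hπ.le
  let ι : LinearMap.ker φ →ₗ[F] ↥(V ⊓ (P ^ (k + 1)).restrictScalars F) :=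
    (A.subtype ∘ₗ (LinearMap.ker φ).subtype).codRestrict _ (by
      rintro ⟨⟨v, hv⟩, h⟩
      exact ⟨hv.1, Ideal.Quotient.eq_zero_iff_mem.1 (congrArg Subtype.val h)⟩)
  have h3 : Module.finrank F (LinearMap.ker φ) ≤ _ :=
    LinearMap.finrank_le_finrank_of_injective (f := ι) fun a b h =>
      Subtype.ext (Subtype.ext (show (ι a).1 = (ι b).1 from congrArg Subtype.val h))
  omega

include D in
theorem exists_orders {P : Ideal O} (hP : P ≠ ⊥) (hP1 : P.codim F = 1) (V : Submodule F O)
    [FiniteDimensional F V] (k : ℕ) : ∃ (s : Finset ℕ) (v : ℕ → O),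
    (∀ e ∈ s, e < k ∧ v e ∈ V ∧ v e ∈ P ^ e ∧ v e ∉ P ^ (e + 1)) ∧
    Module.finrank F V ≤ s.card + Module.finrank F ↥(V ⊓ (P ^ k).restrictScalars F) := by
  induction k with
  | zero => exact ⟨∅, 0, by simp, by
    rw [pow_zero, Ideal.one_eq_top, Submodule.restrictScalars_top, inf_top_eq]
    simp⟩
  | succ k ih =>
    obtain ⟨s, v, h1, h2⟩ := ih
    by_cases h : ∃ a ∈ V, a ∈ P ^ k ∧ a ∉ P ^ (k + 1)
    · obtain ⟨a, ha, ha1, ha2⟩ := h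
      have hks : k ∉ s := fun hk => (h1 k hk).1.false
      refine ⟨insert k s, Function.update v k a, ?_, ?_⟩
      · intro e he
        rcases Finset.mem_insert.1 he with rfl | he
        · simp [ha, ha1, ha2]
        · have := h1 e he
          rw [Function.update_of_ne this.1.ne]
          exact ⟨this.1.trans (Nat.lt_succ_self k), this.2⟩
      · rw [Finset.card_insert_of_notMem hks]
        have := D.finrank_inf_pow_le hP hP1 V k
        omega
    · push Not at h
      have : V ⊓ (P ^ k).restrictScalars F = V ⊓ (P ^ (k + 1)).restrictScalars F :=
        le_antisymm (fun a ha => ⟨ha.1, h a ha.1 ha.2⟩) (inf_le_inf_left _ fun a ha =>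
          Ideal.pow_le_pow_right (Nat.le_succ k) ha)
      refine ⟨s, v, fun e he => ⟨(h1 e he).1.trans (Nat.lt_succ_self k), (h1 e he).2⟩, ?_⟩
      rwa [← this]

/-- Elements of pole order at most `A` that are independent over `Q`-th powers. -/
theorem exists_independent_mul_pow (hn : 0 < n) {P : Ideal O} (hP : Prime P)
    (hP1 : P.codim F = 1) {A Q : ℕ} (hA : n * A < Q) :
    ∃ (s : Finset ℕ) (v : ℕ → O), Module.finrank F (D.P A) ≤ s.card ∧
      (∀ e ∈ s, v e ∈ D.regular A) ∧
      ∀ σ : ℕ → O, (∃ e ∈ s, σ e ≠ 0) → ∑ e ∈ s, v e * σ e ^ Q ≠ 0 := by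
  classical
  have := (D.finite_regular hn A).1
  have hfin : FiniteDimensional F (D.P A) := Submodule.finiteDimensional_of_le (D.P_le_regular A)
  obtain ⟨s, v, h1, h2⟩ := D.exists_orders hP.ne_zero hP1 (D.P A) Q
  have h3 : D.P A ⊓ (P ^ Q).restrictScalars F = ⊥ := by
    rw [Submodule.eq_bot_iff]
    rintro a ⟨ha, haQ⟩
    by_contra ha0
    have h4 := D.codim_span_le ha0 (D.P_le_regular A ha)
    have h5 := D.codim_anti (span_ne_bot ha0) ((Ideal.span_singleton_le_iff_mem _).2 haQ)
    rw [D.codim_pow hP.ne_zero, hP1] at h5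
    have : (n : ℤ) * A < Q := by exact_mod_cast hA
    omega
  rw [h3, finrank_bot, add_zero] at h2
  refine ⟨s, v, h2, fun e he => D.P_le_regular A (h1 e he).2.1, fun σ hσ => ?_⟩
  let w : IsDedekindDomain.HeightOneSpectrum O := ⟨P, (Ideal.prime_iff_isPrime hP.ne_zero).1 hP,
    hP.ne_zero⟩
  have hval : ∀ e ∈ s, ∀ r : O, r ≠ 0 → ∃ k : ℕ,
      w.intValuation (v e * r ^ Q) = WithZero.exp (-((e + Q * k : ℕ) : ℤ)) := by
    intro e he r hr
    have hv0 : v e ≠ 0 := fun h => (h1 e he).2.2.2 (h ▸ zero_mem _)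
    have hv : w.intValuation (v e) = WithZero.exp (-(e : ℤ)) := by
      refine le_antisymm ((w.intValuation_le_pow_iff_mem _ _).2 (h1 e he).2.2.1) ?_
      by_contra hlt
      rw [not_le] at hlt
      refine (h1 e he).2.2.2 ((w.intValuation_le_pow_iff_mem _ _).1 ?_)
      rw [w.intValuation_eq_exp_neg_multiplicity hv0] at hlt ⊢
      rw [WithZero.exp_lt_exp] at hlt
      rw [WithZero.exp_le_exp]
      push_cast
      omega
    rw [map_mul, map_pow, hv, w.intValuation_eq_exp_neg_multiplicity hr]
    refine ⟨multiplicity w.asIdeal (Ideal.span {r}), ?_⟩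
    rw [← WithZero.exp_nsmul, ← WithZero.exp_add]
    congr 1
    push_cast
    rw [nsmul_eq_mul, neg_add, mul_neg]
  have hzero : ∀ e, σ e = 0 → v e * σ e ^ Q = 0 := by
    intro e he
    rw [he, zero_pow (by omega), mul_zero]
  set s' := s.filter fun e => σ e ≠ 0 with hs'
  have hsum : ∑ e ∈ s, v e * σ e ^ Q = ∑ e ∈ s', v e * σ e ^ Q := by
    rw [hs', Finset.sum_filter]
    refine Finset.sum_congr rfl fun e _ => ?_
    split_ifs with h
    · rfl
    · exact hzero e (not_not.1 h)
  obtain ⟨e0, he0, hmax⟩ := Finset.exists_max_image s' (fun e => w.intValuation (v e * σ e ^ Q)) (by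
    obtain ⟨e, he, h⟩ := hσ
    exact ⟨e, Finset.mem_filter.2 ⟨he, h⟩⟩)
  have hmem := Finset.mem_filter.1 he0
  obtain ⟨k0, hk0⟩ := hval e0 hmem.1 _ hmem.2
  rw [hsum]
  intro h0
  have h4 := w.intValuation.map_sum_eq_of_lt (f := fun e => v e * σ e ^ Q) he0 (fun e he => by
    have h5 := Finset.mem_sdiff.1 he
    have hne : e ≠ e0 := fun h => h5.2 (Finset.mem_singleton.2 h)
    have h6 := Finset.mem_filter.1 h5.1
    obtain ⟨k, hk⟩ := hval e h6.1 _ h6.2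
    refine lt_of_le_of_ne (hmax e h5.1) fun h => hne ?_
    rw [hk, hk0, WithZero.exp_inj, neg_inj, Nat.cast_inj] at h
    have h7 := congrArg (· % Q) h
    simp only [Nat.add_mul_mod_self_left] at h7
    rwa [Nat.mod_eq_of_lt (h1 e h6.1).1, Nat.mod_eq_of_lt (h1 e0 hmem.1).1] at h7)
  beta_reduce at h4
  rw [h0, map_zero, hk0] at h4
  exact WithZero.exp_ne_zero h4.symm

end PoleFiltration

end

section

namespace PoleFiltration

theorem stepanov_parameters {n g e Q : ℕ} (hn : 0 < n)
    (hQ : g * ((e + 1) * g + e ^ 2 + 1) + e * ((e + 1) * g + e ^ 2 + 1 + n) + g < Q) :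
    ∃ A m : ℕ, n * A < Q ∧ n * (A + m * Q) ≤ e * Q ^ 2 + ((e + 1) * g + e ^ 2 + 2) * Q ∧
      ∀ a b : ℕ, n * (A + 1) ≤ a + g → n * (m + 1) ≤ b + g → e * (n * (A * Q + m + 1)) < a * b := by
  set c := (e + 1) * g + e ^ 2 + 1 with hc
  refine ⟨(Q - 1) / n, (e * Q + c) / n, ?_, ?_, ?_⟩
  · have := Nat.mul_div_le (Q - 1) n
    omega
  · have h1 := Nat.mul_div_le (Q - 1) n
    have h2 := Nat.mul_div_le (e * Q + c) n
    calc n * ((Q - 1) / n + (e * Q + c) / n * Q)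
        = n * ((Q - 1) / n) + n * ((e * Q + c) / n) * Q := by ring
      _ ≤ Q + (e * Q + c) * Q := by
        gcongr
        omega
      _ = _ := by rw [hc]; ring
  · intro a b ha hb
    have h1 := Nat.mul_div_le (Q - 1) n
    have h2 := Nat.mul_div_le (e * Q + c) n
    have h3 := Nat.lt_mul_div_succ (Q - 1) hn
    have h4 := Nat.lt_mul_div_succ (e * Q + c) hn
    set A := (Q - 1) / n
    set m := (e * Q + c) / n
    have h5 : (Q : ℤ) - g ≤ a := by zify at ha h3 ⊢; omega
    have h6 : (e * Q + c : ℤ) - g ≤ b := by zify at hb h4 ⊢; linarith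
    have h7 : (n : ℤ) * A ≤ Q - 1 := by zify at h1; omega
    have h8 : (n : ℤ) * m ≤ e * Q + c := by exact_mod_cast h2
    have hQ' : (g : ℤ) * c + e * (c + n) + g < Q := by exact_mod_cast hQ
    have hcz : (c : ℤ) = (e + 1) * g + e ^ 2 + 1 := by exact_mod_cast hc
    zify
    have h9 : ((Q : ℤ) - g) * (e * Q + c - g) ≤ a * b := by
      have : (0 : ℤ) ≤ Q - g := by
        have : (0 : ℤ) ≤ (g : ℤ) * c + e * (c + n) := by positivity
        linarith
      have h0 : (0 : ℤ) ≤ e * Q + c - g := by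
        rw [hcz]
        have : (0 : ℤ) ≤ e * Q + e * g + e ^ 2 + 1 := by positivity
        linarith
      exact mul_le_mul h5 h6 h0 (this.trans h5)
    refine lt_of_lt_of_le ?_ h9
    have h10 : (e : ℤ) * (n * (A * Q + m + 1)) ≤ e * ((Q - 1) * Q + (e * Q + c) + n) := by
      have : (n : ℤ) * A * Q ≤ (Q - 1) * Q := by gcongr
      gcongr
      linarith
    refine lt_of_le_of_lt h10 ?_
    have h11 : (0 : ℤ) ≤ e * Q := by positivity
    have h12 : (0 : ℤ) ≤ (g : ℤ) ^ 2 := by positivity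
    rw [hcz] at hQ' ⊢
    nlinarith

variable {F O K : Type*} [Field F] [CommRing O] [IsDedekindDomain O] [Field K] [Algebra O K]
  [IsFractionRing O K] [Algebra F O] [Algebra F K] [IsScalarTower F O K] {n g : ℕ} {x : O}
  (D : PoleFiltration F O K n g x)

/-- Stepanov's method in the form of Bombieri: the number of homomorphisms satisfying `e`
Frobenius relations. -/
theorem card_algHom_le_stepanov (hn : 0 < n) {P : Ideal O} (hP : Prime P) (hP1 : P.codim F = 1)
    (p : ℕ) [Fact p.Prime] [CharP F p] (ν e : ℕ)
    (hQ : g * ((e + 1) * g + e ^ 2 + 1) + e * ((e + 1) * g + e ^ 2 + 1 + n) + g < p ^ ν)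
    (L : ∀ m, Fin e → (D.P m →ₗ[F] O)) (hL : ∀ (m : ℕ) i s, L m i s ∈ D.regular m)
    {E : Type*} [Field E] [Algebra F E] (S : Finset (O →ₐ[F] E))
    (hS : ∀ φ ∈ S, ∃ κ : Fin e → E, ∀ m (s : D.P m),
      φ s ^ ((p ^ ν) * (p ^ ν)) = ∑ i, κ i * φ (L m i s)) :
    S.card ≤ e * (p ^ ν) ^ 2 + ((e + 1) * g + e ^ 2 + 2) * p ^ ν := by
  obtain ⟨A, m, hA, hb, hlt⟩ := stepanov_parameters hn hQ
  set Q := p ^ ν with hQdef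
  obtain ⟨s, v, hs, hv, hind⟩ := D.exists_independent_mul_pow hn hP hP1 hA
  obtain ⟨hf1, hf2⟩ := D.finite_regular hn (A * Q + m)
  have hfm : FiniteDimensional F (D.P m) := by
    have := (D.finite_regular hn m).1
    exact Submodule.finiteDimensional_of_le (D.P_le_regular m)
  let T : (s → D.P m) →ₗ[F] (Fin e → D.regular (A * Q + m : ℕ)) := LinearMap.pi fun i =>
    LinearMap.codRestrict _ (∑ k : s, LinearMap.mulLeft F (v k ^ Q) ∘ₗ L m i ∘ₗ LinearMap.proj k) (by
      intro σ
      rw [LinearMap.sum_apply]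
      refine sum_mem fun k _ => ?_
      have := D.mul_mem_regular (D.pow_mem_regular (hv k k.2) Q) (hL m i (σ k))
      rw [Nat.cast_add, Nat.cast_mul, mul_comm (A : ℤ)]
      exact this)
  have hker : LinearMap.ker T ≠ ⊥ := by
    refine LinearMap.ker_ne_bot_of_finrank_lt ?_
    rw [Module.finrank_pi_fintype, Module.finrank_pi_fintype]
    simp only [Finset.sum_const, Finset.card_univ, Fintype.card_fin, Fintype.card_coe, smul_eq_mul]
    refine lt_of_le_of_lt (Nat.mul_le_mul_left e hf2) ?_
    exact hlt _ _ ((D.P_finrank A).trans (Nat.add_le_add_right hs g)) (D.P_finrank m)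
  obtain ⟨σ, hσ, hσ0⟩ := Submodule.exists_mem_ne_zero_of_ne_bot hker
  let τ : ℕ → O := fun k => if h : k ∈ s then σ ⟨k, h⟩ else 0
  have hτ : ∀ k : s, τ k = σ k := fun k => by simp [τ]
  have hτm : ∀ k, τ k ∈ D.regular m := by
    intro k
    by_cases h : k ∈ s
    · simp only [τ, h, dif_pos]; exact D.P_le_regular m (σ ⟨k, h⟩).2
    · simp only [τ, h, dif_neg, not_false_iff]; exact zero_mem _
  have hG : ∑ k ∈ s, v k * τ k ^ Q ≠ 0 := by
    refine hind τ ?_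
    by_contra! h
    refine hσ0 (funext fun k => Subtype.ext ?_)
    rw [← hτ, h k k.2]
    rfl
  have hGmem : ∑ k ∈ s, v k * τ k ^ Q ∈ D.regular (A + Q * m) :=
    sum_mem fun k hk => D.mul_mem_regular (hv k hk) (D.pow_mem_regular (hτm k) Q)
  have hcard := D.card_algHom_le hG hGmem S fun φ hφ => by
    obtain ⟨κ, hκ⟩ := hS φ hφ
    have : CharP E p := charP_of_injective_algebraMap (algebraMap F E).injective p
    have hpow : (φ (∑ k ∈ s, v k * τ k ^ Q)) ^ Q = 0 := by
      rw [map_sum, sum_pow_char_pow, ← Finset.sum_coe_sort]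
      have h1 : ∀ k : s, φ (v k * τ k ^ Q) ^ p ^ ν =
          ∑ i, κ i * φ (v k ^ Q * L m i (σ k)) := by
        intro k
        rw [map_mul, map_pow, mul_pow, ← pow_mul, hτ, hκ, Finset.mul_sum]
        refine Finset.sum_congr rfl fun i _ => ?_
        rw [map_mul, map_pow]
        ring
      rw [Finset.sum_congr rfl fun k _ => h1 k, Finset.sum_comm]
      refine Finset.sum_eq_zero fun i _ => ?_
      rw [← Finset.mul_sum, ← map_sum]
      have h2 : ∑ k : s, v k ^ Q * L m i (σ k) = 0 := by
        have := congrArg Subtype.val (congrFun (LinearMap.mem_ker.1 hσ) i)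
        simpa [T] using this
      rw [h2, map_zero, mul_zero]
    exact pow_eq_zero_iff (pow_ne_zero _ (Fact.out : p.Prime).ne_zero) |>.1 hpow
  have : (S.card : ℤ) ≤ (n * (A + m * Q) : ℕ) := by
    push_cast
    convert hcard using 3
    ring
  exact (Nat.cast_le.1 this).trans hb

end PoleFiltration

end

section

namespace PoleFiltration

variable {F O K : Type*} [Field F] [CommRing O] [IsDedekindDomain O] [Field K] [Algebra O K]
  [IsFractionRing O K] [Algebra F O] [Algebra F K] [IsScalarTower F O K] {n g : ℕ} {x : O}
  (D : PoleFiltration F O K n g x)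

include D in
theorem prime_ker_algHom (φ : O →ₐ[F] F) :
    Prime (RingHom.ker φ) ∧ (RingHom.ker φ).codim F = 1 := by
  have hne : RingHom.ker φ ≠ ⊥ := by
    intro h
    refine (D.trace_sub (φ x)).1 ?_
    rw [← Ideal.mem_bot, ← h, RingHom.mem_ker, map_sub, AlgHom.commutes]
    simp
  refine ⟨Ideal.prime_of_isPrime hne (RingHom.ker_isPrime _), ?_⟩
  have hs : Function.Surjective φ := fun c => ⟨algebraMap F O c, by simp⟩
  have := (Ideal.quotientKerAlgEquivOfSurjective hs).toLinearEquiv.finrank_eq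
  rw [Module.finrank_self] at this
  exact this

include D in
/-- The upper bound for the number of rational points over a field of square order. -/
theorem card_algHom_le_of_card [Finite F] (hn : 0 < n) (p : ℕ) [Fact p.Prime] [CharP F p] (ν : ℕ)
    (hF : Nat.card F = p ^ ν * p ^ ν)
    (hQ : g * (2 * g + 2) + (2 * g + 2 + n) + g < p ^ ν) (S : Finset (O →ₐ[F] F)) :
    S.card ≤ (p ^ ν) ^ 2 + (2 * g + 3) * p ^ ν := by
  rcases S.eq_empty_or_nonempty with rfl | ⟨φ, -⟩
  · simp
  obtain ⟨hP, hP1⟩ := D.prime_ker_algHom φ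
  have := D.card_algHom_le_stepanov hn hP hP1 p ν 1 (by simpa [two_mul, add_assoc] using hQ)
    (fun m _ => (D.P m).subtype) (fun m _ s => D.P_le_regular m s.2) S
    (fun χ _ => ⟨fun _ => 1, fun m s => by
      have := Fintype.ofFinite F
      rw [← hF, Nat.card_eq_fintype_card, FiniteField.pow_card]
      simp⟩)
  simpa [two_mul, add_assoc] using this

end PoleFiltration

end

section

open Polynomial nonZeroDivisors

theorem Polynomial.aevalAeval_eq_eval_map {F E : Type*} [Field F] [Field E] [Algebra F E] (X Y : E)
    (G : F[X][X]) : aevalAeval X Y G = (G.map (aeval (R := F) X).toRingHom).eval Y := by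
  rw [eval_map, ← coe_eval₂RingHom, ← AlgHom.coe_toRingHom]
  congr 1
  refine Polynomial.ringHom_ext (fun a => ?_) ?_
  · rw [coe_eval₂RingHom, eval₂_C]
    simp
  · rw [coe_eval₂RingHom, eval₂_X]
    simp

/-- A presentation of a Dedekind domain as the integral closure of `F[X]` in the function field
of the curve `H = 0`. -/
structure CurveModel (F O K : Type*) [Field F] [Field K] [Algebra (RatFunc F) K] [Algebra F[X] K]
    [CommRing O] [Algebra F[X] O] [Algebra O K] (H : F[X][X]) (n w : ℕ) where
  pos : 0 < n
  b : Module.Basis (Fin n) (RatFunc F) K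
  y : O
  basis_eq : ∀ i : Fin n, b i = (algebraMap O K y) ^ (i : ℕ)
  monic : H.Monic
  natDegree_eq : H.natDegree = n
  weight : ∀ i, (H.coeff i).natDegree ≤ w * (n - i)
  aeval_eq_zero : aeval y H = 0
  finrank_eq : Module.finrank F[X] O = n
  cast_ne_zero : (n : F) ≠ 0

namespace CurveModel

variable {F K O : Type*} [Field F] [Field K] [Algebra (RatFunc F) K] [Algebra F K]
  [IsScalarTower F (RatFunc F) K] [Algebra F[X] K] [IsScalarTower F[X] (RatFunc F) K]
  [CommRing O] [IsDedekindDomain O] [Algebra F[X] O] [Algebra F O] [IsScalarTower F F[X] O]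
  [Algebra O K] [IsScalarTower F[X] O K] [IsScalarTower F O K] [Module.Finite F[X] O]
  [Module.Free F[X] O] [FaithfulSMul F[X] O] [IsFractionRing O K] [IsIntegralClosure O F[X] K]
  [Algebra.IsSeparable (RatFunc F) K]
  [IsLocalization (Algebra.algebraMapSubmonoid O F[X]⁰) K]
  {n w : ℕ} {H : F[X][X]} (M : CurveModel F O K H n w)

include M

/-- The pole filtration of a curve model. -/
noncomputable def filtration [Finite F] :
    PoleFiltration F O K n (w * n ^ 2) (algebraMap F[X] O X) :=
  curveFiltration M.b M.pos M.basis_eq M.monic M.natDegree_eq M.weight M.aeval_eq_zero M.finrank_eq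

theorem algHom_aeval {E : Type*} [Field E] [Algebra F E] (φ : O →ₐ[F] E) (G : F[X][X]) :
    φ (aeval M.y G) = aevalAeval (φ (algebraMap F[X] O X)) (φ M.y) G := by
  suffices h : φ.toRingHom.comp (aeval M.y : F[X][X] →ₐ[F[X]] O).toRingHom =
      (aevalAeval (φ (algebraMap F[X] O X)) (φ M.y) : F[X][X] →ₐ[F] E).toRingHom from
    congrArg (fun f : F[X][X] →+* E => f G) h
  refine Polynomial.ringHom_ext' (Polynomial.ringHom_ext (fun a => ?_) ?_) ?_
  · have : algebraMap F[X] O (C a) = algebraMap F O a := by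
      rw [IsScalarTower.algebraMap_apply F F[X] O]; rfl
    simp [this]
  · simp
  · simp

theorem aeval_mem_poleLE (G : F[X][X]) (j : ℕ)
    (hG : ∀ i, G.coeff i ≠ 0 → (G.coeff i).natDegree + w * i ≤ j) :
    algebraMap O K (aeval M.y G) ∈ poleLE M.b w j := by
  have hy' : aeval (algebraMap O K M.y) H = 0 := by
    rw [aeval_algebraMap_apply, M.aeval_eq_zero, map_zero]
  rw [aeval_eq_sum_range, map_sum]
  refine sum_mem fun i _ => ?_
  by_cases h0 : G.coeff i = 0
  · simp [h0]
  have h1 := pow_root_mul_mem_poleLE M.b M.basis_eq M.monic M.natDegree_eq M.weight hy' i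
    (one_mem_poleLE M.b (w := w) M.basis_eq M.pos)
  have h2 := smul_mem_poleLE M.b (RatFunc.algebraMap_mem_degLE.2
    (Or.inr le_rfl : G.coeff i = 0 ∨ ((G.coeff i).natDegree : ℤ) ≤ _)) h1
  rw [mul_one] at h2
  rw [Algebra.smul_def, map_mul, ← IsScalarTower.algebraMap_apply, map_pow,
    IsScalarTower.algebraMap_apply F[X] (RatFunc F) K, ← Algebra.smul_def]
  refine poleLE_mono M.b ?_ h2
  have := hG i h0
  zify at this
  linarith

theorem sum_pow_eq_zero (c : Fin n → F[X]) (h : ∑ i, c i • M.y ^ (i : ℕ) = 0) (i : Fin n) :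
    c i = 0 := by
  have h2 : ∑ i, algebraMap F[X] (RatFunc F) (c i) • M.b i = 0 := by
    rw [← map_zero (algebraMap O K), ← h, map_sum]
    refine Finset.sum_congr rfl fun i _ => ?_
    rw [M.basis_eq, ← map_pow, algebraMap_smul, Algebra.smul_def, Algebra.smul_def, map_mul,
      ← IsScalarTower.algebraMap_apply]
  have h3 := congrFun (Module.Basis.repr_sum_self M.b fun i => algebraMap F[X] (RatFunc F) (c i)) i
  rw [h2, map_zero] at h3
  exact (map_eq_zero_iff _ (RatFunc.algebraMap_injective F)).1 h3.symm

theorem dvd_of_aeval_eq_zero {G : F[X][X]} (hG : aeval M.y G = 0) : H ∣ G := by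
  rw [← Polynomial.modByMonic_eq_zero_iff_dvd M.monic]
  have h1 : aeval M.y (G %ₘ H) = 0 := by
    rw [aeval_modByMonic_eq_self_of_root M.aeval_eq_zero, hG]
  have hne : H ≠ 1 := by
    intro h
    have := M.natDegree_eq
    rw [h, natDegree_one] at this
    exact M.pos.ne this
  have hdeg : (G %ₘ H).natDegree < n := by
    rw [← M.natDegree_eq]
    exact natDegree_modByMonic_lt G M.monic hne
  rw [aeval_eq_sum_range' hdeg, Finset.sum_range] at h1
  ext1 i
  rw [coeff_zero]
  by_cases hi : i < n
  · exact M.sum_pow_eq_zero _ h1 ⟨i, hi⟩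
  · exact coeff_eq_zero_of_natDegree_lt (by omega)

theorem derivative_aeval_ne_zero : aeval M.y (derivative H) ≠ 0 := by
  intro h
  have h1 := M.dvd_of_aeval_eq_zero h
  have h0 : derivative H ≠ 0 := by
    intro h0
    have := congrArg (fun p => coeff p (n - 1)) h0
    simp only [coeff_derivative, coeff_zero] at this
    rw [Nat.sub_add_cancel M.pos, ← M.natDegree_eq, coeff_natDegree, M.monic.leadingCoeff,
      M.natDegree_eq] at this
    have h2 : ((n - 1 : ℕ) : F[X]) + 1 = C (n : F) := by
      rw [← Nat.cast_succ, Nat.succ_eq_add_one, Nat.sub_add_cancel M.pos, map_natCast]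
    rw [one_mul, h2, C_eq_zero] at this
    exact M.cast_ne_zero this
  have h2 := natDegree_le_of_dvd h1 h0
  have h3 := natDegree_derivative_le H
  have := M.pos
  rw [M.natDegree_eq] at h2 h3
  omega

theorem minpoly_eq : minpoly F[X] M.y = H := by
  have hint : IsIntegral F[X] M.y := ⟨H, M.monic, M.aeval_eq_zero⟩
  refine eq_of_monic_of_associated (minpoly.monic hint) M.monic (associated_of_dvd_dvd ?_ ?_)
  · exact minpoly.isIntegrallyClosed_dvd hint M.aeval_eq_zero
  · exact M.dvd_of_aeval_eq_zero (minpoly.aeval _ _)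

theorem exists_derivative_mul_eq (o : O) :
    ∃ G : F[X][X], aeval M.y (derivative H) * o = aeval M.y G := by
  have : FiniteDimensional (RatFunc F) K := Module.Finite.of_basis M.b
  have hx : Algebra.adjoin (RatFunc F) {algebraMap O K M.y} = ⊤ := by
    rw [eq_top_iff]
    intro a _
    rw [← M.b.sum_repr a]
    refine sum_mem fun i _ => Subalgebra.smul_mem _ ?_ _
    rw [M.basis_eq]
    exact pow_mem (Algebra.self_mem_adjoin_singleton _ _) _
  have h1 := conductor_mul_differentIdeal F[X] (RatFunc F) K M.y hx
  have h2 : aeval M.y (derivative (minpoly F[X] M.y)) ∈ conductor F[X] M.y := by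
    refine SetLike.le_def.mp ?_ (Ideal.mem_span_singleton_self _)
    rw [← h1]
    exact Ideal.mul_le_left
  rw [M.minpoly_eq] at h2
  have h3 := h2 o
  rw [Algebra.adjoin_singleton_eq_range_aeval] at h3
  obtain ⟨G, hG⟩ := h3
  exact ⟨G, hG.symm⟩

end CurveModel

end

section

open Polynomial nonZeroDivisors

namespace CurveModel

variable {F K O : Type*} [Field F] [Field K] [Algebra (RatFunc F) K] [Algebra F K]
  [IsScalarTower F (RatFunc F) K] [Algebra F[X] K] [IsScalarTower F[X] (RatFunc F) K]
  [CommRing O] [IsDedekindDomain O] [Algebra F[X] O] [Algebra F O] [IsScalarTower F F[X] O]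
  [Algebra O K] [IsScalarTower F[X] O K] [IsScalarTower F O K] [Module.Finite F[X] O]
  [Module.Free F[X] O] [FaithfulSMul F[X] O] [IsFractionRing O K] [IsIntegralClosure O F[X] K]
  [Algebra.IsSeparable (RatFunc F) K]
  [IsLocalization (Algebra.algebraMapSubmonoid O F[X]⁰) K]
  {n w : ℕ} {H : F[X][X]} (M : CurveModel F O K H n w)

include M

theorem derivative_mem_poleLE :
    algebraMap O K (aeval M.y (derivative H)) ∈ poleLE M.b w (w * (n - 1) : ℕ) := by
  refine M.aeval_mem_poleLE _ _ fun i hi => ?_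
  have h0 : H.coeff (i + 1) ≠ 0 := by
    intro h
    rw [coeff_derivative, h, zero_mul] at hi
    exact hi rfl
  have h1 : i + 1 ≤ n := by
    rw [← M.natDegree_eq]
    exact le_natDegree_of_ne_zero h0
  have h2 := M.weight (i + 1)
  have h3 : (coeff (derivative H) i).natDegree ≤ (H.coeff (i + 1)).natDegree := by
    rw [coeff_derivative]
    have : ((i : F[X]) + 1) = C ((i : F) + 1) := by simp
    rw [this]
    exact natDegree_mul_C_le _ _
  calc _ ≤ w * (n - (i + 1)) + w * i := by omega
    _ = w * (n - 1) := by rw [← mul_add]; congr 1; omega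

theorem exists_conductor : ∃ N : F[X], N ≠ 0 ∧ N.natDegree ≤ n * (w * (n - 1)) ∧
    ∃ r : F[X][X], algebraMap F[X] O N = aeval M.y (derivative H * r) := by
  have hy' : aeval (algebraMap O K M.y) H = 0 := by
    rw [aeval_algebraMap_apply, M.aeval_eq_zero, map_zero]
  have h1 := norm_mem_degLE M.b M.basis_eq M.monic M.natDegree_eq M.weight hy'
    M.derivative_mem_poleLE
  rw [Algebra.norm_localization F[X] F[X]⁰, RatFunc.algebraMap_mem_degLE] at h1
  have hN0 := Algebra.norm_ne_zero_iff (R := F[X]).2 M.derivative_aeval_ne_zero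
  refine ⟨_, hN0, by exact_mod_cast h1.resolve_left hN0, ?_⟩
  set v := aeval M.y (derivative H) with hv
  set χ := LinearMap.charpoly (LinearMap.mulLeft F[X] v) with hχ
  have h2 : aeval v χ = 0 := by
    have h3 := LinearMap.aeval_self_charpoly (LinearMap.mulLeft F[X] v)
    have h4 : aeval (LinearMap.mulLeft F[X] v) χ = LinearMap.mulLeft F[X] (aeval v χ) :=
      aeval_algHom_apply (Algebra.lmul F[X] O) v χ
    rw [h4] at h3
    simpa using congrArg (fun f => f 1) h3
  have h3 : Algebra.norm F[X] v = (-1) ^ (Module.finrank F[X] O) * χ.coeff 0 :=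
    LinearMap.det_eq_sign_charpoly_coeff _
  have h4 : algebraMap F[X] O (χ.coeff 0) = - (v * aeval v χ.divX) := by
    have := congrArg (aeval v) (divX_mul_X_add χ)
    rw [h2, map_add, map_mul, aeval_X, aeval_C] at this
    linear_combination this
  refine ⟨(-1) ^ (Module.finrank F[X] O + 1) * aeval (derivative H) χ.divX, ?_⟩
  rw [h3, map_mul, h4, map_mul, map_mul, ← hv, map_pow, map_pow, map_neg, map_one, map_neg,
    map_one, ← aeval_algHom_apply]
  ring

theorem aeval_conductor_eq_zero {N : F[X]} {r : F[X][X]}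
    (hN : algebraMap F[X] O N = aeval M.y (derivative H * r)) {E : Type*} [Field E] [Algebra F E]
    {X Y : E} (h : aevalAeval X Y H = 0) (h' : aevalAeval X Y (derivative H) = 0) :
    aeval X N = 0 := by
  have h1 : aeval M.y (C N - derivative H * r) = 0 := by rw [map_sub, aeval_C, hN, sub_self]
  obtain ⟨G, hG⟩ := M.dvd_of_aeval_eq_zero h1
  have := congrArg (aevalAeval X Y) hG
  rw [map_sub, map_mul, map_mul, h, h', zero_mul, zero_mul, sub_zero, aevalAeval_C] at this
  exact this

variable {E : Type*} [Field E] [Algebra F E]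

theorem aevalAeval_eq_of_aeval_eq {X Y : E} (h : aevalAeval X Y H = 0) {A B : F[X][X]}
    (hAB : aeval M.y A = aeval M.y B) : aevalAeval X Y A = aevalAeval X Y B := by
  have h1 : aeval M.y (A - B) = 0 := by rw [map_sub, hAB, sub_self]
  obtain ⟨G, hG⟩ := M.dvd_of_aeval_eq_zero h1
  have := congrArg (aevalAeval X Y) hG
  rwa [map_sub, map_mul, h, zero_mul, sub_eq_zero] at this

theorem exists_algHom {X Y : E} (h : aevalAeval X Y H = 0)
    (h' : aevalAeval X Y (derivative H) ≠ 0) :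
    ∃ φ : O →ₐ[F] E, φ (algebraMap F[X] O Polynomial.X) = X ∧ φ M.y = Y := by
  choose G hG using M.exists_derivative_mul_eq
  have key : ∀ o A, aeval M.y (derivative H) * o = aeval M.y A →
      aevalAeval X Y (G o) = aevalAeval X Y A := fun o A hA =>
    M.aevalAeval_eq_of_aeval_eq h ((hG o).symm.trans hA)
  have key2 : ∀ A, aevalAeval X Y (G (aeval M.y A)) / aevalAeval X Y (derivative H) =
      aevalAeval X Y A := fun A => by
    rw [key (aeval M.y A) (derivative H * A) (by rw [map_mul]), map_mul, mul_div_cancel_left₀ _ h']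
  let f : O →+* E :=
    { toFun := fun o => aevalAeval X Y (G o) / aevalAeval X Y (derivative H)
      map_one' := by
        have := key2 1
        rwa [map_one, map_one] at this
      map_zero' := by
        have := key2 0
        rwa [map_zero, map_zero] at this
      map_add' := fun o o' => by
        rw [key (o + o') (G o + G o') (by rw [mul_add, map_add, hG, hG]), map_add, add_div]
      map_mul' := fun o o' => by
        have h1 := M.aevalAeval_eq_of_aeval_eq h (A := derivative H * G (o * o')) (B := G o * G o')
          (by rw [map_mul, map_mul, ← hG, ← hG, ← hG]; ring)
        rw [map_mul, map_mul] at h1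
        rw [div_mul_div_comm, ← h1, mul_div_mul_left _ _ h'] }
  have hf : ∀ A, f (aeval M.y A) = aevalAeval X Y A := key2
  have hC : ∀ a : F[X], f (algebraMap F[X] O a) = aeval X a := fun a => by
    rw [← aeval_C (R := F[X]) M.y a, hf, aevalAeval_C]
  refine ⟨{ f with commutes' := fun a => ?_ }, ?_, ?_⟩
  · have := hC (C a)
    rw [aeval_C] at this
    rw [IsScalarTower.algebraMap_apply F F[X] O]
    exact this
  · exact (hC _).trans (aeval_X _)
  · have := hf Polynomial.X
    rw [aeval_X, aevalAeval_Y] at this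
    exact this

theorem algHom_ext {φ φ' : O →ₐ[F] E}
    (hx : φ (algebraMap F[X] O X) = φ' (algebraMap F[X] O X)) (hy : φ M.y = φ' M.y)
    (h : φ (aeval M.y (derivative H)) ≠ 0) : φ = φ' := by
  ext o
  obtain ⟨G, hG⟩ := M.exists_derivative_mul_eq o
  have h1 := congrArg φ hG
  have h2 := congrArg φ' hG
  rw [map_mul, M.algHom_aeval] at h1 h2
  rw [M.algHom_aeval] at h
  rw [M.algHom_aeval, ← hx, ← hy] at h2
  rw [M.algHom_aeval] at h1
  exact mul_left_cancel₀ h (h1.trans h2.symm)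

theorem aevalAeval_algHom (φ : O →ₐ[F] E) :
    aevalAeval (φ (algebraMap F[X] O X)) (φ M.y) H = 0 := by
  rw [← M.algHom_aeval, M.aeval_eq_zero, map_zero]

theorem finite_algHom [Finite E] : Finite (O →ₐ[F] E) := by
  have : Algebra.FiniteType F O := Algebra.FiniteType.trans (S := F[X]) inferInstance inferInstance
  obtain ⟨s, hs⟩ := this.out
  refine Finite.of_injective (fun (φ : O →ₐ[F] E) (a : s) => φ a) fun φ φ' h => ?_
  refine AlgHom.ext_of_adjoin_eq_top hs fun a ha => ?_
  exact congrFun h ⟨a, ha⟩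

/-- The fibre of the curve over a point of the line. -/
theorem map_fibre (X : E) : (H.map (aeval (R := F) X).toRingHom).Monic ∧
    (H.map (aeval (R := F) X).toRingHom).natDegree = n :=
  ⟨M.monic.map _, by rw [M.monic.natDegree_map, M.natDegree_eq]⟩

end CurveModel

end

section

open Polynomial nonZeroDivisors

section DividedDifferences

variable {R S : Type*} [CommRing R] [CommRing S]

theorem Polynomial.coeff_iterate_divX (P : R[X]) (k j : ℕ) :
    (divX^[k] P).coeff j = P.coeff (j + k) := by
  induction k generalizing j with
  | zero => rfl
  | succ k ih =>
    rw [Function.iterate_succ_apply', coeff_divX, ih]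
    congr 1
    ring

theorem Polynomial.sum_iterate_divX_mul (f : R →+* S) (Y T : S) (N : ℕ) (P : R[X])
    (hP : P.natDegree ≤ N) :
    (∑ i ∈ Finset.range N, eval₂ f Y (divX^[i + 1] P) * T ^ i) * (T - Y) =
      eval₂ f T P - eval₂ f Y P := by
  induction N generalizing P with
  | zero =>
    rw [eq_C_of_natDegree_le_zero hP]
    simp
  | succ N ih =>
    have h1 := ih P.divX (by rw [natDegree_divX_eq_natDegree_tsub_one]; omega)
    simp only [← Function.iterate_succ_apply] at h1
    have h2 : ∀ Z, eval₂ f Z P = eval₂ f Z P.divX * Z + f (P.coeff 0) := fun Z => by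
      conv_lhs => rw [← divX_mul_X_add P]
      simp
    rw [Finset.sum_range_succ', h2, h2 Y, add_mul]
    have h3 : ∑ i ∈ Finset.range N, eval₂ f Y (divX^[i + 1 + 1] P) * T ^ (i + 1) =
        (∑ i ∈ Finset.range N, eval₂ f Y (divX^[i + 1 + 1] P) * T ^ i) * T := by
      rw [Finset.sum_mul]
      exact Finset.sum_congr rfl fun i _ => by ring
    have h4 : (divX^[0 + 1] P) = P.divX := rfl
    rw [h3, h4]
    simp only [Nat.succ_eq_add_one] at h1
    linear_combination T * h1

theorem Polynomial.iterate_divX_natDegree {P : R[X]} (hP : P.Monic) : divX^[P.natDegree] P = 1 := by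
  ext j
  rw [coeff_iterate_divX, coeff_one]
  split_ifs with h
  · rw [h, zero_add, coeff_natDegree, hP.leadingCoeff]
  · exact coeff_eq_zero_of_natDegree_lt (by omega)

end DividedDifferences

theorem norm_sum_le_card {ι : Type*} (s : Finset ι) {f : ι → ℂ} (hf : ∀ i, ‖f i‖ ≤ 1) :
    ‖∑ i ∈ s, f i‖ ≤ s.card := by
  refine (norm_sum_le _ _).trans ((Finset.sum_le_card_nsmul _ _ 1 fun i _ => hf _).trans ?_)
  simp

open Classical in
/-- The points of the plane curve `H = 0` with coordinates in `E`. -/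
noncomputable def curvePoints {F : Type*} [Field F] (H : F[X][X]) (E : Type*) [Field E] [Algebra F E]
    [Fintype E] : Finset (E × E) := {z | aevalAeval z.1 z.2 H = 0}

theorem mem_curvePoints {F : Type*} [Field F] {H : F[X][X]} {E : Type*} [Field E] [Algebra F E]
    [Fintype E] {z : E × E} : z ∈ curvePoints H E ↔ aevalAeval z.1 z.2 H = 0 := by
  classical
  simp [curvePoints]

namespace CurveModel

variable {F K O : Type*} [Field F] [Field K] [Algebra (RatFunc F) K] [Algebra F K]
  [IsScalarTower F (RatFunc F) K] [Algebra F[X] K] [IsScalarTower F[X] (RatFunc F) K]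
  [CommRing O] [IsDedekindDomain O] [Algebra F[X] O] [Algebra F O] [IsScalarTower F F[X] O]
  [Algebra O K] [IsScalarTower F[X] O K] [IsScalarTower F O K] [Module.Finite F[X] O]
  [Module.Free F[X] O] [FaithfulSMul F[X] O] [IsFractionRing O K] [IsIntegralClosure O F[X] K]
  [Algebra.IsSeparable (RatFunc F) K]
  [IsLocalization (Algebra.algebraMapSubmonoid O F[X]⁰) K]
  {n w : ℕ} {H : F[X][X]} (M : CurveModel F O K H n w)

include M

theorem card_singular_le {E : Type*} [Field E] [Algebra F E] [Fintype E] (s : Finset (E × E))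
    (hs : ∀ z ∈ s, aevalAeval z.1 z.2 H = 0 ∧ aevalAeval z.1 z.2 (derivative H) = 0) :
    s.card ≤ n * (w * (n - 1)) * n := by
  classical
  obtain ⟨N, hN0, hNd, r, hN⟩ := M.exists_conductor
  have h1 : s ⊆ (N.aroots E).toFinset.biUnion fun X =>
      ((H.map (aeval (R := F) X).toRingHom).roots.toFinset).image (Prod.mk X) := by
    intro z hz
    obtain ⟨h, h'⟩ := hs z hz
    have h2 := M.aeval_conductor_eq_zero hN h h'
    rw [Finset.mem_biUnion]
    refine ⟨z.1, ?_, Finset.mem_image.2 ⟨z.2, ?_, rfl⟩⟩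
    · rw [Multiset.mem_toFinset, mem_aroots]
      exact ⟨hN0, h2⟩
    · rw [Multiset.mem_toFinset, mem_roots (M.map_fibre z.1).1.ne_zero, IsRoot,
        ← aevalAeval_eq_eval_map]
      exact h
  refine (Finset.card_le_card h1).trans ((Finset.card_biUnion_le_card_mul _ _ n ?_).trans ?_)
  · intro X _
    refine Finset.card_image_le.trans ((Multiset.toFinset_card_le _).trans ?_)
    exact (card_roots' _).trans (M.map_fibre X).2.le
  · refine Nat.mul_le_mul_right n (((Multiset.toFinset_card_le _).trans (card_roots' _)).trans ?_)
    exact natDegree_map_le.trans hNd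

theorem norm_sum_algHom_sub_le [Finite F] {E : Type*} [Field E] [Algebra F E] [Fintype E]
    [Fintype (O →ₐ[F] E)] (f : E → ℂ) (hf : ∀ a, ‖f a‖ ≤ 1) :
    ‖∑ φ : O →ₐ[F] E, f (φ (algebraMap F[X] O Polynomial.X)) - ∑ z ∈ curvePoints H E, f z.1‖ ≤
      w * n ^ 3 := by
  classical
  set A := (Finset.univ : Finset (O →ₐ[F] E)) with hA
  set u := aeval M.y (derivative H)
  set A0 := A.filter fun φ => φ u ≠ 0 with hA0
  set A1 := A.filter fun φ => ¬ φ u ≠ 0 with hA1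
  set B0 := (curvePoints H E).filter fun z => aevalAeval z.1 z.2 (derivative H) ≠ 0 with hB0
  set B1 := (curvePoints H E).filter fun z => ¬ aevalAeval z.1 z.2 (derivative H) ≠ 0 with hB1
  have h0 : ∑ φ ∈ A0, f (φ (algebraMap F[X] O Polynomial.X)) = ∑ z ∈ B0, f z.1 := by
    refine Finset.sum_bij (fun φ _ => (φ (algebraMap F[X] O Polynomial.X), φ M.y)) ?_ ?_ ?_ ?_
    · intro φ hφ
      rw [hB0, Finset.mem_filter, mem_curvePoints]
      refine ⟨M.aevalAeval_algHom φ, ?_⟩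
      rw [← M.algHom_aeval]
      exact (Finset.mem_filter.1 hφ).2
    · intro φ hφ φ' _ h
      exact M.algHom_ext (congrArg Prod.fst h) (congrArg Prod.snd h) (Finset.mem_filter.1 hφ).2
    · intro z hz
      obtain ⟨hz1, hz2⟩ := Finset.mem_filter.1 hz
      obtain ⟨φ, hφ1, hφ2⟩ := M.exists_algHom (mem_curvePoints.1 hz1) hz2
      refine ⟨φ, Finset.mem_filter.2 ⟨Finset.mem_univ _, ?_⟩, Prod.ext hφ1 hφ2⟩
      rw [M.algHom_aeval, hφ1, hφ2]
      exact hz2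
    · intro φ _
      rfl
  have h1 : A1.card ≤ n * (w * (n - 1)) := by
    have := M.filtration.card_algHom_le M.derivative_aeval_ne_zero M.derivative_mem_poleLE A1
      (fun φ hφ => not_not.1 (Finset.mem_filter.1 hφ).2)
    exact_mod_cast this
  have h2 : B1.card ≤ n * (w * (n - 1)) * n := M.card_singular_le B1 fun z hz =>
    ⟨mem_curvePoints.1 (Finset.mem_filter.1 hz).1, not_not.1 (Finset.mem_filter.1 hz).2⟩
  rw [← Finset.sum_filter_add_sum_filter_not A fun φ => φ u ≠ 0,
    ← Finset.sum_filter_add_sum_filter_not (curvePoints H E)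
      fun z => aevalAeval z.1 z.2 (derivative H) ≠ 0, ← hA0, ← hB0, ← hA1, ← hB1, h0,
    add_sub_add_left_eq_sub]
  refine (norm_sub_le _ _).trans ((add_le_add (norm_sum_le_card A1 fun _ => hf _)
    (norm_sum_le_card B1 fun _ => hf _)).trans ?_)
  have h3 : A1.card + B1.card ≤ w * n ^ 3 := by
    obtain ⟨m, rfl⟩ : ∃ m, n = m + 1 := ⟨n - 1, by have := M.pos; omega⟩
    simp only [Nat.add_sub_cancel] at h1 h2
    calc _ ≤ _ := add_le_add h1 h2
      _ ≤ w * (m + 1) ^ 3 := by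
        have : (m + 1) * (w * m) + (m + 1) * (w * m) * (m + 1) = w * (m * (m + 1) * (m + 2)) := by ring
        rw [this]
        gcongr
        nlinarith
  exact_mod_cast h3

end CurveModel

end

section

open Polynomial nonZeroDivisors

namespace CurveModel

variable {F K O : Type*} [Field F] [Field K] [Algebra (RatFunc F) K] [Algebra F K]
  [IsScalarTower F (RatFunc F) K] [Algebra F[X] K] [IsScalarTower F[X] (RatFunc F) K]
  [CommRing O] [IsDedekindDomain O] [Algebra F[X] O] [Algebra F O] [IsScalarTower F F[X] O]
  [Algebra O K] [IsScalarTower F[X] O K] [IsScalarTower F O K] [Module.Finite F[X] O]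
  [Module.Free F[X] O] [FaithfulSMul F[X] O] [IsFractionRing O K] [IsIntegralClosure O F[X] K]
  [Algebra.IsSeparable (RatFunc F) K]
  [IsLocalization (Algebra.algebraMapSubmonoid O F[X]⁰) K]
  {n w : ℕ} {H : F[X][X]} (M : CurveModel F O K H n w)

include M

theorem iterate_divX_mem_poleLE (i : ℕ) (hi : i < n) :
    algebraMap O K (aeval M.y (divX^[i + 1] H)) ∈ poleLE M.b w (w * (n - 1 - i) : ℕ) := by
  refine M.aeval_mem_poleLE _ _ fun j hj => ?_
  rw [coeff_iterate_divX] at hj ⊢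
  have h1 : j + (i + 1) ≤ n := by
    rw [← M.natDegree_eq]
    exact le_natDegree_of_ne_zero hj
  calc _ ≤ w * (n - (j + (i + 1))) + w * j := by gcongr; exact M.weight _
    _ = w * (n - 1 - i) := by rw [← mul_add]; congr 1; omega

/-- The coordinates of the Frobenius twist of a weighted combination. -/
noncomputable def twistedCoord (m : ℕ) (i : Fin (n - 1)) :
    (∀ i : Fin n, degreeLT F (m + 1 - w * (i : ℕ))) →ₗ[F] O :=
  let c (k : Fin n) : (∀ i : Fin n, degreeLT F (m + 1 - w * (i : ℕ))) →ₗ[F] O :=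
    ((Algebra.linearMap F[X] O).restrictScalars F) ∘ₗ (degreeLT F _).subtype ∘ₗ LinearMap.proj k
  c ⟨i, by omega⟩ -
    LinearMap.mulRight F (aeval M.y (divX^[(i : ℕ) + 1] H)) ∘ₗ c ⟨n - 1, by have := i.2; omega⟩

theorem twistedCoord_apply (m : ℕ) (i : Fin (n - 1))
    (v : ∀ i : Fin n, degreeLT F (m + 1 - w * (i : ℕ))) :
    M.twistedCoord m i v = algebraMap F[X] O (v ⟨i, by omega⟩).1 -
      algebraMap F[X] O (v ⟨n - 1, by have := i.2; omega⟩).1 * aeval M.y (divX^[(i : ℕ) + 1] H) := rfl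

theorem twistedCoord_mem (m : ℕ) (i : Fin (n - 1))
    (v : ∀ i : Fin n, degreeLT F (m + 1 - w * (i : ℕ))) :
    algebraMap O K (M.twistedCoord m i v) ∈ poleLE M.b w m := by
  have hc : ∀ k : Fin n, algebraMap O K (algebraMap F[X] O (v k).1) ∈
      poleLE M.b w (m - w * (k : ℕ)) := by
    intro k
    rw [← IsScalarTower.algebraMap_apply, IsScalarTower.algebraMap_apply F[X] (RatFunc F) K]
    refine algebraMap_mem_poleLE M.b M.basis_eq M.pos (RatFunc.algebraMap_mem_degLE.2 ?_)
    by_cases h : (v k).1 = 0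
    · exact Or.inl h
    · have := mem_degreeLT.1 (v k).2
      rw [← natDegree_lt_iff_degree_lt h] at this
      right
      zify at this ⊢
      omega
  have hy' : aeval (algebraMap O K M.y) H = 0 := by
    rw [aeval_algebraMap_apply, M.aeval_eq_zero, map_zero]
  rw [twistedCoord_apply, map_sub, map_mul]
  refine sub_mem (poleLE_mono M.b ?_ (hc ⟨i, by omega⟩)) ?_
  · have : (0 : ℤ) ≤ w * (i : ℕ) := by positivity
    change (m : ℤ) - w * (i : ℕ) ≤ m
    linarith
  · refine poleLE_mono M.b ?_ (mul_mem_poleLE M.b M.basis_eq M.monic M.natDegree_eq M.weight hy'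
      (hc ⟨n - 1, by have := i.2; omega⟩) (M.iterate_divX_mem_poleLE i (by omega)))
    change (m : ℤ) - w * (n - 1 : ℕ) + (w * (n - 1 - (i : ℕ)) : ℕ) ≤ m
    have : w * (n - 1 - (i : ℕ)) ≤ w * (n - 1) := Nat.mul_le_mul_left _ (by omega)
    zify at this ⊢
    linarith

theorem frobenius_twist {Ω : Type*} [Field Ω] [Algebra F Ω] (p k : ℕ) [Fact p.Prime] [CharP Ω p]
    (hF : ∀ a : F, a ^ p ^ k = a) {φ : O →ₐ[F] Ω}
    (hx : φ (algebraMap F[X] O Polynomial.X) ^ p ^ k = φ (algebraMap F[X] O Polynomial.X))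
    (hy : φ M.y ^ p ^ k ≠ φ M.y) (m : ℕ)
    (v : ∀ i : Fin n, degreeLT F (m + 1 - w * (i : ℕ))) :
    φ (weightedComb F n w M.y m v) ^ p ^ k =
      ∑ i : Fin (n - 1), (φ M.y ^ p ^ k) ^ (i : ℕ) * φ (M.twistedCoord m i v) := by
  set x := φ (algebraMap F[X] O Polynomial.X) with hxdef
  set T := φ M.y ^ p ^ k with hT
  have hpoly : ∀ a : F[X], φ (algebraMap F[X] O a) ^ p ^ k = φ (algebraMap F[X] O a) := by
    intro a
    suffices h : ((iterateFrobenius Ω p k).comp φ.toRingHom).comp (algebraMap F[X] O) =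
        φ.toRingHom.comp (algebraMap F[X] O) from congrArg (fun f : F[X] →+* Ω => f a) h
    refine Polynomial.ringHom_ext (fun a => ?_) ?_
    · have : algebraMap F[X] O (C a) = algebraMap F O a := by
        rw [IsScalarTower.algebraMap_apply F F[X] O]; rfl
      change φ _ ^ p ^ k = φ _
      rw [this, AlgHom.commutes, ← map_pow, hF]
    · exact hx
  have hroot : aevalAeval x T H = 0 := by
    have h1 : ∀ G : F[X][X], aevalAeval x T G = (aevalAeval x (φ M.y) G) ^ p ^ k := by
      intro G
      suffices h : (aevalAeval x T : F[X][X] →ₐ[F] Ω).toRingHom =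
          (iterateFrobenius Ω p k).comp (aevalAeval x (φ M.y) : F[X][X] →ₐ[F] Ω).toRingHom from
        congrArg (fun f : F[X][X] →+* Ω => f G) h
      refine Polynomial.ringHom_ext' (Polynomial.ringHom_ext (fun a => ?_) ?_) ?_
      · simp [iterateFrobenius_def, ← map_pow, hF]
      · simp [iterateFrobenius_def, hx]
      · simp [iterateFrobenius_def, hT]
    rw [h1, M.aevalAeval_algHom, zero_pow (pow_ne_zero _ (Fact.out : p.Prime).ne_zero)]
  have hrel := Polynomial.sum_iterate_divX_mul (aeval (R := F) x).toRingHom (φ M.y) T n H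
    M.natDegree_eq.le
  have hev : ∀ (G : F[X][X]) Z, eval₂ (aeval (R := F) x).toRingHom Z G = aevalAeval x Z G := by
    intro G Z
    rw [aevalAeval_eq_eval_map, eval_map]
  simp only [hev] at hrel
  rw [hroot, M.aevalAeval_algHom, sub_zero] at hrel
  have hrel2 := (mul_eq_zero.1 hrel).resolve_right (sub_ne_zero.2 hy)
  obtain ⟨e, rfl⟩ : ∃ e, n = e + 1 := ⟨n - 1, by have := M.pos; omega⟩
  have h1 : divX^[e + 1] H = 1 := by
    rw [← M.natDegree_eq]
    exact iterate_divX_natDegree M.monic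
  rw [Finset.sum_range_succ, h1, map_one, one_mul, Finset.sum_range] at hrel2
  simp only [twistedCoord_apply, map_sub, map_mul, mul_sub, Finset.sum_sub_distrib]
  have hL : φ (weightedComb F (e + 1) w M.y m v) ^ p ^ k =
      ∑ i : Fin (e + 1), φ (algebraMap F[X] O (v i).1) * T ^ (i : ℕ) := by
    change φ (∑ i, (v i).1 • M.y ^ (i : ℕ)) ^ p ^ k = _
    rw [map_sum, sum_pow_char_pow]
    refine Finset.sum_congr rfl fun i _ => ?_
    rw [Algebra.smul_def, map_mul, mul_pow, hpoly, hT, map_pow]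
    ring
  rw [hL, Fin.sum_univ_castSucc]
  have h2 : ∀ i : Fin e, φ (aeval M.y (divX^[(i : ℕ) + 1] H)) =
      aevalAeval x (φ M.y) (divX^[(i : ℕ) + 1] H) := fun i => M.algHom_aeval φ _
  have h3 : T ^ e = -∑ i : Fin e, aevalAeval x (φ M.y) (divX^[(i : ℕ) + 1] H) * T ^ (i : ℕ) := by
    linear_combination hrel2
  have h4 : ∀ i : Fin (e + 1 - 1), T ^ (i : ℕ) * (φ (algebraMap F[X] O (v ⟨e + 1 - 1, by omega⟩).1) *
      φ (aeval M.y (divX^[(i : ℕ) + 1] H))) = φ (algebraMap F[X] O (v (Fin.last e)).1) *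
      (aevalAeval x (φ M.y) (divX^[(i : ℕ) + 1] H) * T ^ (i : ℕ)) := fun i => by
    rw [h2 i]
    change _ * (φ (algebraMap F[X] O (v (Fin.last e)).1) * _) = _
    ring
  have h5 : T ^ ((Fin.last e : Fin (e + 1)) : ℕ) = _ := h3
  rw [Finset.sum_congr rfl fun i _ => h4 i, ← Finset.mul_sum, h5, mul_neg, ← sub_eq_add_neg]
  congr 1
  exact Finset.sum_congr rfl fun i _ => mul_comm _ _

theorem card_algHom_le_of_frobenius_ne [Finite F] (p : ℕ) [Fact p.Prime] [CharP F p]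
    (φ₀ : O →ₐ[F] F) {Ω : Type*} [Field Ω] [Algebra F Ω] (ν : ℕ)
    (hQ : w * n ^ 2 * ((n - 1 + 1) * (w * n ^ 2) + (n - 1) ^ 2 + 1) +
      (n - 1) * ((n - 1 + 1) * (w * n ^ 2) + (n - 1) ^ 2 + 1 + n) + w * n ^ 2 < p ^ ν)
    (hF : ∀ a : F, a ^ (p ^ ν * p ^ ν) = a) (S : Finset (O →ₐ[F] Ω))
    (hS : ∀ φ ∈ S, φ (algebraMap F[X] O Polynomial.X) ^ (p ^ ν * p ^ ν) =
      φ (algebraMap F[X] O Polynomial.X) ∧ φ M.y ^ (p ^ ν * p ^ ν) ≠ φ M.y) :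
    S.card ≤ (n - 1) * (p ^ ν) ^ 2 + ((n - 1 + 1) * (w * n ^ 2) + (n - 1) ^ 2 + 2) * p ^ ν := by
  have : CharP Ω p := charP_of_injective_algebraMap (algebraMap F Ω).injective p
  obtain ⟨hP, hP1⟩ := M.filtration.prime_ker_algHom φ₀
  have hinj := weightedComb_injective M.b (w := w) M.basis_eq
  let e : ∀ m : ℕ, (∀ i : Fin n, degreeLT F (m + 1 - w * (i : ℕ))) ≃ₗ[F] M.filtration.P m :=
    fun m => LinearEquiv.ofInjective (weightedComb F n w M.y m) (hinj m)
  refine M.filtration.card_algHom_le_stepanov M.pos hP hP1 p ν (n - 1) hQ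
    (fun m i => M.twistedCoord m i ∘ₗ (e m).symm.toLinearMap)
    (fun m i s => M.twistedCoord_mem m i _) S fun φ hφ => ?_
  refine ⟨fun i => (φ M.y ^ (p ^ ν * p ^ ν)) ^ (i : ℕ), fun m s => ?_⟩
  obtain ⟨h1, h2⟩ := hS φ hφ
  obtain ⟨v, rfl⟩ := (e m).surjective s
  rw [← pow_add] at h1 h2 ⊢
  simp only [← pow_add] at hF
  have := M.frobenius_twist p (ν + ν) hF h1 h2 m v
  refine this.trans (Finset.sum_congr rfl fun i _ => ?_)
  change _ = _ * φ (M.twistedCoord m i ((e m).symm (e m v)))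
  rw [LinearEquiv.symm_apply_apply]

end CurveModel

end

section

open Polynomial nonZeroDivisors

theorem FiniteField.exists_algebraMap_eq_of_pow_card {E A : Type*} [Field E] [Fintype E] [Field A]
    [Algebra E A] {a : A} (h : a ^ Fintype.card E = a) : ∃ c : E, algebraMap E A c = a := by
  classical
  have h1 : (Finset.univ.image (algebraMap E A)) ⊆
      (X ^ Fintype.card E - X : A[X]).roots.toFinset := by
    intro b hb
    obtain ⟨c, -, rfl⟩ := Finset.mem_image.1 hb
    rw [Multiset.mem_toFinset, mem_roots (FiniteField.X_pow_card_sub_X_ne_zero _ Fintype.one_lt_card)]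
    simp [← map_pow, FiniteField.pow_card]
  have h2 := Finset.eq_of_subset_of_card_le h1 (by
    rw [Finset.card_image_of_injective _ (algebraMap E A).injective, Finset.card_univ]
    refine (Multiset.toFinset_card_le _).trans ((card_roots' _).trans ?_)
    rw [FiniteField.X_pow_card_sub_X_natDegree_eq _ Fintype.one_lt_card])
  have h3 : a ∈ (X ^ Fintype.card E - X : A[X]).roots.toFinset := by
    rw [Multiset.mem_toFinset, mem_roots (FiniteField.X_pow_card_sub_X_ne_zero _ Fintype.one_lt_card)]
    simp [h]
  rw [← h2] at h3
  obtain ⟨c, -, hc⟩ := Finset.mem_image.1 h3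
  exact ⟨c, hc⟩

namespace CurveModel

variable {F K O : Type*} [Field F] [Field K] [Algebra (RatFunc F) K] [Algebra F K]
  [IsScalarTower F (RatFunc F) K] [Algebra F[X] K] [IsScalarTower F[X] (RatFunc F) K]
  [CommRing O] [IsDedekindDomain O] [Algebra F[X] O] [Algebra F O] [IsScalarTower F F[X] O]
  [Algebra O K] [IsScalarTower F[X] O K] [IsScalarTower F O K] [Module.Finite F[X] O]
  [Module.Free F[X] O] [FaithfulSMul F[X] O] [IsFractionRing O K] [IsIntegralClosure O F[X] K]
  [Algebra.IsSeparable (RatFunc F) K]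
  [IsLocalization (Algebra.algebraMapSubmonoid O F[X]⁰) K]
  {n w : ℕ} {H : F[X][X]} (M : CurveModel F O K H n w)

include M

theorem card_fibre_roots {Ω : Type*} [Field Ω] [IsAlgClosed Ω] [DecidableEq Ω] [Algebra F Ω] {X : Ω}
    (h : ∀ Y, aevalAeval X Y H = 0 → aevalAeval X Y (derivative H) ≠ 0) :
    ((H.map (aeval (R := F) X).toRingHom).roots.toFinset).card = n := by
  obtain ⟨h1, h2⟩ := M.map_fibre X
  rw [Multiset.toFinset_card_of_nodup, ← (IsAlgClosed.splits _).natDegree_eq_card_roots, h2]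
  rw [Multiset.nodup_iff_count_le_one]
  intro Y
  by_contra! hc
  rw [count_roots, one_lt_rootMultiplicity_iff_isRoot h1.ne_zero, derivative_map, IsRoot, IsRoot,
    ← aevalAeval_eq_eval_map, ← aevalAeval_eq_eval_map] at hc
  exact h Y hc.1 hc.2

theorem le_card_curvePoints [Finite F] (p : ℕ) [Fact p.Prime] [CharP F p] (φ₀ : O →ₐ[F] F)
    {E : Type*} [Field E] [Algebra F E] [Fintype E] (ν : ℕ) (hE : Fintype.card E = p ^ ν * p ^ ν)
    (hQ : w * n ^ 2 * ((n - 1 + 1) * (w * n ^ 2) + (n - 1) ^ 2 + 1) +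
      (n - 1) * ((n - 1 + 1) * (w * n ^ 2) + (n - 1) ^ 2 + 1 + n) + w * n ^ 2 < p ^ ν) :
    (p ^ ν) ^ 2 ≤ (curvePoints H E).card + w * n ^ 3 +
      ((n - 1 + 1) * (w * n ^ 2) + (n - 1) ^ 2 + 2) * p ^ ν := by
  classical
  set Ω := AlgebraicClosure E
  let ι := algebraMap E Ω
  obtain ⟨N, hN0, hNd, r, hN⟩ := M.exists_conductor
  set V := (Finset.univ : Finset E).filter fun X => aeval X N ≠ 0 with hV
  have hVc : Fintype.card E ≤ V.card + n * (w * (n - 1)) := by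
    have h1 := Finset.card_filter_add_card_filter_not (s := (Finset.univ : Finset E))
      (fun X => aeval X N ≠ 0)
    rw [Finset.card_univ] at h1
    have h2 : ((Finset.univ : Finset E).filter fun X => ¬ aeval X N ≠ 0) ⊆ (N.aroots E).toFinset := by
      intro X hX
      rw [Multiset.mem_toFinset, mem_aroots]
      exact ⟨hN0, not_not.1 (Finset.mem_filter.1 hX).2⟩
    have h3 := (Finset.card_le_card h2).trans ((Multiset.toFinset_card_le _).trans (card_roots' _))
    have h4 : (N.map (algebraMap F E)).natDegree ≤ N.natDegree := natDegree_map_le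
    rw [← h1]
    exact Nat.add_le_add (le_of_eq (by rw [hV])) (h3.trans (h4.trans hNd))
  let T : Finset (Σ _ : E, Ω) := V.sigma fun X =>
    (H.map (aeval (R := F) (ι X)).toRingHom).roots.toFinset
  have hsm : ∀ X ∈ V, ∀ Y : Ω, aevalAeval (ι X) Y H = 0 →
      aevalAeval (ι X) Y (derivative H) ≠ 0 := by
    intro X hX Y h h'
    have h1 := M.aeval_conductor_eq_zero hN h h'
    refine (Finset.mem_filter.1 hX).2 ?_
    rw [aeval_algebraMap_apply] at h1
    exact (map_eq_zero_iff _ ι.injective).1 h1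
  have hT : ∀ t ∈ T, t.1 ∈ V ∧ aevalAeval (ι t.1) t.2 H = 0 := by
    intro t ht
    obtain ⟨h1, h2⟩ := Finset.mem_sigma.1 ht
    refine ⟨h1, ?_⟩
    rw [Multiset.mem_toFinset, mem_roots (M.map_fibre _).1.ne_zero, IsRoot,
      ← aevalAeval_eq_eval_map] at h2
    exact h2
  have hTc : T.card = V.card * n := by
    rw [Finset.card_sigma]
    exact Finset.sum_const_nat fun X hX => M.card_fibre_roots (hsm X hX)
  have hφ : ∀ t : T, ∃ φ : O →ₐ[F] Ω, φ (algebraMap F[X] O Polynomial.X) = ι t.1.1 ∧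
      φ M.y = t.1.2 := fun t =>
    M.exists_algHom (hT t.1 t.2).2 (hsm _ (hT t.1 t.2).1 _ (hT t.1 t.2).2)
  choose φ hφx hφy using hφ
  set q := p ^ ν * p ^ ν with hq
  have hpow : ∀ a : E, a ^ q = a := fun a => by rw [← hE, FiniteField.pow_card]
  set T1 := (Finset.univ : Finset T).filter fun t => t.1.2 ^ q ≠ t.1.2 with hT1
  set T0 := (Finset.univ : Finset T).filter fun t => ¬ t.1.2 ^ q ≠ t.1.2 with hT0
  have h01 : T1.card + T0.card = V.card * n := by
    rw [← hTc, hT1, hT0, Finset.card_filter_add_card_filter_not, Finset.card_univ, Fintype.card_coe]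
  have h1 : T1.card ≤ (n - 1) * (p ^ ν) ^ 2 +
      ((n - 1 + 1) * (w * n ^ 2) + (n - 1) ^ 2 + 2) * p ^ ν := by
    rw [← Finset.card_image_of_injective T1 (f := φ) (by
      intro t t' h
      refine Subtype.ext (Sigma.ext ?_ (heq_of_eq ?_))
      · refine ι.injective ?_
        rw [← hφx, ← hφx, h]
      · rw [← hφy, ← hφy, h])]
    refine M.card_algHom_le_of_frobenius_ne p φ₀ ν hQ (fun a => ?_) _ fun ψ hψ => ?_
    · refine (algebraMap F E).injective ?_
      rw [map_pow, hpow]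
    · obtain ⟨t, ht, rfl⟩ := Finset.mem_image.1 hψ
      rw [hφx, hφy, ← map_pow, hpow]
      exact ⟨rfl, (Finset.mem_filter.1 ht).2⟩
  have h0 : T0.card ≤ (curvePoints H E).card := by
    have hsub : T0.image (fun t => t.1) ⊆ (curvePoints H E).image fun z =>
        (⟨z.1, ι z.2⟩ : Σ _ : E, Ω) := by
      intro t ht
      obtain ⟨s, hs, rfl⟩ := Finset.mem_image.1 ht
      have h2 := not_not.1 (Finset.mem_filter.1 hs).2
      rw [← hE] at h2
      obtain ⟨c, hc⟩ := FiniteField.exists_algebraMap_eq_of_pow_card h2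
      refine Finset.mem_image.2 ⟨(s.1.1, c), ?_, Sigma.ext rfl (heq_of_eq hc)⟩
      rw [mem_curvePoints]
      refine ι.injective ?_
      rw [map_zero, ← (hT s.1 s.2).2, ← hc]
      suffices h : ((ι.comp (aevalAeval s.1.1 c : F[X][X] →ₐ[F] E).toRingHom) =
          (aevalAeval (ι s.1.1) (ι c) : F[X][X] →ₐ[F] Ω).toRingHom) from
        congrArg (fun f : F[X][X] →+* Ω => f H) h
      refine Polynomial.ringHom_ext' (Polynomial.ringHom_ext (fun a => ?_) ?_) ?_
      · simp [ι, ← IsScalarTower.algebraMap_apply]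
      · simp
      · simp
    rw [← Finset.card_image_of_injective T0 Subtype.val_injective]
    exact (Finset.card_le_card hsub).trans Finset.card_image_le
  have hfin : (V.card + n * (w * (n - 1))) * n ≥ q * n := Nat.mul_le_mul_right n (by rwa [hE] at hVc)
  have h5 : q * n = (n - 1) * (p ^ ν) ^ 2 + (p ^ ν) ^ 2 := by
    obtain ⟨m, rfl⟩ : ∃ m, n = m + 1 := ⟨n - 1, by have := M.pos; omega⟩
    rw [hq, Nat.add_sub_cancel]
    ring
  have h6 : n * (w * (n - 1)) * n ≤ w * n ^ 3 :=
    calc n * (w * (n - 1)) * n ≤ n * (w * n) * n := by gcongr; omega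
      _ = w * n ^ 3 := by ring
  rw [add_mul] at hfin
  generalize ((n - 1 + 1) * (w * n ^ 2) + (n - 1) ^ 2 + 2) * p ^ ν = e at *
  generalize (n - 1) * (p ^ ν) ^ 2 = e1 at *
  generalize n * (w * (n - 1)) * n = e2 at *
  generalize w * n ^ 3 = e3 at *
  generalize V.card * n = e4 at *
  generalize q * n = e5 at *
  generalize (p ^ ν) ^ 2 = e6 at *
  omega

end CurveModel

end

section

namespace PoleFiltration

variable {F O K : Type*} [Field F] [CommRing O] [IsDedekindDomain O] [Field K] [Algebra O K]
  [IsFractionRing O K] [Algebra F O] [Algebra F K] [IsScalarTower F O K] {n g : ℕ} {x : O}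
  (D : PoleFiltration F O K n g x)

section

variable {E : Type*} [Field E] [Algebra F E]

include D in
theorem prime_ker_algHom_of_finite [FiniteDimensional F E] (hn : 0 < n) (φ : O →ₐ[F] E) :
    Prime (RingHom.ker φ) := by
  refine Ideal.prime_of_isPrime (fun h => ?_) (RingHom.ker_isPrime _)
  have hi : Function.Injective φ := (injective_iff_map_eq_zero φ).2 fun a ha => by
    rwa [← Ideal.mem_bot, ← h, RingHom.mem_ker]
  have hO : FiniteDimensional F O := Module.Finite.of_injective φ.toLinearMap hi
  set d := Module.finrank F O
  have h1 := D.P_finrank (d + g)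
  have h2 := Submodule.finrank_le (D.P (d + g))
  have h3 : d + g + 1 ≤ n * (d + g + 1) := Nat.le_mul_of_pos_left _ hn
  omega

theorem natCard_algHom_ker_eq [Finite F] [Finite E] {P : Ideal O} (hP : Prime P)
    [FiniteDimensional F (O ⧸ P)] (h : P.codim F ∣ Module.finrank F E) :
    Nat.card {φ : O →ₐ[F] E // RingHom.ker φ = P} = P.codim F := by
  have hmax : P.IsMaximal := (Ideal.isPrime_of_prime hP).isMaximal hP.ne_zero
  let _ : Field (O ⧸ P) := Ideal.Quotient.field P
  have : Finite (O ⧸ P) := Module.finite_of_finite F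
  have hc : Nat.card (O ⧸ P →ₐ[F] E) = P.codim F := FiniteField.natCard_algHom_of_finrank_dvd h
  refine (Nat.card_congr ?_).trans hc
  refine ⟨fun φ => Ideal.Quotient.liftₐ P φ.1 fun a ha => by
    rwa [← RingHom.mem_ker, φ.2], fun φ => ⟨φ.comp (Ideal.Quotient.mkₐ F P), ?_⟩, ?_, ?_⟩
  · ext a
    rw [RingHom.mem_ker, AlgHom.comp_apply, map_eq_zero_iff φ φ.toRingHom.injective,
      Ideal.Quotient.mkₐ_eq_mk, Ideal.Quotient.eq_zero_iff_mem]
  · intro φ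
    ext a
    rfl
  · intro φ
    refine AlgHom.ext fun a => ?_
    obtain ⟨a, rfl⟩ := Ideal.Quotient.mk_surjective a
    rfl

theorem trace_algHom_eq [Finite F] [Finite E] {P : Ideal O} (hP : Prime P)
    [FiniteDimensional F (O ⧸ P)] (φ : O →ₐ[F] E) (hφ : RingHom.ker φ = P) (a : O) :
    ∃ i, i * P.codim F = Module.finrank F E ∧ Algebra.trace F E (φ a) = i * P.traceOf F a := by
  have hmax : P.IsMaximal := (Ideal.isPrime_of_prime hP).isMaximal hP.ne_zero
  let _ : Field (O ⧸ P) := Ideal.Quotient.field P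
  let f : O ⧸ P →ₐ[F] E := Ideal.Quotient.liftₐ P φ fun a ha => by
    rwa [← RingHom.mem_ker, hφ]
  algebraize [f.toRingHom]
  have : IsScalarTower F (O ⧸ P) E := IsScalarTower.of_algebraMap_eq fun a => (f.commutes a).symm
  have : FiniteDimensional (O ⧸ P) E := Module.Finite.of_finite
  refine ⟨Module.finrank (O ⧸ P) E, ?_, ?_⟩
  · rw [mul_comm]
    exact Module.finrank_mul_finrank F (O ⧸ P) E
  · have h1 : φ a = algebraMap (O ⧸ P) E (Ideal.Quotient.mk P a) := rfl
    rw [h1, ← Algebra.trace_trace (S := O ⧸ P), Algebra.trace_algebraMap, map_nsmul, nsmul_eq_mul]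
    rfl

theorem powerSum_eq_sum_algHom [Finite F] [Finite E] [Fintype (O →ₐ[F] E)] (hn : 0 < n)
    (ψ : AddChar F ℂ) :
    D.powerSum ψ (Module.finrank F E) = ∑ φ : O →ₐ[F] E, ψ (Algebra.trace F E (φ x)) := by
  classical
  have hj : 0 < Module.finrank F E := Module.finrank_pos
  have hP : ∀ φ : O →ₐ[F] E, Prime (RingHom.ker φ) := D.prime_ker_algHom_of_finite hn
  have hmaps : ∀ φ ∈ (Finset.univ : Finset (O →ₐ[F] E)), (RingHom.ker φ,
      Module.finrank F E / (RingHom.ker φ).codim F) ∈ D.primePowers (Module.finrank F E) := by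
    intro φ _
    rw [mem_primePowers]
    have := D.finite_quotient _ (hP φ).ne_zero
    obtain ⟨i, hi, -⟩ := trace_algHom_eq (hP φ) φ rfl x
    have h1 := D.codim_pos (hP φ)
    rw [← hi, Nat.mul_div_cancel _ h1]
    refine ⟨hP φ, Nat.one_le_iff_ne_zero.2 fun h => ?_, rfl⟩
    rw [h, zero_mul] at hi
    omega
  rw [← Finset.sum_fiberwise_of_maps_to hmaps, powerSum]
  refine Finset.sum_congr rfl fun ⟨P, i⟩ hPi => ?_
  rw [mem_primePowers] at hPi
  obtain ⟨hPp, hi1, hij⟩ := hPi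
  have := D.finite_quotient _ hPp.ne_zero
  have hpos := D.codim_pos hPp
  have hfib : (Finset.univ.filter fun φ : O →ₐ[F] E => (RingHom.ker φ,
      Module.finrank F E / (RingHom.ker φ).codim F) = (P, i)) =
      Finset.univ.filter fun φ : O →ₐ[F] E => RingHom.ker φ = P := by
    refine Finset.filter_congr fun φ _ => ?_
    rw [Prod.mk.injEq, and_iff_left_iff_imp]
    intro h
    rw [h, ← hij, Nat.mul_div_cancel _ hpos]
  rw [hfib, Finset.sum_congr rfl (g := fun _ => ψ (P.traceOf F x) ^ i), Finset.sum_const,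
    ← Fintype.card_subtype, ← Nat.card_eq_fintype_card, natCard_algHom_ker_eq hPp ⟨i, by
      rw [← hij, mul_comm]⟩, nsmul_eq_mul]
  intro φ hφ
  obtain ⟨k, hk, hk'⟩ := trace_algHom_eq hPp φ (Finset.mem_filter.1 hφ).2 x
  have hki : k = i := Nat.eq_of_mul_eq_mul_right hpos (hk.trans hij.symm)
  rw [hk', hki, ← nsmul_eq_mul, AddChar.map_nsmul_eq_pow]

end

end PoleFiltration

end

section

open Polynomial nonZeroDivisors

/-- The hypotheses on a plane curve `H = 0`, of degree `n` over the affine line. -/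
structure IsCurve {F : Type*} [Field F] (H : F[X][X]) (n w : ℕ) : Prop where
  monic : H.Monic
  natDegree_eq : H.natDegree = n
  weight : ∀ i, (H.coeff i).natDegree ≤ w * (n - i)
  irreducible : Irreducible H
  cast_ne_zero : (n : F) ≠ 0

namespace IsCurve

variable {F : Type*} [Field F] {H : F[X][X]} {n w : ℕ}

/-- The function field of a plane curve. -/
abbrev CurveField (H : F[X][X]) : Type _ := AdjoinRoot (H.map (algebraMap F[X] (RatFunc F)))

/-- The ring of functions on the normalisation of a plane curve. -/
abbrev CurveRing (H : F[X][X]) : Type _ := integralClosure F[X] (CurveField H)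

theorem aeval_root :
    aeval (AdjoinRoot.root (H.map (algebraMap F[X] (RatFunc F)))) H = 0 := by
  rw [← aeval_map_algebraMap (RatFunc F), AdjoinRoot.aeval_eq, AdjoinRoot.mk_self]

variable (h : IsCurve H n w)

include h

theorem pos : 0 < n := by
  refine Nat.pos_of_ne_zero fun h0 => h.cast_ne_zero ?_
  rw [h0, Nat.cast_zero]

theorem irreducible_map : Irreducible (H.map (algebraMap F[X] (RatFunc F))) :=
  (h.monic.irreducible_iff_irreducible_map_fraction_map).1 h.irreducible

theorem monic_map : (H.map (algebraMap F[X] (RatFunc F))).Monic := h.monic.map _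

theorem natDegree_map : (H.map (algebraMap F[X] (RatFunc F))).natDegree = n := by
  rw [h.monic.natDegree_map, h.natDegree_eq]

theorem finiteDimensional [Fact (Irreducible (H.map (algebraMap F[X] (RatFunc F))))] :
    FiniteDimensional (RatFunc F) (CurveField H) :=
  h.monic_map.finite_adjoinRoot

theorem isSeparable [Fact (Irreducible (H.map (algebraMap F[X] (RatFunc F))))] :
    Algebra.IsSeparable (RatFunc F) (CurveField H) := by
  have := h.finiteDimensional
  have hn : (n : RatFunc F) ≠ 0 := by
    rw [← map_natCast (algebraMap F (RatFunc F))]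
    exact (_root_.map_ne_zero _).2 h.cast_ne_zero
  have hder : derivative (H.map (algebraMap F[X] (RatFunc F))) ≠ 0 := by
    intro h0
    have h1 := congrArg (fun q => q.coeff (n - 1)) h0
    have h2 := h.monic_map.coeff_natDegree
    rw [h.natDegree_map] at h2
    simp only [coeff_derivative, coeff_zero, Nat.sub_add_cancel h.pos, h2, one_mul] at h1
    rw [Nat.cast_sub h.pos] at h1
    exact hn (by simpa using h1)
  have hroot : IsSeparable (RatFunc F) (AdjoinRoot.root (H.map (algebraMap F[X] (RatFunc F)))) := by
    rw [IsSeparable, AdjoinRoot.minpoly_root h.monic_map.ne_zero, h.monic_map.leadingCoeff,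
      inv_one, C_1, mul_one]
    exact (separable_iff_derivative_ne_zero h.irreducible_map).2 hder
  refine ⟨fun a => ?_⟩
  rw [← mem_separableClosure_iff] at hroot ⊢
  obtain ⟨q, rfl⟩ := AdjoinRoot.mk_surjective a
  rw [← AdjoinRoot.aeval_eq]
  rw [aeval_eq_sum_range]
  exact sum_mem fun i _ => IntermediateField.smul_mem _ (pow_mem hroot i)

theorem faithfulSMul [Fact (Irreducible (H.map (algebraMap F[X] (RatFunc F))))] :
    FaithfulSMul F[X] (CurveField H) := by
  rw [faithfulSMul_iff_algebraMap_injective,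
    IsScalarTower.algebraMap_eq F[X] (RatFunc F) (CurveField H)]
  exact (algebraMap (RatFunc F) (CurveField H)).injective.comp (RatFunc.algebraMap_injective F)

section

variable [Fact (Irreducible (H.map (algebraMap F[X] (RatFunc F))))]

theorem instances :
    IsDedekindDomain (CurveRing H) ∧ Module.Finite F[X] (CurveRing H) ∧
    Module.Free F[X] (CurveRing H) ∧ FaithfulSMul F[X] (CurveRing H) ∧
    IsFractionRing (CurveRing H) (CurveField H) ∧
    Algebra.IsSeparable (RatFunc F) (CurveField H) ∧
    IsLocalization (Algebra.algebraMapSubmonoid (CurveRing H) F[X]⁰) (CurveField H) := by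
  have := h.finiteDimensional
  have := h.isSeparable
  have := h.faithfulSMul
  have := Module.isTorsionFree_iff_faithfulSMul.2 h.faithfulSMul
  exact ⟨integralClosure.isDedekindDomain F[X] (RatFunc F) (CurveField H),
    IsIntegralClosure.finite F[X] (RatFunc F) (CurveField H) _,
    IsIntegralClosure.module_free F[X] (RatFunc F) (CurveField H) _, inferInstance,
    integralClosure.isFractionRing_of_finite_extension (RatFunc F) _, inferInstance,
    IsIntegralClosure.isLocalization F[X] (RatFunc F) (CurveField H) _⟩

/-- The coordinate `Y` on the normalisation of the curve. -/
noncomputable def coordY : CurveRing H :=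
  ⟨AdjoinRoot.root _, H, h.monic, aeval_root⟩

/-- The model given by the integral closure. -/
noncomputable def model : CurveModel F (CurveRing H) (CurveField H) H n w where
  pos := h.pos
  b := (AdjoinRoot.powerBasis' h.monic_map).basis.reindex (finCongr h.natDegree_map)
  y := h.coordY
  basis_eq i := by
    rw [Module.Basis.reindex_apply, PowerBasis.basis_eq_pow]
    rfl
  monic := h.monic
  natDegree_eq := h.natDegree_eq
  weight := h.weight
  aeval_eq_zero := by
    refine Subtype.ext ?_
    rw [← Subalgebra.coe_val, ← aeval_algHom_apply, map_zero]
    exact aeval_root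
  finrank_eq := by
    have := h.finiteDimensional
    have := h.isSeparable
    have := h.faithfulSMul
    have := Module.isTorsionFree_iff_faithfulSMul.2 h.faithfulSMul
    rw [IsIntegralClosure.rank F[X] (RatFunc F) (CurveField H),
      (AdjoinRoot.powerBasis' h.monic_map).finrank]
    exact h.natDegree_map
  cast_ne_zero := h.cast_ne_zero

end

end IsCurve

end

section

open Polynomial nonZeroDivisors

namespace Polynomial

variable {E : Type*} [Field E] (p : ℕ) [Fact p.Prime] [CharP E p]

/-- The Artin-Schreier polynomial `X ^ p - X + c`. -/
noncomputable def artinSchreier (c : E) : E[X] := X ^ p - X + C c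

omit [CharP E p] in
theorem artinSchreier_eq (c : E) : artinSchreier p c = X ^ p + (-X + C c) := by
  rw [artinSchreier]
  ring

omit [CharP E p] in
theorem degree_neg_X_add_C_lt (c : E) : (-X + C c : E[X]).degree < (p : WithBot ℕ) := by
  refine (degree_add_le _ _).trans_lt ?_
  rw [degree_neg, degree_X, max_eq_left (degree_C_le.trans (by norm_num))]
  exact_mod_cast (Fact.out : p.Prime).one_lt

omit [CharP E p] in
theorem monic_artinSchreier (c : E) : (artinSchreier p c).Monic := by
  rw [artinSchreier_eq]
  exact monic_X_pow_add (degree_neg_X_add_C_lt p c)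

omit [CharP E p] in
theorem natDegree_artinSchreier (c : E) : (artinSchreier p c).natDegree = p := by
  rw [artinSchreier_eq, natDegree_add_eq_left_of_degree_lt, natDegree_X_pow]
  rw [degree_X_pow]
  exact degree_neg_X_add_C_lt p c

theorem artinSchreier_comp_X_add_one (c : E) :
    (artinSchreier p c).comp (X + 1) = artinSchreier p c := by
  simp only [artinSchreier, add_comp, sub_comp, X_pow_comp, X_comp, C_comp, add_pow_char, one_pow]
  ring

theorem comp_X_add_C_natCast {a : E[X]} (ha : a.comp (X + 1) = a) (j : ℕ) :
    a.eval (j : E) = a.eval 0 := by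
  induction j with
  | zero => simp
  | succ j ih =>
    rw [← ih]
    nth_rw 2 [← ha]
    simp

theorem exists_eq_comp_artinSchreier (c : E) (a : E[X]) (ha : a.comp (X + 1) = a) :
    ∃ b : E[X], a = b.comp (artinSchreier p c) := by
  induction hd : a.natDegree using Nat.strong_induction_on generalizing a with
  | _ d ih =>
  set g := artinSchreier p c with hg
  have hgm : g.Monic := monic_artinSchreier p c
  have hgd : g.natDegree = p := natDegree_artinSchreier p c
  have h1 := modByMonic_add_div a g
  have hdeg : ((a %ₘ g).comp (X + 1)).degree < g.degree := by
    have : (X + 1 : E[X]) = X + C 1 := by simp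
    rw [this, ← taylor_apply, degree_taylor]
    exact degree_modByMonic_lt _ hgm
  have h2 := div_modByMonic_unique (f := a) ((a /ₘ g).comp (X + 1)) ((a %ₘ g).comp (X + 1)) hgm
    ⟨by
      nth_rw 3 [← ha]
      rw [← h1, add_comp, mul_comp, artinSchreier_comp_X_add_one, h1], hdeg⟩
  have hr : a %ₘ g = C ((a %ₘ g).eval 0) := by
    rw [← sub_eq_zero]
    refine eq_zero_of_natDegree_lt_card_of_eval_eq_zero _ (ι := Fin p) (f := fun j => ((j : ℕ) : E))
      ?_ (fun j => ?_) ?_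
    · intro i j hij
      exact Fin.ext (CharP.natCast_injOn_Iio E p i.2 j.2 hij)
    · rw [eval_sub, eval_C, comp_X_add_C_natCast h2.2.symm, sub_self]
    · rw [natDegree_sub_C, Fintype.card_fin]
      exact (natDegree_modByMonic_lt a hgm fun h => by
        rw [h, natDegree_one] at hgd
        exact (Fact.out : p.Prime).ne_zero hgd.symm).trans_eq hgd
  by_cases h0 : a.natDegree = 0
  · exact ⟨a, by rw [eq_C_of_natDegree_eq_zero h0, C_comp]⟩
  obtain ⟨b, hb⟩ := ih _ (by
    rw [← hd, natDegree_divByMonic _ hgm, hgd]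
    have := (Fact.out : p.Prime).pos
    omega) (a /ₘ g) h2.1.symm rfl
  refine ⟨C ((a %ₘ g).eval 0) + X * b, ?_⟩
  rw [add_comp, C_comp, mul_comp, X_comp, ← hr, ← hb, h1]

theorem compRingHom_artinSchreier_injective (c : E) :
    Function.Injective (compRingHom (artinSchreier p c)) := by
  refine (injective_iff_map_eq_zero _).2 fun a ha => ?_
  rw [coe_compRingHom_apply, comp_eq_zero_iff] at ha
  refine ha.resolve_right fun h => ?_
  have := natDegree_artinSchreier p c
  rw [h.2, natDegree_C] at this
  exact (Fact.out : p.Prime).ne_zero this.symm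

theorem exists_map_eq_of_map_compRingHom (c : E) (A : E[X][X])
    (hA : A.map (compRingHom (X + 1)) = A) :
    ∃ B : E[X][X], B.map (compRingHom (artinSchreier p c)) = A := by
  refine (mem_lifts A).1 ((lifts_iff_coeff_lifts _).2 fun i => ?_)
  obtain ⟨b, hb⟩ := exists_eq_comp_artinSchreier p c (A.coeff i) (by
    conv_rhs => rw [← hA, coeff_map, coe_compRingHom_apply])
  exact ⟨b, hb.symm⟩

omit [Fact p.Prime] [CharP E p] in
theorem iterate_map_compRingHom (A : E[X][X]) (i : ℕ) :
    (fun B : E[X][X] => B.map (compRingHom (X + 1)))^[i] A = A.map (compRingHom (X + C (i : E))) := by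
  induction i with
  | zero =>
    have : compRingHom (X + C ((0 : ℕ) : E)) = RingHom.id E[X] := by
      refine RingHom.ext fun a => ?_
      simp
    rw [this, map_id, Function.iterate_zero, id]
  | succ i ih =>
    rw [Function.iterate_succ_apply', ih, map_map]
    congr 1
    refine RingHom.ext fun a => ?_
    simp [comp_assoc, add_assoc, add_comm]

omit [Fact p.Prime] [CharP E p] in
theorem compRingHom_X_add_C_comp (t : E) :
    (compRingHom (X + C t)).comp (compRingHom (X + C (-t))) = RingHom.id E[X] := by
  refine RingHom.ext fun a => ?_
  simp [comp_assoc]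

/-- A monic irreducible polynomial of degree less than `p` stays irreducible after an
Artin-Schreier base change. -/
theorem irreducible_map_compRingHom_artinSchreier (c : E) {H : E[X][X]} (hm : H.Monic)
    (hi : Irreducible H) (hd : H.natDegree < p) :
    Irreducible (H.map (compRingHom (artinSchreier p c))) := by
  classical
  set θ := compRingHom (artinSchreier p c) with hθ
  set τ := compRingHom (X + 1 : E[X]) with hτ
  have hp : p.Prime := Fact.out
  have hθm : (H.map θ).Monic := hm.map θ
  have hθd : (H.map θ).natDegree = H.natDegree := hm.natDegree_map θ
  have hθu : ¬ IsUnit (H.map θ) := fun h => by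
    have h1 := hθm.eq_one_of_isUnit h
    have h2 := hθd
    rw [h1, natDegree_one] at h2
    refine hi.not_isUnit ?_
    rw [eq_one_of_monic_natDegree_zero hm h2.symm]
    exact isUnit_one
  have hθτ : (H.map θ).map τ = H.map θ := by
    rw [map_map]
    congr 1
    refine RingHom.ext fun a => ?_
    simp [hθ, hτ, comp_assoc, artinSchreier_comp_X_add_one]
  obtain ⟨A, hAi, hAm, B, hAB⟩ : ∃ A : E[X][X], Irreducible A ∧ A.Monic ∧ A ∣ H.map θ := by
    obtain ⟨A, hAi, B, hAB⟩ := WfDvdMonoid.exists_irreducible_factor hθu hθm.ne_zero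
    have h1 : A.leadingCoeff * B.leadingCoeff = 1 := by
      rw [← leadingCoeff_mul, ← hAB, hθm.leadingCoeff]
    have hu : IsUnit (C B.leadingCoeff) := (IsUnit.of_mul_eq_one_right _ h1).map C
    have hass : Associated A (A * C B.leadingCoeff) := ⟨hu.unit, rfl⟩
    refine ⟨A * C B.leadingCoeff, (hass.irreducible_iff).1 hAi, ?_, hass.dvd_iff_dvd_left.1 ⟨B, hAB⟩⟩
    rw [Monic, leadingCoeff_mul, leadingCoeff_C, h1]
  have hBm : B.Monic := hAm.of_mul_monic_left (hAB ▸ hθm)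
  set σ := fun B : E[X][X] => B.map τ with hσ
  have hσi : ∀ i, σ^[i] A = A.map (compRingHom (X + C (i : E))) := iterate_map_compRingHom A
  have hper : Function.IsPeriodicPt σ p A := by
    have : compRingHom (X + C ((p : ℕ) : E)) = RingHom.id E[X] := by
      refine RingHom.ext fun a => ?_
      simp
    rw [Function.IsPeriodicPt, Function.IsFixedPt, hσi, this, map_id]
  have hAd : A.natDegree ≠ 0 := fun h => hAi.not_isUnit (by
    rw [eq_one_of_monic_natDegree_zero hAm h]
    exact isUnit_one)
  have hAτ : A.map τ = A := by
    rcases (Nat.dvd_prime hp).1 hper.minimalPeriod_dvd with h | h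
    · exact Function.minimalPeriod_eq_one_iff_isFixedPt.1 h
    exfalso
    have hinj := Function.iterate_injOn_Iio_minimalPeriod (f := σ) (x := A)
    rw [h] at hinj
    have hirr : ∀ i, Irreducible (σ^[i] A) := by
      intro i
      rw [hσi]
      let e : E[X] ≃+* E[X] := RingEquiv.ofRingHom (compRingHom (X + C (i : E)))
        (compRingHom (X + C (-(i : E)))) (compRingHom_X_add_C_comp _)
        (by simpa using compRingHom_X_add_C_comp (-(i : E)))
      exact (MulEquiv.irreducible_iff (mapEquiv e)).2 hAi
    have hmon : ∀ i, (σ^[i] A).Monic := fun i => by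
      rw [hσi]
      exact hAm.map _
    have hdvd : ∀ i, σ^[i] A ∣ H.map θ := by
      intro i
      induction i with
      | zero => exact ⟨B, hAB⟩
      | succ i ih =>
        rw [Function.iterate_succ_apply', ← hθτ]
        exact Polynomial.map_dvd τ ih
    have hprod : ∏ i ∈ Finset.range p, σ^[i] A ∣ H.map θ := by
      refine Finset.prod_dvd_of_isRelPrime (fun i hi j hj hij => ?_) fun i _ => hdvd i
      refine ((hirr i).isRelPrime_iff_not_dvd).2 fun hd => hij ?_
      refine hinj (Finset.mem_range.1 hi) (Finset.mem_range.1 hj) ?_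
      exact eq_of_monic_of_associated (hmon i) (hmon j) ((hirr i).associated_of_dvd (hirr j) hd)
    have h1 := natDegree_le_of_dvd hprod hθm.ne_zero
    rw [natDegree_prod_of_monic _ _ fun i _ => hmon i, hθd] at h1
    have h2 : ∀ i ∈ Finset.range p, (σ^[i] A).natDegree = A.natDegree := fun i _ => by
      rw [hσi, hAm.natDegree_map]
    rw [Finset.sum_congr rfl h2, Finset.sum_const, Finset.card_range, smul_eq_mul] at h1
    have := Nat.le_mul_of_pos_right p (Nat.pos_of_ne_zero hAd)
    omega
  have hBτ : B.map τ = B := by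
    refine mul_left_cancel₀ hAm.ne_zero ?_
    rw [← hAB, ← hθτ, hAB, Polynomial.map_mul, hAτ]
  obtain ⟨A0, hA0⟩ := exists_map_eq_of_map_compRingHom p c A hAτ
  obtain ⟨B0, hB0⟩ := exists_map_eq_of_map_compRingHom p c B hBτ
  have hH : H = A0 * B0 := by
    refine map_injective θ (compRingHom_artinSchreier_injective p c) ?_
    rw [hAB, Polynomial.map_mul, hA0, hB0]
  rcases hi.isUnit_or_isUnit hH with hu | hu
  · exact absurd (hA0 ▸ hu.map (mapRingHom θ)) hAi.not_isUnit
  · have : B = 1 := hBm.eq_one_of_isUnit (hB0 ▸ hu.map (mapRingHom θ))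
    rwa [hAB, this, mul_one]

end Polynomial

theorem IsCurve.map_artinSchreier {E : Type*} [Field E] (p : ℕ) [Fact p.Prime] [CharP E p] (c : E)
    {H : E[X][X]} {n w : ℕ} (h : IsCurve H n w) (hn : n < p) :
    IsCurve (H.map (compRingHom (artinSchreier p c))) n (w * p) where
  monic := h.monic.map _
  natDegree_eq := by rw [h.monic.natDegree_map, h.natDegree_eq]
  weight i := by
    rw [coeff_map, coe_compRingHom_apply, natDegree_comp, natDegree_artinSchreier, mul_right_comm]
    exact Nat.mul_le_mul_right _ (h.weight i)
  irreducible := irreducible_map_compRingHom_artinSchreier p c h.monic h.irreducible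
    (h.natDegree_eq ▸ hn)
  cast_ne_zero := h.cast_ne_zero

end

section

open Polynomial nonZeroDivisors

theorem exists_pow_sub_eq_of_trace_eq_zero (p : ℕ) [Fact p.Prime] {E : Type*} [Field E] [Finite E]
    [Algebra (ZMod p) E] {a : E} (ha : Algebra.trace (ZMod p) E a = 0) : ∃ z : E, z ^ p - z = a := by
  classical
  have : CharP E p := charP_of_injective_algebraMap (algebraMap (ZMod p) E).injective p
  have hp : p.Prime := Fact.out
  let f : E →ₗ[ZMod p] E :=
    { toFun := fun z => z ^ p - z
      map_add' := fun y z => by rw [add_pow_char]; ring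
      map_smul' := fun c z => by
        rw [Algebra.smul_def, mul_pow, ← map_pow, ZMod.pow_card, RingHom.id_apply,
          Algebra.smul_def]
        ring }
  have hker : Module.finrank (ZMod p) (LinearMap.ker f) ≤ 1 := by
    have h1 : (LinearMap.ker f : Set E) ⊆ ((X ^ p - X : Polynomial E).roots.toFinset : Set E) := by
      intro z hz
      rw [Finset.mem_coe, Multiset.mem_toFinset, mem_roots (FiniteField.X_pow_card_sub_X_ne_zero E hp.one_lt)]
      simpa [f] using hz
    have h2 := Set.ncard_le_ncard h1 (Finset.finite_toSet _)
    rw [Set.ncard_coe_finset] at h2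
    have h3 := h2.trans ((Multiset.toFinset_card_le _).trans (card_roots' _))
    rw [FiniteField.X_pow_card_sub_X_natDegree_eq E hp.one_lt] at h3
    have h4 : Nat.card (LinearMap.ker f) = p ^ Module.finrank (ZMod p) (LinearMap.ker f) := by
      rw [Module.natCard_eq_pow_finrank (K := ZMod p), Nat.card_zmod]
    rw [← Nat.card_coe_set_eq] at h3
    have h5 : p ^ Module.finrank (ZMod p) (LinearMap.ker f) ≤ p ^ 1 := by
      rw [← h4, pow_one]
      exact h3
    exact (Nat.pow_le_pow_iff_right hp.one_lt).1 h5
  have hsurj := Algebra.trace_surjective (ZMod p) E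
  have h1 := LinearMap.finrank_range_add_finrank_ker f
  have h2 := LinearMap.finrank_range_add_finrank_ker (Algebra.trace (ZMod p) E)
  rw [LinearMap.range_eq_top.2 hsurj, finrank_top, Module.finrank_self] at h2
  have hle : LinearMap.range f ≤ LinearMap.ker (Algebra.trace (ZMod p) E) := by
    rintro _ ⟨z, rfl⟩
    rw [LinearMap.mem_ker]
    change Algebra.trace (ZMod p) E (z ^ p - z) = 0
    rw [map_sub, sub_eq_zero]
    have := Algebra.trace_eq_of_algEquiv (FiniteField.frobeniusAlgEquiv (ZMod p) E p) z
    simpa using this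
  have heq := Submodule.eq_of_le_of_finrank_le hle (by omega)
  have : a ∈ LinearMap.range f := by
    rw [heq]
    exact ha
  exact this

namespace IsCurve

theorem card_curvePoints_le {F : Type*} [Field F] [Fintype F] {H : F[X][X]} {n w : ℕ}
    (h : IsCurve H n w) (p : ℕ) [Fact p.Prime] [CharP F p] (ν : ℕ)
    (hF : Nat.card F = p ^ ν * p ^ ν)
    (hQ : w * n ^ 2 * (2 * (w * n ^ 2) + 2) + (2 * (w * n ^ 2) + 2 + n) + w * n ^ 2 < p ^ ν) :
    (curvePoints H F).card ≤ (p ^ ν) ^ 2 + (2 * (w * n ^ 2) + 3) * p ^ ν + w * n ^ 3 := by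
  classical
  have : Fact (Irreducible (H.map (algebraMap F[X] (RatFunc F)))) := ⟨h.irreducible_map⟩
  obtain ⟨h1, h2, h3, h4, h5, h6, h7⟩ := h.instances
  set M := h.model
  have := M.finite_algHom (E := F)
  have := Fintype.ofFinite (CurveRing H →ₐ[F] F)
  have hS := M.filtration.card_algHom_le_of_card h.pos p ν hF hQ Finset.univ
  have hd := M.norm_sum_algHom_sub_le (E := F) (fun _ => 1) (fun _ => by simp)
  simp only [Finset.sum_const, nsmul_eq_mul, mul_one] at hd
  have hd' : ((curvePoints H F).card : ℝ) ≤
      (Finset.univ : Finset (CurveRing H →ₐ[F] F)).card + w * n ^ 3 := by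
    have h8 := norm_sub_norm_le ((curvePoints H F).card : ℂ)
      ((Finset.univ : Finset (CurveRing H →ₐ[F] F)).card : ℂ)
    rw [norm_sub_rev, Complex.norm_natCast, Complex.norm_natCast] at h8
    linarith
  have hd'' : (curvePoints H F).card ≤
      (Finset.univ : Finset (CurveRing H →ₐ[F] F)).card + w * n ^ 3 := by exact_mod_cast hd'
  omega

theorem card_fibre_trace_le (p : ℕ) [Fact p.Prime] {E : Type*} [Field E] [Fintype E]
    [Algebra (ZMod p) E] {H : E[X][X]} {n w : ℕ} (h : IsCurve H n w) (hn : n < p) (ν : ℕ)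
    (hE : Nat.card E = p ^ ν * p ^ ν)
    (hQ : w * p * n ^ 2 * (2 * (w * p * n ^ 2) + 2) + (2 * (w * p * n ^ 2) + 2 + n) +
      w * p * n ^ 2 < p ^ ν) (c : ZMod p) :
    p * ((curvePoints H E).filter fun z => Algebra.trace (ZMod p) E z.1 = c).card ≤
      (p ^ ν) ^ 2 + (2 * (w * p * n ^ 2) + 3) * p ^ ν + w * p * n ^ 3 := by
  classical
  have : CharP E p := charP_of_injective_algebraMap (algebraMap (ZMod p) E).injective p
  obtain ⟨c0, hc0⟩ := Algebra.trace_surjective (ZMod p) E c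
  refine le_trans ?_ ((h.map_artinSchreier p c0 hn).card_curvePoints_le p ν hE hQ)
  set A := (curvePoints H E).filter fun z => Algebra.trace (ZMod p) E z.1 = c with hA
  have hζ : ∀ z ∈ A, ∃ ζ : E, ζ ^ p - ζ = z.1 - c0 := fun z hz => by
    refine exists_pow_sub_eq_of_trace_eq_zero p ?_
    rw [map_sub, hc0, (Finset.mem_filter.1 hz).2, sub_self]
  choose! ζ hζ using hζ
  have hcard : ((Finset.univ : Finset (ZMod p)) ×ˢ A).card = p * A.card := by
    rw [Finset.card_product, Finset.card_univ, ZMod.card]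
  rw [← hcard]
  refine Finset.card_le_card_of_injOn (fun t => (ζ t.2 + algebraMap (ZMod p) E t.1, t.2.2)) ?_ ?_
  · rintro ⟨j, z⟩ hz
    have hz := (Finset.mem_product.1 hz).2
    have hzc := (Finset.mem_filter.1 hz).1
    rw [mem_curvePoints, aevalAeval_eq_eval_map] at hzc
    rw [Finset.mem_coe, mem_curvePoints, aevalAeval_eq_eval_map, map_map]
    convert hzc using 3
    refine RingHom.ext fun a => ?_
    have h1 : (ζ z + algebraMap (ZMod p) E j) ^ p - (ζ z + algebraMap (ZMod p) E j) + c0 = z.1 := by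
      rw [add_pow_char, ← map_pow, ZMod.pow_card]
      linear_combination hζ z hz
    simp [artinSchreier, eval_comp, h1]
  · rintro ⟨j, z⟩ hz ⟨j', z'⟩ hz' heq
    obtain ⟨h1, h2⟩ := Prod.mk.inj heq
    have hz := (Finset.mem_product.1 hz).2
    have hz' := (Finset.mem_product.1 hz').2
    have h3 : z.1 = z'.1 := by
      have h4 := congrArg (fun t => t ^ p - t) h1
      simp only [add_pow_char, ← map_pow, ZMod.pow_card] at h4
      linear_combination h4 - hζ z hz + hζ z' hz'
    have h5 : z = z' := Prod.ext h3 h2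
    subst h5
    exact Prod.ext ((algebraMap (ZMod p) E).injective (add_left_cancel h1)) rfl

end IsCurve

theorem norm_sum_mul_addChar_le {p : ℕ} [Fact p.Prime] (ψ : AddChar (ZMod p) ℂ) (hψ : ψ ≠ 1)
    (N : ZMod p → ℕ) (B : ℕ) (hN : ∀ c, p * N c ≤ B) :
    ‖∑ c, (N c : ℂ) * ψ c‖ ≤ B - ∑ c, (N c : ℝ) := by
  have hp : (0 : ℝ) < p := Nat.cast_pos.2 (Fact.out : p.Prime).pos
  have h0 : ∑ c, ψ c = 0 := AddChar.sum_eq_zero_of_ne_one hψ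
  have h1 : ∑ c, (N c : ℂ) * ψ c = ∑ c, ((N c - B / p : ℝ) : ℂ) * ψ c := by
    push_cast
    simp only [sub_mul, Finset.sum_sub_distrib, ← Finset.mul_sum, h0, mul_zero, sub_zero]
  have h2 : ∀ c, (N c : ℝ) ≤ B / p := fun c => by
    rw [le_div_iff₀ hp, mul_comm]
    exact_mod_cast hN c
  rw [h1]
  refine (norm_sum_le _ _).trans (le_of_eq ?_)
  have h3 : ∀ c ∈ (Finset.univ : Finset (ZMod p)),
      ‖((N c - B / p : ℝ) : ℂ) * ψ c‖ = B / p - N c := fun c _ => by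
    rw [norm_mul, AddChar.norm_apply, mul_one, Complex.norm_real, Real.norm_of_nonpos (by
      linarith [h2 c])]
    ring
  rw [Finset.sum_congr rfl h3, Finset.sum_sub_distrib, Finset.sum_const, Finset.card_univ,
    ZMod.card, nsmul_eq_mul, mul_div_cancel₀ _ hp.ne']

end

section

open Polynomial nonZeroDivisors

theorem curvePoints_map {F E : Type*} [Field F] [Field E] [Algebra F E] [Fintype E] (H : F[X][X]) :
    curvePoints (H.map (mapRingHom (algebraMap F E))) E = curvePoints H E := by
  ext z
  rw [mem_curvePoints, mem_curvePoints, aevalAeval_eq_eval_map, aevalAeval_eq_eval_map, map_map]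
  have : ((aeval z.1 : E[X] →ₐ[E] E).toRingHom).comp (mapRingHom (algebraMap F E)) =
      (aeval z.1 : F[X] →ₐ[F] E).toRingHom := by
    refine Polynomial.ringHom_ext (fun a => ?_) ?_ <;> simp
  rw [this]

namespace IsCurve

variable {p : ℕ} [Fact p.Prime] {H : (ZMod p)[X][X]} {n w : ℕ}

theorem map_mapRingHom (h : IsCurve H n w) {E : Type*} [Field E] [Algebra (ZMod p) E]
    (hE : Irreducible (H.map (mapRingHom (algebraMap (ZMod p) E)))) :
    IsCurve (H.map (mapRingHom (algebraMap (ZMod p) E))) n w where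
  monic := h.monic.map _
  natDegree_eq := by rw [h.monic.natDegree_map, h.natDegree_eq]
  weight i := by
    rw [coeff_map, coe_mapRingHom]
    exact natDegree_map_le.trans (h.weight i)
  irreducible := hE
  cast_ne_zero := by
    rw [← map_natCast (algebraMap (ZMod p) E)]
    exact (_root_.map_ne_zero _).2 h.cast_ne_zero

/-- Estimates of square-root quality, with an unspecified constant, over large fields of square
order. -/
theorem exists_bound_curvePoints (h : IsCurve H n w) (hn : n < p) {x₀ y₀ : ZMod p}
    (h₀ : aevalAeval x₀ y₀ H = 0) (h₁ : aevalAeval x₀ y₀ (derivative H) ≠ 0) :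
    ∃ C μ₀ : ℕ, ∀ μ, μ₀ ≤ μ → ∀ (E : Type) [Field E] [Fintype E] [Algebra (ZMod p) E],
      Nat.card E = p ^ μ * p ^ μ → Irreducible (H.map (mapRingHom (algebraMap (ZMod p) E))) →
      ‖((curvePoints H E).card : ℂ) - ((p : ℂ) ^ μ) ^ 2‖ ≤ C * (p : ℝ) ^ μ ∧
      ∀ ψ : AddChar (ZMod p) ℂ, ψ ≠ 1 →
        ‖∑ z ∈ curvePoints H E, ψ (Algebra.trace (ZMod p) E z.1)‖ ≤ C * (p : ℝ) ^ μ := by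
  classical
  have hp : p.Prime := Fact.out
  set c1 := w * n ^ 2 * ((n - 1 + 1) * (w * n ^ 2) + (n - 1) ^ 2 + 1) +
      (n - 1) * ((n - 1 + 1) * (w * n ^ 2) + (n - 1) ^ 2 + 1 + n) + w * n ^ 2 with hc1
  set c2 := w * p * n ^ 2 * (2 * (w * p * n ^ 2) + 2) + (2 * (w * p * n ^ 2) + 2 + n) +
      w * p * n ^ 2 with hc2
  set d1 := (n - 1 + 1) * (w * n ^ 2) + (n - 1) ^ 2 + 2 with hd1
  set d2 := 2 * (w * p * n ^ 2) + 3 with hd2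
  set e1 := w * n ^ 3 with he1
  set e2 := w * p * n ^ 3 with he2
  refine ⟨d1 + d2 + e1 + e2, c1 + c2, fun μ hμ E _ _ _ hE hirr => ?_⟩
  have hμ' : c1 + c2 < p ^ μ := hμ.trans_lt (Nat.lt_pow_self hp.one_lt)
  have hQ1 : 1 ≤ p ^ μ := Nat.one_le_pow _ _ hp.pos
  have : Fact (Irreducible (H.map (algebraMap (ZMod p)[X] (RatFunc (ZMod p))))) :=
    ⟨h.irreducible_map⟩
  obtain ⟨_, _, _, _, _, _, _⟩ := h.instances
  obtain ⟨φ₀, -⟩ := h.model.exists_algHom h₀ h₁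
  have hlow := h.model.le_card_curvePoints p φ₀ (E := E) μ
    (by rw [← Nat.card_eq_fintype_card, hE]) (by omega)
  rw [← hd1, ← he1] at hlow
  have hup := (h.map_mapRingHom hirr).card_fibre_trace_le p hn μ hE (by omega)
  rw [curvePoints_map, ← hd2, ← he2] at hup
  set N : ZMod p → ℕ := fun c =>
    ((curvePoints H E).filter fun z => Algebra.trace (ZMod p) E z.1 = c).card with hN
  set B := (p ^ μ) ^ 2 + d2 * p ^ μ + e2 with hB
  have hsum : (curvePoints H E).card = ∑ c, N c :=
    Finset.card_eq_sum_card_fiberwise fun _ _ => Finset.mem_coe.2 (Finset.mem_univ _)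
  have hle : (curvePoints H E).card ≤ B := by
    have h2 : ∑ c : ZMod p, p * N c ≤ ∑ _c : ZMod p, B := Finset.sum_le_sum fun c _ => hup c
    rw [← Finset.mul_sum, ← hsum, Finset.sum_const, Finset.card_univ, ZMod.card, smul_eq_mul] at h2
    exact Nat.le_of_mul_le_mul_left h2 hp.pos
  have hlowR : ((p : ℝ) ^ μ) ^ 2 ≤ (curvePoints H E).card + e1 + d1 * (p : ℝ) ^ μ := by
    exact_mod_cast hlow
  have hleR : ((curvePoints H E).card : ℝ) ≤ ((p : ℝ) ^ μ) ^ 2 + d2 * (p : ℝ) ^ μ + e2 := by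
    exact_mod_cast hle
  have hQ : (1 : ℝ) ≤ (p : ℝ) ^ μ := by exact_mod_cast hQ1
  have he1' : (e1 : ℝ) ≤ e1 * (p : ℝ) ^ μ := le_mul_of_one_le_right (Nat.cast_nonneg _) hQ
  have he2' : (e2 : ℝ) ≤ e2 * (p : ℝ) ^ μ := le_mul_of_one_le_right (Nat.cast_nonneg _) hQ
  have hd1' : (0 : ℝ) ≤ d1 * (p : ℝ) ^ μ := by positivity
  have hd2' : (0 : ℝ) ≤ d2 * (p : ℝ) ^ μ := by positivity
  have he1'' : (0 : ℝ) ≤ e1 * (p : ℝ) ^ μ := by positivity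
  have he2'' : (0 : ℝ) ≤ e2 * (p : ℝ) ^ μ := by positivity
  push_cast
  constructor
  · have : ((curvePoints H E).card : ℂ) - ((p : ℂ) ^ μ) ^ 2 =
        (((curvePoints H E).card - ((p : ℝ) ^ μ) ^ 2 : ℝ) : ℂ) := by push_cast; rfl
    rw [this, Complex.norm_real, Real.norm_eq_abs, abs_le]
    constructor <;> linarith
  · intro ψ hψ
    have h3 := norm_sum_mul_addChar_le ψ hψ N B hup
    have h4 : ∑ z ∈ curvePoints H E, ψ (Algebra.trace (ZMod p) E z.1) = ∑ c, (N c : ℂ) * ψ c := by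
      rw [← Finset.sum_fiberwise (curvePoints H E) (fun z => Algebra.trace (ZMod p) E z.1)]
      refine Finset.sum_congr rfl fun c _ => ?_
      rw [Finset.sum_congr rfl (g := fun _ => ψ c), Finset.sum_const, nsmul_eq_mul]
      intro z hz
      rw [(Finset.mem_filter.1 hz).2]
    rw [h4]
    refine h3.trans ?_
    rw [← Nat.cast_sum, ← hsum, hB]
    push_cast
    linarith

end IsCurve

theorem exists_bound_of_eventually {S : ℕ → ℂ} {C r : ℝ} (hC : 0 ≤ C) (hr : 1 ≤ r) {μ₀ : ℕ}
    (h : ∀ μ, 1 ≤ μ → μ₀ ≤ μ → ‖S (2 * μ)‖ ≤ C * r ^ μ) :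
    ∃ C', ∀ μ, 1 ≤ μ → ‖S (2 * μ)‖ ≤ C' * r ^ μ := by
  refine ⟨C + ∑ μ ∈ Finset.range μ₀, ‖S (2 * μ)‖, fun μ hμ => ?_⟩
  have h1 : 1 ≤ r ^ μ := one_le_pow₀ hr
  have h2 : 0 ≤ ∑ μ ∈ Finset.range μ₀, ‖S (2 * μ)‖ := Finset.sum_nonneg fun _ _ => norm_nonneg _
  rcases le_or_gt μ₀ μ with h3 | h3
  · refine (h μ hμ h3).trans ?_
    gcongr
    linarith
  · have h4 := Finset.single_le_sum (f := fun μ => ‖S (2 * μ)‖) (fun _ _ => norm_nonneg _)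
      (Finset.mem_range.2 h3)
    calc ‖S (2 * μ)‖ ≤ C + ∑ μ ∈ Finset.range μ₀, ‖S (2 * μ)‖ := by
          linarith
      _ ≤ _ := le_mul_of_one_le_right (by positivity) h1

namespace IsCurve

variable {p : ℕ} [Fact p.Prime] {H : (ZMod p)[X][X]} {n w : ℕ}

/-- Weil's bound for exponential sums and point counts on an absolutely irreducible plane curve. -/
theorem weil_bound (h : IsCurve H n w) (hn : n < p) {x₀ y₀ : ZMod p}
    (h₀ : aevalAeval x₀ y₀ H = 0) (h₁ : aevalAeval x₀ y₀ (derivative H) ≠ 0)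
    (habs : ∀ (E : Type) [Field E] [Finite E] [Algebra (ZMod p) E],
      Irreducible (H.map (mapRingHom (algebraMap (ZMod p) E)))) :
    ((curvePoints H (ZMod p)).card : ℝ) ≤ p + (2 * (w * n ^ 2) + 1) * √p + w * n ^ 3 ∧
    ∀ ψ : AddChar (ZMod p) ℂ, ψ ≠ 1 →
      ‖∑ z ∈ curvePoints H (ZMod p), ψ z.1‖ ≤ 2 * (w * n ^ 2) * √p + w * n ^ 3 := by
  classical
  have hp : p.Prime := Fact.out
  have hp1 : (1 : ℝ) ≤ p := by exact_mod_cast hp.one_lt.le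
  have hp0 : (0 : ℝ) < p := by linarith
  have : Fact (Irreducible (H.map (algebraMap (ZMod p)[X] (RatFunc (ZMod p))))) :=
    ⟨h.irreducible_map⟩
  obtain ⟨_, _, _, _, _, _, _⟩ := h.instances
  set M := h.model
  set D := M.filtration with hD
  obtain ⟨φ₀, -⟩ := M.exists_algHom h₀ h₁
  obtain ⟨hP, hP1⟩ := D.prime_ker_algHom φ₀
  obtain ⟨C, μ₀, hC⟩ := h.exists_bound_curvePoints hn h₀ h₁
  have hhom : ∀ (E : Type) [Field E] [Fintype E] [Algebra (ZMod p) E] (ψ : AddChar (ZMod p) ℂ),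
      ‖D.powerSum ψ (Module.finrank (ZMod p) E) -
        ∑ z ∈ curvePoints H E, ψ (Algebra.trace (ZMod p) E z.1)‖ ≤ w * n ^ 3 := by
    intro E _ _ _ ψ
    have := M.finite_algHom (E := E)
    have := Fintype.ofFinite (CurveRing H →ₐ[ZMod p] E)
    rw [D.powerSum_eq_sum_algHom h.pos ψ]
    exact M.norm_sum_algHom_sub_le (fun a => ψ (Algebra.trace (ZMod p) E a))
      fun a => (AddChar.norm_apply ψ _).le
  have hone : ∀ ψ : AddChar (ZMod p) ℂ,
      ‖D.powerSum ψ 1 - ∑ z ∈ curvePoints H (ZMod p), ψ z.1‖ ≤ w * n ^ 3 := by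
    intro ψ
    have h2 := hhom (ZMod p) ψ
    rw [Module.finrank_self] at h2
    simpa [Algebra.trace_self_apply] using h2
  have heven : ∀ μ, 1 ≤ μ → μ₀ ≤ μ →
      ‖D.powerSum 1 (2 * μ) - (p : ℂ) ^ (2 * μ)‖ ≤ (C + w * n ^ 3 : ℝ) * (p : ℝ) ^ μ ∧
      ∀ ψ : AddChar (ZMod p) ℂ, ψ ≠ 1 →
        ‖D.powerSum ψ (2 * μ)‖ ≤ (C + w * n ^ 3 : ℝ) * (p : ℝ) ^ μ := by
    intro μ hμ hμ₀
    have := Fintype.ofFinite (GaloisField p (2 * μ))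
    have hcard : Nat.card (GaloisField p (2 * μ)) = p ^ μ * p ^ μ := by
      rw [GaloisField.card p _ (by omega), two_mul, pow_add]
    have hQ : (w * n ^ 3 : ℝ) ≤ w * n ^ 3 * (p : ℝ) ^ μ :=
      le_mul_of_one_le_right (by positivity) (one_le_pow₀ hp1)
    obtain ⟨h2, h3⟩ := hC μ hμ₀ (GaloisField p (2 * μ)) hcard (habs _)
    have h4 := hhom (GaloisField p (2 * μ))
    rw [GaloisField.finrank p (by omega : 2 * μ ≠ 0)] at h4
    constructor
    · have h5 := h4 1
      simp only [AddChar.one_apply, Finset.sum_const, nsmul_eq_mul, mul_one] at h5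
      rw [mul_comm 2 μ, pow_mul, mul_comm μ 2]
      refine (norm_sub_le_norm_sub_add_norm_sub _ ((curvePoints H (GaloisField p (2 * μ))).card : ℂ)
        _).trans ?_
      linarith
    · intro ψ hψ
      have h5 := norm_le_norm_add_norm_sub' (D.powerSum ψ (2 * μ))
        (∑ z ∈ curvePoints H (GaloisField p (2 * μ)),
          ψ (Algebra.trace (ZMod p) (GaloisField p (2 * μ)) z.1))
      have h6 := h4 ψ
      have h7 := h3 ψ hψ
      linarith
  constructor
  · obtain ⟨C', hC'⟩ := exists_bound_of_eventually
      (S := fun j => D.powerSum 1 j - (p : ℂ) ^ j) (C := C + w * n ^ 3) (by positivity) hp1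
      fun μ h2 h3 => (heven μ h2 h3).1
    have h2 := norm_powerSum_one_le
      (fun m => D.coeffL 1 m - if m = 0 then 0 else (p : ℂ) * D.coeffL 1 (m - 1))
      (fun j => D.powerSum 1 j - (p : ℂ) ^ j) (2 * (w * n ^ 2) + 1)
      (by simp [D.coeffL_zero]) (fun m hm => ?_)
      (newton_sub_geometric _ _ _ (D.natCast_mul_coeffL 1)) hp0 hC'
    · have h3 := hone 1
      simp only [AddChar.one_apply, Finset.sum_const, nsmul_eq_mul, mul_one] at h3
      have h4 := norm_sub_norm_le ((curvePoints H (ZMod p)).card : ℂ) (p : ℂ)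
      have h5 := norm_sub_le_norm_sub_add_norm_sub ((curvePoints H (ZMod p)).card : ℂ)
        (D.powerSum 1 1) (p : ℂ)
      rw [norm_sub_rev (_ : ℂ) (D.powerSum 1 1)] at h5
      rw [Complex.norm_natCast, Complex.norm_natCast] at h4
      simp only [pow_one] at h2
      push_cast at h2
      linarith
    · obtain ⟨k, rfl⟩ : ∃ k, m = k + 1 := ⟨m - 1, by omega⟩
      have h3 := D.card_idealsOfCodim_succ h.pos hP.ne_zero hP1 (m := k) (by omega)
      rw [Nat.card_zmod] at h3
      simp only [PoleFiltration.coeffL, AddChar.one_apply, Finset.sum_const, nsmul_eq_mul, mul_one,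
        h3, Nat.add_sub_cancel, if_neg (Nat.succ_ne_zero k)]
      push_cast
      ring
  · intro ψ hψ
    obtain ⟨C', hC'⟩ := exists_bound_of_eventually (S := D.powerSum ψ) (C := C + w * n ^ 3)
      (by positivity) hp1 fun μ h2 h3 => (heven μ h2 h3).2 ψ hψ
    have h2 := norm_powerSum_one_le (D.coeffL ψ) (D.powerSum ψ) (2 * (w * n ^ 2))
      (D.coeffL_zero ψ) (fun m hm => D.sum_traceOf_eq_zero h.cast_ne_zero ψ hψ hm)
      (D.natCast_mul_coeffL ψ) hp0 hC'
    have h3 := hone ψ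
    have h4 := norm_le_norm_add_norm_sub (D.powerSum ψ 1) (∑ z ∈ curvePoints H (ZMod p), ψ z.1)
    push_cast at h2
    linarith

end IsCurve

end

section

open Polynomial

section WeightedDegree

variable {F : Type*} [Field F]

/-- The substitution `X ↦ X S ^ a`, `Y ↦ Y S ^ b`, with values in polynomials in `S`. -/
noncomputable def weightHom (F : Type*) [Field F] (a b : ℕ) : F[X][X] →+* F[X][X][X] :=
  eval₂RingHom (S := F[X][X][X]) (eval₂RingHom (S := F[X][X][X])
    (((C : F[X][X] →+* F[X][X][X]).comp (C : F[X] →+* F[X][X])).comp (C : F →+* F[X]))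
    (C (C Polynomial.X) * Polynomial.X ^ a)) (C Polynomial.X * Polynomial.X ^ b)

theorem coeff_weightHom (a b : ℕ) (G : F[X][X]) (n i j : ℕ) :
    (((weightHom F a b G).coeff n).coeff i).coeff j =
      if a * j + b * i = n then (G.coeff i).coeff j else 0 := by
  induction G using Polynomial.induction_on' with
  | add G₁ G₂ h₁ h₂ =>
    simp only [map_add, coeff_add, h₁, h₂]
    split_ifs <;> simp
  | monomial i' g =>
    induction g using Polynomial.induction_on' with
    | add g₁ g₂ h₁ h₂ =>
      simp only [map_add, coeff_add, h₁, h₂]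
      split_ifs <;> simp
    | monomial j' c =>
      have h1 : weightHom F a b (monomial i' (monomial j' c)) =
          C (monomial i' (monomial j' c)) * Polynomial.X ^ (a * j' + b * i') := by
        simp only [← C_mul_X_pow_eq_monomial, weightHom, coe_eval₂RingHom, eval₂_mul, eval₂_pow, eval₂_X, eval₂_C, RingHom.coe_comp,
          Function.comp_apply, map_mul, map_pow, mul_pow, ← pow_mul, pow_add]
        ring
      rw [h1, coeff_C_mul, coeff_X_pow, mul_ite, mul_one, mul_zero]
      by_cases hi : i' = i
      · by_cases hj : j' = j
        · subst hi hj
          simp only [eq_comm (a := n)]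
          split_ifs <;> simp
        · split_ifs <;> simp [coeff_monomial, hi, hj]
      · split_ifs <;> simp [coeff_monomial, hi]

theorem weightHom_injective (a b : ℕ) : Function.Injective (weightHom F a b) := by
  rw [injective_iff_map_eq_zero]
  intro G h
  ext i j
  have h1 := coeff_weightHom a b G (a * j + b * i) i j
  rw [h] at h1
  simpa using h1.symm

/-- The weighted degree in which `X` has weight `a` and `Y` has weight `b`. -/
noncomputable def weightedDegree (a b : ℕ) (G : F[X][X]) : ℕ := (weightHom F a b G).natDegree

theorem weightedDegree_mul (a b : ℕ) {G₁ G₂ : F[X][X]} (h₁ : G₁ ≠ 0) (h₂ : G₂ ≠ 0) :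
    weightedDegree a b (G₁ * G₂) = weightedDegree a b G₁ + weightedDegree a b G₂ := by
  rw [weightedDegree, map_mul, natDegree_mul]
  · rfl
  · exact (map_ne_zero_iff _ (weightHom_injective a b)).2 h₁
  · exact (map_ne_zero_iff _ (weightHom_injective a b)).2 h₂

theorem le_weightedDegree (a b : ℕ) {G : F[X][X]} {i j : ℕ} (h : (G.coeff i).coeff j ≠ 0) :
    a * j + b * i ≤ weightedDegree a b G := by
  refine le_natDegree_of_ne_zero fun h1 => h ?_
  have h2 := coeff_weightHom a b G (a * j + b * i) i j
  rw [h1] at h2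
  simpa using h2.symm

theorem weightedDegree_le (a b : ℕ) {G : F[X][X]} {n : ℕ}
    (h : ∀ i j, (G.coeff i).coeff j ≠ 0 → a * j + b * i ≤ n) : weightedDegree a b G ≤ n := by
  refine natDegree_le_iff_coeff_eq_zero.2 fun m hm => ?_
  ext i j
  rw [coeff_weightHom]
  split_ifs with h1
  · by_contra h2
    have := h i j h2
    omega
  · rfl

theorem Polynomial.Monic.le_weightedDegree {G : F[X][X]} (hG : G.Monic) (a b : ℕ) :
    b * G.natDegree ≤ weightedDegree a b G := by
  have := _root_.le_weightedDegree a b (G := G) (i := G.natDegree) (j := 0)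
    (by rw [hG.coeff_natDegree]; simp)
  simpa using this

/-- A polynomial `P(Y) - Q(X)` with `P` monic whose degree is coprime to that of `Q` is
irreducible. -/
theorem irreducible_map_C_sub_C {P Q : F[X]} (hP : P.Monic) (hQ : Q.natDegree ≠ 0)
    (h : P.natDegree.Coprime Q.natDegree) (hP0 : P.natDegree ≠ 0) :
    Irreducible (P.map C - C Q : F[X][X]) := by
  set l := P.natDegree with hl
  set k := Q.natDegree with hk
  have hdeg : (C Q : F[X][X]).degree < (P.map C : F[X][X]).degree := by
    refine degree_C_le.trans_lt ?_
    rw [degree_map_eq_of_injective C_injective, degree_eq_natDegree hP.ne_zero]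
    exact_mod_cast Nat.pos_of_ne_zero hP0
  have hmon : (P.map C - C Q : F[X][X]).Monic := (hP.map C).sub_of_left hdeg
  have hnat : (P.map C - C Q : F[X][X]).natDegree = l := by
    rw [natDegree_sub_eq_left_of_natDegree_lt, hP.natDegree_map]
    rw [natDegree_C, hP.natDegree_map]
    exact Nat.pos_of_ne_zero hP0
  refine (hmon.irreducible_iff_natDegree).2 ⟨fun h1 => ?_, fun A B hA hB hAB => ?_⟩
  · rw [h1, natDegree_one] at hnat
    exact hP0 hnat.symm
  have hw : weightedDegree l k (P.map C - C Q : F[X][X]) ≤ k * l := by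
    refine weightedDegree_le _ _ fun i j hij => ?_
    rw [coeff_sub, coeff_map, coeff_C, coeff_sub, coeff_C] at hij
    by_cases hj : j = 0
    · have hi : i ≤ l := by
        rw [← hnat]
        refine le_natDegree_of_ne_zero fun h0 => hij ?_
        have := congrArg (fun f : F[X] => f.coeff j) h0
        simpa [coeff_C] using this
      rw [hj, mul_zero, zero_add]
      exact Nat.mul_le_mul_left _ hi
    · rw [if_neg hj, zero_sub, neg_ne_zero] at hij
      by_cases hi : i = 0
      · rw [if_pos hi] at hij
        rw [hi, mul_zero, add_zero, mul_comm]
        exact Nat.mul_le_mul_right _ (le_natDegree_of_ne_zero hij)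
      · simp [hi] at hij
  rw [← hAB, weightedDegree_mul _ _ hA.ne_zero hB.ne_zero] at hw
  have hA1 := hA.le_weightedDegree l k
  have hB1 := hB.le_weightedDegree l k
  have hsum : A.natDegree + B.natDegree = l := by rw [← hA.natDegree_mul hB, hAB, hnat]
  have h0 : A.coeff 0 * B.coeff 0 = C (P.coeff 0) - Q := by
    rw [← mul_coeff_zero, hAB]
    simp
  have hQd : (C (P.coeff 0) - Q).natDegree = k := by
    rw [natDegree_sub_eq_right_of_natDegree_lt]
    rw [natDegree_C]
    exact Nat.pos_of_ne_zero hQ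
  have hne : A.coeff 0 * B.coeff 0 ≠ 0 := fun h1 => by
    rw [← h0, h1, natDegree_zero] at hQd
    exact hQ hQd.symm
  have hA0 := left_ne_zero_of_mul hne
  have hB0 := right_ne_zero_of_mul hne
  rw [← h0, natDegree_mul hA0 hB0] at hQd
  have hA2 := le_weightedDegree l k (G := A) (i := 0) (j := (A.coeff 0).natDegree)
    (by rwa [coeff_natDegree, leadingCoeff_ne_zero])
  have hB2 := le_weightedDegree l k (G := B) (i := 0) (j := (B.coeff 0).natDegree)
    (by rwa [coeff_natDegree, leadingCoeff_ne_zero])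
  have h3 : k * A.natDegree + k * B.natDegree = k * l := by rw [← mul_add, hsum]
  have h4 : l * (A.coeff 0).natDegree + l * (B.coeff 0).natDegree = k * l := by
    rw [← mul_add, hQd, mul_comm]
  have h5 : k * A.natDegree = l * (A.coeff 0).natDegree := by
    generalize k * A.natDegree = x1 at *
    generalize k * B.natDegree = x2 at *
    generalize l * (A.coeff 0).natDegree = x3 at *
    generalize l * (B.coeff 0).natDegree = x4 at *
    omega
  have h6 : l ∣ A.natDegree := h.dvd_of_dvd_mul_left ⟨_, h5⟩
  rcases Nat.eq_zero_or_pos A.natDegree with h7 | h7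
  · exact Or.inl h7
  · right
    have := Nat.le_of_dvd h7 h6
    omega

end WeightedDegree

end

section

open Polynomial

/-- For `k` prime, the only rational linear relations between the `k`-th roots of unity are the
multiples of the vanishing of their sum. -/
theorem eq_of_sum_mul_addChar_eq_zero {k : ℕ} [Fact k.Prime] {ψ : AddChar (ZMod k) ℂ} (hψ : ψ ≠ 1)
    {c : ZMod k → ℚ} (h : ∑ a, (c a : ℂ) * ψ a = 0) (a b : ZMod k) : c a = c b := by
  have hk : k.Prime := Fact.out
  have hψ1 : ∀ a : ZMod k, ψ a = ψ 1 ^ a.val := fun a => by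
    rw [← AddChar.map_nsmul_eq_pow, nsmul_one, ZMod.natCast_zmod_val]
  have hω : IsPrimitiveRoot (ψ 1) k := by
    refine IsPrimitiveRoot.of_map_of_injective (f := MonoidHom.id ℂ) ?_ Function.injective_id
    rw [MonoidHom.id_apply, IsPrimitiveRoot.iff_orderOf]
    refine orderOf_eq_prime ?_ fun h1 => hψ ?_
    · rw [← AddChar.map_nsmul_eq_pow, nsmul_one, ZMod.natCast_self, AddChar.map_zero_eq_one]
    · ext a
      rw [hψ1, h1, one_pow, AddChar.one_apply]
  suffices ∀ a, c a = c (-1) from (this a).trans (this b).symm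
  set R : ℚ[X] := ∑ a : ZMod k, monomial a.val (c a - c (-1)) with hR
  have hval : (-1 : ZMod k).val = k - 1 := by
    obtain ⟨m, rfl⟩ : ∃ m, k = m + 1 := ⟨k - 1, by have := hk.pos; omega⟩
    exact ZMod.val_neg_one m
  have hcoeff : ∀ a : ZMod k, R.coeff a.val = c a - c (-1) := fun a => by
    rw [hR, finsetSum_coeff]
    simp only [coeff_monomial]
    rw [Finset.sum_eq_single a]
    · simp
    · intro b _ hb
      rw [if_neg fun h1 => hb (ZMod.val_injective k h1)]
    · simp
  have hR0 : R = 0 := by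
    by_contra hR0
    have hroot : aeval (ψ 1) R = 0 := by
      rw [hR, map_sum]
      simp only [aeval_monomial, ← hψ1, map_sub, sub_mul, Finset.sum_sub_distrib, ← Finset.mul_sum]
      rw [AddChar.sum_eq_zero_of_ne_one hψ, mul_zero, sub_zero]
      simpa using h
    have h1 := natDegree_le_natDegree (minpoly.degree_le_of_ne_zero ℚ (ψ 1) hR0 hroot)
    rw [← cyclotomic_eq_minpoly_rat hω hk.pos, natDegree_cyclotomic, Nat.totient_prime hk] at h1
    have h2 : R.natDegree ≤ k - 1 := by
      rw [hR]
      refine natDegree_sum_le_of_forall_le _ _ fun a _ => (natDegree_monomial_le _).trans ?_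
      have := a.val_lt
      omega
    have h3 : R.coeff (k - 1) = 0 := by rw [← hval, hcoeff, sub_self]
    exact hR0 (leadingCoeff_eq_zero.1 (by rw [leadingCoeff, le_antisymm h2 h1, h3]))
  intro a
  rw [← sub_eq_zero, ← hcoeff, hR0, coeff_zero]

/-- A circulant `0`-`1` matrix of prime order, with zero diagonal, has a rational eigenvector
modulo constants only if it is trivial. -/
theorem card_eq_of_circulant {k : ℕ} [Fact k.Prime] {Z : Finset (ZMod k)} (hZ : 0 ∉ Z)
    {v : ZMod k → ℚ} (hv : ∃ a b, v a ≠ v b) {e e' : ℚ}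
    (h : ∀ b, ∑ a ∈ Z, v (a + b) = e * v b + e') : Z.card = 0 ∨ Z.card = k - 1 := by
  classical
  obtain ⟨ψ, hψ⟩ : ∃ ψ : AddChar (ZMod k) ℂ, ψ ≠ 1 := by
    have : Nontrivial (AddChar (ZMod k) ℂ) := by
      rw [← Fintype.one_lt_card_iff_nontrivial, AddChar.card_eq, ZMod.card]
      exact (Fact.out : k.Prime).one_lt
    exact exists_ne 1
  have hv0 : ∑ b, (v b : ℂ) * ψ b ≠ 0 := fun h1 => by
    obtain ⟨a, b, hab⟩ := hv
    exact hab (eq_of_sum_mul_addChar_eq_zero hψ h1 a b)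
  have h1 : (∑ a ∈ Z, ψ (-a)) * ∑ b, (v b : ℂ) * ψ b = e * ∑ b, (v b : ℂ) * ψ b := by
    calc (∑ a ∈ Z, ψ (-a)) * ∑ b, (v b : ℂ) * ψ b
        = ∑ a ∈ Z, ∑ b, (v (a + b) : ℂ) * ψ b := by
          rw [Finset.sum_mul]
          refine Finset.sum_congr rfl fun a _ => ?_
          rw [← Equiv.sum_comp (Equiv.addLeft a), Finset.mul_sum]
          refine Finset.sum_congr rfl fun b _ => ?_
          rw [Equiv.coe_addLeft, AddChar.map_add_eq_mul, mul_left_comm, ← mul_assoc (ψ (-a)),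
            ← AddChar.map_add_eq_mul, neg_add_cancel, AddChar.map_zero_eq_one, one_mul]
      _ = ∑ b, ((e * v b + e' : ℚ) : ℂ) * ψ b := by
          rw [Finset.sum_comm]
          refine Finset.sum_congr rfl fun b _ => ?_
          rw [← Finset.sum_mul, ← h b]
          push_cast
          rfl
      _ = e * ∑ b, (v b : ℂ) * ψ b + e' * ∑ b, ψ b := by
          rw [Finset.mul_sum, Finset.mul_sum, ← Finset.sum_add_distrib]
          refine Finset.sum_congr rfl fun b _ => ?_
          push_cast
          ring
      _ = _ := by rw [AddChar.sum_eq_zero_of_ne_one hψ, mul_zero, add_zero]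
  have h2 : ∑ a, (((if -a ∈ Z then 1 else 0) - (if a = 0 then e else 0) : ℚ) : ℂ) * ψ a = 0 := by
    push_cast
    simp only [apply_ite (fun x : ℚ => (x : ℂ)), Rat.cast_one, Rat.cast_zero, sub_mul, Finset.sum_sub_distrib, ite_mul, one_mul, zero_mul]
    rw [Finset.sum_ite_eq' Finset.univ, if_pos (Finset.mem_univ _), AddChar.map_zero_eq_one,
      mul_one, ← mul_right_cancel₀ hv0 h1, sub_eq_zero, ← Equiv.sum_comp (Equiv.neg (ZMod k))]
    simp [Finset.sum_ite_mem]
  have h3 := eq_of_sum_mul_addChar_eq_zero hψ h2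
  by_cases hZe : Z = ∅
  · left
    rw [hZe, Finset.card_empty]
  · right
    obtain ⟨a, ha⟩ := Finset.nonempty_of_ne_empty hZe
    have hZ' : Z = Finset.univ.erase 0 := by
      ext b
      rw [Finset.mem_erase, and_iff_left (Finset.mem_univ b)]
      refine ⟨fun hb h0 => hZ (h0 ▸ hb), fun hb => ?_⟩
      by_contra hbZ
      have := h3 (-a) (-b)
      have ha0 : a ≠ 0 := fun h0 => hZ (h0 ▸ ha)
      simp [ha, hb, hbZ, ha0] at this
    rw [hZ', Finset.card_erase_of_mem (Finset.mem_univ _), Finset.card_univ, ZMod.card]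

end

section

open Polynomial

theorem Polynomial.Monic.eq_prod_filter_X_sub_C {K ι : Type*} [Field K] {y : ι → K}
    (hy : Function.Injective y) {S : Finset ι} {A : K[X]} (hA : A.Monic)
    (h : A ∣ ∏ a ∈ S, (Polynomial.X - C (y a))) [DecidablePred fun a => A.eval (y a) = 0] :
    A = ∏ a ∈ S with A.eval (y a) = 0, (Polynomial.X - C (y a)) := by
  have hne : ∏ a ∈ S, (Polynomial.X - C (y a)) ≠ 0 := (monic_prod_X_sub_C y S).ne_zero
  have hsplit : A.Splits :=
    (Splits.prod fun a _ => Splits.X_sub_C (y a)).of_dvd hne h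
  have hroots : A.roots = (S.filter fun a => A.eval (y a) = 0).val.map y := by
    have h1 : (∏ a ∈ S, (Polynomial.X - C (y a))).roots = S.val.map y :=
      roots_multiset_prod_X_sub_C (S.val.map y) ▸ by rw [Multiset.map_map]; rfl
    have h2 := roots.le_of_dvd hne h
    rw [h1] at h2
    have h3 : (S.val.map y).Nodup := S.nodup.map hy
    refine (Multiset.Nodup.ext (Multiset.nodup_of_le h2 h3)
      ((Finset.nodup _).map hy)).2 fun x => ⟨fun hx => ?_, fun hx => ?_⟩
    · obtain ⟨a, ha, rfl⟩ := Multiset.mem_map.1 (Multiset.subset_of_le h2 hx)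
      exact Multiset.mem_map.2 ⟨a, Finset.mem_filter.2 ⟨ha, (mem_roots hA.ne_zero).1 hx⟩, rfl⟩
    · obtain ⟨a, ha, rfl⟩ := Multiset.mem_map.1 hx
      exact (mem_roots hA.ne_zero).2 (Finset.mem_filter.1 ha).2
  conv_lhs => rw [hsplit.eq_prod_roots_of_monic hA, hroots, Multiset.map_map]
  rfl

section CyclicRoots

variable {K : Type*} [Field K] {k : ℕ} [hk : Fact k.Prime]

/-- The roots of a separable irreducible polynomial of prime degree can be indexed by `ZMod k` in
such a way that some automorphism of the splitting field acts by translation. -/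
theorem exists_cyclic_roots {f : K[X]} (hf : Irreducible f) (hsep : f.Separable)
    (hmon : f.Monic) (hdeg : f.natDegree = k) :
    ∃ (y : ZMod k → f.SplittingField) (σ : ZMod k → f.SplittingField ≃ₐ[K] f.SplittingField),
      Function.Injective y ∧ (∀ a b, σ b (y a) = y (a + b)) ∧
      f.map (algebraMap K f.SplittingField) = ∏ a, (Polynomial.X - C (y a)) := by
  have hgal : IsGalois K f.SplittingField := IsGalois.of_separable_splitting_field hsep
  have hsplit : (f.map (algebraMap K f.SplittingField)).Splits := SplittingField.splits f
  have hdvd : k ∣ Nat.card (f.SplittingField ≃ₐ[K] f.SplittingField) := by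
    rw [IsGalois.card_aut_eq_finrank]
    obtain ⟨x, hx⟩ := hsplit.exists_eval_eq_zero
      (by rw [degree_map]; exact hf.degree_pos.ne')
    have h1 : aeval x f = 0 := by rwa [eval_map_algebraMap] at hx
    have h2 := minpoly.degree_dvd (IsIntegral.of_finite K x)
    rwa [← minpoly.eq_of_irreducible_of_monic hf h1 hmon, hdeg] at h2
  obtain ⟨τ, hτ⟩ := exists_prime_orderOf_dvd_card' k hdvd
  have hτ1 : τ ≠ 1 := fun h => by
    rw [h, orderOf_one] at hτ
    exact hk.out.one_lt.ne hτ
  obtain ⟨r, hr, hτr⟩ : ∃ r ∈ f.rootSet f.SplittingField, τ r ≠ r := by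
    by_contra! h
    exact hτ1 (Gal.ext f h)
  set σ : ZMod k → f.SplittingField ≃ₐ[K] f.SplittingField := fun a => τ ^ a.val with hσ
  have hσadd : ∀ a b, σ (a + b) = σ a * σ b := fun a b => by
    simp only [hσ]
    rw [ZMod.val_add, ← pow_add]
    have h1 := pow_mod_orderOf τ (a.val + b.val)
    rwa [hτ] at h1
  have hσ0 : σ 0 = 1 := by simp only [hσ, ZMod.val_zero, pow_zero]
  have hσ1 : σ 1 = τ := by
    simp only [hσ]
    rw [ZMod.val_one'' hk.out.one_lt.ne', pow_one]
  have hinj : Function.Injective fun a => σ a r := by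
    have key : ∀ c, σ c r = r → c = 0 := fun c hc => by
      by_contra hc0
      have h1 : ∀ n : ℕ, σ (n * c) r = r := fun n => by
        induction n with
        | zero => rw [Nat.cast_zero, zero_mul, hσ0]; rfl
        | succ n ih =>
          rw [Nat.cast_succ, add_mul, one_mul, hσadd, AlgEquiv.mul_apply, hc, ih]
      have h2 := h1 (c⁻¹).val
      rw [ZMod.natCast_zmod_val, inv_mul_cancel₀ hc0, hσ1] at h2
      exact hτr h2
    intro a b hab
    refine sub_eq_zero.1 (key (a - b) ?_)
    have h3 : σ (-b) (σ a r) = σ (-b) (σ b r) := congrArg _ hab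
    rw [← AlgEquiv.mul_apply, ← AlgEquiv.mul_apply, ← hσadd, ← hσadd, neg_add_cancel, hσ0,
      neg_add_eq_sub] at h3
    exact h3
  refine ⟨fun a => σ a r, σ, hinj, fun a b => ?_, ?_⟩
  · change σ b (σ a r) = _
    rw [← AlgEquiv.mul_apply, ← hσadd, add_comm]
  · have hroot : ∀ a, σ a r ∈ (f.map (algebraMap K f.SplittingField)).roots := fun a => by
      rw [mem_roots (hmon.map _).ne_zero, IsRoot, eval_map_algebraMap]
      have h1 := (mem_rootSet.1 hr).2
      rw [← AlgEquiv.coe_toAlgHom, aeval_algHom_apply, h1, map_zero]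
    have h1 : (Finset.univ.val.map fun a => σ a r) ≤
        (f.map (algebraMap K f.SplittingField)).roots := by
      rw [Multiset.le_iff_subset (Finset.univ.nodup.map hinj)]
      intro x hx
      obtain ⟨a, -, rfl⟩ := Multiset.mem_map.1 hx
      exact hroot a
    have h2 := (Multiset.prod_X_sub_C_dvd_iff_le_roots (hmon.map _).ne_zero _).2 h1
    rw [Multiset.map_map] at h2
    refine eq_of_monic_of_dvd_of_natDegree_le (monic_prod_X_sub_C _ Finset.univ) (hmon.map _) h2 ?_
    rw [hmon.natDegree_map, hdeg, natDegree_prod_of_monic _ _ fun a _ => monic_X_sub_C _]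
    simp [ZMod.card]

end CyclicRoots

end

section

open Polynomial

universe u

section Specialisation

variable {E : Type u} [Field E] {k : ℕ} [hk : Fact k.Prime]

theorem exists_cyclic_roots_sub_X_of_isFractionRing (K : Type u) [Field K] [Algebra E[X] K]
    [IsFractionRing E[X] K] [Algebra E K] [IsScalarTower E E[X] K] {P : E[X]} (hP : P.Monic) (hdeg : P.natDegree = k)
    (hkE : (k : E) ≠ 0) :
    ∃ (Ω : Type u) (_ : Field Ω) (_ : Algebra E Ω) (_ : Algebra E[X] Ω)
      (_ : IsScalarTower E E[X] Ω) (y : ZMod k → Ω) (σ : ZMod k → Ω ≃ₐ[E] Ω),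
      Function.Injective (algebraMap E[X] Ω) ∧ Function.Injective y ∧
      (∀ a b, σ b (y a) = y (a + b)) ∧
      P.map (algebraMap E Ω) - C (algebraMap E[X] Ω Polynomial.X) =
        ∏ a, (Polynomial.X - C (y a)) := by
  have hk0 : k ≠ 0 := hk.out.ne_zero
  set f₀ : E[X][X] := P.map C - C Polynomial.X with hf₀
  have hirr : Irreducible f₀ := irreducible_map_C_sub_C hP (by simp) (by simp) (by rwa [hdeg])
  have hdeglt : (C Polynomial.X : E[X][X]).degree < (P.map C : E[X][X]).degree := by
    refine degree_C_le.trans_lt ?_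
    rw [degree_map_eq_of_injective C_injective, degree_eq_natDegree hP.ne_zero, hdeg]
    exact_mod_cast hk.out.pos
  have hmon₀ : f₀.Monic := (hP.map C).sub_of_left hdeglt
  set f : K[X] := f₀.map (algebraMap E[X] K) with hf
  have hmon : f.Monic := hmon₀.map _
  have hfP : f = P.map (algebraMap E K) - C (algebraMap E[X] K Polynomial.X) := by
    rw [hf, hf₀, Polynomial.map_sub, map_map, map_C, ← algebraMap_eq,
      ← IsScalarTower.algebraMap_eq]
  have hfdeg : f.natDegree = k := by
    rw [hf, hmon₀.natDegree_map, hf₀, natDegree_sub_C, hP.natDegree_map, hdeg]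
  have hfirr : Irreducible f := (hmon₀.irreducible_iff_irreducible_map_fraction_map).1 hirr
  have hsep : f.Separable := by
    rw [separable_iff_derivative_ne_zero hfirr]
    intro h
    have h1 := congrArg (fun g : K[X] => g.coeff (k - 1)) h
    simp only [coeff_derivative, coeff_zero] at h1
    rw [Nat.sub_add_cancel hk.out.one_lt.le, ← hfdeg, hmon.coeff_natDegree, one_mul, hfdeg] at h1
    have h2 : ((k - 1 : ℕ) : K) + 1 = algebraMap E K k := by
      rw [map_natCast]
      exact_mod_cast congrArg (Nat.cast : ℕ → K) (Nat.sub_add_cancel hk.out.one_lt.le)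
    rw [h2] at h1
    exact hkE ((_root_.map_eq_zero _).1 h1)
  obtain ⟨y, σ, hy, hσ, hprod⟩ := exists_cyclic_roots hfirr hsep hmon hfdeg
  refine ⟨f.SplittingField, inferInstance, inferInstance, inferInstance, ?_, y,
    fun a => (σ a).restrictScalars E, ?_, hy, hσ, ?_⟩
  · refine IsScalarTower.of_algebraMap_eq fun a => ?_
    rw [IsScalarTower.algebraMap_apply E K f.SplittingField,
      IsScalarTower.algebraMap_apply E[X] K f.SplittingField,
      ← IsScalarTower.algebraMap_apply E E[X] K]
  · rw [IsScalarTower.algebraMap_eq E[X] K f.SplittingField]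
    exact (FaithfulSMul.algebraMap_injective K f.SplittingField).comp (IsFractionRing.injective E[X] K)
  · refine Eq.trans ?_
      ((congrArg (Polynomial.map (algebraMap K f.SplittingField)) hfP).symm.trans hprod)
    rw [Polynomial.map_sub, map_map, map_C, ← IsScalarTower.algebraMap_apply,
      ← IsScalarTower.algebraMap_eq]

/-- The roots of `P(Y) - t`, with `t` transcendental, are permuted cyclically by an automorphism. -/
theorem exists_cyclic_roots_sub_X {P : E[X]} (hP : P.Monic) (hdeg : P.natDegree = k)
    (hkE : (k : E) ≠ 0) :
    ∃ (Ω : Type u) (_ : Field Ω) (_ : Algebra E Ω) (_ : Algebra E[X] Ω)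
      (_ : IsScalarTower E E[X] Ω) (y : ZMod k → Ω) (σ : ZMod k → Ω ≃ₐ[E] Ω),
      Function.Injective (algebraMap E[X] Ω) ∧ Function.Injective y ∧
      (∀ a b, σ b (y a) = y (a + b)) ∧
      P.map (algebraMap E Ω) - C (algebraMap E[X] Ω Polynomial.X) =
        ∏ a, (Polynomial.X - C (y a)) :=
  exists_cyclic_roots_sub_X_of_isFractionRing (FractionRing E[X]) hP hdeg hkE

/-- The translates of the linear relation between the roots of `P(Y) - t` given by the second
coefficient of a divisor of `(P(Y) - P(X)) / (Y - X)`, specialised at `t = 0`. -/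
theorem exists_circulant_relation {P : E[X]} (hP : P.Monic) (hdeg : P.natDegree = k)
    (hkE : (k : E) ≠ 0) {A G : E[X][X]} (hA : A.Monic) (hAG : A ∣ G)
    (hG : (Polynomial.X - C Polynomial.X) * G = P.map C - C P) :
    ∃ (Z : Finset (ZMod k)) (R : Type u) (_ : CommRing R) (_ : IsDomain R) (_ : Algebra E R)
      (x : ZMod k → R), 0 ∉ Z ∧ Z.card = A.natDegree ∧
      P.map (algebraMap E R) = ∏ a, (Polynomial.X - C (x a)) ∧
      ∀ b, ∑ a ∈ Z, x (a + b) = - aeval (x b) A.nextCoeff := by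
  classical
  obtain ⟨Ω, _, _, _, _, y, σ, hinj, hy, hσ, hprod⟩ := exists_cyclic_roots_sub_X hP hdeg hkE
  set t : Ω := algebraMap E[X] Ω Polynomial.X with ht
  have hroot : ∀ a, aeval (y a) P = t := fun a => by
    have h1 := congrArg (eval (y a)) hprod
    rw [eval_prod, Finset.prod_eq_zero (Finset.mem_univ a) (by simp), eval_sub, eval_C,
      eval_map_algebraMap, sub_eq_zero] at h1
    exact h1
  set φ : ZMod k → E[X] →+* Ω := fun b => (aeval (y b) : E[X] →ₐ[E] Ω).toRingHom with hφ
  have hφX : ∀ b, φ b Polynomial.X = y b := fun b => aeval_X _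
  have hφC : ∀ b, (φ b).comp C = algebraMap E Ω := fun b => by
    ext a
    simp [hφ]
  have hGy : ∀ b, G.map (φ b) = ∏ a ∈ Finset.univ.erase b, (Polynomial.X - C (y a)) := fun b => by
    have h1 := congrArg (Polynomial.map (φ b)) hG
    rw [Polynomial.map_mul, Polynomial.map_sub, Polynomial.map_sub, map_X, map_C, map_C, hφX,
      map_map, hφC, show φ b P = t from hroot b, hprod,
      ← Finset.mul_prod_erase _ _ (Finset.mem_univ b)] at h1
    exact mul_left_cancel₀ (X_sub_C_ne_zero _) h1
  set Z : Finset (ZMod k) := {a ∈ Finset.univ.erase 0 | (A.map (φ 0)).eval (y a) = 0} with hZ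
  have hA0 : A.map (φ 0) = ∏ a ∈ Z, (Polynomial.X - C (y a)) :=
    (hA.map _).eq_prod_filter_X_sub_C hy (by rw [← hGy]; exact Polynomial.map_dvd _ hAG)
  have hAb : ∀ b, A.map (φ b) = ∏ a ∈ Z, (Polynomial.X - C (y (a + b))) := fun b => by
    have h1 := congrArg (Polynomial.map (σ b : Ω →+* Ω)) hA0
    rw [map_map, Polynomial.map_prod] at h1
    have h2 : (σ b : Ω →+* Ω).comp (φ 0) = φ b := by
      refine Polynomial.ringHom_ext (fun a => ?_) ?_
      · simp [hφ]
      · simp [hφ, hσ]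
    rw [h2] at h1
    rw [h1]
    refine Finset.prod_congr rfl fun a _ => ?_
    rw [Polynomial.map_sub, map_X, map_C]
    exact congrArg (fun z => Polynomial.X - C z) (hσ a b)
  have hrel : ∀ b, ∑ a ∈ Z, y (a + b) = - aeval (y b) A.nextCoeff := fun b => by
    have h1 := congrArg nextCoeff (hAb b)
    rw [prod_X_sub_C_nextCoeff, nextCoeff_map_of_leadingCoeff_ne_zero _ (by simp [hA])] at h1
    rw [eq_neg_iff_add_eq_zero, add_comm, ← eq_neg_iff_add_eq_zero]
    exact h1
  have hint : ∀ a, IsIntegral E[X] (y a) := fun a => by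
    refine ⟨P.map C - C Polynomial.X, (hP.map C).sub_of_left ?_, ?_⟩
    · refine degree_C_le.trans_lt ?_
      rw [degree_map_eq_of_injective C_injective, degree_eq_natDegree hP.ne_zero, hdeg]
      exact_mod_cast hk.out.pos
    · rw [← eval_map, Polynomial.map_sub, map_map, map_C, ← algebraMap_eq,
        ← IsScalarTower.algebraMap_eq, hprod, eval_prod,
        Finset.prod_eq_zero (Finset.mem_univ a) (by simp)]
  set O := integralClosure E[X] Ω with hO
  set z : ZMod k → O := fun a => ⟨y a, hint a⟩ with hz
  have hprime : (Ideal.span {(Polynomial.X : E[X])}).IsPrime :=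
    (Ideal.span_singleton_prime X_ne_zero).2 prime_X
  obtain ⟨Q, hQ, hQX⟩ := Ideal.exists_ideal_over_prime_of_isIntegral_of_isDomain (S := O)
    (Ideal.span {(Polynomial.X : E[X])}) (by
      rw [(RingHom.injective_iff_ker_eq_bot _).1]
      · exact bot_le
      · exact (FaithfulSMul.algebraMap_injective O Ω).of_comp_iff _ |>.1 hinj)
  have htQ : algebraMap E[X] O Polynomial.X ∈ Q := by
    rw [← Ideal.mem_comap, hQX]
    exact Ideal.mem_span_singleton_self _
  have hprodO : P.map (algebraMap E O) - C (algebraMap E[X] O Polynomial.X) =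
      ∏ a, (Polynomial.X - C (z a)) := by
    refine Polynomial.map_injective (algebraMap O Ω) (FaithfulSMul.algebraMap_injective O Ω) ?_
    rw [Polynomial.map_prod, Polynomial.map_sub, map_map, map_C]
    simp only [Polynomial.map_sub, map_X, map_C]
    exact hprod
  have hrelO : ∀ b, ∑ a ∈ Z, z (a + b) = - aeval (z b) A.nextCoeff := fun b => by
    refine FaithfulSMul.algebraMap_injective O Ω ?_
    rw [map_sum, map_neg, ← aeval_algebraMap_apply]
    exact hrel b
  refine ⟨Z, O ⧸ Q, inferInstance, inferInstance, inferInstance,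
    fun a => Ideal.Quotient.mk Q (z a), by simp [hZ], ?_, ?_, fun b => ?_⟩
  · rw [← hA.natDegree_map (φ 0), hA0, natDegree_prod_of_monic _ _ fun a _ => monic_X_sub_C _]
    simp
  · have h1 := congrArg (Polynomial.map (Ideal.Quotient.mk Q)) hprodO
    rw [Polynomial.map_prod, Polynomial.map_sub, map_map, map_C,
      Ideal.Quotient.eq_zero_iff_mem.2 htQ, C_0, sub_zero] at h1
    simp only [Polynomial.map_sub, map_X, map_C] at h1
    exact h1
  · have h1 := congrArg (Ideal.Quotient.mkₐ E Q) (hrelO b)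
    rw [map_sum, map_neg, ← aeval_algHom_apply] at h1
    exact h1

end Specialisation

end

section

open Polynomial

/-- The polynomial `(X + 1) ⋯ (X + k)`. -/
noncomputable def shiftedRising (R : Type*) [CommRing R] (k : ℕ) : R[X] :=
  ∏ i ∈ Finset.range k, (Polynomial.X + C ((i : R) + 1))

section ShiftedRising

variable (R : Type*) [CommRing R] (k : ℕ)

theorem monic_shiftedRising : (shiftedRising R k).Monic :=
  monic_prod_of_monic _ _ fun _ _ => monic_X_add_C _

theorem natDegree_shiftedRising [Nontrivial R] : (shiftedRising R k).natDegree = k := by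
  rw [shiftedRising, natDegree_prod_of_monic _ _ fun i _ => monic_X_add_C _,
    Finset.sum_congr rfl fun i _ => natDegree_X_add_C _]
  simp

theorem map_shiftedRising {S : Type*} [CommRing S] (f : R →+* S) :
    (shiftedRising R k).map f = shiftedRising S k := by
  simp [shiftedRising, Polynomial.map_prod]

theorem eval_shiftedRising (x : R) :
    (shiftedRising R k).eval x = ∏ i ∈ Finset.range k, (x + ((i : R) + 1)) := by
  simp [shiftedRising, eval_prod]

theorem eval_shiftedRising_natCast_mul_factorial (n : ℕ) :
    (shiftedRising R k).eval (n : R) * n.factorial = ((n + k).factorial : ℕ) := by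
  rw [eval_shiftedRising]
  induction k with
  | zero => simp
  | succ k ih =>
    rw [Finset.prod_range_succ, mul_right_comm, ih, ← add_assoc, ← add_assoc n k 1, Nat.factorial_succ]
    push_cast
    ring

end ShiftedRising

universe u

section Residual

variable {E : Type u} [Field E] {p : ℕ} [CharP E p] {k : ℕ} [hk : Fact k.Prime]

/-- A factor of `(P(Y) - P(X)) / (Y - X)` with `P = (X + 1) ⋯ (X + k)`, all of whose monomials are
of total degree at most the degree in `Y`, has trivial degree. -/
theorem natDegree_eq_of_dvd_residual (hp : 3 * k ^ 3 < p) {A G : E[X][X]}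
    (hA : A.Monic) (hAG : A ∣ G) (hA1 : A.nextCoeff.natDegree ≤ 1)
    (hG : (Polynomial.X - C Polynomial.X) * G = (shiftedRising E k).map C - C (shiftedRising E k)) :
    A.natDegree = 0 ∨ A.natDegree = k - 1 := by
  have hk2 := hk.out.two_le
  have hkp : k < p := by nlinarith [Nat.pow_le_pow_left hk2 2]
  have hkE : (k : E) ≠ 0 := fun h => by
    have h1 := (CharP.cast_eq_zero_iff E p k).1 h
    exact absurd (Nat.le_of_dvd hk.out.pos h1) (by omega)
  obtain ⟨Z, R, _, _, _, x, hZ0, hZA, hprod, hrel⟩ := exists_circulant_relation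
    (monic_shiftedRising E k) (natDegree_shiftedRising E k) hkE hA hAG hG
  have : CharP R p := charP_of_injective_algebraMap (algebraMap E R).injective p
  rw [map_shiftedRising] at hprod
  have hf : ∀ a, ∃ i < k, x a = -((i : R) + 1) := fun a => by
    have h1 := congrArg (eval (x a)) hprod
    rw [eval_shiftedRising, eval_prod, Finset.prod_eq_zero (Finset.mem_univ a) (by simp),
      Finset.prod_eq_zero_iff] at h1
    obtain ⟨i, hi, h2⟩ := h1
    exact ⟨i, Finset.mem_range.1 hi, eq_neg_of_add_eq_zero_left h2⟩
  choose f hfk hxf using hf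
  have hinj : ∀ i < k, ∀ j < k, (i : R) = j → i = j := fun i hi j hj h => by
    have := (CharP.natCast_eq_natCast R p).1 h
    rwa [Nat.ModEq, Nat.mod_eq_of_lt (hi.trans hkp), Nat.mod_eq_of_lt (hj.trans hkp)] at this
  have hsurj : ∀ i < k, ∃ a, f a = i := fun i hi => by
    have h1 := congrArg (eval (-((i : R) + 1))) hprod
    rw [eval_shiftedRising, eval_prod,
      Finset.prod_eq_zero (Finset.mem_range.2 hi) (neg_add_cancel _)] at h1
    obtain ⟨a, -, ha⟩ := Finset.prod_eq_zero_iff.1 h1.symm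
    refine ⟨a, (hinj i hi _ (hfk a) ?_).symm⟩
    rw [eval_sub, eval_X, eval_C, hxf, sub_eq_zero, neg_inj] at ha
    exact add_right_cancel ha
  obtain ⟨α, β, hαβ⟩ : ∃ α β : R, ∀ b, ((∑ a ∈ Z, f (a + b) : ℕ) : R) = α * f b + β := by
    obtain ⟨c, d, hcd⟩ := exists_eq_X_add_C_of_natDegree_le_one hA1
    refine ⟨- algebraMap E R c, algebraMap E R d - algebraMap E R c - Z.card, fun b => ?_⟩
    have h1 := hrel b
    rw [hcd] at h1
    simp only [hxf, map_add, map_mul, aeval_C, aeval_X, Finset.sum_neg_distrib,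
      Finset.sum_add_distrib, Finset.sum_const, nsmul_eq_mul, mul_one] at h1
    push_cast
    linear_combination -h1
  obtain ⟨b₀, hb₀⟩ := hsurj 0 (by omega)
  obtain ⟨b₁, hb₁⟩ := hsurj 1 (by omega)
  set s : ZMod k → ℕ := fun b => ∑ a ∈ Z, f (a + b) with hs
  have hsle : ∀ b, s b ≤ k * k := fun b => by
    refine (Finset.sum_le_card_nsmul Z _ k fun a _ => (hfk _).le).trans ?_
    rw [smul_eq_mul]
    refine Nat.mul_le_mul_right _ ((Finset.card_le_univ Z).trans ?_)
    rw [ZMod.card]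
  have hint : ∀ b, (s b : ℤ) = ((s b₁ : ℤ) - s b₀) * f b + s b₀ := fun b => by
    have h0 := hαβ b₀
    have h1 := hαβ b₁
    have h2 := hαβ b
    change ((s b₀ : ℕ) : R) = _ at h0
    change ((s b₁ : ℕ) : R) = _ at h1
    change ((s b : ℕ) : R) = _ at h2
    rw [hb₀] at h0
    rw [hb₁] at h1
    have h3 : (((s b : ℤ) - (((s b₁ : ℤ) - s b₀) * f b + s b₀) : ℤ) : R) = 0 := by
      push_cast
      rw [h0, h1, h2]
      push_cast
      ring
    rw [CharP.intCast_eq_zero_iff R p] at h3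
    rw [← sub_eq_zero]
    refine Int.eq_zero_of_abs_lt_dvd h3 ?_
    have e0 : (s b₀ : ℤ) ≤ k * k := by exact_mod_cast hsle b₀
    have e1 : (s b₁ : ℤ) ≤ k * k := by exact_mod_cast hsle b₁
    have e2 : (s b : ℤ) ≤ k * k := by exact_mod_cast hsle b
    have e3 : (f b : ℤ) ≤ k := by exact_mod_cast (hfk b).le
    have e4 : (3 * k ^ 3 : ℤ) < p := by exact_mod_cast hp
    have e5 : (2 : ℤ) ≤ k := by exact_mod_cast hk2
    have e6 : |((s b₁ : ℤ) - s b₀) * f b| ≤ k * k * k := by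
      rw [abs_mul, Nat.abs_cast]
      refine mul_le_mul (abs_le.2 ⟨by omega, by omega⟩) e3 (by positivity) (by positivity)
    have e7 : (k * k : ℤ) * 2 ≤ k * k * k := mul_le_mul_of_nonneg_left e5 (by positivity)
    have e8 : (k ^ 3 : ℤ) = k * k * k := by ring
    rw [e8] at e4
    have e9 : (0 : ℤ) < k * k := by positivity
    rw [abs_le] at e6
    rw [abs_lt]
    generalize ((s b₁ : ℤ) - s b₀) * f b = u at *
    generalize (k * k * k : ℤ) = v at *
    generalize (k * k : ℤ) = w at *
    constructor <;> omega
  rw [← hZA]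
  refine card_eq_of_circulant hZ0 (v := fun a => (f a : ℚ)) ⟨b₀, b₁, by simp [hb₀, hb₁]⟩
    (e := (s b₁ : ℚ) - s b₀) (e' := s b₀) fun b => ?_
  have h1 := congrArg (Int.cast : ℤ → ℚ) (hint b)
  push_cast at h1
  rw [← h1, hs]
  push_cast
  rfl

variable {G : E[X][X]}

theorem weightedDegree_residual_le (hGm : G.Monic)
    (hG : (Polynomial.X - C Polynomial.X) * G = (shiftedRising E k).map C - C (shiftedRising E k)) :
    weightedDegree 1 1 G ≤ k - 1 := by
  have h1 : weightedDegree 1 1 ((shiftedRising E k).map C - C (shiftedRising E k)) ≤ k := by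
    refine weightedDegree_le _ _ fun i j hij => ?_
    rw [coeff_sub, coeff_map, coeff_C, coeff_sub, coeff_C] at hij
    by_cases hj : j = 0
    · by_cases hi : i = 0
      · omega
      · have : (shiftedRising E k).coeff i ≠ 0 := fun h0 => hij (by simp [h0, hi])
        have := le_natDegree_of_ne_zero this
        rw [natDegree_shiftedRising] at this
        omega
    · rw [if_neg hj, zero_sub, neg_ne_zero] at hij
      by_cases hi : i = 0
      · rw [if_pos hi] at hij
        have := le_natDegree_of_ne_zero hij
        rw [natDegree_shiftedRising] at this
        omega
      · simp [hi] at hij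
  rw [← hG, weightedDegree_mul _ _ (X_sub_C_ne_zero _) hGm.ne_zero] at h1
  have h2 := (monic_X_sub_C (Polynomial.X : E[X])).le_weightedDegree 1 1
  rw [natDegree_X_sub_C] at h2
  omega

theorem irreducible_residual (hp : 3 * k ^ 3 < p) (hk3 : 3 ≤ k)
    (hGm : G.Monic) (hGd : G.natDegree = k - 1)
    (hG : (Polynomial.X - C Polynomial.X) * G = (shiftedRising E k).map C - C (shiftedRising E k)) :
    Irreducible G := by
  refine hGm.irreducible_iff_natDegree.2 ⟨fun h => ?_, fun A B hA hB hAB => ?_⟩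
  · rw [h, natDegree_one] at hGd
    omega
  have hw := weightedDegree_residual_le hGm hG
  rw [← hAB, weightedDegree_mul _ _ hA.ne_zero hB.ne_zero] at hw
  have hA1 := hA.le_weightedDegree 1 1
  have hB1 := hB.le_weightedDegree 1 1
  have hsum : A.natDegree + B.natDegree = k - 1 := by rw [← hA.natDegree_mul hB, hAB, hGd]
  by_cases hA0 : A.natDegree = 0
  · exact Or.inl hA0
  have hnext : A.nextCoeff.natDegree ≤ 1 := by
    rw [nextCoeff_of_natDegree_pos (Nat.pos_of_ne_zero hA0)]
    refine natDegree_le_iff_coeff_eq_zero.2 fun j hj => ?_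
    by_contra h
    have := le_weightedDegree 1 1 h
    omega
  rcases natDegree_eq_of_dvd_residual hp hA ⟨B, hAB.symm⟩ hnext hG with h | h
  · exact Or.inl h
  · right
    omega

end Residual

end

section

open Polynomial

theorem natDegree_le_weightedDegree {F : Type*} [Field F] (G : F[X][X]) :
    G.natDegree ≤ weightedDegree 1 1 G := by
  by_cases hG : G = 0
  · simp [hG]
  have h1 : (G.coeff G.natDegree).coeff (G.coeff G.natDegree).natDegree ≠ 0 := by
    rwa [coeff_natDegree, coeff_natDegree, leadingCoeff_ne_zero, leadingCoeff_ne_zero]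
  have := le_weightedDegree 1 1 h1
  omega

theorem natDegree_coeff_le_of_weightedDegree_le {F : Type*} [Field F] {G : F[X][X]} {n : ℕ}
    (h : weightedDegree 1 1 G ≤ n) (i : ℕ) : (G.coeff i).natDegree ≤ 1 * (n - i) := by
  rcases Nat.eq_zero_or_pos (G.coeff i).natDegree with h0 | h0
  · omega
  have h1 : (G.coeff i).coeff (G.coeff i).natDegree ≠ 0 := by
    rw [coeff_natDegree, leadingCoeff_ne_zero]
    rintro h2
    simp [h2] at h0
  have := le_weightedDegree 1 1 h1
  omega

section Shear

variable {R : Type*} [CommRing R]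

/-- The substitution `X ↦ X - c Y`, `Y ↦ Y`. -/
noncomputable def shear (c : R) : R[X][X] →+* R[X][X] :=
  eval₂RingHom (S := R[X][X]) (eval₂RingHom (S := R[X][X])
    ((C : R[X] →+* R[X][X]).comp (C : R →+* R[X])) (C Polynomial.X - C (C c) * Polynomial.X))
    Polynomial.X

@[simp]
theorem shear_X (c : R) : shear c Polynomial.X = Polynomial.X := by simp [shear]

@[simp]
theorem shear_C_X (c : R) :
    shear c (C Polynomial.X) = C Polynomial.X - C (C c) * Polynomial.X := by simp [shear]

@[simp]
theorem shear_C_C (c a : R) : shear c (C (C a)) = C (C a) := by simp [shear]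

theorem shear_comp_shear_neg (c : R) : (shear c).comp (shear (-c)) = RingHom.id _ := by
  refine Polynomial.ringHom_ext' (Polynomial.ringHom_ext (fun a => ?_) ?_) ?_
  · simp
  · simp only [RingHom.comp_apply, shear_C_X, map_sub, map_mul, shear_C_C, shear_X, map_neg,
      RingHom.id_apply]
    ring
  · simp

theorem irreducible_shear {c : R} {G : R[X][X]} (hG : Irreducible G) : Irreducible (shear c G) := by
  have h := shear_comp_shear_neg (-c)
  rw [neg_neg] at h
  exact (MulEquiv.irreducible_iff (RingEquiv.ofRingHom (shear c) (shear (-c))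
    (shear_comp_shear_neg c) h)).2 hG

theorem shear_map_C (c : R) (P : R[X]) : shear c (P.map C) = P.map C := by
  rw [← coe_mapRingHom]
  suffices h : (shear c).comp (mapRingHom C) = mapRingHom C from
    congrArg (fun f : R[X] →+* R[X][X] => f P) h
  refine Polynomial.ringHom_ext (fun a => ?_) ?_ <;> simp

/-- The polynomial `P(X - c Y)` for `P = (X + 1) ⋯ (X + k)`. -/
noncomputable def shearedRising (c : R) (k : ℕ) : R[X][X] :=
  ∏ i ∈ Finset.range k, (C Polynomial.X - C (C c) * Polynomial.X + C (C ((i : R) + 1)))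

theorem shear_C_shiftedRising (c : R) (k : ℕ) :
    shear c (C (shiftedRising R k)) = shearedRising c k := by
  rw [shiftedRising, shearedRising, map_prod, map_prod]
  refine Finset.prod_congr rfl fun i _ => ?_
  rw [map_add, map_add, shear_C_X, shear_C_C]

theorem map_shearedRising {S : Type*} [CommRing S] (f : R →+* S) (c : R) (k : ℕ) :
    (shearedRising c k).map (mapRingHom f) = shearedRising (f c) k := by
  simp [shearedRising, Polynomial.map_prod]

end Shear

section Field

variable {F : Type*} [Field F]

theorem weightedDegree_shearedRising_le (c : F) (k : ℕ) :
    weightedDegree 1 1 (shearedRising c k) ≤ k := by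
  rw [weightedDegree, shearedRising, map_prod]
  refine (natDegree_prod_le _ _).trans ((Finset.sum_le_card_nsmul _ _ 1 fun i _ => ?_).trans
    (by simp))
  refine weightedDegree_le 1 1 fun m j hmj => ?_
  by_contra h
  refine hmj ?_
  simp only [coeff_add, coeff_sub, coeff_C_mul, Polynomial.coeff_X, coeff_C]
  rcases m with _ | m
  · rcases j with _ | _ | j
    · omega
    · omega
    · simp [Polynomial.coeff_X, coeff_C, coeff_one]
  · rcases m with _ | m
    · rcases j with _ | j
      · omega
      · simp [coeff_C, coeff_one]
    · simp

/-- The curve `P(Y) = Q(X - c Y)` with `P = (X + 1) ⋯ (X + l)` and `Q = (X + 1) ⋯ (X + k)`. -/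
noncomputable def shearedCurve (c : F) (k l : ℕ) : F[X][X] :=
  (shiftedRising F l).map C - shearedRising c k

theorem map_shearedCurve {E : Type*} [Field E] (f : F →+* E) (c : F) (k l : ℕ) :
    (shearedCurve c k l).map (mapRingHom f) = shearedCurve (f c) k l := by
  rw [shearedCurve, shearedCurve, Polynomial.map_sub, map_shearedRising, map_map,
    ← map_shiftedRising F l f, map_map]
  congr 2
  ext a
  simp

theorem irreducible_shearedCurve (c : F) {k l : ℕ} (hk : k ≠ 0) (hl : l ≠ 0) (h : l.Coprime k) :
    Irreducible (shearedCurve c k l) := by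
  have h1 := irreducible_map_C_sub_C (monic_shiftedRising F l)
    (by rwa [natDegree_shiftedRising]) (by rwa [natDegree_shiftedRising, natDegree_shiftedRising])
    (by rwa [natDegree_shiftedRising]) (Q := shiftedRising F k)
  have h2 := irreducible_shear (c := c) h1
  rwa [map_sub, shear_map_C, shear_C_shiftedRising] at h2

theorem isCurve_shearedCurve (c : F) {k l : ℕ} (hk : k ≠ 0) (hkl : k < l) (h : l.Coprime k)
    (hF : (l : F) ≠ 0) : IsCurve (shearedCurve c k l) l 1 := by
  have hd : (shearedRising c k).natDegree < ((shiftedRising F l).map C).natDegree := by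
    rw [(monic_shiftedRising F l).natDegree_map, natDegree_shiftedRising]
    exact ((natDegree_le_weightedDegree _).trans (weightedDegree_shearedRising_le c k)).trans_lt hkl
  refine ⟨?_, ?_, natDegree_coeff_le_of_weightedDegree_le ?_, irreducible_shearedCurve c hk
    (by omega) h, hF⟩
  · exact ((monic_shiftedRising F l).map C).sub_of_left (degree_lt_degree hd)
  · rw [shearedCurve, natDegree_sub_eq_left_of_natDegree_lt hd,
      (monic_shiftedRising F l).natDegree_map, natDegree_shiftedRising]
  · rw [weightedDegree, shearedCurve, map_sub]
    refine (natDegree_sub_le _ _).trans (max_le ?_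
      ((weightedDegree_shearedRising_le c k).trans hkl.le))
    refine weightedDegree_le 1 1 fun i j hij => ?_
    rw [coeff_map, coeff_C] at hij
    by_cases hj : j = 0
    · rw [if_pos hj] at hij
      have := le_natDegree_of_ne_zero hij
      rw [natDegree_shiftedRising] at this
      omega
    · simp [hj] at hij

theorem map_aeval_shearedCurve (c x : F) (k l : ℕ) :
    (shearedCurve c k l).map (aeval (R := F) x).toRingHom =
      shiftedRising F l - (shiftedRising F k).comp (C x - C c * Polynomial.X) := by
  have h1 : ((aeval (R := F) x).toRingHom : F[X] →+* F).comp C = RingHom.id F := by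
    ext a
    simp
  rw [shearedCurve, Polynomial.map_sub, map_map, h1, Polynomial.map_id]
  congr 1
  simp [shearedRising, shiftedRising, Polynomial.map_prod, prod_comp]

theorem aevalAeval_shearedCurve (c x y : F) (k l : ℕ) :
    aevalAeval x y (shearedCurve c k l) =
      (shiftedRising F l).eval y - (shiftedRising F k).eval (x - c * y) := by
  rw [aevalAeval_eq_eval_map, map_aeval_shearedCurve]
  simp

theorem aevalAeval_derivative_shearedCurve (c x y : F) (k l : ℕ) :
    aevalAeval x y (derivative (shearedCurve c k l)) =
      (derivative (shiftedRising F l)).eval y +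
        c * (derivative (shiftedRising F k)).eval (x - c * y) := by
  rw [aevalAeval_eq_eval_map, ← derivative_map, map_aeval_shearedCurve]
  simp [derivative_comp]

end Field

end

section

open Polynomial

theorem map_mapRingHom_map_C {R S : Type*} [CommRing R] [CommRing S] (f : R →+* S) (P : R[X]) :
    ((P.map C).map (mapRingHom f) : S[X][X]) = (P.map f).map C := by
  rw [map_map, map_map]
  congr 1
  ext a
  simp

theorem aevalAeval_map_C_sub_C {F : Type*} [Field F] (x y : F) (Q R : F[X]) :
    aevalAeval x y (Q.map C - C R) = Q.eval y - R.eval x := by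
  have h1 : ((aeval (R := F) x).toRingHom : F[X] →+* F).comp C = RingHom.id F := by
    ext a
    simp
  rw [aevalAeval_eq_eval_map, Polynomial.map_sub, map_map, h1, Polynomial.map_id]
  simp

section Derivative

variable (F : Type*) [Field F]

theorem eval_neg_one_shiftedRising {k : ℕ} (hk : 1 ≤ k) : (shiftedRising F k).eval (-1) = 0 := by
  rw [eval_shiftedRising]
  exact Finset.prod_eq_zero (Finset.mem_range.2 (show 0 < k by omega)) (by simp)

theorem eval_neg_two_shiftedRising {k : ℕ} (hk : 2 ≤ k) : (shiftedRising F k).eval (-2) = 0 := by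
  rw [eval_shiftedRising]
  exact Finset.prod_eq_zero (Finset.mem_range.2 (show 1 < k by omega)) (by norm_num)

theorem eval_neg_one_derivative_shiftedRising (n : ℕ) :
    (derivative (shiftedRising F (n + 1))).eval (-1) = n.factorial := by
  rw [shiftedRising, Finset.prod_range_succ', derivative_mul, eval_add, eval_mul, eval_mul,
    eval_prod, ← Finset.prod_range_add_one_eq_factorial, Nat.cast_prod]
  simp

theorem eval_neg_two_derivative_shiftedRising (n : ℕ) :
    (derivative (shiftedRising F (n + 2))).eval (-2) = -n.factorial := by
  have h : ∏ i ∈ Finset.range n, ((-2 : F) + (((i + 1 + 1 : ℕ) : F) + 1)) = n.factorial := by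
    rw [← Finset.prod_range_add_one_eq_factorial]
    push_cast
    refine Finset.prod_congr rfl fun i _ => ?_
    ring
  rw [shiftedRising, Finset.prod_range_succ', Finset.prod_range_succ', derivative_mul,
    derivative_mul]
  simp only [eval_add, eval_mul, eval_prod, eval_X, eval_C, h, derivative_add, derivative_X,
    derivative_C, eval_one, eval_zero]
  push_cast
  ring

end Derivative

section Bounds

variable {p : ℕ} [Fact p.Prime]

theorem natCast_factorial_ne_zero {n : ℕ} (hn : n < p) : ((n.factorial : ℕ) : ZMod p) ≠ 0 := by
  rw [Ne, ZMod.natCast_eq_zero_iff, (Fact.out : p.Prime).dvd_factorial]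
  omega

theorem exists_smooth_point_shearedCurve (c : ZMod p) {k l : ℕ} (hk : 2 ≤ k) (hkl : k < l)
    (hl : l < p) : ∃ x y : ZMod p, aevalAeval x y (shearedCurve c k l) = 0 ∧
      aevalAeval x y (derivative (shearedCurve c k l)) ≠ 0 := by
  obtain ⟨k, rfl⟩ : ∃ k', k = k' + 2 := ⟨k - 2, by omega⟩
  obtain ⟨l, rfl⟩ : ∃ l', l = l' + 1 := ⟨l - 1, by omega⟩
  have h1 := eval_neg_one_shiftedRising (ZMod p) (k := k + 2) (by omega)
  have h2 := eval_neg_two_shiftedRising (ZMod p) (k := k + 2) (by omega)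
  have h3 := eval_neg_one_shiftedRising (ZMod p) (k := l + 1) (by omega)
  have e1 := eval_neg_one_derivative_shiftedRising (ZMod p) (k + 1)
  have e2 := eval_neg_two_derivative_shiftedRising (ZMod p) k
  have e3 := eval_neg_one_derivative_shiftedRising (ZMod p) l
  by_contra! h
  have f1 := h (-1 + c * -1) (-1) (by rw [aevalAeval_shearedCurve, add_sub_cancel_right, h1, h3,
    sub_self])
  have f2 := h (-2 + c * -1) (-1) (by rw [aevalAeval_shearedCurve, add_sub_cancel_right, h2, h3,
    sub_self])
  rw [aevalAeval_derivative_shearedCurve, add_sub_cancel_right, e3, e1] at f1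
  rw [aevalAeval_derivative_shearedCurve, add_sub_cancel_right, e3, e2] at f2
  have f3 : c * ((k.factorial : ZMod p) * ((k + 2 : ℕ) : ZMod p)) = 0 := by
    rw [Nat.factorial_succ] at f1
    push_cast at f1 ⊢
    linear_combination f1 - f2
  have g1 := natCast_factorial_ne_zero (p := p) (n := k) (by omega)
  have g2 : ((k + 2 : ℕ) : ZMod p) ≠ 0 := by
    rw [Ne, ZMod.natCast_eq_zero_iff]
    exact fun h => absurd (Nat.le_of_dvd (by omega) h) (by omega)
  have hc : c = 0 := (mul_eq_zero.1 f3).resolve_right (mul_ne_zero g1 g2)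
  rw [hc, zero_mul, add_zero] at f1
  exact natCast_factorial_ne_zero (by omega) f1

theorem weil_bound_shearedCurve (c : ZMod p) {k l : ℕ} (hk : 2 ≤ k) (hkl : k < l)
    (h : l.Coprime k) (hl : l < p) :
    ((curvePoints (shearedCurve c k l) (ZMod p)).card : ℝ) ≤ p + (2 * l ^ 2 + 1) * √p + l ^ 3 ∧
    ∀ ψ : AddChar (ZMod p) ℂ, ψ ≠ 1 →
      ‖∑ z ∈ curvePoints (shearedCurve c k l) (ZMod p), ψ z.1‖ ≤ 2 * l ^ 2 * √p + l ^ 3 := by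
  have hF : (l : ZMod p) ≠ 0 := by
    rw [Ne, ZMod.natCast_eq_zero_iff]
    exact fun h => absurd (Nat.le_of_dvd (by omega) h) (by omega)
  obtain ⟨x, y, h0, h1⟩ := exists_smooth_point_shearedCurve c hk hkl hl
  have := (isCurve_shearedCurve c (by omega) hkl h hF).weil_bound hl h0 h1 fun E _ _ _ => by
    rw [map_shearedCurve]
    exact irreducible_shearedCurve _ (by omega) (by omega) h
  simpa using this

theorem weil_bound_rising {k l : ℕ} (hk : 2 ≤ k) (hkl : k < l) (hl3 : l ≤ 3 * k)
    (h : k.Coprime l) (hl : l < p) {ψ : AddChar (ZMod p) ℂ} (hψ : ψ ≠ 1) :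
    ‖∑ z ∈ curvePoints ((shiftedRising (ZMod p) k).map C - C (shiftedRising (ZMod p) l)) (ZMod p),
      ψ z.1‖ ≤ 6 * k ^ 2 * √p + 3 * k ^ 3 := by
  have hirr : ∀ (E : Type) [Field E],
      Irreducible ((shiftedRising E k).map C - C (shiftedRising E l) : E[X][X]) := fun E _ =>
    irreducible_map_C_sub_C (monic_shiftedRising E k) (by rw [natDegree_shiftedRising]; omega)
      (by rwa [natDegree_shiftedRising, natDegree_shiftedRising])
      (by rw [natDegree_shiftedRising]; omega)
  have hmon := monic_shiftedRising (ZMod p) k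
  have hnat := natDegree_shiftedRising (ZMod p) k
  have hd : (C (shiftedRising (ZMod p) l) : (ZMod p)[X][X]).degree <
      ((shiftedRising (ZMod p) k).map C : (ZMod p)[X][X]).degree := by
    refine degree_C_le.trans_lt ?_
    rw [degree_map_eq_of_injective C_injective, degree_eq_natDegree hmon.ne_zero, hnat]
    exact_mod_cast (by omega : 0 < k)
  have hC : IsCurve ((shiftedRising (ZMod p) k).map C - C (shiftedRising (ZMod p) l)) k 3 := by
    refine ⟨(hmon.map C).sub_of_left hd, ?_, fun i => ?_, hirr _, ?_⟩
    · rw [natDegree_sub_C, hmon.natDegree_map, hnat]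
    · rw [coeff_sub, coeff_map, coeff_C]
      split_ifs with hi
      · refine (natDegree_sub_le _ _).trans (max_le ?_ ?_)
        · rw [natDegree_C]
          omega
        · rw [natDegree_shiftedRising]
          omega
      · rw [sub_zero, natDegree_C]
        omega
    · rw [Ne, ZMod.natCast_eq_zero_iff]
      exact fun h => absurd (Nat.le_of_dvd (by omega) h) (by omega)
  have h2 := (hC.weil_bound (by omega) (x₀ := -1) (y₀ := -1) ?_ ?_ fun E _ _ _ => ?_).2 ψ hψ
  · push_cast at h2
    linarith
  · rw [aevalAeval_map_C_sub_C, eval_neg_one_shiftedRising _ (by omega), eval_neg_one_shiftedRising _ (by omega),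
      sub_self]
  · rw [derivative_sub, derivative_C, derivative_map, ← C_0, aevalAeval_map_C_sub_C, eval_zero, sub_zero]
    obtain ⟨k, rfl⟩ : ∃ k', k = k' + 1 := ⟨k - 1, by omega⟩
    rw [eval_neg_one_derivative_shiftedRising]
    exact natCast_factorial_ne_zero (by omega)
  · have h3 : ((shiftedRising (ZMod p) k).map C - C (shiftedRising (ZMod p) l)).map
        (mapRingHom (algebraMap (ZMod p) E)) =
        (shiftedRising E k).map C - C (shiftedRising E l) := by
      rw [Polynomial.map_sub, map_mapRingHom_map_C, map_C, coe_mapRingHom,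
        map_shiftedRising (ZMod p) k (algebraMap (ZMod p) E),
        map_shiftedRising (ZMod p) l (algebraMap (ZMod p) E)]
    rw [h3]
    exact hirr E

end Bounds

end

section

open Polynomial

section Pairs

variable {p : ℕ} [Fact p.Prime]

/-- The pairs `(x, y)` with `(x + 1) ⋯ (x + k) = (y + 1) ⋯ (y + l)`. -/
noncomputable def risingPairs (p : ℕ) [Fact p.Prime] (k l : ℕ) : Finset (ZMod p × ZMod p) :=
  {z | (shiftedRising (ZMod p) k).eval z.1 = (shiftedRising (ZMod p) l).eval z.2}

theorem mem_risingPairs {k l : ℕ} {z : ZMod p × ZMod p} : z ∈ risingPairs p k l ↔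
    (shiftedRising (ZMod p) k).eval z.1 = (shiftedRising (ZMod p) l).eval z.2 := by
  simp [risingPairs]

theorem sum_risingPairs_swap {M : Type*} [AddCommMonoid M] (k l : ℕ)
    (f : ZMod p × ZMod p → M) :
    ∑ z ∈ risingPairs p k l, f z = ∑ z ∈ risingPairs p l k, f z.swap := by
  refine Finset.sum_bij' (fun z _ => z.swap) (fun z _ => z.swap) ?_ ?_ ?_ ?_ ?_ <;>
    simp +contextual [mem_risingPairs]

theorem mem_curvePoints_shearedCurve {c : ZMod p} {k l : ℕ} {z : ZMod p × ZMod p} :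
    z ∈ curvePoints (shearedCurve c k l) (ZMod p) ↔
      (shiftedRising (ZMod p) k).eval (z.1 - c * z.2) = (shiftedRising (ZMod p) l).eval z.2 := by
  rw [mem_curvePoints, aevalAeval_shearedCurve, sub_eq_zero, eq_comm]

theorem mem_curvePoints_map_C_sub_C {Q R : (ZMod p)[X]} {z : ZMod p × ZMod p} :
    z ∈ curvePoints (Q.map C - C R) (ZMod p) ↔ Q.eval z.2 = R.eval z.1 := by
  rw [mem_curvePoints, aevalAeval_map_C_sub_C, sub_eq_zero]

theorem sum_risingPairs_eq_sum_shearedCurve {M : Type*} [AddCommMonoid M] (c : ZMod p) (k l : ℕ)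
    (f : ZMod p × ZMod p → M) :
    ∑ z ∈ risingPairs p k l, f (z.1 + c * z.2, z.2) =
      ∑ z ∈ curvePoints (shearedCurve c k l) (ZMod p), f z := by
  refine Finset.sum_bij' (fun z _ => (z.1 + c * z.2, z.2)) (fun z _ => (z.1 - c * z.2, z.2))
    ?_ ?_ ?_ ?_ ?_ <;>
    simp +contextual [mem_risingPairs, mem_curvePoints_shearedCurve]

theorem exists_mulShift_eq {ψ : AddChar (ZMod p) ℂ} (hψ : ψ ≠ 1) (φ : AddChar (ZMod p) ℂ) :
    ∃ c, ψ.mulShift c = φ := by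
  have h := AddChar.to_mulShift_inj_of_isPrimitive (AddChar.IsPrimitive.of_ne_one hψ)
  exact ((Fintype.bijective_iff_injective_and_card _).2 ⟨h, by rw [AddChar.card_eq]⟩).2 φ

theorem card_risingPairs_le_of_lt {k l : ℕ} (hk : 2 ≤ k) (hkl : k < l) (h : l.Coprime k)
    (hl : l < p) : ((risingPairs p k l).card : ℝ) ≤ p + (2 * l ^ 2 + 1) * √p + l ^ 3 := by
  have h1 := sum_risingPairs_eq_sum_shearedCurve (0 : ZMod p) k l fun _ => 1
  rw [← Finset.card_eq_sum_ones, ← Finset.card_eq_sum_ones] at h1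
  rw [h1]
  exact (weil_bound_shearedCurve 0 hk hkl h hl).1

theorem norm_sum_risingPairs_le_of_lt {k l : ℕ} (hk : 2 ≤ k) (hkl : k < l) (hl3 : l ≤ 3 * k)
    (h : l.Coprime k) (hl : l < p) {ψ φ : AddChar (ZMod p) ℂ} (hψφ : ψ ≠ 1 ∨ φ ≠ 1) :
    ‖∑ z ∈ risingPairs p k l, ψ z.1 * φ z.2‖ ≤ 6 * l ^ 2 * √p + 3 * l ^ 3 := by
  by_cases hψ : ψ = 1
  · have h1 := weil_bound_rising hk hkl hl3 h.symm hl (hψφ.resolve_left (not_not.2 hψ))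
    have h2 : ∑ z ∈ risingPairs p k l, ψ z.1 * φ z.2 = ∑ z ∈ curvePoints
        ((shiftedRising (ZMod p) k).map C - C (shiftedRising (ZMod p) l)) (ZMod p), φ z.1 := by
      refine Finset.sum_bij' (fun z _ => z.swap) (fun z _ => z.swap) ?_ ?_ ?_ ?_ ?_ <;>
        simp +contextual [mem_risingPairs, mem_curvePoints_map_C_sub_C, hψ]
    rw [h2]
    refine h1.trans ?_
    have : (k : ℝ) ≤ l := by exact_mod_cast hkl.le
    gcongr
  · obtain ⟨c, rfl⟩ := exists_mulShift_eq hψ φ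
    have h1 := (weil_bound_shearedCurve c hk hkl h hl).2 ψ hψ
    rw [← sum_risingPairs_eq_sum_shearedCurve c k l fun z => ψ z.1] at h1
    simp only [AddChar.mulShift_apply, ← AddChar.map_add_eq_mul]
    refine h1.trans ?_
    have : (0 : ℝ) ≤ l ^ 2 * √p := by positivity
    have : (0 : ℝ) ≤ l ^ 3 := by positivity
    linarith

theorem card_risingPairs_le {Q k l : ℕ} (hk : k.Prime) (hl : l.Prime) (hkl : k ≠ l) (hkQ : k ≤ Q)
    (hlQ : l ≤ Q) (hQ : Q < p) :
    ((risingPairs p k l).card : ℝ) ≤ p + (2 * Q ^ 2 + 1) * √p + Q ^ 3 := by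
  wlog hlt : k < l generalizing k l
  · have h1 := sum_risingPairs_swap (p := p) k l fun _ => 1
    rw [← Finset.card_eq_sum_ones, ← Finset.card_eq_sum_ones] at h1
    rw [h1]
    exact this hl hk hkl.symm hlQ hkQ (by omega)
  refine (card_risingPairs_le_of_lt hk.two_le hlt
    ((Nat.coprime_primes hl hk).2 hkl.symm) (by omega)).trans ?_
  have : (l : ℝ) ≤ Q := by exact_mod_cast hlQ
  gcongr

theorem norm_sum_risingPairs_le {Q k l : ℕ} (hk : k.Prime) (hl : l.Prime) (hkl : k ≠ l)
    (hkQ : k ≤ Q) (hlQ : l ≤ Q) (hQ : Q < p) (hl3 : l ≤ 3 * k) (hk3 : k ≤ 3 * l)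
    {ψ φ : AddChar (ZMod p) ℂ} (hψφ : ψ ≠ 1 ∨ φ ≠ 1) :
    ‖∑ z ∈ risingPairs p k l, ψ z.1 * φ z.2‖ ≤ 6 * Q ^ 2 * √p + 3 * Q ^ 3 := by
  wlog hlt : k < l generalizing k l ψ φ
  · rw [sum_risingPairs_swap]
    simp only [Prod.fst_swap, Prod.snd_swap, mul_comm (ψ _)]
    exact this hl hk hkl.symm hlQ hkQ hk3 hl3 hψφ.symm (by omega)
  refine (norm_sum_risingPairs_le_of_lt hk.two_le hlt hl3
    ((Nat.coprime_primes hl hk).2 hkl.symm) (by omega) hψφ).trans ?_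
  have : (l : ℝ) ≤ Q := by exact_mod_cast hlQ
  gcongr

end Pairs

section Residual

/-- The polynomial `(P(Y) - P(X)) / (Y - X)` for `P = (X + 1) ⋯ (X + k)`. -/
noncomputable def risingResidual (R : Type*) [CommRing R] (k : ℕ) : R[X][X] :=
  ((shiftedRising R k).map C - C (shiftedRising R k)) /ₘ (Polynomial.X - C Polynomial.X)

theorem X_sub_C_mul_risingResidual (R : Type*) [CommRing R] (k : ℕ) :
    (Polynomial.X - C Polynomial.X) * risingResidual R k =
      (shiftedRising R k).map C - C (shiftedRising R k) := by
  rw [risingResidual, mul_divByMonic_eq_iff_isRoot, IsRoot, eval_sub, eval_C, eval_map]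
  rw [← Polynomial.algebraMap_eq, ← aeval_def, aeval_X_left_apply, sub_self]

theorem map_risingResidual {R S : Type*} [CommRing R] [CommRing S] (f : R →+* S) (k : ℕ) :
    (risingResidual R k).map (mapRingHom f) = risingResidual S k := by
  rw [risingResidual, map_divByMonic _ (monic_X_sub_C _), Polynomial.map_sub, Polynomial.map_sub,
    map_mapRingHom_map_C, map_X, map_C, map_C, coe_mapRingHom, map_X, map_shiftedRising R k f,
    risingResidual]

variable {F : Type*} [Field F]

theorem monic_natDegree_risingResidual {k : ℕ} (hk : 1 ≤ k) :
    (risingResidual F k).Monic ∧ (risingResidual F k).natDegree = k - 1 := by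
  have hmon := monic_shiftedRising F k
  have hnat := natDegree_shiftedRising F k
  have hd : (C (shiftedRising F k) : F[X][X]).degree <
      ((shiftedRising F k).map C : F[X][X]).degree := by
    refine degree_C_le.trans_lt ?_
    rw [degree_map_eq_of_injective C_injective, degree_eq_natDegree hmon.ne_zero, hnat]
    exact_mod_cast (by omega : 0 < k)
  have h1 := (hmon.map C).sub_of_left hd
  have h2 := X_sub_C_mul_risingResidual F k
  rw [← h2] at h1
  have h3 := (monic_X_sub_C _).of_mul_monic_left h1
  refine ⟨h3, ?_⟩
  have h4 := congrArg natDegree h2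
  rw [(monic_X_sub_C _).natDegree_mul h3, natDegree_X_sub_C, natDegree_sub_C,
    hmon.natDegree_map, hnat] at h4
  omega

theorem sub_mul_aevalAeval_risingResidual (x y : F) (k : ℕ) :
    (y - x) * aevalAeval x y (risingResidual F k) =
      (shiftedRising F k).eval y - (shiftedRising F k).eval x := by
  rw [← aevalAeval_map_C_sub_C, ← X_sub_C_mul_risingResidual, map_mul]
  simp [aevalAeval_eq_eval_map]

theorem sub_mul_aevalAeval_derivative_risingResidual (x y : F) (k : ℕ) :
    aevalAeval x y (risingResidual F k) + (y - x) * aevalAeval x y (derivative (risingResidual F k))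
      = (derivative (shiftedRising F k)).eval y := by
  have h1 := congrArg (fun G => aevalAeval x y (derivative G)) (X_sub_C_mul_risingResidual F k)
  simp only [derivative_mul, derivative_sub, derivative_X, derivative_C, sub_zero, one_mul,
    map_add, map_mul, derivative_map] at h1
  have h2 := aevalAeval_map_C_sub_C x y (derivative (shiftedRising F k)) 0
  simp only [map_zero, sub_zero, eval_zero] at h2
  rw [h2] at h1
  rw [← h1]
  simp [aevalAeval_eq_eval_map]

variable {p : ℕ} [Fact p.Prime]

theorem eq_or_mem_curvePoints_risingResidual {k : ℕ} {x y : ZMod p}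
    (h : (shiftedRising (ZMod p) k).eval x = (shiftedRising (ZMod p) k).eval y) :
    x = y ∨ (x, y) ∈ curvePoints (risingResidual (ZMod p) k) (ZMod p) := by
  have h1 := sub_mul_aevalAeval_risingResidual x y k
  rw [h, sub_self, mul_eq_zero, sub_eq_zero] at h1
  rw [mem_curvePoints]
  exact h1.imp_left Eq.symm

theorem weil_bound_risingResidual {k : ℕ} (hk : k.Prime) (hk3 : 3 ≤ k) (hkp : 3 * k ^ 3 < p) :
    ((curvePoints (risingResidual (ZMod p) k) (ZMod p)).card : ℝ) ≤
      p + (2 * k ^ 2 + 1) * √p + k ^ 3 ∧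
    ∀ ψ : AddChar (ZMod p) ℂ, ψ ≠ 1 →
      ‖∑ z ∈ curvePoints (risingResidual (ZMod p) k) (ZMod p), ψ z.1‖ ≤
        2 * k ^ 2 * √p + k ^ 3 := by
  have : Fact k.Prime := ⟨hk⟩
  have hkp' : k < p := (Nat.le_self_pow (by norm_num : 3 ≠ 0) k).trans_lt (by omega)
  obtain ⟨hm, hd⟩ := monic_natDegree_risingResidual (F := ZMod p) (k := k) (by omega)
  have hirr : ∀ (E : Type) [Field E] [CharP E p], Irreducible (risingResidual E k) :=
    fun E _ _ => by
      obtain ⟨hm, hd⟩ := monic_natDegree_risingResidual (F := E) (k := k) (by omega)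
      exact irreducible_residual hkp hk3 hm hd (X_sub_C_mul_risingResidual E k)
  have hC : IsCurve (risingResidual (ZMod p) k) (k - 1) 1 :=
    ⟨hm, hd, natDegree_coeff_le_of_weightedDegree_le
      (weightedDegree_residual_le hm (X_sub_C_mul_risingResidual _ k)), hirr _, by
        rw [Ne, ZMod.natCast_eq_zero_iff]
        exact fun h => absurd (Nat.le_of_dvd (by omega) h) (by omega)⟩
  have e1 := sub_mul_aevalAeval_risingResidual (-1 : ZMod p) (-2) k
  have e2 := sub_mul_aevalAeval_derivative_risingResidual (-1 : ZMod p) (-2) k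
  rw [eval_neg_one_shiftedRising _ (by omega), eval_neg_two_shiftedRising _ (by omega)] at e1
  have e3 : aevalAeval (-1 : ZMod p) (-2 : ZMod p) (risingResidual (ZMod p) k) = 0 := by
    linear_combination -e1
  have e4 : aevalAeval (-1 : ZMod p) (-2 : ZMod p) (derivative (risingResidual (ZMod p) k)) ≠ 0 := by
    intro h
    obtain ⟨n, rfl⟩ : ∃ n, k = n + 2 := ⟨k - 2, by omega⟩
    rw [e3, h, eval_neg_two_derivative_shiftedRising] at e2
    exact natCast_factorial_ne_zero (p := p) (n := n) (by omega) (by linear_combination e2)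
  obtain ⟨h1, h2⟩ := hC.weil_bound (by omega) e3 e4 fun E _ _ _ => by
    have : CharP E p := charP_of_injective_algebraMap (algebraMap (ZMod p) E).injective p
    rw [map_risingResidual]
    exact hirr E
  have h3 : ((k - 1 : ℕ) : ℝ) ≤ k := by exact_mod_cast Nat.sub_le k 1
  refine ⟨h1.trans ?_, fun ψ hψ => (h2 ψ hψ).trans ?_⟩
  · simp only [Nat.cast_one, one_mul]
    gcongr
  · simp only [Nat.cast_one, one_mul]
    gcongr

end Residual

end

section Fourier

variable {G : Type*} [AddCommGroup G] [Fintype G] [DecidableEq G]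

/-- The Fourier transform of a function on a finite abelian group. -/
noncomputable def fourierSum (f : G → ℝ) (ψ : AddChar G ℂ) : ℂ := ∑ x, (f x : ℂ) * ψ x

theorem fourierSum_one (f : G → ℝ) : fourierSum f 1 = ((∑ x, f x : ℝ) : ℂ) := by
  simp [fourierSum]

theorem fourierSum_inversion (f : G → ℝ) (x : G) :
    ∑ ψ : AddChar G ℂ, fourierSum f ψ * ψ⁻¹ x = (Fintype.card G : ℂ) * f x := by
  have h : ∀ ψ : AddChar G ℂ, fourierSum f ψ * ψ⁻¹ x = ∑ y, (f y : ℂ) * ψ (y - x) := fun ψ => by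
    rw [fourierSum, Finset.sum_mul]
    refine Finset.sum_congr rfl fun y _ => ?_
    rw [mul_assoc, AddChar.inv_apply, ← AddChar.map_add_eq_mul, sub_eq_add_neg]
  simp_rw [h]
  rw [Finset.sum_comm]
  simp_rw [← Finset.mul_sum, AddChar.sum_apply_eq_ite, sub_eq_zero]
  simp [mul_comm]

theorem card_mul_sum_fst_le {f : G → ℝ} {S : Finset (G × G)} {B : ℝ} (hB : 0 ≤ B)
    (h : ∀ ψ : AddChar G ℂ, ψ ≠ 1 → ‖∑ z ∈ S, ψ z.1‖ ≤ B) :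
    Fintype.card G * ∑ z ∈ S, f z.1 ≤
      ‖fourierSum f 1‖ * S.card + B * ∑ ψ : AddChar G ℂ, ‖fourierSum f ψ‖ := by
  have h1 : ((Fintype.card G * ∑ z ∈ S, f z.1 : ℝ) : ℂ) =
      ∑ ψ : AddChar G ℂ, fourierSum f ψ * ∑ z ∈ S, ψ⁻¹ z.1 := by
    simp_rw [Finset.mul_sum]
    rw [Finset.sum_comm]
    simp_rw [fourierSum_inversion]
    push_cast
    rfl
  have h2 : ∀ ψ : AddChar G ℂ, ‖∑ z ∈ S, ψ⁻¹ z.1‖ ≤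
      (if ψ = 1 then (S.card : ℝ) else 0) + B := fun ψ => by
    split_ifs with hψ
    · rw [hψ]
      simpa using hB
    · rw [zero_add]
      exact h _ (inv_ne_one.2 hψ)
  have h3 : Fintype.card G * ∑ z ∈ S, f z.1 ≤
      ∑ ψ : AddChar G ℂ, ‖fourierSum f ψ‖ * ((if ψ = 1 then (S.card : ℝ) else 0) + B) := by
    refine (le_abs_self _).trans ?_
    rw [← Real.norm_eq_abs, ← Complex.norm_real, h1]
    refine (norm_sum_le _ _).trans (Finset.sum_le_sum fun ψ _ => ?_)
    rw [norm_mul]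
    gcongr
    exact h2 ψ
  refine h3.trans (le_of_eq ?_)
  simp_rw [mul_add, Finset.sum_add_distrib, mul_ite, mul_zero]
  rw [Finset.sum_ite_eq' Finset.univ, if_pos (Finset.mem_univ _), ← Finset.sum_mul, mul_comm B]

theorem card_sq_mul_sum_le {f : G → ℝ} {S : Finset (G × G)} {B : ℝ} (hB : 0 ≤ B)
    (h : ∀ ψ φ : AddChar G ℂ, ψ ≠ 1 ∨ φ ≠ 1 → ‖∑ z ∈ S, ψ z.1 * φ z.2‖ ≤ B) :
    (Fintype.card G : ℝ) ^ 2 * ∑ z ∈ S, f z.1 * f z.2 ≤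
      ‖fourierSum f 1‖ ^ 2 * S.card + B * (∑ ψ : AddChar G ℂ, ‖fourierSum f ψ‖) ^ 2 := by
  have h1 : (((Fintype.card G : ℝ) ^ 2 * ∑ z ∈ S, f z.1 * f z.2 : ℝ) : ℂ) =
      ∑ ψ : AddChar G ℂ × AddChar G ℂ, fourierSum f ψ.1 * fourierSum f ψ.2 *
        ∑ z ∈ S, ψ.1⁻¹ z.1 * ψ.2⁻¹ z.2 := by
    simp_rw [Finset.mul_sum]
    rw [Finset.sum_comm]
    push_cast
    refine Finset.sum_congr rfl fun z _ => ?_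
    have e : ((Fintype.card G : ℂ) ^ 2 * (f z.1 * f z.2)) =
        (Fintype.card G * f z.1) * (Fintype.card G * f z.2) := by ring
    rw [e, ← fourierSum_inversion, ← fourierSum_inversion, Finset.sum_mul_sum,
      ← Finset.univ_product_univ, Finset.sum_product]
    refine Finset.sum_congr rfl fun ψ _ => Finset.sum_congr rfl fun φ _ => ?_
    ring
  have h2 : ∀ ψ : AddChar G ℂ × AddChar G ℂ, ‖∑ z ∈ S, ψ.1⁻¹ z.1 * ψ.2⁻¹ z.2‖ ≤
      (if ψ = 1 then (S.card : ℝ) else 0) + B := fun ψ => by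
    split_ifs with hψ
    · rw [hψ]
      simpa using hB
    · rw [zero_add]
      refine h _ _ ?_
      by_contra! h3
      exact hψ (Prod.ext (inv_eq_one.1 h3.1) (inv_eq_one.1 h3.2))
  have h3 : (Fintype.card G : ℝ) ^ 2 * ∑ z ∈ S, f z.1 * f z.2 ≤
      ∑ ψ : AddChar G ℂ × AddChar G ℂ, ‖fourierSum f ψ.1‖ * ‖fourierSum f ψ.2‖ *
        ((if ψ = 1 then (S.card : ℝ) else 0) + B) := by
    refine (le_abs_self _).trans ?_
    rw [← Real.norm_eq_abs, ← Complex.norm_real, h1]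
    refine (norm_sum_le _ _).trans (Finset.sum_le_sum fun ψ _ => ?_)
    rw [norm_mul, norm_mul]
    gcongr
    exact h2 ψ
  refine h3.trans (le_of_eq ?_)
  simp_rw [mul_add, Finset.sum_add_distrib, mul_ite, mul_zero]
  rw [Finset.sum_ite_eq' Finset.univ, if_pos (Finset.mem_univ _), ← Finset.sum_mul,
    ← Finset.univ_product_univ, Finset.sum_product, pow_two, pow_two, Finset.sum_mul_sum]
  simp [mul_comm]

theorem sum_norm_sq_sum_eq (I : Finset G) :
    ∑ ψ : AddChar G ℂ, ‖∑ u ∈ I, ψ u‖ ^ 2 = Fintype.card G * I.card := by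
  have h1 : ∀ ψ : AddChar G ℂ, ((‖∑ u ∈ I, ψ u‖ ^ 2 : ℝ) : ℂ) =
      ∑ u ∈ I, ∑ v ∈ I, ψ (u - v) := fun ψ => by
    push_cast
    rw [← Complex.mul_conj', map_sum, Finset.sum_mul_sum]
    refine Finset.sum_congr rfl fun u _ => Finset.sum_congr rfl fun v _ => ?_
    rw [sub_eq_add_neg, AddChar.map_add_eq_mul, AddChar.map_neg_eq_conj]
  have h2 : ((∑ ψ : AddChar G ℂ, ‖∑ u ∈ I, ψ u‖ ^ 2 : ℝ) : ℂ) =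
      ((Fintype.card G * I.card : ℝ) : ℂ) := by
    rw [Complex.ofReal_sum]
    have h3 : ∀ u ∈ I, ∑ ψ : AddChar G ℂ, ∑ v ∈ I, ψ (u - v) = Fintype.card G := fun u hu => by
      rw [Finset.sum_comm]
      simp_rw [AddChar.sum_apply_eq_ite, sub_eq_zero]
      simp [hu]
    simp_rw [h1]
    rw [Finset.sum_comm, Finset.sum_congr rfl h3]
    simp [mul_comm]
  exact_mod_cast h2

/-- The number of representations `x = u + v` with `u ∈ I` and `v ∈ J`. -/
def sumCount (I J : Finset G) (x : G) : ℕ := ((I ×ˢ J).filter fun z => z.1 + z.2 = x).card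

theorem sum_sumCount_mul (I J : Finset G) {R : Type*} [CommSemiring R] (g : G → R) :
    ∑ x, (sumCount I J x : R) * g x = ∑ u ∈ I, ∑ v ∈ J, g (u + v) := by
  simp_rw [sumCount, Finset.card_filter, Nat.cast_sum, Finset.sum_mul]
  rw [Finset.sum_comm, ← Finset.sum_product' I J fun u v => g (u + v)]
  refine Finset.sum_congr rfl fun z _ => ?_
  simp

theorem sum_sumCount (I J : Finset G) : ∑ x, sumCount I J x = I.card * J.card := by
  simpa using sum_sumCount_mul I J (fun _ => (1 : ℕ))

theorem sumCount_le (I J : Finset G) (x : G) : sumCount I J x ≤ I.card := by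
  refine Finset.card_le_card_of_injOn Prod.fst (fun z hz => ?_) fun z hz w hw h => ?_
  · simp only [Finset.coe_filter, Finset.mem_product, Set.mem_ofPred_eq] at hz
    exact hz.1.1
  · simp only [Finset.coe_filter, Finset.mem_product, Set.mem_ofPred_eq] at hz hw
    refine Prod.ext h (add_left_cancel (a := z.1) ?_)
    rw [hz.2, h, hw.2]

theorem fourierSum_sumCount (I J : Finset G) (ψ : AddChar G ℂ) :
    fourierSum (fun x => (sumCount I J x : ℝ)) ψ = (∑ u ∈ I, ψ u) * ∑ v ∈ J, ψ v := by
  have := sum_sumCount_mul I J ψ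
  simp only [fourierSum, Complex.ofReal_natCast]
  rw [this, Finset.sum_mul_sum]
  simp_rw [AddChar.map_add_eq_mul]

theorem sum_norm_fourierSum_sumCount_le {I J : Finset G} {M : ℕ} (hI : I.card = M)
    (hJ : J.card = M) : ∑ ψ : AddChar G ℂ, ‖fourierSum (fun x => (sumCount I J x : ℝ)) ψ‖ ≤
      Fintype.card G * M := by
  have h1 : ∀ ψ : AddChar G ℂ, ‖fourierSum (fun x => (sumCount I J x : ℝ)) ψ‖ ≤
      (‖∑ u ∈ I, ψ u‖ ^ 2 + ‖∑ u ∈ J, ψ u‖ ^ 2) / 2 := fun ψ => by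
    rw [fourierSum_sumCount, norm_mul]
    nlinarith [sq_nonneg (‖∑ u ∈ I, ψ u‖ - ‖∑ u ∈ J, ψ u‖)]
  refine (Finset.sum_le_sum fun ψ _ => h1 ψ).trans (le_of_eq ?_)
  rw [← Finset.sum_div, Finset.sum_add_distrib, sum_norm_sq_sum_eq, sum_norm_sq_sum_eq, hI, hJ]
  ring

end Fourier

section Variance

variable {G : Type*} [AddCommGroup G] [Fintype G] [DecidableEq G]

theorem norm_fourierSum_sumCount_one (I J : Finset G) :
    ‖fourierSum (fun x => (sumCount I J x : ℝ)) 1‖ = I.card * J.card := by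
  rw [fourierSum_one, ← Nat.cast_sum, sum_sumCount]
  simp

variable {I J : Finset G} {M : ℕ} {B : ℝ}

theorem sum_sumCount_mul_sumCount_le (hI : I.card = M) (hJ : J.card = M) (hB : 0 ≤ B)
    {S : Finset (G × G)} (hS : (S.card : ℝ) ≤ Fintype.card G + B)
    (h : ∀ ψ φ : AddChar G ℂ, ψ ≠ 1 ∨ φ ≠ 1 → ‖∑ z ∈ S, ψ z.1 * φ z.2‖ ≤ B) :
    ∑ z ∈ S, (sumCount I J z.1 : ℝ) * sumCount I J z.2 ≤
      M ^ 4 / Fintype.card G + 2 * B * M ^ 2 := by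
  have h1 := card_sq_mul_sum_le (f := fun x => (sumCount I J x : ℝ)) hB h
  have h2 := sum_norm_fourierSum_sumCount_le hI hJ
  have hp : (0 : ℝ) < Fintype.card G := by exact_mod_cast Fintype.card_pos
  have hM : (M : ℝ) ≤ Fintype.card G := by
    rw [← hI]
    exact_mod_cast I.card_le_univ
  rw [norm_fourierSum_sumCount_one, hI, hJ] at h1
  have h3 : 0 ≤ ∑ ψ : AddChar G ℂ, ‖fourierSum (fun x => (sumCount I J x : ℝ)) ψ‖ := by positivity
  set q : ℝ := ((Fintype.card G : ℕ) : ℝ)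
  have h4 : q ^ 2 * ∑ z ∈ S, (sumCount I J z.1 : ℝ) * sumCount I J z.2 ≤
      (M * M) ^ 2 * (q + B) + B * (q * M) ^ 2 := by
    refine h1.trans ?_
    gcongr
  have h5 : (M : ℝ) ^ 2 * (M ^ 2 * B) ≤ q ^ 2 * (M ^ 2 * B) := by gcongr
  have h6 : q ^ 2 * ((M : ℝ) ^ 4 / q + 2 * B * M ^ 2) = M ^ 4 * q + 2 * B * M ^ 2 * q ^ 2 := by
    field_simp
  refine le_of_mul_le_mul_left ?_ (pow_pos hp 2)
  rw [h6]
  nlinarith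

theorem sum_sumCount_fst_le (hI : I.card = M) (hJ : J.card = M) (hB : 0 ≤ B) (hBM : B ≤ M)
    {S : Finset (G × G)} (hS : (S.card : ℝ) ≤ 2 * Fintype.card G)
    (h : ∀ ψ : AddChar G ℂ, ψ ≠ 1 → ‖∑ z ∈ S, ψ z.1‖ ≤ B) :
    ∑ z ∈ S, (sumCount I J z.1 : ℝ) ≤ 3 * M ^ 2 := by
  have h1 := card_mul_sum_fst_le (f := fun x => (sumCount I J x : ℝ)) hB h
  have h2 := sum_norm_fourierSum_sumCount_le hI hJ
  have hp : (0 : ℝ) < Fintype.card G := by exact_mod_cast Fintype.card_pos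
  rw [norm_fourierSum_sumCount_one, hI, hJ] at h1
  set q : ℝ := ((Fintype.card G : ℕ) : ℝ)
  have h4 : q * ∑ z ∈ S, (sumCount I J z.1 : ℝ) ≤ (M * M) * (2 * q) + M * (q * M) := by
    refine h1.trans ?_
    gcongr
  refine le_of_mul_le_mul_left ?_ hp
  linarith

theorem sum_filter_sumCount_mul_sumCount_le (hI : I.card = M) (hJ : J.card = M) (hB : 0 ≤ B)
    (hBM : B ≤ M) {P : G → G} {S : Finset (G × G)}
    (hP : ∀ x y, P x = P y → x = y ∨ (x, y) ∈ S) (hS : (S.card : ℝ) ≤ 2 * Fintype.card G)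
    (h : ∀ ψ : AddChar G ℂ, ψ ≠ 1 → ‖∑ z ∈ S, ψ z.1‖ ≤ B) :
    ∑ z : G × G with P z.1 = P z.2, (sumCount I J z.1 : ℝ) * sumCount I J z.2 ≤ 4 * M ^ 3 := by
  have h1 : ∀ z : G × G, (sumCount I J z.1 : ℝ) * sumCount I J z.2 ≤ M * sumCount I J z.1 :=
    fun z => by
      rw [mul_comm]
      have : (sumCount I J z.2 : ℝ) ≤ M := by exact_mod_cast hI ▸ sumCount_le I J z.2
      gcongr
  have h2 : ({z : G × G | P z.1 = P z.2} : Finset (G × G)) ⊆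
      Finset.univ.image (fun x => (x, x)) ∪ S := fun z hz => by
    rw [Finset.mem_union, Finset.mem_image]
    refine (hP z.1 z.2 (Finset.mem_filter.1 hz).2).imp_left fun h => ⟨z.1, Finset.mem_univ _, ?_⟩
    exact Prod.ext rfl h
  have h3 : ∑ x : G, (sumCount I J x : ℝ) = M * M := by
    rw [← Nat.cast_sum, sum_sumCount, hI, hJ]
    push_cast
    rfl
  calc ∑ z : G × G with P z.1 = P z.2, (sumCount I J z.1 : ℝ) * sumCount I J z.2
      ≤ ∑ z ∈ Finset.univ.image (fun x => (x, x)) ∪ S, (M : ℝ) * sumCount I J z.1 :=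
        (Finset.sum_le_sum fun z _ => h1 z).trans
          (Finset.sum_le_sum_of_subset_of_nonneg h2 fun _ _ _ => by positivity)
    _ ≤ ∑ z ∈ Finset.univ.image (fun x : G => (x, x)), (M : ℝ) * sumCount I J z.1 +
        ∑ z ∈ S, (M : ℝ) * sumCount I J z.1 := by
        rw [← Finset.sum_union_inter]
        exact le_add_of_nonneg_right (Finset.sum_nonneg fun _ _ => by positivity)
    _ ≤ M * (M * M) + M * (3 * M ^ 2) := by
        rw [Finset.sum_image fun x _ y _ h => congrArg Prod.fst h, ← Finset.mul_sum,
          ← Finset.mul_sum, h3]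
        gcongr
        exact sum_sumCount_fst_le hI hJ hB hBM hS h
    _ = 4 * M ^ 3 := by ring

theorem sum_fiber_mul_fiber (f : G → ℝ) (P Q : G → G) :
    ∑ a, ∑ x with P x = a, ∑ y with Q y = a, f x * f y =
      ∑ z : G × G with P z.1 = Q z.2, f z.1 * f z.2 := by
  have h : ∀ a, ∑ x with P x = a, ∑ y with Q y = a, f x * f y =
      ∑ x with P x = a, ∑ y with Q y = P x, f x * f y := fun a =>
    Finset.sum_congr rfl fun x hx => by rw [(Finset.mem_filter.1 hx).2]
  simp_rw [h]
  rw [Finset.sum_fiberwise, Finset.sum_filter, ← Finset.univ_product_univ, Finset.sum_product]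
  simp_rw [Finset.sum_filter, eq_comm]

/-- A lower bound for the number of values taken by a family of maps whose collisions are
equidistributed. -/
theorem card_sub_card_mul_le {ι : Type*} [DecidableEq ι] (K : Finset ι) (P : ι → G → G)
    (hI : I.card = M) (hJ : J.card = M) (hB : 0 ≤ B) (hBM : B ≤ M)
    (hcard : ∀ k ∈ K, ∀ l ∈ K, k ≠ l →
      ((({z : G × G | P k z.1 = P l z.2} : Finset (G × G)).card : ℕ) : ℝ) ≤ Fintype.card G + B)
    (hchar : ∀ k ∈ K, ∀ l ∈ K, k ≠ l → ∀ ψ φ : AddChar G ℂ, ψ ≠ 1 ∨ φ ≠ 1 →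
      ‖∑ z : G × G with P k z.1 = P l z.2, ψ z.1 * φ z.2‖ ≤ B)
    (hdiag : ∀ k ∈ K, ∃ S : Finset (G × G), (∀ x y, P k x = P k y → x = y ∨ (x, y) ∈ S) ∧
      (S.card : ℝ) ≤ 2 * Fintype.card G ∧ ∀ ψ : AddChar G ℂ, ψ ≠ 1 → ‖∑ z ∈ S, ψ z.1‖ ≤ B)
    (A : Finset G) (hA : ∀ k ∈ K, ∀ u ∈ I, ∀ v ∈ J, P k (u + v) ∈ A) :
    ((Fintype.card G : ℝ) - A.card) * (K.card * M ^ 4) ≤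
      Fintype.card G ^ 2 * (2 * K.card * B * M ^ 2 + 4 * M ^ 3) := by
  set q : ℝ := ((Fintype.card G : ℕ) : ℝ) with hq
  have hp : 0 < q := Nat.cast_pos.2 Fintype.card_pos
  set f : G → ℝ := fun x => (sumCount I J x : ℝ) with hf
  set r : G → ℝ := fun a => ∑ k ∈ K, ∑ x with P k x = a, f x with hr
  have hsum : ∑ x, f x = (M : ℝ) ^ 2 := by
    rw [hf, ← Nat.cast_sum, sum_sumCount, hI, hJ]
    push_cast
    ring
  have hr1 : ∑ a, r a = K.card * M ^ 2 := by
    rw [hr, Finset.sum_comm]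
    simp_rw [Finset.sum_fiberwise, hsum]
    simp
  have hr2 : ∑ a, r a ^ 2 = ∑ k ∈ K, ∑ l ∈ K, ∑ z : G × G with P k z.1 = P l z.2, f z.1 * f z.2 := by
    simp_rw [hr, pow_two, Finset.sum_mul_sum]
    rw [Finset.sum_comm]
    refine Finset.sum_congr rfl fun k _ => ?_
    rw [Finset.sum_comm]
    exact Finset.sum_congr rfl fun l _ => sum_fiber_mul_fiber f (P k) (P l)
  have hr3 : ∀ a, a ∉ A → r a = 0 := fun a ha => by
    refine Finset.sum_eq_zero fun k hk => Finset.sum_eq_zero fun x hx => ?_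
    rw [Finset.mem_filter] at hx
    simp only [hf, sumCount, Nat.cast_eq_zero, Finset.card_eq_zero, Finset.filter_eq_empty_iff]
    rintro ⟨u, v⟩ huv h
    rw [Finset.mem_product] at huv
    refine ha ?_
    rw [← hx.2, ← h]
    exact hA k hk u huv.1 v huv.2
  have hκ : (0 : ℝ) ≤ K.card := by positivity
  have hr4 : ∑ a, r a ^ 2 ≤ K.card ^ 2 * (M ^ 4 / q + 2 * B * M ^ 2) + K.card * (4 * M ^ 3) := by
    rw [hr2]
    have h1 : ∀ k ∈ K, ∀ l ∈ K, ∑ z : G × G with P k z.1 = P l z.2, f z.1 * f z.2 ≤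
        (M ^ 4 / q + 2 * B * M ^ 2) + if l = k then (4 * M ^ 3 : ℝ) else 0 := fun k hk l hl => by
      split_ifs with hkl
      · subst hkl
        obtain ⟨S, hS1, hS2, hS3⟩ := hdiag l hl
        refine (sum_filter_sumCount_mul_sumCount_le hI hJ hB hBM hS1 hS2 hS3).trans ?_
        have : 0 ≤ (M ^ 4 / q + 2 * B * M ^ 2) := by positivity
        linarith
      · rw [add_zero]
        exact sum_sumCount_mul_sumCount_le hI hJ hB (hcard k hk l hl (Ne.symm hkl))
          (hchar k hk l hl (Ne.symm hkl))
    refine (Finset.sum_le_sum fun k hk => Finset.sum_le_sum fun l hl => h1 k hk l hl).trans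
      (le_of_eq ?_)
    have h2 : ∀ k ∈ K, ∑ l ∈ K, ((M ^ 4 / q + 2 * B * M ^ 2) + if l = k then (4 * M ^ 3 : ℝ) else 0)
        = K.card * (M ^ 4 / q + 2 * B * M ^ 2) + 4 * M ^ 3 := fun k hk => by
      rw [Finset.sum_add_distrib, Finset.sum_ite_eq' K, if_pos hk]
      simp [mul_add]
    rw [Finset.sum_congr rfl h2]
    simp only [Finset.sum_const, nsmul_eq_mul]
    ring
  set μ : ℝ := K.card * M ^ 2 / q with hμ
  have hvar : ∑ a, (r a - μ) ^ 2 = ∑ a, r a ^ 2 - K.card ^ 2 * (M ^ 4 / q) := by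
    have h1 : ∀ a, (r a - μ) ^ 2 = r a ^ 2 - 2 * μ * r a + μ ^ 2 := fun a => by ring
    simp_rw [h1, Finset.sum_add_distrib, Finset.sum_sub_distrib, ← Finset.mul_sum, hr1]
    simp only [Finset.sum_const, Finset.card_univ, nsmul_eq_mul, ← hq, hμ]
    field_simp
    ring
  have hlow : (q - A.card) * μ ^ 2 ≤ ∑ a, (r a - μ) ^ 2 := by
    calc (q - A.card) * μ ^ 2 = ∑ a ∈ Aᶜ, (r a - μ) ^ 2 := by
          rw [Finset.sum_congr rfl fun a ha => by
            rw [hr3 a (Finset.mem_compl.1 ha), zero_sub, neg_sq], Finset.sum_const, nsmul_eq_mul,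
            Finset.card_compl, Nat.cast_sub A.card_le_univ]
      _ ≤ _ := Finset.sum_le_univ_sum_of_nonneg fun _ => sq_nonneg _
  rcases K.eq_empty_or_nonempty with rfl | hKne
  · simp only [Finset.card_empty, Nat.cast_zero, zero_mul, mul_zero, zero_add]
    positivity
  have hK0 : (0 : ℝ) < K.card := by exact_mod_cast hKne.card_pos
  have hfin : (q - A.card) * μ ^ 2 ≤ K.card ^ 2 * (2 * B * M ^ 2) + K.card * (4 * M ^ 3) := by
    rw [hvar] at hlow
    nlinarith
  rw [hμ] at hfin
  have e : (q - A.card) * (K.card * M ^ 2 / q) ^ 2 =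
      (q - A.card) * (K.card * M ^ 4) * K.card / q ^ 2 := by
    field_simp
  rw [e, div_le_iff₀ (by positivity)] at hfin
  refine le_of_mul_le_mul_right ?_ hK0
  linarith

end Variance

section Factorials

variable {p : ℕ} [Fact p.Prime]

theorem eval_shiftedRising_mem_ratio {L N n k : ℕ} (hn : L + 1 ≤ n) (hnk : n + k ≤ L + N)
    (hp : L + N < p) :
    (shiftedRising (ZMod p) k).eval (n : ZMod p) ∈ intervalFactorialsRatio p L N := by
  refine Finset.mem_image₂.2 ⟨((n + k).factorial : ℕ), ?_, (n.factorial : ℕ), ?_, ?_⟩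
  · exact Finset.mem_image_of_mem _ (Finset.mem_Icc.2 ⟨by omega, by omega⟩)
  · exact Finset.mem_image_of_mem _ (Finset.mem_Icc.2 ⟨by omega, by omega⟩)
  · rw [← eval_shiftedRising_natCast_mul_factorial,
      mul_inv_cancel_right₀ (natCast_factorial_ne_zero (by omega))]

theorem card_image_range_natCast {M : ℕ} (hM : M ≤ p) (a : ZMod p) :
    ((Finset.range M).image fun i : ℕ => a + (i : ZMod p)).card = M := by
  rw [Finset.card_image_of_injOn, Finset.card_range]
  intro i hi j hj hij
  rw [Finset.coe_range, Set.mem_Iio] at hi hj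
  have h := add_left_cancel hij
  rw [ZMod.natCast_eq_natCast_iff', Nat.mod_eq_of_lt (by omega), Nat.mod_eq_of_lt (by omega)] at h
  exact h

theorem sub_card_intervalFactorialsRatio_mul_le {L N K M : ℕ} (hK : 3 ≤ K)
    (hKp : 3 * (3 * K) ^ 3 < p) (hN : 2 * M + 3 * K ≤ N) (hp : L + N < p)
    (hM : 200 * K ^ 2 * √p ≤ M) :
    ((p : ℝ) - (intervalFactorialsRatio p L N).card) *
        (((Finset.Ioc K (3 * K)).filter Nat.Prime).card * M ^ 4) ≤
      p ^ 2 * (2 * ((Finset.Ioc K (3 * K)).filter Nat.Prime).card * (200 * K ^ 2 * √p) * M ^ 2 +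
        4 * M ^ 3) := by
  have hK1 : (1 : ℝ) ≤ K := by exact_mod_cast (by omega : 1 ≤ K)
  have hp1 : 1 ≤ p := by omega
  have hKsq : (K : ℝ) ≤ √p := by
    refine Real.le_sqrt_of_sq_le ?_
    have h1 : K ^ 2 ≤ 3 * (3 * K) ^ 3 := by
      have h0 := Nat.pow_le_pow_right (n := K) (by omega) (show 2 ≤ 3 by omega)
      rw [mul_pow]
      omega
    exact_mod_cast h1.trans hKp.le
  have hs1 : (1 : ℝ) ≤ √p := hK1.trans hKsq
  have hQ3 : 3 * K < p := (Nat.le_self_pow (by norm_num : 3 ≠ 0) (3 * K)).trans_lt (by omega)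
  have b0 : (1 : ℝ) ≤ K ^ 2 := one_le_pow₀ hK1
  have b1 : (K : ℝ) ^ 3 ≤ K ^ 2 * √p := by
    rw [pow_succ]
    gcongr
  have b2 : √(p : ℝ) ≤ K ^ 2 * √p := le_mul_of_one_le_left (by positivity) b0
  have hMp : (M : ℝ) ≤ p := by exact_mod_cast (by omega : M ≤ p)
  set B : ℝ := 200 * K ^ 2 * √p with hB
  have bcard : (2 * ((3 * K : ℕ) : ℝ) ^ 2 + 1) * √p + ((3 * K : ℕ) : ℝ) ^ 3 ≤ B := by
    push_cast
    nlinarith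
  have bchar : 6 * ((3 * K : ℕ) : ℝ) ^ 2 * √p + 3 * ((3 * K : ℕ) : ℝ) ^ 3 ≤ B := by
    push_cast
    nlinarith
  have hcard : ((Fintype.card (ZMod p) : ℕ) : ℝ) = p := by rw [ZMod.card]
  have key := card_sub_card_mul_le ((Finset.Ioc K (3 * K)).filter Nat.Prime)
    (fun k x => (shiftedRising (ZMod p) k).eval x) (M := M) (B := B)
    (card_image_range_natCast (p := p) (by omega) 0)
    (card_image_range_natCast (p := p) (by omega) ((L + 1 : ℕ) : ZMod p)) (by positivity) hM
    ?_ ?_ ?_ (intervalFactorialsRatio p L N) ?_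
  · rw [hcard] at key
    exact key
  · intro k hk l hl hkl
    rw [Finset.mem_filter, Finset.mem_Ioc] at hk hl
    rw [hcard]
    have := card_risingPairs_le hk.2 hl.2 hkl hk.1.2 hl.1.2 hQ3
    rw [risingPairs] at this
    linarith
  · intro k hk l hl hkl ψ φ hψφ
    rw [Finset.mem_filter, Finset.mem_Ioc] at hk hl
    exact (norm_sum_risingPairs_le hk.2 hl.2 hkl hk.1.2 hl.1.2 hQ3 (by omega) (by omega)
      hψφ).trans bchar
  · intro k hk
    rw [Finset.mem_filter, Finset.mem_Ioc] at hk
    have hkQ : (k : ℝ) ≤ (3 * K : ℕ) := by exact_mod_cast hk.1.2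
    have h1 : k ^ 3 ≤ (3 * K) ^ 3 := Nat.pow_le_pow_left hk.1.2 3
    obtain ⟨h2, h3⟩ := weil_bound_risingResidual (p := p) hk.2 (by omega) (by omega)
    have h4 : (2 * (k : ℝ) ^ 2 + 1) * √p + k ^ 3 ≤
        (2 * ((3 * K : ℕ) : ℝ) ^ 2 + 1) * √p + ((3 * K : ℕ) : ℝ) ^ 3 := by gcongr
    have h5 : 2 * (k : ℝ) ^ 2 * √p + k ^ 3 ≤
        6 * ((3 * K : ℕ) : ℝ) ^ 2 * √p + 3 * ((3 * K : ℕ) : ℝ) ^ 3 := by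
      have : 2 * (k : ℝ) ^ 2 * √p + k ^ 3 ≤
        2 * ((3 * K : ℕ) : ℝ) ^ 2 * √p + ((3 * K : ℕ) : ℝ) ^ 3 := by gcongr
      have e1 : 0 ≤ ((3 * K : ℕ) : ℝ) ^ 2 * √p := by positivity
      have e2 : 0 ≤ ((3 * K : ℕ) : ℝ) ^ 3 := by positivity
      linarith
    refine ⟨_, fun x y h => eq_or_mem_curvePoints_risingResidual h, ?_, fun ψ hψ =>
      (h3 ψ hψ).trans (h5.trans bchar)⟩
    rw [hcard]
    linarith
  · intro k hk u hu v hv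
    rw [Finset.mem_filter, Finset.mem_Ioc] at hk
    obtain ⟨i, hi, rfl⟩ := Finset.mem_image.1 hu
    obtain ⟨j, hj, rfl⟩ := Finset.mem_image.1 hv
    rw [Finset.mem_range] at hi hj
    have h := eval_shiftedRising_mem_ratio (p := p) (L := L) (N := N) (n := i + (L + 1 + j)) (k := k)
      (by omega) (by omega) hp
    push_cast at h
    rw [zero_add]
    push_cast
    exact h

end Factorials

theorem theta_three_mul_sub_theta_le (K : ℕ) :
    Chebyshev.theta (3 * K : ℕ) - Chebyshev.theta K ≤
      ((Finset.Ioc K (3 * K)).filter Nat.Prime).card * Real.log (3 * K) := by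
  rw [Chebyshev.theta, Chebyshev.theta, Nat.floor_natCast, Nat.floor_natCast]
  have h : Finset.Ioc 0 (3 * K) = Finset.Ioc 0 K ∪ Finset.Ioc K (3 * K) :=
    (Finset.Ioc_union_Ioc_eq_Ioc (Nat.zero_le _) (by omega)).symm
  rw [h, Finset.filter_union, Finset.sum_union
    (Finset.disjoint_filter_filter (Finset.Ioc_disjoint_Ioc_of_le le_rfl)), add_sub_cancel_left,
    ← nsmul_eq_mul]
  refine Finset.sum_le_card_nsmul _ _ _ fun q hq => ?_
  rw [Finset.mem_filter, Finset.mem_Ioc] at hq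
  refine Real.log_le_log (by exact_mod_cast hq.2.pos) ?_
  exact_mod_cast hq.1.2

theorem exists_forall_le_card_primes_Ioc : ∃ K₀ : ℕ, ∀ K ≥ K₀,
    (K : ℝ) / 2 ≤ ((Finset.Ioc K (3 * K)).filter Nat.Prime).card * Real.log (3 * K) := by
  have h1 := (isLittleO_log_rpow_atTop (show (0 : ℝ) < 1 / 2 by norm_num)).def
    (show (0 : ℝ) < 1 / 100 by norm_num)
  obtain ⟨x₀, hx₀⟩ := Filter.eventually_atTop.1 h1
  refine ⟨⌈x₀⌉₊ + 2, fun K hK => ?_⟩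
  refine le_trans ?_ (theta_three_mul_sub_theta_le K)
  have hK2 : (2 : ℝ) ≤ K := by exact_mod_cast (by omega : 2 ≤ K)
  have hKx : x₀ ≤ K := (Nat.le_ceil x₀).trans (by exact_mod_cast (by omega : ⌈x₀⌉₊ ≤ K))
  have h2 := hx₀ (3 * K) (by linarith)
  rw [← Real.sqrt_eq_rpow, Real.norm_of_nonneg (Real.log_nonneg (by linarith)),
    Real.norm_of_nonneg (Real.sqrt_nonneg _)] at h2
  have h3 := Chebyshev.theta_ge (3 * K)
  have h4 := Chebyshev.theta_le_log4_mul_x (x := K) (by positivity)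
  have h5 : Real.log 4 = 2 * Real.log 2 := by
    rw [show (4 : ℝ) = 2 ^ 2 by norm_num, Real.log_pow]
    norm_num
  have h6 := Real.log_two_gt_d9
  have h7 : Real.log (3 * K + 1) ≤ 2 * Real.log (3 * K) := by
    rw [← Real.log_rpow (by positivity)]
    refine Real.log_le_log (by positivity) ?_
    norm_num
    nlinarith
  have h8 := Real.sq_sqrt (show (0 : ℝ) ≤ 3 * K by positivity)
  have h9 : 1 ≤ √(3 * (K : ℝ)) := Real.one_le_sqrt.2 (by linarith)
  push_cast at h3 ⊢
  rw [h5] at h4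
  set y := √(3 * (K : ℝ))
  have h10 : 2 * y * Real.log (3 * K) ≤ 2 * y * (1 / 100 * y) := by gcongr
  nlinarith

theorem exists_parameters {p L N K₀ : ℕ} {c : ℝ} (hc : 1600 ≤ c) (hcK : (K₀ : ℝ) + 1 ≤ c)
    (hp3 : 3 ≤ p) (hLN : L + N < p)
    (hN : c * (p : ℝ) ^ ((13 : ℝ) / 14) * (Real.log p) ^ ((4 : ℝ) / 7) ≤ N) :
    ∃ (s t : ℝ) (K M : ℕ), 1 ≤ t ∧ 1600 ≤ s ∧ (p : ℝ) = s ^ 14 ∧ Real.log p = t ^ 7 ∧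
      √(p : ℝ) = s ^ 7 ∧ (p : ℝ) ^ ((13 : ℝ) / 14) * (Real.log p) ^ ((4 : ℝ) / 7) = s ^ 13 * t ^ 4 ∧
      (K : ℝ) ≤ s ^ 2 ∧ s ^ 2 / 2 ≤ K ∧ K₀ ≤ K ∧ 3 ≤ K ∧ 2 * M + 3 * K ≤ N ∧
      200 * s ^ 13 * t ^ 4 ≤ M := by
  have hp0 : (0 : ℝ) ≤ p := by positivity
  have hlog : 1 ≤ Real.log p := by
    rw [Real.le_log_iff_exp_le (by exact_mod_cast (by omega : 0 < p))]
    have := Real.exp_one_lt_d9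
    have h3 : (3 : ℝ) ≤ p := by exact_mod_cast hp3
    linarith
  set s : ℝ := (p : ℝ) ^ ((1 : ℝ) / 14) with hs
  set t : ℝ := (Real.log p) ^ ((1 : ℝ) / 7) with ht
  have hps : (p : ℝ) = s ^ 14 := by
    rw [hs, ← Real.rpow_natCast, ← Real.rpow_mul hp0]
    norm_num
  have hlt : Real.log p = t ^ 7 := by
    rw [ht, ← Real.rpow_natCast, ← Real.rpow_mul (by linarith)]
    norm_num
  have hs0 : 0 ≤ s := by positivity
  have ht1 : 1 ≤ t := Real.one_le_rpow hlog (by norm_num)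
  have h13 : (p : ℝ) ^ ((13 : ℝ) / 14) = s ^ 13 := by
    rw [hs, ← Real.rpow_natCast, ← Real.rpow_mul hp0]
    norm_num
  have h4 : (Real.log p) ^ ((4 : ℝ) / 7) = t ^ 4 := by
    rw [ht, ← Real.rpow_natCast, ← Real.rpow_mul (by linarith)]
    norm_num
  have hsqrt : √(p : ℝ) = s ^ 7 := by
    rw [hps, show s ^ 14 = (s ^ 7) ^ 2 by ring, Real.sqrt_sq (by positivity)]
  rw [h13, h4] at hN
  have ht4 : 1 ≤ t ^ 4 := one_le_pow₀ ht1
  have hNp : (N : ℝ) < p := by exact_mod_cast (by omega : N < p)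
  have hs13 : 0 < s ^ 13 := by
    have : 0 < s := Real.rpow_pos_of_pos (by exact_mod_cast (by omega : 0 < p)) _
    positivity
  have hcs : c < s := by
    have h1 : c * s ^ 13 ≤ c * s ^ 13 * t ^ 4 := le_mul_of_one_le_right (by positivity) ht4
    have h2 : c * s ^ 13 < s * s ^ 13 := by
      calc c * s ^ 13 ≤ N := h1.trans hN
        _ < p := hNp
        _ = s * s ^ 13 := by rw [hps]; ring
    exact lt_of_mul_lt_mul_right h2 hs13.le
  have hs1600 : 1600 ≤ s := hc.trans hcs.le
  have hss : s ≤ s ^ 2 := by nlinarith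
  have hK1 : (⌊s ^ 2⌋₊ : ℝ) ≤ s ^ 2 := Nat.floor_le (by positivity)
  have hK2 := Nat.lt_floor_add_one (s ^ 2)
  have hD : s ^ 2 ≤ s ^ 13 * t ^ 4 :=
    (pow_le_pow_right₀ (by linarith) (by norm_num : 2 ≤ 13)).trans
      (le_mul_of_one_le_right hs13.le ht4)
  have hN2 : 1600 * (s ^ 13 * t ^ 4) ≤ N := by
    refine le_trans ?_ hN
    rw [mul_assoc]
    gcongr
  have hM := Nat.div_add_mod N 4
  have hM' := Nat.mod_lt N (show 4 > 0 by norm_num)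
  have hMr : (N : ℝ) ≤ 4 * ((N / 4 : ℕ) : ℝ) + 3 := by exact_mod_cast (by omega : N ≤ 4 * (N / 4) + 3)
  refine ⟨s, t, ⌊s ^ 2⌋₊, N / 4, ht1, hs1600, hps, hlt, hsqrt, by rw [h13, h4], hK1, by linarith,
    Nat.le_floor (by linarith), Nat.le_floor (by push_cast; linarith), ?_, by linarith⟩
  have h6 : 6 * ⌊s ^ 2⌋₊ ≤ N := by
    have : (6 : ℝ) * ⌊s ^ 2⌋₊ ≤ N := by linarith
    exact_mod_cast this
  omega

/-- **Theorem 2, Case 1.** If `N ≥ c₁·p^{13/14}·(log p)^{4/7}` then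
`|A_N / A_N| ≥ p − C·p^{13/14}·(log p)^{4/7}`. -/
theorem card_intervalFactorialsRatio_ge_case1 :
    ∃ c₁ C : ℝ, c₁ > 0 ∧ C > 0 ∧ ∀ p L N : ℕ, p.Prime →
      0 < L + 1 → L + 1 < L + N → L + N < p →
      (N : ℝ) ≥ c₁ * (p : ℝ) ^ ((13 : ℝ) / 14) * (Real.log p) ^ ((4 : ℝ) / 7) →
      ((intervalFactorialsRatio p L N).card : ℝ) ≥
        (p : ℝ) - C * (p : ℝ) ^ ((13 : ℝ) / 14) * (Real.log p) ^ ((4 : ℝ) / 7) := by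
  obtain ⟨K₀, hK₀⟩ := exists_forall_le_card_primes_Ioc
  refine ⟨K₀ + 1600, 416, by positivity, by norm_num, fun p L N hp _ hN2 hLN hN => ?_⟩
  have : Fact p.Prime := ⟨hp⟩
  have hK₀' : (0 : ℝ) ≤ K₀ := by positivity
  obtain ⟨s, t, K, M, ht, hs, hps, hlt, hsqrt, hD, hK1, hK2, hKK, hK3, hMK, hM⟩ :=
    exists_parameters (K₀ := K₀) (by linarith) (by linarith) (by omega) hLN hN
  rw [mul_assoc, hD]
  have hp0 : (0 : ℝ) < p := by exact_mod_cast hp.pos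
  have hprimes := hK₀ K hKK
  have hs0 : 0 < s := by linarith
  have hs1 : 1 ≤ s := by linarith
  have ht0 : 0 < t := by linarith
  have hKp : 3 * (3 * K) ^ 3 < p := by
    have h1 : 3 * (3 * (K : ℝ)) ^ 3 < p := by
      calc 3 * (3 * (K : ℝ)) ^ 3 ≤ 3 * (3 * s ^ 2) ^ 3 := by gcongr
        _ = 81 * s ^ 6 := by ring
        _ < s ^ 8 * s ^ 6 := by
          gcongr
          calc (81 : ℝ) < 1600 ^ 1 := by norm_num
            _ ≤ s ^ 1 := by gcongr
            _ ≤ s ^ 8 := pow_le_pow_right₀ hs1 (by norm_num)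
        _ = p := by rw [hps]; ring
    exact_mod_cast h1
  have hD0 : s ^ 13 ≤ s ^ 13 * t ^ 4 := le_mul_of_one_le_right (by positivity) (one_le_pow₀ ht)
  have hB : 200 * (K : ℝ) ^ 2 * √p ≤ M := by
    calc 200 * (K : ℝ) ^ 2 * √p ≤ 200 * (s ^ 2) ^ 2 * s ^ 7 := by rw [hsqrt]; gcongr
      _ = 200 * s ^ 11 := by ring
      _ ≤ 200 * s ^ 13 := by
        gcongr
        norm_num
      _ ≤ M := by linarith
  have key := sub_card_intervalFactorialsRatio_mul_le hK3 hKp hMK hLN hB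
  set κ : ℝ := (((Finset.Ioc K (3 * K)).filter Nat.Prime).card : ℝ)
  set D : ℝ := s ^ 13 * t ^ 4 with hDdef
  have hDM : D ≤ M := by
    have : 0 ≤ D := by positivity
    linarith
  have hDpos : 0 < D := by positivity
  have hMpos : (0 : ℝ) < M := hDpos.trans_le hDM
  have hKpos : (0 : ℝ) < K := by positivity
  have hκ0 : 0 ≤ κ := by positivity
  have hκ : s ^ 2 / 4 ≤ κ * t ^ 7 := by
    have h1 : Real.log (3 * K) ≤ t ^ 7 := by
      rw [← hlt]
      refine Real.log_le_log (by positivity) ?_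
      have : 3 * K ≤ p := by omega
      exact_mod_cast this
    calc s ^ 2 / 4 ≤ K / 2 := by linarith
      _ ≤ κ * Real.log (3 * K) := hprimes
      _ ≤ κ * t ^ 7 := by gcongr
  have hκpos : 0 < κ := by
    have : 0 < κ * t ^ 7 := lt_of_lt_of_le (by positivity) hκ
    exact pos_of_mul_pos_left this (by positivity)
  have e1 : (p : ℝ) ^ 2 * (2 * (200 * K ^ 2 * √p)) ≤ 400 * D * M ^ 2 := by
    calc (p : ℝ) ^ 2 * (2 * (200 * K ^ 2 * √p)) ≤
        (s ^ 14) ^ 2 * (2 * (200 * (s ^ 2) ^ 2 * s ^ 7)) := by rw [hsqrt, hps]; gcongr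
      _ = 400 * s ^ 13 * (s ^ 13) ^ 2 := by ring
      _ ≤ 400 * D * M ^ 2 := by
        gcongr
        exact hD0.trans hDM
  have e2 : (p : ℝ) ^ 2 ≤ 4 * (D * κ * M) := by
    calc (p : ℝ) ^ 2 = 4 * (s ^ 26 * (s ^ 2 / 4)) := by rw [hps]; ring
      _ ≤ 4 * (s ^ 26 * (κ * t ^ 7)) := by gcongr
      _ ≤ 4 * (s ^ 26 * (κ * t ^ 8)) := by
        gcongr
        norm_num
      _ = 4 * (D * κ * D) := by rw [hDdef]; ring
      _ ≤ 4 * (D * κ * M) := by gcongr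
  have e3 : (p : ℝ) ^ 2 * (2 * κ * (200 * K ^ 2 * √p) * M ^ 2 + 4 * M ^ 3) ≤
      416 * D * (κ * M ^ 4) := by
    calc (p : ℝ) ^ 2 * (2 * κ * (200 * K ^ 2 * √p) * M ^ 2 + 4 * M ^ 3) =
        (p : ℝ) ^ 2 * (2 * (200 * K ^ 2 * √p)) * (κ * M ^ 2) + p ^ 2 * (4 * M ^ 3) := by ring
      _ ≤ 400 * D * M ^ 2 * (κ * M ^ 2) + 4 * (D * κ * M) * (4 * M ^ 3) := by gcongr
      _ = 416 * D * (κ * M ^ 4) := by ring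
  have := le_of_mul_le_mul_right (key.trans e3) (by positivity)
  linarith
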